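/- Let d ≥ 4 and let P be a centrally symmetric simplicial d-polytope in ℝ^d. Then g_2(P) = C(d,2) − d if and only if P is obtained from a d-dimensional cross-polytope by symmetric stacking. -/

import Mathlib

open Finset
open scoped Classical

noncomputable section

/-- A finite graph: a finite vertex set together with a finite set of edges,
where each edge is (intended to be) a 2-element subset of the vertex set. -/
structure FinGraph (ι : Type) where
  verts : Finset ι
  edges : Finset (Finset ι)

/-- Every edge is a 2-element subset of the vertex set. -/
def FinGraph.Good {ι : Type} (G : FinGraph ι) : Prop :=
  ∀ e ∈ G.edges, e ⊆ G.verts ∧ e.card = 2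

/-- The standard inner (dot) product on `ℝ^d`. -/
def dotR {d : ℕ} (x y : Fin d → ℝ) : ℝ := ∑ i, x i * y i

/-- An infinitesimal motion of the framework `(G, p)`. -/
def IsMotion {ι : Type} {d : ℕ} (G : FinGraph ι) (p m : ι → Fin d → ℝ) : Prop :=
  ∀ e ∈ G.edges, ∀ u ∈ e, ∀ v ∈ e, dotR (p u - p v) (m u - m v) = 0

/-- The framework `(G, p)` is infinitesimally rigid in `ℝ^d`: every infinitesimal
motion is the restriction of a motion `x ↦ A x + b` of `ℝ^d` with `A` skew-symmetric. -/
def IsInfRigid {ι : Type} (d : ℕ) (G : FinGraph ι) (p : ι → Fin d → ℝ) : Prop :=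
  ∀ m : ι → Fin d → ℝ, IsMotion G p m →
    ∃ (A : Matrix (Fin d) (Fin d) ℝ) (b : Fin d → ℝ),
      A.transpose = -A ∧ ∀ v ∈ G.verts, m v = A.mulVec (p v) + b

/-- A stress on the framework `(G, p)`. -/
def IsStress {ι : Type} {d : ℕ} (G : FinGraph ι) (p : ι → Fin d → ℝ)
    (ω : Finset ι → ℝ) : Prop :=
  ∀ v ∈ G.verts,
    (∑ e ∈ G.edges.filter (fun e => v ∈ e), ∑ u ∈ e.erase v, ω e • (p v - p u)) = 0

/-- A centrally symmetric framework with free involution `ν` satisfying `p (ν v) = -(p v)`. -/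
def IsCSFramework {ι : Type} {d : ℕ} (G : FinGraph ι) (p : ι → Fin d → ℝ) (ν : ι → ι) : Prop :=
  (∀ v ∈ G.verts, ν (ν v) = v) ∧
  (∀ v ∈ G.verts, ν v ∈ G.verts) ∧
  (∀ v ∈ G.verts, ν v ≠ v) ∧
  (∀ e ∈ G.edges, e.image ν ∈ G.edges) ∧
  (∀ e ∈ G.edges, e.image ν ≠ e) ∧
  (∀ v ∈ G.verts, p (ν v) = -(p v))

/-- The convex body spanned by a finite point set. -/
def polyBody {d : ℕ} (V : Finset (Fin d → ℝ)) : Set (Fin d → ℝ) :=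
  convexHull ℝ (V : Set (Fin d → ℝ))

/-- `(f, c)` is a supporting functional for `conv V` exposing the face `F`. -/
def IsSupport {d : ℕ} (V : Finset (Fin d → ℝ)) (f : (Fin d → ℝ) →ₗ[ℝ] ℝ) (c : ℝ)
    (F : Set (Fin d → ℝ)) : Prop :=
  (∀ y ∈ polyBody V, f y ≤ c) ∧ F = {y ∈ polyBody V | f y = c}

/-- A proper face of the polytope `conv V`. -/
def IsProperFace {d : ℕ} (V : Finset (Fin d → ℝ)) (F : Set (Fin d → ℝ)) : Prop :=
  (∃ f c, IsSupport V f c F) ∧ F ≠ polyBody V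

/-- A simplicial `d`-polytope in `ℝ^d`, recorded by its vertex set `V`: the polytope is
`conv V`, it is `d`-dimensional, every element of `V` is a vertex, and every proper face
is a simplex (the convex hull of its affinely independent vertex set). -/
structure SPolytope (d : ℕ) where
  V : Finset (Fin d → ℝ)
  span_top : affineSpan ℝ (V : Set (Fin d → ℝ)) = ⊤
  extreme : ∀ v ∈ V, v ∉ convexHull ℝ ((V.erase v : Finset (Fin d → ℝ)) : Set (Fin d → ℝ))
  simplicial : ∀ F : Set (Fin d → ℝ), IsProperFace V F →
    AffineIndependent ℝ
      (fun x : {y : Fin d → ℝ // y ∈ (V : Set (Fin d → ℝ)) ∩ F} => (x : Fin d → ℝ)) ∧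
    F = convexHull ℝ ((V : Set (Fin d → ℝ)) ∩ F)

/-- `s` is a face of the boundary complex `∂P`. -/
def BFace {d : ℕ} (P : SPolytope d) (s : Finset (Fin d → ℝ)) : Prop :=
  s ⊆ P.V ∧ ∃ F : Set (Fin d → ℝ), IsProperFace P.V F ∧ (s : Set (Fin d → ℝ)) ⊆ F

/-- The number of vertices of `∂P`. -/
def f0 {d : ℕ} (P : SPolytope d) : ℕ := P.V.card

/-- The edges of `∂P`. -/
def edgeFinset {d : ℕ} (P : SPolytope d) : Finset (Finset (Fin d → ℝ)) :=
  P.V.powerset.filter fun e => e.card = 2 ∧ BFace P e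

/-- The number of edges of `∂P`. -/
def f1 {d : ℕ} (P : SPolytope d) : ℕ := (edgeFinset P).card

/-- `g₂(P) = f₁ - d f₀ + C(d+1, 2)`. -/
def g2 {d : ℕ} (P : SPolytope d) : ℤ :=
  (f1 P : ℤ) - (d : ℤ) * (f0 P : ℤ) + ((d + 1).choose 2 : ℤ)

/-- `P` is centrally symmetric. -/
def IsCS {d : ℕ} (P : SPolytope d) : Prop := ∀ v ∈ P.V, -v ∈ P.V

/-- A missing face of `∂P`. -/
def IsMissingFace {d : ℕ} (P : SPolytope d) (σ : Finset (Fin d → ℝ)) : Prop :=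
  σ ⊆ P.V ∧ ¬ BFace P σ ∧ ∀ τ ⊂ σ, BFace P τ

/-- `P` is prime: `∂P` has no missing facet, i.e. no missing face of cardinality `d`. -/
def IsPrimePoly {d : ℕ} (P : SPolytope d) : Prop :=
  ¬ ∃ σ : Finset (Fin d → ℝ), IsMissingFace P σ ∧ σ.card = d

/-- The graph (1-skeleton) of `∂P` as a framework graph. -/
def fullGraph {d : ℕ} (P : SPolytope d) : FinGraph (Fin d → ℝ) :=
  ⟨P.V, edgeFinset P⟩

/-- The graph (1-skeleton) of the star of the face `τ` in `∂P`. -/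
def starGraph {d : ℕ} (P : SPolytope d) (τ : Finset (Fin d → ℝ)) : FinGraph (Fin d → ℝ) :=
  ⟨P.V.filter fun v => BFace P (insert v τ),
   P.V.powerset.filter fun e => e.card = 2 ∧ BFace P (e ∪ τ)⟩

/-- Adjacency in the graph of `∂P`. -/
def Adj {d : ℕ} (P : SPolytope d) (u v : Fin d → ℝ) : Prop :=
  u ≠ v ∧ BFace P {u, v}

/-- `σ` is a face of the link of the face `τ` in `∂P`. -/
def LinkFace {d : ℕ} (P : SPolytope d) (τ σ : Finset (Fin d → ℝ)) : Prop :=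
  Disjoint σ τ ∧ BFace P (σ ∪ τ)

/-- `P` is a `d`-dimensional cross-polytope: its vertex set is `{±b₁, …, ±b_d}`
for some basis `b₁, …, b_d` of `ℝ^d`. -/
def IsCrossPolytope {d : ℕ} (P : SPolytope d) : Prop :=
  ∃ b : Fin d → (Fin d → ℝ), LinearIndependent ℝ b ∧
    (P.V : Set (Fin d → ℝ)) = Set.range b ∪ Set.range (fun i => -(b i))

/-- A facet of `P`: a proper face with `d` vertices. -/
def IsFacet {d : ℕ} (P : SPolytope d) (F : Set (Fin d → ℝ)) : Prop :=
  IsProperFace P.V F ∧ ((P.V : Set (Fin d → ℝ)) ∩ F).ncard = d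

/-- `x` lies beyond exactly one facet of `P`: it is strictly separated from `P` by the
affine hull of one facet `F`, and not separated from `P` by the affine hull of any
other facet. -/
def BeyondExactlyOne {d : ℕ} (P : SPolytope d) (x : Fin d → ℝ) : Prop :=
  ∃ F : Set (Fin d → ℝ), IsFacet P F ∧
    (∀ f c, IsSupport P.V f c F → c < f x) ∧
    (∀ F' : Set (Fin d → ℝ), IsFacet P F' → F' ≠ F →
      ∀ f c, IsSupport P.V f c F' → f x < c)

/-- `P` is obtained from a `d`-dimensional cross-polytope by symmetric stacking: there is
a sequence of cs simplicial `d`-polytopes starting at a cross-polytope and ending at `P`,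
each obtained from the previous one as `conv (P_k ∪ {v, -v})` for a point `v` lying
beyond exactly one facet of `P_k`. -/
def SymmetricStackingFrom {d : ℕ} (P : SPolytope d) : Prop :=
  ∃ (m : ℕ) (Q : Fin (m + 1) → SPolytope d),
    (∀ k, IsCS (Q k)) ∧
    IsCrossPolytope (Q 0) ∧
    Q (Fin.last m) = P ∧
    ∀ k : Fin m, ∃ v : Fin d → ℝ,
      BeyondExactlyOne (Q (Fin.castSucc k)) v ∧
      polyBody (Q (Fin.succ k)).V =
        convexHull ℝ (polyBody (Q (Fin.castSucc k)).V ∪ {v, -v})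

/-- `P` is a stacked `d`-polytope: obtained from a `d`-simplex by repeatedly adding a
point beyond exactly one facet. -/
def IsStacked {d : ℕ} (P : SPolytope d) : Prop :=
  ∃ (m : ℕ) (R : Fin (m + 1) → SPolytope d),
    (R 0).V.card = d + 1 ∧
    R (Fin.last m) = P ∧
    ∀ k : Fin m, ∃ v : Fin d → ℝ,
      BeyondExactlyOne (R (Fin.castSucc k)) v ∧
      polyBody (R (Fin.succ k)).V =
        convexHull ℝ (polyBody (R (Fin.castSucc k)).V ∪ {v})

/-- Every `d` vertices of `P`, no two of which are antipodal, are affinely independent. -/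
def GenPos {d : ℕ} (P : SPolytope d) : Prop :=
  ∀ S : Finset (Fin d → ℝ), S ⊆ P.V → S.card = d →
    (∀ x ∈ S, ∀ y ∈ S, x ≠ -y) →
    AffineIndependent ℝ (fun s : {x : Fin d → ℝ // x ∈ S} => (s : Fin d → ℝ))

/-- The graph of the cone `v₀ * S` over a simplicial complex `S` (a set of finsets):
the vertices of `S` together with `v₀`, and the edges of `S` together with all edges
from `v₀` to vertices of `S`. -/
def coneGraph {d : ℕ} (P : SPolytope d) (v0 : Fin d → ℝ)
    (S : Set (Finset (Fin d → ℝ))) : FinGraph (Fin d → ℝ) :=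
  ⟨insert v0 (P.V.filter fun u => ({u} : Finset (Fin d → ℝ)) ∈ S),
   (P.V.powerset.filter fun e => e.card = 2 ∧ e ∈ S) ∪
     (P.V.filter fun u => ({u} : Finset (Fin d → ℝ)) ∈ S).image
       fun u => ({v0, u} : Finset (Fin d → ℝ))⟩

noncomputable section

set_option linter.unusedVariables false
set_option linter.unusedSectionVars false

/-! ### Abstract centrally symmetric fans -/

/-- Complete simplicial fan spanned by the boundary of a cs simplicial polytope. -/
structure CFan (d : ℕ) (ι : Type) [Fintype ι] [DecidableEq ι] where
  p : ι → Fin d → ℝ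
  fac : Finset (Finset ι)
  fac_ne : fac.Nonempty
  fac_card : ∀ F ∈ fac, F.card = d
  co : Finset ι → ι → ((Fin d → ℝ) →ₗ[ℝ] ℝ)
  co_off : ∀ F ∈ fac, ∀ v, v ∉ F → co F v = 0
  co_eq : ∀ F ∈ fac, ∀ v ∈ F, ∀ w ∈ F, co F v (p w) = if v = w then 1 else 0
  co_sum : ∀ F ∈ fac, ∀ x, ∑ v, co F v x • p v = x
  lt_one : ∀ F ∈ fac, ∀ w, w ∉ F → ∑ v, co F v (p w) < 1
  piv : ∀ F ∈ fac, ∀ i ∈ F, ∃ j, j ∉ F ∧ insert j (F.erase i) ∈ fac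
  cover : ∀ v, ∃ F ∈ fac, v ∈ F
  ν : ι → ι
  νν : ∀ v, ν (ν v) = v
  νp : ∀ v, p (ν v) = - p v
  νfac : ∀ F ∈ fac, F.image ν ∈ fac

namespace CFan
variable {d : ℕ} {ι : Type} [Fintype ι] [DecidableEq ι] (S : CFan d ι)

/-- linear functional on `ℝ^d` agreeing with `z` on the vertices of `F`. -/
def lin (F : Finset ι) (z : ι → ℝ) : (Fin d → ℝ) →ₗ[ℝ] ℝ := ∑ v, z v • S.co F v

/-- the functional that equals one on `F` -/
def ff (F : Finset ι) : (Fin d → ℝ) →ₗ[ℝ] ℝ := S.lin F 1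

variable {S}

lemma lin_apply (F : Finset ι) (z : ι → ℝ) (x) : S.lin F z x = ∑ v, z v * S.co F v x := by
  simp [lin, LinearMap.sum_apply]

lemma ff_apply (F : Finset ι) (x) : S.ff F x = ∑ v, S.co F v x := by
  simp [ff, lin_apply]

lemma lin_p {F} (hF : F ∈ S.fac) {v} (hv : v ∈ F) (z : ι → ℝ) : S.lin F z (S.p v) = z v := by
  rw [lin_apply, Finset.sum_eq_single v]
  · simp [S.co_eq F hF v hv v hv]
  · intro w _ hw
    by_cases hwF : w ∈ F
    · simp [S.co_eq F hF w hwF v hv, hw]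
    · simp [S.co_off F hF w hwF]
  · simp

lemma ff_p {F} (hF : F ∈ S.fac) {v} (hv : v ∈ F) : S.ff F (S.p v) = 1 := by
  simp [ff, lin_p hF hv]

lemma ff_lt {F} (hF : F ∈ S.fac) {v} (hv : v ∉ F) : S.ff F (S.p v) < 1 := by
  rw [ff_apply]; exact S.lt_one F hF v hv

lemma ff_le {F} (hF : F ∈ S.fac) (v) : S.ff F (S.p v) ≤ 1 := by
  by_cases hv : v ∈ F
  · exact (ff_p hF hv).le
  · exact (ff_lt hF hv).le

lemma mem_of_ff {F} (hF : F ∈ S.fac) {v} (h : S.ff F (S.p v) = 1) : v ∈ F := by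
  by_contra hv
  exact absurd h (ff_lt hF hv).ne

lemma ext_on {F} (hF : F ∈ S.fac) {f g : (Fin d → ℝ) →ₗ[ℝ] ℝ}
    (h : ∀ v ∈ F, f (S.p v) = g (S.p v)) : f = g := by
  ext1 x
  apply LinearMap.ext
  intro y
  simp only [LinearMap.comp_apply]
  rw [← S.co_sum F hF (LinearMap.single ℝ (fun _ => ℝ) x y)]
  simp only [map_sum, map_smul]
  refine Finset.sum_congr rfl fun v _ => ?_
  by_cases hv : v ∈ F
  · rw [h v hv]
  · simp [S.co_off F hF v hv]

lemma lin_comp {F} (hF : F ∈ S.fac) (f : (Fin d → ℝ) →ₗ[ℝ] ℝ) :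
    S.lin F (fun v => f (S.p v)) = f :=
  ext_on hF fun v hv => by rw [lin_p hF hv]

lemma lin_congr {F} (hF : F ∈ S.fac) {z z' : ι → ℝ} (h : ∀ v ∈ F, z v = z' v) :
    S.lin F z = S.lin F z' :=
  ext_on hF fun v hv => by rw [lin_p hF hv, lin_p hF hv, h v hv]

/-- expansion of a functional in a facet basis -/
lemma expand {F} (hF : F ∈ S.fac) (f : (Fin d → ℝ) →ₗ[ℝ] ℝ) (x) :
    f x = ∑ v ∈ F, S.co F v x * f (S.p v) := by
  conv_lhs => rw [← S.co_sum F hF x]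
  rw [map_sum]
  simp only [map_smul, smul_eq_mul]
  symm
  apply Finset.sum_subset (Finset.subset_univ _)
  intro v _ hv
  simp [S.co_off F hF v hv]

lemma ν_inj : Function.Injective S.ν := fun a b h => by
  rw [← S.νν a, h, S.νν]

lemma not_mem_ν {F} (hF : F ∈ S.fac) {v} (hv : v ∈ F) : S.ν v ∉ F := fun h => by
  have h1 := ff_p hF hv
  have h2 := ff_p hF h
  rw [S.νp, map_neg] at h2
  linarith

lemma ν_ne (v) : S.ν v ≠ v := fun h => by
  obtain ⟨F, hF, hv⟩ := S.cover v
  exact not_mem_ν hF hv (h.symm ▸ hv)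

lemma p_inj : Function.Injective S.p := fun a b h => by
  obtain ⟨F, hF, ha⟩ := S.cover a
  have hb : b ∈ F := mem_of_ff hF (h ▸ ff_p hF ha)
  by_contra hab
  have h1 := S.co_eq F hF a ha a ha
  have h2 := S.co_eq F hF a ha b hb
  rw [← h, h1] at h2
  simp [hab] at h2

lemma piv_not {F : Finset ι} (hF : F ∈ S.fac) {i : ι} (hi : i ∈ F) {j : ι} (hj : j ∉ F)
    (hF' : insert j (F.erase i) ∈ S.fac) : i ∉ insert j (F.erase i) := by
  simp only [Finset.mem_insert, Finset.mem_erase]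
  rintro (rfl | h)
  · exact hj hi
  · exact h.1 rfl

/-- two functionals agreeing on a ridge -/
lemma piv_diff {F : Finset ι} (hF : F ∈ S.fac) {i : ι} (hi : i ∈ F) {j : ι} (hj : j ∉ F)
    (hF' : insert j (F.erase i) ∈ S.fac) {f g : (Fin d → ℝ) →ₗ[ℝ] ℝ} (h : ∀ v ∈ F.erase i, f (S.p v) = g (S.p v)) :
    f = g + (f (S.p i) - g (S.p i)) • S.co F i := by
  apply ext_on hF
  intro v hv
  by_cases hvi : v = i
  · subst hvi
    simp [S.co_eq F hF v hv v hv]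
  · simp [S.co_eq F hF i hi v hv, Ne.symm hvi, h v (Finset.mem_erase.2 ⟨hvi, hv⟩)]

lemma piv_ff {F : Finset ι} (hF : F ∈ S.fac) {i : ι} (hi : i ∈ F) {j : ι} (hj : j ∉ F)
    (hF' : insert j (F.erase i) ∈ S.fac) : S.ff (insert j (F.erase i)) =
    S.ff F + (S.ff (insert j (F.erase i)) (S.p i) - 1) • S.co F i := by
  have := piv_diff hF hi hj hF' (f := S.ff (insert j (F.erase i))) (g := S.ff F) ?_
  · rwa [ff_p hF hi] at this
  · intro v hv
    rw [ff_p hF' (Finset.mem_insert_of_mem hv), ff_p hF (Finset.mem_of_mem_erase hv)]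

lemma piv_lt {F : Finset ι} (hF : F ∈ S.fac) {i : ι} (hi : i ∈ F) {j : ι} (hj : j ∉ F)
    (hF' : insert j (F.erase i) ∈ S.fac) : S.ff (insert j (F.erase i)) (S.p i) < 1 := ff_lt hF' (piv_not hF hi hj hF')

lemma piv_neg {F : Finset ι} (hF : F ∈ S.fac) {i : ι} (hi : i ∈ F) {j : ι} (hj : j ∉ F)
    (hF' : insert j (F.erase i) ∈ S.fac) : S.co F i (S.p j) < 0 := by
  have h1 := congrArg (fun f => f (S.p j)) (piv_ff hF hi hj hF')
  simp only [LinearMap.add_apply, LinearMap.smul_apply, smul_eq_mul] at h1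
  rw [ff_p hF' (Finset.mem_insert_self _ _)] at h1
  have h2 := ff_lt hF hj
  have h3 := piv_lt hF hi hj hF'
  by_contra h
  push Not at h
  nlinarith

lemma piv_inc {F : Finset ι} (hF : F ∈ S.fac) {i : ι} (hi : i ∈ F) {j : ι} (hj : j ∉ F)
    (hF' : insert j (F.erase i) ∈ S.fac) {z} (hz : S.co F i z < 0) : S.ff F z < S.ff (insert j (F.erase i)) z := by
  have h1 := congrArg (fun f => f z) (piv_ff hF hi hj hF')
  simp only [LinearMap.add_apply, LinearMap.smul_apply, smul_eq_mul] at h1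
  have h3 := piv_lt hF hi hj hF'
  nlinarith

lemma piv_unique {F : Finset ι} (hF : F ∈ S.fac) {i : ι} (hi : i ∈ F) {j : ι} (hj : j ∉ F)
    (hF' : insert j (F.erase i) ∈ S.fac) {k : ι} (hk : k ∉ F) (hF'' : insert k (F.erase i) ∈ S.fac) : j = k := by
  by_contra hjk
  have hkF' : k ∉ insert j (F.erase i) := by
    simp only [Finset.mem_insert, Finset.mem_erase]
    rintro (h | h)
    · exact hjk h.symm
    · exact hk h.2
  have hjF'' : j ∉ insert k (F.erase i) := by
    simp only [Finset.mem_insert, Finset.mem_erase]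
    rintro (h | h)
    · exact hjk h
    · exact hj h.2
  have a1 := congrArg (fun f => f (S.p j)) (piv_ff hF hi hj hF')
  have a2 := congrArg (fun f => f (S.p k)) (piv_ff hF hi hj hF')
  have b1 := congrArg (fun f => f (S.p j)) (piv_ff hF hi hk hF'')
  have b2 := congrArg (fun f => f (S.p k)) (piv_ff hF hi hk hF'')
  simp only [LinearMap.add_apply, LinearMap.smul_apply, smul_eq_mul] at a1 a2 b1 b2
  rw [ff_p hF' (Finset.mem_insert_self _ _)] at a1
  rw [ff_p hF'' (Finset.mem_insert_self _ _)] at b2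
  have a3 := ff_lt hF' hkF'
  have b3 := ff_lt hF'' hjF''
  have n1 := piv_neg hF hi hj hF'
  have n2 := piv_neg hF hi hk hF''
  generalize S.ff (insert j (F.erase i)) (S.p i) - 1 = s at *
  generalize S.ff (insert k (F.erase i)) (S.p i) - 1 = t at *
  have : t < s := by nlinarith
  nlinarith

/-- strong connectivity of stars -/
theorem conn (Q : Finset ι) (Pr : Finset ι → Prop) {F0} (h0 : F0 ∈ S.fac) (hQ0 : Q ⊆ F0)
    (hP0 : Pr F0)
    (step : ∀ F ∈ S.fac, Q ⊆ F → Pr F → ∀ i ∈ F, i ∉ Q → ∀ j, j ∉ F →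
      insert j (F.erase i) ∈ S.fac → Pr (insert j (F.erase i)))
    {F1} (h1 : F1 ∈ S.fac) (hQ1 : Q ⊆ F1) : Pr F1 := by
  set y : Fin d → ℝ := ∑ v ∈ F1, S.p v with hy
  set N : ℝ := ∑ F ∈ S.fac, ∑ v, |S.co F v y| with hN
  set z : Fin d → ℝ := y + N • ∑ q ∈ Q, S.p q with hz
  obtain ⟨F, hFm, hmax⟩ := Finset.exists_max_image
    (S.fac.filter fun F => Q ⊆ F ∧ Pr F) (fun F => S.ff F z)
    ⟨F0, Finset.mem_filter.2 ⟨h0, hQ0, hP0⟩⟩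
  obtain ⟨hF, hQF, hPF⟩ := Finset.mem_filter.1 hFm
  have hpos : ∀ i ∈ F, 0 ≤ S.co F i z := by
    intro i hi
    by_cases hiQ : i ∈ Q
    · have e : S.co F i z = S.co F i y + N := by
        rw [hz, map_add, map_smul, map_sum (S.co F i) _ Q, Finset.sum_eq_single (s := Q) i]
        · rw [S.co_eq F hF i hi i hi]; simp
        · intro q hq hqi
          rw [S.co_eq F hF i hi q (hQF hq), if_neg (Ne.symm hqi)]
        · exact fun h => absurd hiQ h
      have : |S.co F i y| ≤ N := by
        refine le_trans ?_ (Finset.single_le_sum (f := fun F => ∑ v, |S.co F v y|)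
          (fun F _ => Finset.sum_nonneg fun v _ => abs_nonneg _) hF)
        exact Finset.single_le_sum (f := fun v => |S.co F v y|)
          (fun v _ => abs_nonneg _) (Finset.mem_univ i)
      rw [e]; linarith [neg_abs_le (S.co F i y)]
    · by_contra hneg
      push Not at hneg
      obtain ⟨j, hj, hF'⟩ := S.piv F hF i hi
      have hQ' : Q ⊆ insert j (F.erase i) := fun q hq =>
        Finset.mem_insert_of_mem (Finset.mem_erase.2 ⟨fun h => hiQ (h ▸ hq), hQF hq⟩)
      have := hmax _ (Finset.mem_filter.2 ⟨hF', hQ', step F hF hQF hPF i hi hiQ j hj hF'⟩)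
      exact absurd (piv_inc hF hi hj hF' hneg) (not_lt.2 this)
  have e1 : S.ff F1 z ≤ S.ff F z := by
    rw [expand hF (S.ff F1), expand hF (S.ff F)]
    refine Finset.sum_le_sum fun v hv => ?_
    rw [ff_p hF hv]
    exact mul_le_mul_of_nonneg_left (ff_le h1 v) (hpos v hv)
  have e2 : ∑ q ∈ Q, S.ff F1 (S.p q) = ∑ q ∈ Q, S.ff F (S.p q) :=
    Finset.sum_congr rfl fun q hq => by rw [ff_p h1 (hQ1 hq), ff_p hF (hQF hq)]
  simp only [hz, hy, map_add, map_smul, map_sum, e2] at e1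
  have e3 : ∀ v ∈ F1, S.ff F (S.p v) = S.ff F1 (S.p v) := by
    have h3 : ∀ v ∈ F1, S.ff F (S.p v) ≤ S.ff F1 (S.p v) := fun v hv => by
      rw [ff_p h1 hv]; exact ff_le hF v
    exact (Finset.sum_eq_sum_iff_of_le h3).1 (le_antisymm (Finset.sum_le_sum h3) (by linarith))
  have : F1 ⊆ F := fun v hv => mem_of_ff hF (by rw [e3 v hv, ff_p h1 hv])
  rw [Finset.eq_of_subset_of_card_le this (by rw [S.fac_card F hF, S.fac_card F1 h1])]
  exact hPF

theorem complete (z : Fin d → ℝ) : ∃ F ∈ S.fac, ∀ v, 0 ≤ S.co F v z := by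
  obtain ⟨F, hF, hmax⟩ := Finset.exists_max_image S.fac (fun F => S.ff F z) S.fac_ne
  refine ⟨F, hF, fun v => ?_⟩
  by_cases hv : v ∈ F
  · by_contra hneg
    push Not at hneg
    obtain ⟨j, hj, hF'⟩ := S.piv F hF v hv
    exact absurd (piv_inc hF hv hj hF' hneg) (not_lt.2 (hmax _ hF'))
  · simp [S.co_off F hF v hv]

lemma exists_avoid {Q F : Finset ι} (hF : F ∈ S.fac) (hQ : Q ⊆ F) {v} (hv : v ∉ Q) :
    ∃ F' ∈ S.fac, Q ⊆ F' ∧ v ∉ F' := by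
  by_cases h : v ∈ F
  · obtain ⟨j, hj, hF'⟩ := S.piv F hF v h
    refine ⟨_, hF', fun q hq => Finset.mem_insert_of_mem
      (Finset.mem_erase.2 ⟨fun h => hv (h ▸ hq), hQ hq⟩), piv_not hF h hj hF'⟩
  · exact ⟨F, hF, hQ, h⟩

/-- exposing functional of a face -/
theorem exposing {Q F : Finset ι} (hF : F ∈ S.fac) (hQ : Q ⊆ F) :
    ∃ f : (Fin d → ℝ) →ₗ[ℝ] ℝ, (∀ v ∈ Q, f (S.p v) = 1) ∧ ∀ v, v ∉ Q → f (S.p v) < 1 := by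
  set T := S.fac.filter fun F => Q ⊆ F with hT
  have hTn : (0 : ℝ) < T.card := by
    exact_mod_cast Finset.card_pos.2 ⟨F, Finset.mem_filter.2 ⟨hF, hQ⟩⟩
  have e : ∀ v, ((T.card : ℝ)⁻¹ • ∑ F ∈ T, S.ff F) (S.p v) =
      (T.card : ℝ)⁻¹ * ∑ F ∈ T, S.ff F (S.p v) := by
    intro v; simp [LinearMap.sum_apply]
  refine ⟨(T.card : ℝ)⁻¹ • ∑ F ∈ T, S.ff F, fun v hv => ?_, fun v hv => ?_⟩
  · have : ∑ F ∈ T, S.ff F (S.p v) = ∑ F ∈ T, (1 : ℝ) := Finset.sum_congr rfl fun F hF =>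
      ff_p (Finset.mem_filter.1 hF).1 ((Finset.mem_filter.1 hF).2 hv)
    rw [e, this]
    simp only [Finset.sum_const, nsmul_eq_mul, mul_one]
    exact inv_mul_cancel₀ hTn.ne'
  · rw [e, inv_mul_lt_iff₀ hTn, mul_one]
    obtain ⟨F', hF', hQF', hv'⟩ := exists_avoid hF hQ hv
    calc ∑ F ∈ T, S.ff F (S.p v) < ∑ F ∈ T, (1 : ℝ) :=
          Finset.sum_lt_sum (fun F hF => ff_le (Finset.mem_filter.1 hF).1 v)
            ⟨F', Finset.mem_filter.2 ⟨hF', hQF'⟩, ff_lt hF' hv'⟩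
      _ = T.card := by simp

end CFan
end

noncomputable section
set_option linter.unusedVariables false
set_option linter.unusedSectionVars false

namespace CFan
variable {d : ℕ} {ι : Type} [Fintype ι] [DecidableEq ι] (S : CFan d ι)

/-! ### Generic points -/

lemma exists_generic {κ : Type} [Finite κ] (f : κ → ((Fin d → ℝ) →ₗ[ℝ] ℝ))
    (h : ∀ k, ∃ x, f k x ≠ 0) : ∃ x, ∀ k, f k x ≠ 0 :=
  Module.Dual.exists_forall_ne_zero_of_forall_exists f h

lemma exists_xi : ∃ ξ : Fin d → ℝ, ∀ F ∈ S.fac, ∀ v ∈ F, S.co F v ξ ≠ 0 := by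
  obtain ⟨x, hx⟩ := exists_generic (κ := {q : Finset ι × ι // q.1 ∈ S.fac ∧ q.2 ∈ q.1})
    (fun k => S.co k.1.1 k.1.2) (fun k => ⟨S.p k.1.2, by
      rw [S.co_eq _ k.2.1 _ k.2.2 _ k.2.2]; simp⟩)
  exact ⟨x, fun F hF v hv => hx ⟨(F, v), hF, hv⟩⟩

/-- a generic vector -/
def ξ : Fin d → ℝ := S.exists_xi.choose
lemma hξ : ∀ F ∈ S.fac, ∀ v ∈ F, S.co F v S.ξ ≠ 0 := S.exists_xi.choose_spec

/-! ### Volumes -/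

/-- absolute determinant of an ordered tuple of vertices -/
def adet (g : Fin d → ι) : ℝ := |Matrix.det (Matrix.of fun k => S.p (g k))|

/-- normalized volume -/
def vol (F : Finset ι) : ℝ :=
  if h : F.card = d then S.adet (fun k => ((F.equivFinOfCardEq h).symm k : ι)) else 1

variable {S}

lemma adet_perm {g g' : Fin d → ι} (hg : Function.Injective g) (hg' : Function.Injective g')
    (h : Set.range g = Set.range g') : S.adet g = S.adet g' := by
  let e : Fin d ≃ Fin d := (Equiv.ofInjective g hg).trans
    ((Equiv.setCongr h).trans (Equiv.ofInjective g' hg').symm)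
  have he : ∀ k, g' (e k) = g k := by
    intro k
    have := Equiv.apply_ofInjective_symm hg' ((Equiv.setCongr h) ((Equiv.ofInjective g hg) k))
    simpa [e] using this
  have hm : (Matrix.of fun k => S.p (g k)) =
      (Matrix.of fun k => S.p (g' k)).submatrix e id := by
    ext a b; simp [he]
  unfold adet
  rw [hm, Matrix.det_permute, abs_mul]
  rcases Int.units_eq_one_or (Equiv.Perm.sign e) with h | h <;> simp [h]

lemma vol_eq {F : Finset ι} {g : Fin d → ι} (hg : Function.Injective g)
    (h : Set.range g = (F : Set ι)) : S.vol F = S.adet g := by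
  have hc : F.card = d := by
    have : F = Finset.univ.image g := by ext x; have := Set.ext_iff.1 h x; simpa using this.symm
    rw [this, Finset.card_image_of_injective _ hg]; simp
  rw [vol, dif_pos hc]
  refine adet_perm (Subtype.val_injective.comp (Equiv.injective _)) hg ?_
  rw [h]
  ext x
  constructor
  · rintro ⟨k, rfl⟩; exact ((F.equivFinOfCardEq hc).symm k).2
  · intro hx; exact ⟨F.equivFinOfCardEq hc ⟨x, hx⟩, by simp⟩

lemma exists_enum {F} (hF : F ∈ S.fac) :
    ∃ g : Fin d → ι, Function.Injective g ∧ Set.range g = (F : Set ι) := by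
  have hc := S.fac_card F hF
  refine ⟨fun k => ((F.equivFinOfCardEq hc).symm k : ι),
    Subtype.val_injective.comp (Equiv.injective _), ?_⟩
  ext x
  constructor
  · rintro ⟨k, rfl⟩; exact ((F.equivFinOfCardEq hc).symm k).2
  · intro hx; exact ⟨F.equivFinOfCardEq hc ⟨x, hx⟩, by simp⟩

lemma vol_pos {F} (hF : F ∈ S.fac) : 0 < S.vol F := by
  obtain ⟨g, hg, hr⟩ := exists_enum hF
  rw [vol_eq hg hr, adet, abs_pos]
  have hmem : ∀ k, g k ∈ F := fun k => by
    have : g k ∈ (F : Set ι) := hr ▸ Set.mem_range_self k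
    simpa using this
  intro h0
  have : (Matrix.of fun k => S.p (g k)) *
      (Matrix.of fun a b => S.co F (g b) (Pi.single a 1)) = 1 := by
    ext k b
    rw [Matrix.mul_apply, Matrix.one_apply]
    have := LinearMap.pi_apply_eq_sum_univ (S.co F (g b)) (S.p (g k))
    simp only [Matrix.of_apply]
    simp only [smul_eq_mul] at this
    have h2 : ∀ i : Fin d, (Pi.single i (1:ℝ) : Fin d → ℝ) = fun j => if i = j then 1 else 0 := by
      intro i; ext j; simp [Pi.single_apply, eq_comm]
    simp only [h2]
    rw [← this, S.co_eq F hF _ (hmem b) _ (hmem k)]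
    simp [hg.eq_iff, eq_comm]
  have h1 := congrArg Matrix.det this
  rw [Matrix.det_mul, h0] at h1
  simp at h1

lemma vol_piv {F} (hF : F ∈ S.fac) {i} (hi : i ∈ F) {j} (hj : j ∉ F)
    (hF' : insert j (F.erase i) ∈ S.fac) :
    S.vol (insert j (F.erase i)) = - S.co F i (S.p j) * S.vol F := by
  obtain ⟨g, hg, hr⟩ := exists_enum hF
  have hmem : ∀ k, g k ∈ F := fun k => by
    have : g k ∈ (F : Set ι) := hr ▸ Set.mem_range_self k
    simpa using this
  obtain ⟨k0, hk0⟩ : ∃ k, g k = i := by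
    have : i ∈ Set.range g := hr ▸ hi
    exact this
  have hne : ∀ k, g k ≠ j := fun k h => hj (h ▸ hmem k)
  have hg' : Function.Injective (Function.update g k0 j) := by
    intro a b hab
    by_cases ha : a = k0 <;> by_cases hb : b = k0
    · rw [ha, hb]
    · subst ha; simp only [Function.update_self, Function.update_of_ne hb] at hab
      exact absurd hab.symm (hne b)
    · subst hb; simp only [Function.update_self, Function.update_of_ne ha] at hab
      exact absurd hab (hne a)
    · simp only [Function.update_of_ne ha, Function.update_of_ne hb] at hab
      exact hg hab
  have hr' : Set.range (Function.update g k0 j) = ((insert j (F.erase i) : Finset ι) : Set ι) := by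
    ext x
    simp only [Set.mem_range, Finset.coe_insert, Finset.coe_erase, Set.mem_insert_iff,
      Set.mem_sdiff, Set.mem_singleton_iff, Finset.mem_coe]
    constructor
    · rintro ⟨k, rfl⟩
      by_cases hk : k = k0
      · subst hk; simp
      · rw [Function.update_of_ne hk]
        exact Or.inr ⟨hmem k, fun h => hk (hg (h.trans hk0.symm))⟩
    · rintro (rfl | ⟨hx, hxi⟩)
      · exact ⟨k0, by simp⟩
      · obtain ⟨k, rfl⟩ : x ∈ Set.range g := hr ▸ hx
        refine ⟨k, Function.update_of_ne (fun h => hxi (by rw [h, hk0])) _ _⟩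
  rw [vol_eq hg' hr', vol_eq hg hr]
  have hm : (Matrix.of fun k => S.p (Function.update g k0 j k)) =
      (Matrix.of fun k => S.p (g k)).updateRow k0
        (∑ k, S.co F (g k) (S.p j) • (Matrix.of fun k => S.p (g k)) k) := by
    have hs : (∑ k, S.co F (g k) (S.p j) • (Matrix.of fun k => S.p (g k)) k) = S.p j := by
      conv_rhs => rw [← S.co_sum F hF (S.p j)]
      have : ∑ v, S.co F v (S.p j) • S.p v = ∑ v ∈ F, S.co F v (S.p j) • S.p v :=
        (Finset.sum_subset (Finset.subset_univ _) fun v _ hv => by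
          simp [S.co_off F hF v hv]).symm
      rw [this]
      have hFi : F = Finset.univ.image g := by
        ext x; have := Set.ext_iff.1 hr x; simpa using this.symm
      conv_rhs => rw [hFi, Finset.sum_image (fun a _ b _ h => hg h)]
      rw [← hFi]
      rfl
    rw [hs]
    ext a b
    by_cases ha : a = k0
    · subst ha; simp
    · simp [Function.update_of_ne ha, Matrix.updateRow_ne ha]
  unfold adet
  rw [hm, Matrix.det_updateRow_sum, hk0, smul_eq_mul, abs_mul,
    abs_of_neg (piv_neg hF hi hj hF')]

lemma co_ν {F} (hF : F ∈ S.fac) (v) : S.co (F.image S.ν) (S.ν v) = - S.co F v := by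
  by_cases hv : v ∈ F
  · refine ext_on hF fun w hw => ?_
    have := S.co_eq _ (S.νfac F hF) (S.ν v) (Finset.mem_image_of_mem _ hv) (S.ν w)
      (Finset.mem_image_of_mem _ hw)
    rw [S.νp, map_neg] at this
    rw [LinearMap.neg_apply, S.co_eq F hF v hv w hw]
    simp only [ν_inj.eq_iff] at this
    linarith
  · rw [S.co_off F hF v hv, S.co_off _ (S.νfac F hF)]
    · simp
    · intro h
      obtain ⟨w, hw, hwv⟩ := Finset.mem_image.1 h
      exact hv (ν_inj hwv ▸ hw)

lemma vol_ν {F} (hF : F ∈ S.fac) : S.vol (F.image S.ν) = S.vol F := by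
  obtain ⟨g, hg, hr⟩ := exists_enum hF
  rw [vol_eq hg hr, vol_eq (g := S.ν ∘ g) (ν_inj.comp hg)]
  · unfold adet
    have : (Matrix.of fun k => S.p ((S.ν ∘ g) k)) = - (Matrix.of fun k => S.p (g k)) := by
      ext a b; simp [S.νp]
    rw [this, Matrix.det_neg, abs_mul]; simp
  · rw [Set.range_comp, hr]; simp

/-! ### The ring model -/

variable (S)
/-- ring of piecewise polynomial functions evaluated at `ξ` -/
abbrev Rg := {F // F ∈ S.fac} → ℝ

/-- piecewise linear function with given values on vertices -/
def E : (ι → ℝ) →ₗ[ℝ] S.Rg where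
  toFun z F := S.lin F z S.ξ
  map_add' z z' := by
    ext F; simp [lin_apply, add_mul, Finset.sum_add_distrib]
  map_smul' c z := by
    ext F; simp [lin_apply, Finset.mul_sum, mul_assoc]

/-- Courant functions -/
def X (v : ι) : S.Rg := S.E (Pi.single v 1)

/-- the sum of all Courant functions -/
def om : S.Rg := S.E 1

/-- the degree map -/
def tr : S.Rg →ₗ[ℝ] ℝ :=
  ∑ F : {F // F ∈ S.fac}, (S.vol F * ∏ v ∈ F.1, S.co F v S.ξ)⁻¹ • LinearMap.proj F

/-- piecewise linear functions -/
def PL : Submodule ℝ S.Rg := LinearMap.range S.E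

variable {S}

lemma tr_apply (g : S.Rg) : S.tr g =
    ∑ F : {F // F ∈ S.fac}, (S.vol F * ∏ v ∈ F.1, S.co F v S.ξ)⁻¹ * g F := by
  simp [tr, LinearMap.sum_apply]

lemma E_apply (z : ι → ℝ) (F) : S.E z F = S.lin F.1 z S.ξ := rfl

lemma X_apply (v : ι) (F : {F // F ∈ S.fac}) : S.X v F = S.co F.1 v S.ξ := by
  simp [X, E_apply, lin_apply, Pi.single_apply]

lemma E_sum (z : ι → ℝ) : S.E z = ∑ v, z v • S.X v := by
  ext F; simp [E_apply, lin_apply, X_apply]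

lemma om_sum : S.om = ∑ v, S.X v := by
  simp [om, E_sum]

lemma E_lin (f : (Fin d → ℝ) →ₗ[ℝ] ℝ) : S.E (fun v => f (S.p v)) = f S.ξ • 1 := by
  ext F; simp [E_apply, lin_comp F.2]

lemma lagrange_zero (s : Finset ι) (t : ι → ℝ) (ht : Set.InjOn t s) (N : Polynomial ℝ)
    (hN : N.degree < s.card) :
    N.eval 0 = ∑ v ∈ s, N.eval (t v) * ∏ w ∈ s.erase v, ((t v - t w)⁻¹ * (0 - t w)) := by
  conv_lhs => rw [Lagrange.eq_interpolate ht hN]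
  rw [Lagrange.interpolate_apply, Polynomial.eval_finsetSum]
  refine Finset.sum_congr rfl fun v hv => ?_
  rw [Polynomial.eval_mul, Polynomial.eval_C, Lagrange.basis, Polynomial.eval_prod]
  simp [Lagrange.basisDivisor]

theorem tr_list (l : List (ι → ℝ)) (hl : l.length < d) : S.tr (l.map S.E).prod = 0 := by
  -- choose a generic direction
  obtain ⟨η, hη⟩ := exists_generic
    (κ := {q : Finset ι × ι × ι // q.1 ∈ S.fac ∧ q.2.1 ∈ q.1 ∧ q.2.2 ∈ q.1})
    (fun k => if k.1.2.1 = k.1.2.2 then S.co k.1.1 k.1.2.1 else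
      S.co k.1.1 k.1.2.1 S.ξ • S.co k.1.1 k.1.2.2 - S.co k.1.1 k.1.2.2 S.ξ • S.co k.1.1 k.1.2.1)
    (by
      rintro ⟨⟨F, v, w⟩, hF, hv, hw⟩
      refine ⟨S.p w, ?_⟩
      dsimp only at hF hv hw ⊢
      split_ifs with h
      · subst h; simp [S.co_eq F hF v hv v hv]
      · simp [S.co_eq F hF v hv w hw, S.co_eq F hF w hw w hw, h, S.hξ F hF v hv])
  have hη1 : ∀ F ∈ S.fac, ∀ v ∈ F, S.co F v η ≠ 0 := fun F hF v hv => by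
    simpa using hη ⟨(F, v, v), hF, hv, hv⟩
  have hη2 : ∀ F ∈ S.fac, ∀ v ∈ F, ∀ w ∈ F, v ≠ w →
      S.co F v S.ξ * S.co F w η - S.co F w S.ξ * S.co F v η ≠ 0 := fun F hF v hv w hw h => by
    simpa [h] using hη ⟨(F, v, w), hF, hv, hw⟩
  -- the numerators
  let Nv : Finset ι → (Fin d → ℝ) → ℝ := fun F x => (l.map fun z => S.lin F z x).prod
  let pt : ((Fin d → ℝ) →ₗ[ℝ] ℝ) → (Fin d → ℝ) := fun f => S.ξ + (-(f S.ξ / f η)) • η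
  let term : Finset ι × ι → ℝ := fun q =>
    (S.vol q.1)⁻¹ * (S.co q.1 q.2 S.ξ)⁻¹ * Nv q.1 (pt (S.co q.1 q.2)) *
      ∏ w ∈ q.1.erase q.2, (S.co q.1 w (pt (S.co q.1 q.2)))⁻¹
  have key : ∀ F ∈ S.fac, (S.vol F * ∏ v ∈ F, S.co F v S.ξ)⁻¹ * Nv F S.ξ =
      ∑ v ∈ F, term (F, v) := by
    intro F hF
    let t : ι → ℝ := fun v => -(S.co F v S.ξ / S.co F v η)
    let N : Polynomial ℝ := (l.map fun z => Polynomial.C (S.lin F z S.ξ) +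
      Polynomial.C (S.lin F z η) * Polynomial.X).prod
    have hNe : ∀ s, N.eval s = Nv F (S.ξ + s • η) := by
      intro s
      simp only [N, Nv]
      rw [← Polynomial.coe_evalRingHom, map_list_prod, List.map_map]
      congr 1
      apply List.map_congr_left
      intro z _
      simp only [Function.comp, Polynomial.coe_evalRingHom, Polynomial.eval_add,
        Polynomial.eval_mul, Polynomial.eval_C, Polynomial.eval_X, map_add, map_smul, smul_eq_mul]
      ring
    have hNd : N.degree < F.card := by
      rw [S.fac_card F hF]
      have : N.degree ≤ (l.length : WithBot ℕ) := by
        have := Polynomial.degree_list_prod_le (l.map fun z => Polynomial.C (S.lin F z S.ξ) +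
          Polynomial.C (S.lin F z η) * Polynomial.X)
        refine this.trans ?_
        have h2 := List.sum_le_card_nsmul (((l.map fun z => Polynomial.C (S.lin F z S.ξ) +
          Polynomial.C (S.lin F z η) * Polynomial.X)).map Polynomial.degree) 1 ?_
        · simpa using h2
        · intro x hx
          simp only [List.map_map, List.mem_map] at hx
          obtain ⟨z, _, rfl⟩ := hx
          simp only [Function.comp]
          rw [add_comm]
          exact Polynomial.degree_linear_le
      exact this.trans_lt (by exact_mod_cast hl)
    have ht : Set.InjOn t F := by
      intro v hv w hw h
      by_contra hvw
      apply hη2 F hF v hv w hw hvw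
      have h' : S.co F v S.ξ / S.co F v η = S.co F w S.ξ / S.co F w η := neg_injective h
      rw [div_eq_div_iff (hη1 F hF v hv) (hη1 F hF w hw)] at h'
      linarith
    have h0 := lagrange_zero F t ht N hNd
    rw [hNe, zero_smul, add_zero] at h0
    rw [h0, Finset.mul_sum]
    refine Finset.sum_congr rfl fun v hv => ?_
    have e1 : N.eval (t v) = Nv F (pt (S.co F v)) := hNe _
    have e2 : ∀ w ∈ F.erase v, (t v - t w)⁻¹ * (0 - t w) =
        S.co F w S.ξ * (S.co F w (pt (S.co F v)))⁻¹ := by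
      intro w hw
      have hw' := Finset.mem_of_mem_erase hw
      have hne := Finset.ne_of_mem_erase hw
      have a1 := hη1 F hF v hv
      have a2 := hη1 F hF w hw'
      have a3 := hη2 F hF v hv w hw' hne.symm
      simp only [t, pt, map_add, map_smul, smul_eq_mul]
      have b1 : -(S.co F v S.ξ / S.co F v η) - -(S.co F w S.ξ / S.co F w η) =
        (-(S.co F v S.ξ * S.co F w η - S.co F w S.ξ * S.co F v η)) /
          (S.co F v η * S.co F w η) := by field_simp; ring
      have b2 : S.co F w S.ξ + -(S.co F v S.ξ / S.co F v η) * S.co F w η =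
        (-(S.co F v S.ξ * S.co F w η - S.co F w S.ξ * S.co F v η)) / S.co F v η := by
          field_simp; ring
      rw [b1, b2]
      generalize S.co F v S.ξ * S.co F w η - S.co F w S.ξ * S.co F v η = D at *
      field_simp
      ring
    rw [e1, Finset.prod_congr rfl e2, Finset.prod_mul_distrib]
    simp only [term]
    rw [← Finset.mul_prod_erase F _ hv]
    have hp : ∏ w ∈ F.erase v, S.co F w S.ξ ≠ 0 :=
      Finset.prod_ne_zero_iff.2 fun w hw => S.hξ F hF w (Finset.mem_of_mem_erase hw)
    have hv0 := S.hξ F hF v hv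
    have hvol := (vol_pos hF).ne'
    field_simp
  have hmain : S.tr (l.map S.E).prod =
      ∑ q ∈ (S.fac ×ˢ (Finset.univ : Finset ι)).filter (fun q => q.2 ∈ q.1), term q := by
    rw [tr_apply]
    have e0 : ∀ F : {F // F ∈ S.fac}, ((l.map S.E).prod : S.Rg) F = Nv F.1 S.ξ := by
      intro F
      have := map_list_prod (Pi.evalMonoidHom (fun _ : {F // F ∈ S.fac} => ℝ) F) (l.map S.E)
      rw [List.map_map] at this
      exact this
    simp only [e0]
    rw [Finset.sum_filter, Finset.sum_product]
    rw [← Finset.sum_coe_sort S.fac (fun F => ∑ v, if v ∈ F then term (F, v) else 0)]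
    refine Finset.sum_congr rfl fun F _ => ?_
    rw [key F.1 F.2]
    simp
  rw [hmain]
  choose! J hJ1 hJ2 using S.piv
  have back : ∀ F ∈ S.fac, ∀ i ∈ F,
      insert i ((insert (J F i) (F.erase i)).erase (J F i)) = F := by
    intro F hF i hi
    rw [Finset.erase_insert, Finset.insert_erase hi]
    exact fun h => hJ1 F hF i hi (Finset.mem_of_mem_erase h)
  refine Finset.sum_involution
    (fun q _ => (insert (J q.1 q.2) (q.1.erase q.2), J q.1 q.2)) ?_ ?_ ?_ ?_
  · rintro ⟨F, i⟩ hq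
    simp only [Finset.mem_filter, Finset.mem_product, Finset.mem_univ, and_true] at hq
    obtain ⟨hF, hi⟩ := hq
    dsimp only
    have hj := hJ1 F hF i hi
    have hF' := hJ2 F hF i hi
    generalize J F i = j at *
    have hneg := piv_neg hF hi hj hF'
    have c1 : S.co F i = S.co F i (S.p j) • S.co (insert j (F.erase i)) j := by
      apply ext_on hF'
      intro v hv
      rcases Finset.mem_insert.1 hv with rfl | hv'
      · simp [S.co_eq _ hF' v (Finset.mem_insert_self _ _) v (Finset.mem_insert_self _ _)]
      · have hvj : v ≠ j := fun h => hj (h ▸ Finset.mem_of_mem_erase hv')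
        simp [S.co_eq _ hF' j (Finset.mem_insert_self _ _) v hv, Ne.symm hvj,
          S.co_eq _ hF i hi v (Finset.mem_of_mem_erase hv'), (Finset.ne_of_mem_erase hv').symm]
    have cpt : pt (S.co (insert j (F.erase i)) j) = pt (S.co F i) := by
      simp only [pt]
      rw [c1]
      simp only [LinearMap.smul_apply, smul_eq_mul]
      rw [mul_div_mul_left _ _ hneg.ne]
    have hker : S.co F i (pt (S.co F i)) = 0 := by
      have := hη1 F hF i hi
      simp only [pt, map_add, map_smul, smul_eq_mul]
      field_simp; ring
    have hagree : ∀ f g : (Fin d → ℝ) →ₗ[ℝ] ℝ, (∀ v ∈ F.erase i, f (S.p v) = g (S.p v)) →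
        f (pt (S.co F i)) = g (pt (S.co F i)) := by
      intro f g h
      rw [piv_diff hF hi hj hF' h]
      simp [hker]
    simp only [term, cpt]
    have hNv : Nv (insert j (F.erase i)) (pt (S.co F i)) = Nv F (pt (S.co F i)) := by
      simp only [Nv]
      congr 1
      apply List.map_congr_left
      intro z _
      apply hagree
      intro v hv
      rw [lin_p hF' (Finset.mem_insert_of_mem hv), lin_p hF (Finset.mem_of_mem_erase hv)]
    have hers : (insert j (F.erase i)).erase j = F.erase i :=
      Finset.erase_insert fun h => hj (Finset.mem_of_mem_erase h)
    have hco : ∀ w ∈ F.erase i, S.co (insert j (F.erase i)) w (pt (S.co F i)) =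
        S.co F w (pt (S.co F i)) := by
      intro w hw
      apply hagree
      intro v hv
      rw [S.co_eq _ hF' w (Finset.mem_insert_of_mem hw) v (Finset.mem_insert_of_mem hv),
        S.co_eq _ hF w (Finset.mem_of_mem_erase hw) v (Finset.mem_of_mem_erase hv)]
    have hpr : ∏ w ∈ F.erase i, (S.co (insert j (F.erase i)) w (pt (S.co F i)))⁻¹ =
        ∏ w ∈ F.erase i, (S.co F w (pt (S.co F i)))⁻¹ :=
      Finset.prod_congr rfl fun w hw => by rw [hco w hw]
    rw [hNv, hers, hpr, vol_piv hF hi hj hF']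
    have c1' := congrArg (fun f => f S.ξ) c1
    simp only [LinearMap.smul_apply, smul_eq_mul] at c1'
    rw [c1']
    have := S.hξ _ hF' j (Finset.mem_insert_self _ _)
    have hvol := (vol_pos hF).ne'
    have hneg' := hneg.ne
    field_simp
    ring
  · rintro ⟨F, i⟩ hq _ h
    simp only [Finset.mem_filter, Finset.mem_product, Finset.mem_univ, and_true] at hq
    simp only [Prod.mk.injEq] at h
    exact hJ1 F hq.1 i hq.2 (by rw [h.2]; exact hq.2)
  · rintro ⟨F, i⟩ hq
    simp only [Finset.mem_filter, Finset.mem_product, Finset.mem_univ, and_true] at hq ⊢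
    exact ⟨hJ2 F hq.1 i hq.2, Finset.mem_insert_self _ _⟩
  · rintro ⟨F, i⟩ hq
    simp only [Finset.mem_filter, Finset.mem_product, Finset.mem_univ, and_true] at hq
    obtain ⟨hF, hi⟩ := hq
    have hj := hJ1 F hF i hi
    have hF' := hJ2 F hF i hi
    have hF'' := back F hF i hi
    have : J (insert (J F i) (F.erase i)) (J F i) = i := by
      refine piv_unique hF' (Finset.mem_insert_self _ _) ?_ ?_
        (piv_not hF hi hj hF') (by rw [hF'']; exact hF)
      · exact hJ1 _ hF' _ (Finset.mem_insert_self _ _)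
      · exact hJ2 _ hF' _ (Finset.mem_insert_self _ _)
    dsimp only
    rw [this, hF'']

end CFan
end

noncomputable section
set_option linter.unusedVariables false
set_option linter.unusedSectionVars false

/-- spectral lemma for the Bochner step -/
lemma bochner_spec {κ : Type} [Fintype κ] (A : κ → κ → ℝ) (hA : ∀ v w, A v w = A w v)
    (D h : κ → ℝ) (hD : ∀ v, 0 < D v)
    (H1 : ∀ z : κ → ℝ, ∑ v, z v * ∑ w, A v w * z w ≤ ∑ v, (∑ w, A v w * z w) ^ 2 / D v)
    (H2 : ∀ z : κ → ℝ, ∑ v, z v * ∑ w, A v w * z w ≤ ∑ v, D v * z v ^ 2)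
    (H3 : ∀ z : κ → ℝ, ∑ v, z v * ∑ w, A v w * z w = ∑ v, D v * z v ^ 2 → ∃ c, ∀ v, z v = c * h v)
    (z : κ → ℝ) (hz : ∑ v, D v * h v * z v = 0) : ∑ v, z v * ∑ w, A v w * z w ≤ 0 := by
  have hs : ∀ v, 0 < √(D v) := fun v => Real.sqrt_pos.2 (hD v)
  have hss : ∀ v, √(D v) * √(D v) = D v := fun v => Real.mul_self_sqrt (hD v).le
  let M : Matrix κ κ ℝ := Matrix.of fun v w => A v w / (√(D v) * √(D w))
  have hM : M.IsHermitian := by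
    ext v w
    simp [M, Matrix.conjTranspose_apply, hA v w, mul_comm]
  have hMz : ∀ (u : κ → ℝ) v, ∑ w, A v w * (u w / √(D w)) = √(D v) * (M.mulVec u) v := by
    intro u v
    rw [Matrix.mulVec, dotProduct, Finset.mul_sum]
    refine Finset.sum_congr rfl fun w _ => ?_
    have := hs v; have := hs w
    simp only [M, Matrix.of_apply]
    field_simp
  let b := hM.eigenvectorBasis
  let lam := hM.eigenvalues
  have hb1 : ∀ k, ∑ v, (b k) v ^ 2 = 1 := by
    intro k
    have := b.orthonormal.1 k
    have h2 : ‖b k‖ ^ 2 = 1 := by rw [this]; norm_num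
    rw [EuclideanSpace.norm_sq_eq] at h2
    simpa using h2
  have hbe : ∀ k, M.mulVec (fun v => (b k) v) = fun v => lam k * (b k) v := by
    intro k
    have := hM.mulVec_eigenvectorBasis k
    simpa [b, lam, funext_iff, Pi.smul_apply] using this
  -- test inequalities on eigenvectors
  have hq : ∀ k v, ∑ w, A v w * ((b k) w / √(D w)) = √(D v) * (lam k * (b k) v) := by
    intro k v; rw [hMz (fun v => (b k) v), hbe]
  have hq1 : ∀ k, ∑ v, ((b k) v / √(D v)) * ∑ w, A v w * ((b k) w / √(D w)) = lam k := by
    intro k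
    have h0 : lam k = ∑ v, lam k * (b k) v ^ 2 := by rw [← Finset.mul_sum, hb1 k, mul_one]
    simp only [hq]
    refine Eq.trans ?_ h0.symm
    refine Finset.sum_congr rfl fun v _ => ?_
    have := hs v
    field_simp
  have hq2 : ∀ k, ∑ v, (∑ w, A v w * ((b k) w / √(D w))) ^ 2 / D v = lam k ^ 2 := by
    intro k
    simp only [hq]
    rw [← mul_one (lam k ^ 2), ← hb1 k, Finset.mul_sum]
    refine Finset.sum_congr rfl fun v _ => ?_
    have := hD v
    rw [mul_pow, Real.sq_sqrt this.le]
    field_simp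
  have hq3 : ∀ k, ∑ v, D v * ((b k) v / √(D v)) ^ 2 = 1 := by
    intro k
    rw [← hb1 k]
    refine Finset.sum_congr rfl fun v _ => ?_
    have := hD v
    rw [div_pow, Real.sq_sqrt this.le]
    field_simp
  have hl1 : ∀ k, lam k ≤ lam k ^ 2 := fun k => by
    have := H1 (fun v => (b k) v / √(D v)); rwa [hq1, hq2] at this
  have hl2 : ∀ k, lam k ≤ 1 := fun k => by
    have := H2 (fun v => (b k) v / √(D v)); rwa [hq1, hq3] at this
  let g : EuclideanSpace ℝ κ := WithLp.toLp 2 fun v => √(D v) * z v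
  let c : κ → ℝ := fun k => ∑ v, (b k) v * (√(D v) * z v)
  have hc : ∀ k, inner ℝ (b k) g = c k := by
    intro k
    simp [PiLp.inner_apply, g, c, mul_comm]
  have hl3 : ∀ k, lam k * c k ^ 2 ≤ 0 := by
    intro k
    by_cases h1 : lam k = 1
    · obtain ⟨e, he⟩ := H3 (fun v => (b k) v / √(D v)) (by rw [hq1, hq3, h1])
      have : c k = e * ∑ v, D v * h v * z v := by
        simp only [c, Finset.mul_sum]
        refine Finset.sum_congr rfl fun v _ => ?_
        have h2 := he v
        have h3 := hs v
        rw [div_eq_iff h3.ne'] at h2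
        rw [h2]; linear_combination (e * h v * z v) * hss v
      rw [this, hz]; simp
    · have h2 : lam k < 1 := lt_of_le_of_ne (hl2 k) h1
      have h3 : lam k ≤ 0 := by nlinarith [hl1 k]
      exact mul_nonpos_of_nonpos_of_nonneg h3 (sq_nonneg _)
  have hg : ∀ v, √(D v) * z v = ∑ k, c k * (b k) v := by
    intro v
    have := congrArg (fun x : EuclideanSpace ℝ κ => x v) (b.sum_repr' g)
    simp only [hc] at this
    simp only [WithLp.ofLp_sum, WithLp.ofLp_smul, Finset.sum_apply, Pi.smul_apply,
      smul_eq_mul] at this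
    exact this.symm
  have hMg : ∀ v, ∑ w, A v w * z w = √(D v) * ∑ k, c k * (lam k * (b k) v) := by
    intro v
    have e1 : ∀ w, z w = ∑ k, c k * ((b k) w / √(D w)) := by
      intro w
      have := hs w
      have h2 := hg w
      rw [← Finset.sum_congr rfl fun k _ => mul_div_assoc (c k) ((b k) w) (√(D w)),
        ← Finset.sum_div, ← h2]
      field_simp
    have e2 : ∑ w, A v w * z w = ∑ k, c k * ∑ w, A v w * ((b k) w / √(D w)) := by
      simp only [Finset.mul_sum]
      rw [Finset.sum_comm]
      refine Finset.sum_congr rfl fun w _ => ?_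
      rw [e1 w, Finset.mul_sum]
      refine Finset.sum_congr rfl fun k _ => ?_
      ring
    rw [e2, Finset.mul_sum]
    refine Finset.sum_congr rfl fun k _ => ?_
    rw [hq]; ring
  have hfin : ∑ v, z v * ∑ w, A v w * z w = ∑ k, lam k * c k ^ 2 := by
    have : ∀ k, lam k * c k ^ 2 = ∑ v, (√(D v) * z v) * (c k * (lam k * (b k) v)) := by
      intro k
      rw [sq]
      conv_lhs => rw [show lam k * (c k * c k) = (lam k * c k) * c k by ring]
      rw [show c k = ∑ v, (b k) v * (√(D v) * z v) from rfl, Finset.mul_sum]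
      refine Finset.sum_congr rfl fun v _ => ?_
      ring
    simp only [this, hMg]
    rw [Finset.sum_comm]
    refine Finset.sum_congr rfl fun v _ => ?_
    simp only [Finset.mul_sum]
    refine Finset.sum_congr rfl fun k _ => ?_
    ring
  rw [hfin]
  exact Finset.sum_nonpos fun k _ => hl3 k

namespace CFan
variable {d : ℕ} {ι : Type} [Fintype ι] [DecidableEq ι] {S : CFan d ι}

/-! ### degrees -/

lemma mE (z : ι → ℝ) : S.E z ∈ S.PL ^ 1 := by
  rw [pow_one]; exact LinearMap.mem_range_self _ _

lemma mX (v : ι) : S.X v ∈ S.PL ^ 1 := mE _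

lemma mm {a b : S.Rg} {i j : ℕ} (ha : a ∈ S.PL ^ i) (hb : b ∈ S.PL ^ j) :
    a * b ∈ S.PL ^ (i + j) := by
  rw [pow_add]; exact Submodule.mul_mem_mul ha hb

lemma mom (m : ℕ) : S.om ^ m ∈ S.PL ^ m := by
  have := Submodule.pow_mem_pow S.PL (x := S.om) (LinearMap.mem_range_self _ _) m
  exact this

lemma tr0_aux {x : S.Rg} {k : ℕ} (hx : x ∈ S.PL ^ k) :
    ∀ l : List (ι → ℝ), l.length + k < d → S.tr (x * (l.map S.E).prod) = 0 := by
  induction hx using Submodule.pow_induction_on_left' with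
  | algebraMap r =>
    intro l hl
    rw [Algebra.algebraMap_eq_smul_one, smul_mul_assoc, one_mul, map_smul, tr_list l (by omega)]
    simp
  | add x y i hx hy ihx ihy =>
    intro l hl
    rw [add_mul, map_add, ihx l hl, ihy l hl, add_zero]
  | mem_mul m hm i x hx ih =>
    intro l hl
    obtain ⟨z, rfl⟩ := hm
    have := ih (z :: l) (by simp; omega)
    rw [List.map_cons, List.prod_cons] at this
    rw [← this]; congr 1; ring

lemma tr0 {x : S.Rg} {k : ℕ} (hx : x ∈ S.PL ^ k) (hk : k < d) : S.tr x = 0 := by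
  simpa using tr0_aux hx [] (by simpa using hk)

lemma kill {x : S.Rg} {k : ℕ} (hx : x ∈ S.PL ^ k) (hk : k < d) (f : (Fin d → ℝ) →ₗ[ℝ] ℝ) :
    S.tr (S.E (fun v => f (S.p v)) * x) = 0 := by
  rw [E_lin, smul_mul_assoc, one_mul, map_smul, tr0 hx hk, smul_zero]

variable (S)
/-- squarefree monomials -/
def XQ (Q : Finset ι) : S.Rg := ∏ v ∈ Q, S.X v

/-- faces -/
def Fc (Q : Finset ι) : Prop := ∃ F ∈ S.fac, Q ⊆ F
variable {S}

lemma Fc.mono {Q Q' : Finset ι} (h : S.Fc Q) (hq : Q' ⊆ Q) : S.Fc Q' := by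
  obtain ⟨F, hF, h⟩ := h
  exact ⟨F, hF, hq.trans h⟩

lemma mXQ (Q : Finset ι) : S.XQ Q ∈ S.PL ^ Q.card := by
  induction Q using Finset.induction_on with
  | empty => simp [XQ, Submodule.one_le.1 le_rfl]
  | insert v Q hv ih =>
    rw [XQ, Finset.prod_insert hv, Finset.card_insert_of_notMem hv, add_comm]
    exact mm (mX v) ih

lemma XQ_insert {Q : Finset ι} {v} (hv : v ∉ Q) : S.XQ (insert v Q) = S.X v * S.XQ Q := by
  rw [XQ, Finset.prod_insert hv]; rfl

lemma X_off {v} {F : {F // F ∈ S.fac}} (hv : v ∉ F.1) : S.X v F = 0 := by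
  rw [X_apply, S.co_off _ F.2 v hv]; simp

lemma XQ_off {Q : Finset ι} {F : {F // F ∈ S.fac}} (hQ : ¬ Q ⊆ F.1) : S.XQ Q F = 0 := by
  obtain ⟨v, hv, hvF⟩ := Finset.not_subset.1 hQ
  rw [XQ, Finset.prod_apply]
  exact Finset.prod_eq_zero hv (X_off hvF)

lemma XQ_zero {Q : Finset ι} (hQ : ¬ S.Fc Q) : S.XQ Q = 0 := by
  ext F
  exact XQ_off fun h => hQ ⟨F.1, F.2, h⟩

lemma XQ_congr {Q : Finset ι} {z z' : ι → ℝ}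
    (h : ∀ v, S.Fc (insert v Q) → z v = z' v) : S.XQ Q * S.E z = S.XQ Q * S.E z' := by
  ext F
  by_cases hQ : Q ⊆ F.1
  · simp only [Pi.mul_apply, E_apply]
    rw [lin_congr F.2 fun v hv => h v ⟨F.1, F.2, Finset.insert_subset hv hQ⟩]
  · simp [XQ_off hQ]

lemma tr_facet {F} (hF : F ∈ S.fac) : S.tr (S.XQ F) = (S.vol F)⁻¹ := by
  rw [tr_apply, Finset.sum_eq_single ⟨F, hF⟩]
  · have : S.XQ F ⟨F, hF⟩ = ∏ v ∈ F, S.co F v S.ξ := by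
      rw [XQ, Finset.prod_apply]; simp [X_apply]
    rw [this]
    have h0 : ∏ v ∈ F, S.co F v S.ξ ≠ 0 := Finset.prod_ne_zero_iff.2 fun v hv => S.hξ F hF v hv
    have := (vol_pos hF).ne'
    field_simp
  · intro G _ hG
    rw [XQ_off, mul_zero]
    intro h
    apply hG
    ext1
    exact (Finset.eq_of_subset_of_card_le h (by rw [S.fac_card _ G.2, S.fac_card _ hF])).symm
  · simp

lemma tr_facet_pos {F} (hF : F ∈ S.fac) : 0 < S.tr (S.XQ F) := by
  rw [tr_facet hF]; exact inv_pos.2 (vol_pos hF)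

lemma om_eq (f : (Fin d → ℝ) →ₗ[ℝ] ℝ) :
    S.om = S.E (fun v => 1 - f (S.p v)) + S.E (fun v => f (S.p v)) := by
  rw [← map_add]; unfold om; congr 1; ext v; simp

lemma XQ_facet {Q : Finset ι} (hQ : S.Fc Q) (hc : Q.card = d) : Q ∈ S.fac := by
  obtain ⟨F, hF, h⟩ := hQ
  rwa [Finset.eq_of_subset_of_card_le h (by rw [S.fac_card _ hF, hc])]

lemma W_pos : ∀ (m : ℕ) (Q : Finset ι), Q.card + m = d → S.Fc Q → 0 < S.tr (S.XQ Q * S.om ^ m) := by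
  intro m
  induction m with
  | zero =>
    intro Q hc hQ
    rw [pow_zero, mul_one]
    exact tr_facet_pos (XQ_facet hQ (by omega))
  | succ m ih =>
    intro Q hc hQ
    obtain ⟨F, hF, hQF⟩ := hQ
    obtain ⟨f, hf1, hf2⟩ := exposing hF hQF
    have e : S.tr (S.XQ Q * S.om ^ (m + 1)) =
        ∑ v, (1 - f (S.p v)) * S.tr (S.X v * (S.XQ Q * S.om ^ m)) := by
      rw [pow_succ']
      conv_lhs => rw [show S.XQ Q * (S.om * S.om ^ m) = S.om * (S.XQ Q * S.om ^ m) by ring]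
      rw [om_eq f, add_mul, map_add, ← om_eq f, kill (mm (mXQ Q) (mom m)) (by omega), add_zero,
        E_sum, Finset.sum_mul, map_sum]
      refine Finset.sum_congr rfl fun v _ => ?_
      rw [smul_mul_assoc, map_smul, smul_eq_mul]
    rw [e]
    have ht : ∀ v, v ∉ Q → S.tr (S.X v * (S.XQ Q * S.om ^ m)) =
        S.tr (S.XQ (insert v Q) * S.om ^ m) := by
      intro v hv; rw [XQ_insert hv, mul_assoc]
    have hnn : ∀ v, v ∉ Q → 0 ≤ S.tr (S.X v * (S.XQ Q * S.om ^ m)) := by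
      intro v hv
      rw [ht v hv]
      by_cases hf : S.Fc (insert v Q)
      · exact (ih _ (by rw [Finset.card_insert_of_notMem hv]; omega) hf).le
      · rw [XQ_zero hf]; simp
    have : ∃ v ∈ F, v ∉ Q := by
      by_contra hcon
      push Not at hcon
      have := Finset.card_le_card (show F ⊆ Q from hcon)
      rw [S.fac_card F hF] at this
      omega
    obtain ⟨v, hvF, hv⟩ := this
    refine Finset.sum_pos' (fun w _ => ?_) ⟨v, Finset.mem_univ v, ?_⟩
    · by_cases hw : w ∈ Q
      · rw [hf1 w hw]; simp
      · exact mul_nonneg (by linarith [hf2 w hw]) (hnn w hw)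
    · refine mul_pos (by linarith [hf2 v hv]) ?_
      rw [ht v hv]
      exact ih _ (by rw [Finset.card_insert_of_notMem hv]; omega)
        ⟨F, hF, Finset.insert_subset hvF hQF⟩

lemma W_nonneg (m : ℕ) (Q : Finset ι) (h : Q.card + m = d) : 0 ≤ S.tr (S.XQ Q * S.om ^ m) := by
  by_cases hQ : S.Fc Q
  · exact (W_pos m Q h hQ).le
  · rw [XQ_zero hQ]; simp

/-! ### The bilinear forms -/
variable (S)
/-- the form `tr (X_Q z z' ω^m)` -/
def BB (Q : Finset ι) (m : ℕ) : (ι → ℝ) →ₗ[ℝ] (ι → ℝ) →ₗ[ℝ] ℝ :=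
  LinearMap.mk₂ ℝ (fun z z' => S.tr (S.XQ Q * S.E z * S.E z' * S.om ^ m))
    (by intro a b c; rw [map_add, ← map_add S.tr]; congr 1; ring)
    (by intro a b c; rw [map_smul, ← map_smul S.tr]; congr 1
        simp only [mul_smul_comm, smul_mul_assoc])
    (by intro a b c; rw [map_add, ← map_add S.tr]; congr 1; ring)
    (by intro a b c; rw [map_smul, ← map_smul S.tr]; congr 1
        simp only [mul_smul_comm, smul_mul_assoc])
variable {S}

lemma BB_apply (Q : Finset ι) (m : ℕ) (z z' : ι → ℝ) :
    S.BB Q m z z' = S.tr (S.XQ Q * S.E z * S.E z' * S.om ^ m) := rfl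

lemma BB_symm (Q : Finset ι) (m : ℕ) (z z' : ι → ℝ) : S.BB Q m z z' = S.BB Q m z' z := by
  rw [BB_apply, BB_apply]; congr 1; ring

lemma BB_one (Q : Finset ι) (m : ℕ) (z : ι → ℝ) :
    S.BB Q m z 1 = S.tr (S.XQ Q * S.E z * S.om ^ (m + 1)) := by
  rw [BB_apply, pow_succ']; congr 1; unfold om; ring

lemma BB_oneone (Q : Finset ι) (m : ℕ) : S.BB Q m 1 1 = S.tr (S.XQ Q * S.om ^ (m + 2)) := by
  rw [BB_apply]; congr 1; unfold om; ring

lemma BB_lin (Q : Finset ι) (m : ℕ) (h : Q.card + m + 2 ≤ d) (f : (Fin d → ℝ) →ₗ[ℝ] ℝ) (z) :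
    S.BB Q m (fun v => f (S.p v)) z = 0 := by
  rw [BB_apply]
  have := kill (mm (mm (mXQ Q) (mE z)) (mom m)) (by omega) (S := S) f
  rw [← this]; congr 1; ring

lemma BB_lin' (Q : Finset ι) (m : ℕ) (h : Q.card + m + 2 ≤ d) (f : (Fin d → ℝ) →ₗ[ℝ] ℝ) (z) :
    S.BB Q m z (fun v => f (S.p v)) = 0 := by rw [BB_symm, BB_lin Q m h]

lemma BB_congr {Q : Finset ι} {m : ℕ} {z z' : ι → ℝ}
    (h : ∀ v, S.Fc (insert v Q) → z v = z' v) (y) : S.BB Q m z y = S.BB Q m z' y := by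
  rw [BB_apply, BB_apply, XQ_congr h]

lemma BB_single {Q : Finset ι} {m : ℕ} {v} (hv : v ∉ Q) (z : ι → ℝ) :
    S.BB Q m (Pi.single v 1) z = S.tr (S.XQ (insert v Q) * S.E z * S.om ^ m) := by
  rw [BB_apply, XQ_insert hv]; unfold X; congr 1; ring

lemma BB_expand (Q : Finset ι) (m : ℕ) (z y : ι → ℝ) :
    S.BB Q m z y = ∑ v, z v * S.BB Q m (Pi.single v 1) y := by
  have : z = ∑ v, z v • (Pi.single v 1 : ι → ℝ) := by
    ext w; simp [Finset.sum_apply, Pi.single_apply]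
  conv_lhs => rw [this]
  simp [LinearMap.sum_apply]

lemma BB_two {Q : Finset ι} {m : ℕ} {v w} (hv : v ∉ Q) (hw : w ∉ insert v Q) :
    S.BB Q m (Pi.single v 1) (Pi.single w 1) = S.tr (S.XQ (insert w (insert v Q)) * S.om ^ m) := by
  rw [BB_single hv, XQ_insert hw]; unfold X; congr 1; ring

variable (S)
/-- the Hodge-Riemann property -/
def HRP (Q : Finset ι) (m : ℕ) : Prop := ∀ z, S.BB Q m z 1 = 0 → S.BB Q m z z ≤ 0 ∧
  (S.BB Q m z z = 0 → ∃ f : (Fin d → ℝ) →ₗ[ℝ] ℝ, ∀ F ∈ S.fac, Q ⊆ F → S.lin F z = f)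
variable {S}

/-- projection to the orthogonal complement of one -/
lemma BB_proj {Q : Finset ι} {m : ℕ} (hc : Q.card + m + 2 = d) (hQ : S.Fc Q) (z : ι → ℝ) :
    ∃ c : ℝ, S.BB Q m (z - c • 1) 1 = 0 ∧ c * S.BB Q m 1 1 = S.BB Q m z 1 := by
  have hp : 0 < S.BB Q m 1 1 := by rw [BB_oneone]; exact W_pos _ _ (by omega) hQ
  refine ⟨S.BB Q m z 1 / S.BB Q m 1 1, ?_, ?_⟩
  · simp only [map_sub, map_smul, LinearMap.sub_apply, LinearMap.smul_apply, smul_eq_mul]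
    field_simp; ring
  · field_simp

lemma rcs {Q : Finset ι} {m : ℕ} (hc : Q.card + m + 2 = d) (hQ : S.Fc Q)
    (H : ∀ z, S.BB Q m z 1 = 0 → S.BB Q m z z ≤ 0) (z : ι → ℝ) :
    S.BB Q m z z * S.BB Q m 1 1 ≤ S.BB Q m z 1 ^ 2 := by
  have hp : 0 < S.BB Q m 1 1 := by rw [BB_oneone]; exact W_pos _ _ (by omega) hQ
  obtain ⟨c, h1, h2⟩ := BB_proj hc hQ z
  have h3 := H _ h1
  simp only [map_sub, map_smul, LinearMap.sub_apply, LinearMap.smul_apply, smul_eq_mul] at h3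
  rw [BB_symm Q m 1 z] at h3
  rw [← h2] at h3 ⊢
  nlinarith

lemma HR_kernel {Q : Finset ι} {m : ℕ} (hc : Q.card + m + 2 = d) (hQ : S.Fc Q)
    (H : ∀ z, S.BB Q m z 1 = 0 → S.BB Q m z z ≤ 0) {z : ι → ℝ} (h1 : S.BB Q m z 1 = 0)
    (h2 : S.BB Q m z z = 0) (y : ι → ℝ) : S.BB Q m z y = 0 := by
  obtain ⟨c, h3, h4⟩ := BB_proj hc hQ y
  set y' := y - c • (1 : ι → ℝ) with hy'
  have e : S.BB Q m z y = S.BB Q m z y' := by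
    rw [hy', map_sub, map_smul, h1]; simp
  rw [e]
  have key : ∀ t : ℝ, 2 * t * S.BB Q m z y' + t ^ 2 * S.BB Q m y' y' ≤ 0 := by
    intro t
    have := H (z + t • y') (by simp [h1, h3])
    simp only [map_add, map_smul, LinearMap.add_apply, LinearMap.smul_apply, smul_eq_mul, h2] at this
    rw [BB_symm Q m y' z] at this
    nlinarith
  by_contra hne
  set a := S.BB Q m z y'
  set b := S.BB Q m y' y'
  have hb : b ≤ 0 := H _ h3
  have h5 := key (a / (1 - b))
  have h6 : 0 < 1 - b := by linarith
  have h7 : 2 * (a / (1 - b)) * a + (a / (1 - b)) ^ 2 * b = a ^ 2 * (2 - b) / (1 - b) ^ 2 := by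
    field_simp; ring
  rw [h7] at h5
  have h8 : 0 < a ^ 2 * (2 - b) / (1 - b) ^ 2 := by
    have : 0 < a ^ 2 := by positivity
    have : 0 < 2 - b := by linarith
    positivity
  linarith

end CFan
end

noncomputable section
set_option linter.unusedVariables false
set_option linter.unusedSectionVars false

namespace CFan
variable {d : ℕ} {ι : Type} [Fintype ι] [DecidableEq ι] {S : CFan d ι}

lemma ne_nm {Q : Finset ι} {v q : ι} (hv : v ∉ Q) (hq : q ∈ Q) : v ≠ q := fun h => hv (h ▸ hq)

lemma cone_unique {G G' : Finset ι} (hG : G ∈ S.fac) (hG' : G' ∈ S.fac) (a b : ι → ℝ)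
    (ha : ∀ v ∈ G, 0 < a v) (hb : ∀ v ∈ G', 0 ≤ b v)
    (h : ∑ v ∈ G, a v • S.p v = ∑ v ∈ G', b v • S.p v) : G = G' := by
  have e1 : S.ff G (∑ v ∈ G, a v • S.p v) = ∑ v ∈ G, a v := by
    rw [map_sum]; refine Finset.sum_congr rfl fun v hv => ?_
    rw [map_smul, ff_p hG hv]; simp
  have e2 : S.ff G' (∑ v ∈ G', b v • S.p v) = ∑ v ∈ G', b v := by
    rw [map_sum]; refine Finset.sum_congr rfl fun v hv => ?_
    rw [map_smul, ff_p hG' hv]; simp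
  have e3 : S.ff G' (∑ v ∈ G, a v • S.p v) = ∑ v ∈ G, a v * S.ff G' (S.p v) := by
    rw [map_sum]; simp
  have e4 : S.ff G (∑ v ∈ G', b v • S.p v) = ∑ v ∈ G', b v * S.ff G (S.p v) := by
    rw [map_sum]; simp
  have e5 : ∑ v ∈ G', b v * S.ff G (S.p v) ≤ ∑ v ∈ G', b v := by
    refine Finset.sum_le_sum fun v hv => ?_
    nlinarith [ff_le hG v, hb v hv]
  have e6 : ∀ v ∈ G, a v * S.ff G' (S.p v) ≤ a v := by
    intro v hv
    nlinarith [ff_le hG' v, ha v hv]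
  have e7 : ∑ v ∈ G, a v * S.ff G' (S.p v) = ∑ v ∈ G, a v := by
    refine le_antisymm (Finset.sum_le_sum e6) ?_
    rw [← e1, ← e3, h, e2, e4]; exact e5
  have e8 := (Finset.sum_eq_sum_iff_of_le e6).1 e7
  have : G ⊆ G' := fun v hv => mem_of_ff hG' (by
    have := e8 v hv; have h0 := ha v hv
    exact mul_left_cancel₀ h0.ne' (by rw [this, mul_one]))
  exact Finset.eq_of_subset_of_card_le this (by rw [S.fac_card _ hG, S.fac_card _ hG'])

lemma exists_gen_vanish (Q : Finset ι) : ∃ l : (Fin d → ℝ) →ₗ[ℝ] ℝ,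
    (∀ q ∈ Q, l (S.p q) = 0) ∧ ∀ v, v ∉ Q → S.Fc (insert v Q) → l (S.p v) ≠ 0 := by
  let M : Submodule ℝ ((Fin d → ℝ) →ₗ[ℝ] ℝ) :=
    { carrier := {f | ∀ q ∈ Q, f (S.p q) = 0}
      add_mem' := by
        intro a b ha hb q hq; simp [ha q hq, hb q hq]
      zero_mem' := by intro q hq; simp
      smul_mem' := by intro c a ha q hq; simp [ha q hq] }
  obtain ⟨x, hx⟩ := Module.Dual.exists_forall_ne_zero_of_forall_exists
    (ι := {v // v ∉ Q ∧ S.Fc (insert v Q)}) (M := M) (K := ℝ)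
    (fun v => (LinearMap.applyₗ (S.p v.1)).comp M.subtype) (by
      rintro ⟨v, hv, F, hF, hvF⟩
      have hvF' := hvF (Finset.mem_insert_self _ _)
      refine ⟨⟨S.co F v, fun q hq => ?_⟩, ?_⟩
      · rw [S.co_eq F hF v hvF' q (hvF (Finset.mem_insert_of_mem hq)),
          if_neg (ne_nm hv hq)]
      · simp [S.co_eq F hF v hvF' v hvF'])
  exact ⟨x.1, x.2, fun v hv hF => hx ⟨v, hv, hF⟩⟩

/-- dirichlet form identity -/
lemma dirichlet {κ : Type} [Fintype κ] (A : κ → κ → ℝ) (hA : ∀ v w, A v w = A w v) (l g : κ → ℝ) :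
    ∑ v, (l v * g v) * ∑ w, A v w * (l w * g w) =
      ∑ v, l v * g v ^ 2 * (∑ w, A v w * l w) -
        (1 / 2) * ∑ v, ∑ w, A v w * l v * l w * (g v - g w) ^ 2 := by
  have e1 : ∑ v, l v * g v ^ 2 * (∑ w, A v w * l w) = ∑ v, ∑ w, A v w * l v * l w * g v ^ 2 := by
    refine Finset.sum_congr rfl fun v _ => ?_
    rw [Finset.mul_sum]; refine Finset.sum_congr rfl fun w _ => ?_
    ring
  have e2 : ∑ v, ∑ w, A v w * l v * l w * g v ^ 2 = ∑ v, ∑ w, A v w * l v * l w * g w ^ 2 := by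
    rw [Finset.sum_comm]
    refine Finset.sum_congr rfl fun v _ => Finset.sum_congr rfl fun w _ => ?_
    rw [hA]; ring
  have e3 : ∑ v, ∑ w, A v w * l v * l w * (g v - g w) ^ 2 =
      ∑ v, ∑ w, A v w * l v * l w * g v ^ 2 + ∑ v, ∑ w, A v w * l v * l w * g w ^ 2
      - 2 * ∑ v, (l v * g v) * ∑ w, A v w * (l w * g w) := by
    simp only [Finset.mul_sum, ← Finset.sum_add_distrib, ← Finset.sum_sub_distrib]
    refine Finset.sum_congr rfl fun v _ => Finset.sum_congr rfl fun w _ => ?_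
    ring
  rw [e1, e3, ← e2]; ring

lemma BB_expand2 (Q : Finset ι) (m : ℕ) (z y : ι → ℝ) :
    S.BB Q m z y = ∑ v, z v * ∑ w, S.BB Q m (Pi.single v 1) (Pi.single w 1) * y w := by
  rw [BB_expand]
  refine Finset.sum_congr rfl fun v _ => ?_
  rw [BB_symm, BB_expand]
  congr 1
  refine Finset.sum_congr rfl fun w _ => ?_
  rw [BB_symm, mul_comm]

lemma A_nonneg {Q : Finset ι} {m : ℕ} (hc : Q.card + m + 2 = d) {v w : ι} (hv : v ∉ Q)
    (hw : w ∉ Q) (hvw : v ≠ w) : 0 ≤ S.BB Q m (Pi.single v 1) (Pi.single w 1) := by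
  have hw' : w ∉ insert v Q := by simp [hw, hvw.symm]
  rw [BB_two hv hw']
  exact W_nonneg _ _ (by rw [Finset.card_insert_of_notMem hw', Finset.card_insert_of_notMem hv]; omega)

lemma A_pos {Q : Finset ι} {m : ℕ} (hc : Q.card + m + 2 = d) {v w : ι} (hv : v ∉ Q)
    (hw : w ∉ Q) (hvw : v ≠ w) (hF : S.Fc (insert w (insert v Q))) :
    0 < S.BB Q m (Pi.single v 1) (Pi.single w 1) := by
  have hw' : w ∉ insert v Q := by simp [hw, hvw.symm]
  rw [BB_two hv hw']
  exact W_pos _ _ (by rw [Finset.card_insert_of_notMem hw', Finset.card_insert_of_notMem hv]; omega) hF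

lemma base_neg {Q : Finset ι} (hc : Q.card + 2 = d) (l : (Fin d → ℝ) →ₗ[ℝ] ℝ)
    (hl0 : ∀ q ∈ Q, l (S.p q) = 0) (hl1 : ∀ v, v ∉ Q → S.Fc (insert v Q) → l (S.p v) ≠ 0)
    (f : ι → ℝ) (hf0 : ∀ q ∈ Q, f q = 0)
    (hf : ∀ v w, v ∉ Q → w ∉ Q → insert w (insert v Q) ∈ S.fac → 0 < l (S.p v) → l (S.p w) < 0 →
      f v * l (S.p w) = f w * l (S.p v)) : S.BB Q 0 f f ≤ 0 := by
  set g : ι → ℝ := fun v => f v / l (S.p v) with hg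
  have e0 : ∀ v, S.Fc (insert v Q) → f v = (fun v => l (S.p v) * g v) v := by
    intro v hv
    by_cases hvQ : v ∈ Q
    · simp [hf0 v hvQ, hl0 v hvQ]
    · have := hl1 v hvQ hv
      simp only [hg]; field_simp
  rw [BB_congr e0, BB_symm, BB_congr e0, BB_expand2,
    dirichlet (fun v w => S.BB Q 0 (Pi.single v 1) (Pi.single w 1)) (fun v w => BB_symm _ _ _ _)
      (fun v => l (S.p v)) g]
  have e1 : ∀ v, ∑ w, S.BB Q 0 (Pi.single v 1) (Pi.single w 1) * l (S.p w) = 0 := by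
    intro v
    have := BB_lin Q 0 (by omega) l (Pi.single v 1) (S := S)
    rw [BB_expand] at this
    rw [← this]
    refine Finset.sum_congr rfl fun w _ => ?_
    rw [BB_symm, mul_comm]
  simp only [e1, mul_zero, Finset.sum_const_zero, zero_sub, Left.neg_nonpos_iff]
  refine mul_nonneg (by norm_num) (Finset.sum_nonneg fun v _ => Finset.sum_nonneg fun w _ => ?_)
  by_cases hv : v ∈ Q
  · simp [hl0 v hv]
  by_cases hw : w ∈ Q
  · simp [hl0 w hw]
  by_cases hvw : v = w
  · simp [hvw]
  have hA := A_nonneg (S := S) (m := 0) (by omega) hv hw hvw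
  by_cases hpos : 0 ≤ l (S.p v) * l (S.p w)
  · rw [mul_assoc (S.BB Q 0 _ _)]
    positivity
  by_cases hF : S.Fc (insert w (insert v Q))
  · have hgg : g v = g w := by
      have hw' : w ∉ insert v Q := by simp [hw, Ne.symm hvw]
      have hw2 : v ∉ insert w Q := by simp [hv, hvw]
      have n1 := hl1 v hv (hF.mono (Finset.subset_insert _ _))
      have n2 := hl1 w hw (hF.mono (Finset.insert_subset_insert _ (Finset.subset_insert _ _)))
      simp only [hg]
      rw [div_eq_div_iff n1 n2]
      rcases lt_or_gt_of_ne n1 with h1 | h1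
      · have h2 : 0 < l (S.p w) := by
          by_contra hcon; push Not at hcon; exact hpos (by nlinarith)
        refine (hf w v hw hv (XQ_facet ?_ ?_) h2 h1).symm
        · rwa [Finset.insert_comm]
        · rw [Finset.card_insert_of_notMem hw2, Finset.card_insert_of_notMem hw]; omega
      · have h2 : l (S.p w) < 0 := by
          by_contra hcon; push Not at hcon; exact hpos (by nlinarith)
        refine hf v w hv hw (XQ_facet hF ?_) h1 h2
        rw [Finset.card_insert_of_notMem hw', Finset.card_insert_of_notMem hv]; omega
    rw [hgg]; simp
  · rw [BB_two hv (by simp [hw, Ne.symm hvw]), XQ_zero hF]; simp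

/-- the structure of crossing pairs -/
lemma crossing {Q : Finset ι} (hc : Q.card + 2 = d) (l : (Fin d → ℝ) →ₗ[ℝ] ℝ)
    (hl0 : ∀ q ∈ Q, l (S.p q) = 0) {a b : ι} (ha : a ∉ Q) (hb : b ∉ Q)
    (hab : insert b (insert a Q) ∈ S.fac) (hla : 0 < l (S.p a)) (hlb : l (S.p b) < 0) :
    ∃ k : (Fin d → ℝ) →ₗ[ℝ] ℝ, (∀ q ∈ Q, k (S.p q) = 0) ∧
      (∀ v w, v ∉ Q → w ∉ Q → insert w (insert v Q) ∈ S.fac → 0 < l (S.p v) → l (S.p w) < 0 →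
        k (l (S.p v) • S.p w - l (S.p w) • S.p v) ≠ 0) ∧
      (∀ v w, v ∉ Q → w ∉ Q → insert w (insert v Q) ∈ S.fac → 0 < l (S.p v) → l (S.p w) < 0 →
       ∀ v' w', v' ∉ Q → w' ∉ Q → insert w' (insert v' Q) ∈ S.fac → 0 < l (S.p v') →
        l (S.p w') < 0 →
        0 < k (l (S.p v) • S.p w - l (S.p w) • S.p v) * k (l (S.p v') • S.p w' - l (S.p w') • S.p v') →
        v = v' ∧ w = w') := by
  set F0 := insert b (insert a Q) with hF0
  have hne : a ≠ b := by rintro rfl; linarith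
  have hb' : b ∉ insert a Q := by simp [hb, hne.symm]
  have haF : a ∈ F0 := by simp [F0]
  have hbF : b ∈ F0 := by simp [F0]
  have hQF : ∀ q ∈ Q, q ∈ F0 := fun q hq => by simp [F0, hq]
  have key : ∀ u, l u = 0 → (S.co F0 a + S.co F0 b) u = 0 → u = ∑ q ∈ Q, S.co F0 q u • S.p q := by
    intro u h1 h2
    rw [expand hab, hF0, Finset.sum_insert hb', Finset.sum_insert ha] at h1
    have : ∑ x ∈ Q, S.co F0 x u * l (S.p x) = 0 := Finset.sum_eq_zero fun q hq => by
      rw [hl0 q hq, mul_zero]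
    rw [← hF0, this] at h1
    simp only [LinearMap.add_apply] at h2
    have h3 : S.co F0 a u = 0 := by
      have : S.co F0 a u * (l (S.p a) - l (S.p b)) = 0 := by
        linear_combination h1 - l (S.p b) * h2
      rcases mul_eq_zero.1 this with h | h
      · exact h
      · linarith
    have h4 : S.co F0 b u = 0 := by linarith
    conv_lhs => rw [← S.co_sum F0 hab u]
    rw [← Finset.sum_subset (Finset.subset_univ F0)]
    · rw [hF0, Finset.sum_insert hb', Finset.sum_insert ha, ← hF0, h3, h4]; simp
    · intro x _ hx; rw [S.co_off F0 hab x hx]; simp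
  have ly : ∀ v w, l (l (S.p v) • S.p w - l (S.p w) • S.p v) = 0 := by
    intro v w; simp only [map_sub, map_smul, smul_eq_mul]; ring
  refine ⟨S.co F0 a + S.co F0 b, ?_, ?_, ?_⟩
  · intro q hq
    rw [LinearMap.add_apply, S.co_eq F0 hab a haF q (hQF q hq), S.co_eq F0 hab b hbF q (hQF q hq),
      if_neg (ne_nm ha hq), if_neg (ne_nm hb hq), add_zero]
  · intro v w hv hw hF h1 h2 h3
    have h4 := congrArg (S.co (insert w (insert v Q)) w) (key _ (ly v w) h3)
    have hwm : w ∈ insert w (insert v Q) := by simp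
    have hvm : v ∈ insert w (insert v Q) := by simp
    have hvw : w ≠ v := by rintro rfl; linarith
    rw [map_sum, Finset.sum_eq_zero] at h4
    · simp only [map_sub, map_smul, smul_eq_mul, S.co_eq _ hF w hwm w hwm, S.co_eq _ hF w hwm v hvm,
        if_neg hvw] at h4
      simp at h4; linarith
    · intro q hq
      rw [map_smul, S.co_eq _ hF w hwm q (by simp [hq]), if_neg (ne_nm hw hq), smul_zero]
  · intro v w hv hw hF h1 h2 v' w' hv' hw' hF' h1' h2' hpos
    set k := S.co F0 a + S.co F0 b
    set y := l (S.p v) • S.p w - l (S.p w) • S.p v with hy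
    set y' := l (S.p v') • S.p w' - l (S.p w') • S.p v' with hy'
    have hky : k y ≠ 0 := fun h => by rw [h] at hpos; simp at hpos
    set c := k y' / k y with hcdef
    have hcpos : 0 < c := by
      rw [hcdef, ← mul_div_mul_left _ _ hky]
      exact div_pos hpos (mul_self_pos.2 hky)
    have hu := key (y' - c • y) (by rw [map_sub, map_smul, ly, ly]; simp)
      (by rw [map_sub, map_smul, smul_eq_mul, hcdef]; field_simp; ring)
    set s : ι → ℝ := fun q => S.co F0 q (y' - c • y)
    set N : ℝ := ∑ q ∈ Q, |s q| + 1
    have hN : ∀ q ∈ Q, |s q| < N := fun q hq => by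
      have := Finset.single_le_sum (f := fun q => |s q|) (fun q _ => abs_nonneg _) hq
      simp only [N]; linarith
    have hN0 : 0 < N := by
      have := Finset.sum_nonneg (s := Q) (f := fun q => |s q|) (fun q _ => abs_nonneg _)
      simp only [N]; linarith
    have hvw : w ≠ v := by rintro rfl; linarith
    have hvw' : w' ≠ v' := by rintro rfl; linarith
    have nw : w ∉ insert v Q := by simp [hw, hvw]
    have nw' : w' ∉ insert v' Q := by simp [hw', hvw']
    have hGG := cone_unique hF' hF
      (fun x => if x = w' then l (S.p v') else if x = v' then - l (S.p w') else N)
      (fun x => if x = w then c * l (S.p v) else if x = v then - (c * l (S.p w)) else s x + N)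
      (by
        intro x hx
        split_ifs
        · exact h1'
        · linarith
        · exact hN0)
      (by
        intro x hx
        split_ifs with hh1 hh2
        · positivity
        · nlinarith
        · have hxQ : x ∈ Q := by simpa [hh1, hh2] using hx
          have := hN x hxQ
          linarith [neg_abs_le (s x)])
      (by
        rw [Finset.sum_insert nw', Finset.sum_insert hv', Finset.sum_insert nw, Finset.sum_insert hv]
        have g1 : ∀ x ∈ Q, (if x = w' then l (S.p v') else if x = v' then - l (S.p w') else N) = N := by
          intro x hx
          rw [if_neg (ne_nm hw' hx).symm, if_neg (ne_nm hv' hx).symm]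
        have g2 : ∀ x ∈ Q, (if x = w then c * l (S.p v) else if x = v then - (c * l (S.p w)) else s x + N)
            = s x + N := by
          intro x hx
          rw [if_neg (ne_nm hw hx).symm, if_neg (ne_nm hv hx).symm]
        have g3 : ∑ x ∈ Q, (if x = w' then l (S.p v') else if x = v' then - l (S.p w') else N) • S.p x
            = ∑ x ∈ Q, N • S.p x := Finset.sum_congr rfl fun x hx => by rw [g1 x hx]
        have g4 : ∑ x ∈ Q, (if x = w then c * l (S.p v) else if x = v then - (c * l (S.p w))
            else s x + N) • S.p x = ∑ x ∈ Q, (s x + N) • S.p x :=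
          Finset.sum_congr rfl fun x hx => by rw [g2 x hx]
        rw [g3, g4]
        simp only [if_true, if_neg hvw.symm, if_neg hvw'.symm, add_smul, Finset.sum_add_distrib]
        have hu' : y' = c • y + ∑ q ∈ Q, s q • S.p q := by rw [← hu]; abel
        have e1 : l (S.p v') • S.p w' + (- l (S.p w') • S.p v' + ∑ x ∈ Q, N • S.p x) =
          y' + ∑ x ∈ Q, N • S.p x := by rw [hy']; module
        rw [e1, hu', hy]; module)
    have hv2 : v' ∈ insert w (insert v Q) := hGG ▸ (by simp)
    have hw2 : w' ∈ insert w (insert v Q) := hGG ▸ (by simp)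
    have hv3 : v' = w ∨ v' = v := by simpa [hv'] using hv2
    have hw3 : w' = w ∨ w' = v := by simpa [hw'] using hw2
    constructor
    · rcases hv3 with h | h
      · rw [h] at h1'; linarith
      · exact h.symm
    · rcases hw3 with h | h
      · exact h.symm
      · rw [h] at h2'; linarith

lemma exists_ker3 (c d : Fin 3 → ℝ) : ∃ x : Fin 3 → ℝ, x ≠ 0 ∧
    c 0 * x 0 + c 1 * x 1 + c 2 * x 2 = 0 ∧ d 0 * x 0 + d 1 * x 1 + d 2 * x 2 = 0 := by
  have := LinearMap.ker_ne_bot_of_finrank_lt (f := Matrix.toLin' (Matrix.of ![c, d])) (by simp)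
  obtain ⟨x, hx, hx0⟩ := (Submodule.ne_bot_iff _).1 this
  refine ⟨x, hx0, ?_, ?_⟩
  · have := congrFun (LinearMap.mem_ker.1 hx) 0
    simpa [Matrix.mulVec, dotProduct, Fin.sum_univ_three] using this
  · have := congrFun (LinearMap.mem_ker.1 hx) 1
    simpa [Matrix.mulVec, dotProduct, Fin.sum_univ_three] using this

/-- normalisation -/
lemma normalise {Q : Finset ι} {m : ℕ} (hc : Q.card + m + 2 = d) (hQ : S.Fc Q)
    (H : ∀ z, (∀ q ∈ Q, z q = 0) → S.BB Q m z 1 = 0 → S.BB Q m z z ≤ 0) :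
    ∀ z, S.BB Q m z 1 = 0 → S.BB Q m z z ≤ 0 := by
  intro z hz
  obtain ⟨F, hF, hQF⟩ := hQ
  have e : z = (z - fun v => S.lin F z (S.p v)) + fun v => S.lin F z (S.p v) := by simp
  have h1 := H (z - fun v => S.lin F z (S.p v)) (fun q hq => by
    rw [Pi.sub_apply, lin_p hF (hQF hq), sub_self])
    (by rw [map_sub, LinearMap.sub_apply, hz, BB_lin Q m (by omega), sub_zero])
  rw [e]
  simp only [map_add, LinearMap.add_apply, BB_lin Q m (show Q.card + m + 2 ≤ d by omega), BB_lin' Q m (show Q.card + m + 2 ≤ d by omega)]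
  linarith

lemma exists_h {Q : Finset ι} {m : ℕ} (hc : Q.card + m + 2 = d) (hQ : S.Fc Q) :
    ∃ f : (Fin d → ℝ) →ₗ[ℝ] ℝ, ∃ h : ι → ℝ, h = (1 - fun v => f (S.p v)) ∧ (∀ q ∈ Q, h q = 0) ∧
      (∀ v, v ∉ Q → 0 < h v) ∧
      ∀ z, S.BB Q m z h = S.BB Q m z 1 := by
  obtain ⟨F, hF, hQF⟩ := hQ
  obtain ⟨f, h1, h2⟩ := exposing hF hQF
  refine ⟨f, _, rfl, fun q hq => by simp [h1 q hq], fun v hv => by simpa using h2 v hv, fun z => ?_⟩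
  rw [map_sub, BB_lin' Q m (by omega), sub_zero]

lemma HR_base_le {Q : Finset ι} (hc : Q.card + 2 = d) (hQ : S.Fc Q) :
    ∀ z, S.BB Q 0 z 1 = 0 → S.BB Q 0 z z ≤ 0 := by
  refine normalise (by omega) hQ fun z hz0 hz1 => ?_
  by_contra hcon
  push Not at hcon
  obtain ⟨fe, h, hh, hh0, hh1, hhB⟩ := exists_h (m := 0) (by omega) hQ
  have hzh : S.BB Q 0 z h = 0 := by rw [hhB, hz1]
  have hhh : 0 < S.BB Q 0 h h := by
    rw [hhB, BB_symm, hhB, BB_oneone]; exact W_pos _ _ (by omega) hQ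
  obtain ⟨l, hl0, hl1⟩ := exists_gen_vanish (S := S) Q
  by_cases hcr : ∃ a b, a ∉ Q ∧ b ∉ Q ∧ insert b (insert a Q) ∈ S.fac ∧ 0 < l (S.p a) ∧ l (S.p b) < 0
  · obtain ⟨a, b, ha, hb, hab, hla, hlb⟩ := hcr
    obtain ⟨k, hk0, hk1, hk2⟩ := crossing hc l hl0 ha hb hab hla hlb
    -- the conditions
    let kap : (ι → ℝ) → ι → ι → ℝ := fun f v w => f v * l (S.p w) - f w * l (S.p v)
    let Cr : ι → ι → Prop := fun v w => v ∉ Q ∧ w ∉ Q ∧ insert w (insert v Q) ∈ S.fac ∧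
      0 < l (S.p v) ∧ l (S.p w) < 0
    let K : ι → ι → ℝ := fun v w => k (l (S.p v) • S.p w - l (S.p w) • S.p v)
    let kf : ι → ℝ := fun v => k (S.p v)
    have hKk : ∀ v w, kap kf v w = - K v w := by
      intro v w; simp only [kap, kf, K, map_sub, map_smul, smul_eq_mul]; ring
    have ex : ∀ P : ℝ → Prop, (∀ s t, P s → P t → 0 < s * t) → ∃ c : Fin 3 → ℝ, ∀ v w, Cr v w → P (K v w) →
        c 0 = kap z v w ∧ c 1 = kap h v w ∧ c 2 = kap kf v w := by
      intro P hP
      by_cases he : ∃ v w, Cr v w ∧ P (K v w)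
      · obtain ⟨v, w, hvw, hp⟩ := he
        refine ⟨![kap z v w, kap h v w, kap kf v w], fun v' w' hvw' hp' => ?_⟩
        obtain ⟨rfl, rfl⟩ := hk2 v w hvw.1 hvw.2.1 hvw.2.2.1 hvw.2.2.2.1 hvw.2.2.2.2
          v' w' hvw'.1 hvw'.2.1 hvw'.2.2.1 hvw'.2.2.2.1 hvw'.2.2.2.2 (hP _ _ hp hp')
        exact ⟨rfl, rfl, rfl⟩
      · exact ⟨0, fun v w hvw hp => absurd ⟨v, w, hvw, hp⟩ he⟩
    obtain ⟨c1, hc1⟩ := ex (fun t => 0 < t) (fun s t => mul_pos)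
    obtain ⟨c2, hc2⟩ := ex (fun t => t < 0) (fun s t => mul_pos_of_neg_of_neg)
    obtain ⟨x, hx0, hx1, hx2⟩ := exists_ker3 c1 c2
    set f : ι → ℝ := x 0 • z + x 1 • h + x 2 • kf with hf
    have hkapf : ∀ v w, kap f v w = kap z v w * x 0 + kap h v w * x 1 + kap kf v w * x 2 := by
      intro v w; simp [kap, hf]; ring
    have hkf : ∀ v w, Cr v w → kap f v w = 0 := by
      intro v w hvw
      rw [hkapf]
      rcases lt_or_gt_of_ne (hk1 v w hvw.1 hvw.2.1 hvw.2.2.1 hvw.2.2.2.1 hvw.2.2.2.2) with hh | hh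
      · obtain ⟨e1, e2, e3⟩ := hc2 v w hvw hh
        rw [← e1, ← e2, ← e3]; exact hx2
      · obtain ⟨e1, e2, e3⟩ := hc1 v w hvw hh
        rw [← e1, ← e2, ← e3]; exact hx1
    have hneg := base_neg hc l hl0 hl1 f (fun q hq => by simp [hf, hz0 q hq, hh0 q hq, kf, hk0 q hq])
      (fun v w hv hw hF h1 h2 => by
        have := hkf v w ⟨hv, hw, hF, h1, h2⟩
        simp only [kap] at this; linarith)
    have hval : S.BB Q 0 f f = x 0 ^ 2 * S.BB Q 0 z z + x 1 ^ 2 * S.BB Q 0 h h := by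
      simp only [hf, map_add, LinearMap.add_apply, map_smul, LinearMap.smul_apply, smul_eq_mul, kf,
        BB_lin Q 0 (show Q.card + 0 + 2 ≤ d by omega), BB_lin' Q 0 (show Q.card + 0 + 2 ≤ d by omega), hzh,
        BB_symm Q 0 h z]
      ring
    have hx0' : x 0 = 0 := by
      by_contra hne
      have : 0 < x 0 ^ 2 * S.BB Q 0 z z := by positivity
      have : 0 ≤ x 1 ^ 2 * S.BB Q 0 h h := by positivity
      linarith
    have hx1' : x 1 = 0 := by
      by_contra hne
      have : 0 < x 1 ^ 2 * S.BB Q 0 h h := by positivity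
      have : 0 ≤ x 0 ^ 2 * S.BB Q 0 z z := by positivity
      linarith
    have h9 := hkf a b ⟨ha, hb, hab, hla, hlb⟩
    rw [hkapf, hx0', hx1', hKk] at h9
    have h10 := hk1 a b ha hb hab hla hlb
    have hx2' : x 2 = 0 := by
      have : K a b * x 2 = 0 := by linarith
      exact (mul_eq_zero.1 this).resolve_left h10
    apply hx0
    ext i; fin_cases i
    · exact hx0'
    · exact hx1'
    · exact hx2'
  · have := base_neg hc l hl0 hl1 h hh0 (fun v w hv hw hF h1 h2 => absurd ⟨v, w, hv, hw, hF, h1, h2⟩ hcr)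
    linarith

lemma exists_other {Q F : Finset ι} (hF : F ∈ S.fac) (hQF : Q ⊆ F) (hc : Q.card + 2 ≤ d) (i : ι) :
    ∃ v ∈ F, v ∉ Q ∧ v ≠ i := by
  by_contra hcon
  push Not at hcon
  have : F ⊆ insert i Q := fun v hv => by
    by_cases hvQ : v ∈ Q
    · simp [hvQ]
    · simp [hcon v hv hvQ]
  have h1 := Finset.card_le_card this
  have h2 := Finset.card_insert_le i Q
  rw [S.fac_card F hF] at h1
  omega

theorem HR_base {Q : Finset ι} (hc : Q.card + 2 = d) (hQ : S.Fc Q) : S.HRP Q 0 := by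
  intro z hz1
  refine ⟨HR_base_le hc hQ z hz1, fun hz2 => ?_⟩
  have hker := HR_kernel (by omega) hQ (HR_base_le hc hQ) hz1 hz2
  obtain ⟨F0, hF0, hQ0⟩ := hQ
  refine ⟨S.lin F0 z, fun F hF hQF => ?_⟩
  refine conn Q (fun F => S.lin F z = S.lin F0 z) hF0 hQ0 rfl ?_ hF hQF
  intro F hF hQF hPF i hi hiQ j hj hF'
  obtain ⟨v, hvF, hvQ, hvi⟩ := exists_other hF hQF (by omega) i
  have hFe : F.erase i = insert v Q := by
    symm
    apply Finset.eq_of_subset_of_card_le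
    · intro x hx
      rcases Finset.mem_insert.1 hx with rfl | hx
      · exact Finset.mem_erase.2 ⟨hvi, hvF⟩
      · exact Finset.mem_erase.2 ⟨fun h => hiQ (h ▸ hx), hQF hx⟩
    · rw [Finset.card_erase_of_mem hi, S.fac_card F hF, Finset.card_insert_of_notMem hvQ]; omega
  set f := S.lin F0 z
  set z' : ι → ℝ := z - fun v => f (S.p v) with hz'
  have hz'0 : ∀ w ∈ F, z' w = 0 := by
    intro w hw; rw [hz', Pi.sub_apply, ← hPF, lin_p hF hw, sub_self]
  have h1 : S.BB Q 0 (Pi.single v 1) z' = 0 := by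
    rw [hz', map_sub, BB_lin' Q 0 (by omega), BB_symm, hker, sub_zero]
  rw [BB_single hvQ, XQ_congr (z' := z' j • Pi.single j 1)] at h1
  · rw [map_smul, pow_zero, mul_one, mul_smul_comm, map_smul] at h1
    have h2 : S.XQ (insert v Q) * S.E (Pi.single j 1) = S.XQ (insert j (F.erase i)) := by
      rw [XQ_insert (fun h => hj (Finset.mem_of_mem_erase h)), hFe, mul_comm]; rfl
    rw [h2, smul_eq_mul] at h1
    have h3 := (mul_eq_zero.1 h1).resolve_right (tr_facet_pos hF').ne'
    refine ext_on hF' fun w hw => ?_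
    rw [lin_p hF' hw]
    rcases Finset.mem_insert.1 hw with rfl | hw
    · simpa [hz', sub_eq_zero] using h3
    · simpa [hz', sub_eq_zero] using hz'0 w (Finset.mem_of_mem_erase hw)
  · intro w hw
    by_cases hwF : w ∈ F
    · have : w ≠ j := fun h => hj (h ▸ hwF)
      simp [hz'0 w hwF, this]
    · rw [← hFe] at hw
      have hw2 := XQ_facet hw (by
        rw [Finset.card_insert_of_notMem (fun h => hwF (Finset.mem_of_mem_erase h)),
          Finset.card_erase_of_mem hi, S.fac_card F hF]; omega)
      have := piv_unique hF hi hwF hw2 hj hF'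
      subst this; simp

lemma BB_desc {Q : Finset ι} {m : ℕ} (hc : Q.card + (m + 1) + 2 = d)
    (f : (Fin d → ℝ) →ₗ[ℝ] ℝ) (hf : ∀ q ∈ Q, f (S.p q) = 1) (z y : ι → ℝ) :
    S.BB Q (m + 1) z y = ∑ v, (1 - f (S.p v)) * S.BB (insert v Q) m z y := by
  rw [BB_apply, pow_succ']
  have e0 : S.XQ Q * S.E z * S.E y * (S.om * S.om ^ m) =
    S.om * (S.XQ Q * S.E z * S.E y * S.om ^ m) := by ring
  rw [e0, om_eq f, add_mul, map_add, ← om_eq f,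
    kill (mm (mm (mm (mXQ Q) (mE z)) (mE y)) (mom m)) (by omega), add_zero,
        E_sum, Finset.sum_mul, map_sum]
  refine Finset.sum_congr rfl fun v _ => ?_
  by_cases hv : v ∈ Q
  · simp [hf v hv]
  · rw [smul_mul_assoc, map_smul, smul_eq_mul, BB_apply, XQ_insert hv]
    congr 2; ring

lemma sum_restrict {κ : Type} [Fintype κ] (P : κ → Prop) [Fintype {v // P v}] (f : κ → ℝ) (h : ∀ v, ¬ P v → f v = 0) :
    ∑ v, f v = ∑ v : {v // P v}, f v := by
  rw [← Finset.sum_filter_add_sum_filter_not Finset.univ P f,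
    Finset.sum_eq_zero (s := Finset.univ.filter fun v => ¬ P v) fun v hv => h v (Finset.mem_filter.1 hv).2,
    add_zero]
  exact (Finset.sum_subtype _ (by simp) f)

lemma HR_step_le {Q : Finset ι} {m : ℕ} (hc : Q.card + (m + 1) + 2 = d) (hQ : S.Fc Q)
    (ih : ∀ v, v ∉ Q → S.Fc (insert v Q) → ∀ z, S.BB (insert v Q) m z 1 = 0 → S.BB (insert v Q) m z z ≤ 0) :
    ∀ z, S.BB Q (m + 1) z 1 = 0 → S.BB Q (m + 1) z z ≤ 0 := by
  refine normalise (by omega) hQ fun z0 hz0 hz1 => ?_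
  obtain ⟨fe, h, hh, hh0, hh1, hhB⟩ := exists_h (m := m + 1) (by omega) hQ
  have hfe : ∀ q ∈ Q, fe (S.p q) = 1 := fun q hq => by
    have := hh0 q hq; rw [hh] at this; simp at this; linarith
  have hfeh : ∀ v, 1 - fe (S.p v) = h v := fun v => by rw [hh]; simp
  let κ := {v // v ∉ Q ∧ S.Fc (insert v Q)}
  let A : κ → κ → ℝ := fun v w => S.BB Q (m + 1) (Pi.single v.1 1) (Pi.single w.1 1)
  let W : κ → ℝ := fun v => S.BB Q (m + 1) (Pi.single v.1 1) 1
  have hBv : ∀ (v : κ) y, S.BB Q (m + 1) (Pi.single v.1 1) y = S.BB (insert v.1 Q) m y 1 := by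
    intro v y; rw [BB_single v.2.1, BB_one]
  have hcv : ∀ v : κ, (insert v.1 Q).card + m + 2 = d := fun v => by
    rw [Finset.card_insert_of_notMem v.2.1]; omega
  have hW : ∀ v, 0 < W v := by
    intro v
    simp only [W]
    rw [hBv, BB_oneone]
    exact W_pos _ _ (by have := hcv v; omega) v.2.2
  -- sums restricted
  have hres : ∀ z : ι → ℝ, (∀ q ∈ Q, z q = 0) → ∀ y, S.BB Q (m + 1) z y =
      ∑ v : κ, z v * S.BB Q (m + 1) (Pi.single v.1 1) y := by
    intro z hz y
    rw [BB_expand]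
    refine sum_restrict (fun v => v ∉ Q ∧ S.Fc (insert v Q)) _ fun v hv => ?_
    by_cases hvQ : v ∈ Q
    · rw [hz v hvQ, zero_mul]
    · rw [BB_single hvQ, XQ_zero (fun h => hv ⟨hvQ, h⟩)]; simp
  let ex : (κ → ℝ) → ι → ℝ := fun u v => if hv : v ∉ Q ∧ S.Fc (insert v Q) then u ⟨v, hv⟩ else 0
  have hex : ∀ u (v : κ), ex u v = u v := fun u v => dif_pos v.2
  have hex0 : ∀ u, ∀ q ∈ Q, ex u q = 0 := fun u q hq => dif_neg fun h => h.1 hq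
  have hexx : ∀ (z : ι → ℝ), (∀ q ∈ Q, z q = 0) → ∀ w, S.Fc (insert w Q) →
      ex (fun v : κ => z v.1) w = z w := by
    intro z hz w hw
    by_cases hwQ : w ∈ Q
    · exact (hex0 (fun v : κ => z v.1) w hwQ).trans (hz w hwQ).symm
    · exact hex (fun v : κ => z v.1) ⟨w, hwQ, hw⟩
  have hA1 : ∀ u (v : κ), ∑ w, A v w * u w = S.BB Q (m + 1) (Pi.single v.1 1) (ex u) := by
    intro u v
    rw [BB_symm, hres _ (hex0 u)]
    refine Finset.sum_congr rfl fun w _ => ?_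
    rw [hex, BB_symm, mul_comm]
  have hA2 : ∀ u, ∑ v, u v * ∑ w, A v w * u w = S.BB Q (m + 1) (ex u) (ex u) := by
    intro u
    rw [hres _ (hex0 u)]
    refine Finset.sum_congr rfl fun v _ => ?_
    rw [hex, hA1]
  have hW2 : ∀ v : κ, ∑ w : κ, A v w * h w = W v := by
    intro v
    have h1 := hA1 (fun w => h w.1) v
    refine h1.trans ?_
    simp only [W]
    rw [← hhB, BB_symm, BB_symm _ _ _ h]
    refine BB_congr (fun w hw => hexx h hh0 w hw) _
  have hhp : ∀ v : κ, 0 < h v := fun v => hh1 v.1 v.2.1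
  have hDir : ∀ u : κ → ℝ, ∑ v, u v * ∑ w, A v w * u w = ∑ v, W v / h v * u v ^ 2 -
      (1 / 2) * ∑ v : κ, ∑ w : κ, A v w * h v * h w * (u v / h v - u w / h w) ^ 2 := by
    intro u
    have h1 := dirichlet A (fun v w => BB_symm _ _ _ _) (fun v => h v.1) (fun v => u v / h v.1)
    have h2 : ∀ v : κ, h v.1 * (u v / h v.1) = u v := fun v => by have := hhp v; field_simp
    simp only [h2, hW2] at h1
    rw [h1]; congr 1
    refine Finset.sum_congr rfl fun v _ => ?_
    have := hhp v
    field_simp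
  have hnn : ∀ (u : κ → ℝ) (v w : κ), 0 ≤ A v w * h v * h w * (u v / h v - u w / h w) ^ 2 := by
    intro u v w
    by_cases hvw : v = w
    · subst hvw; simp
    · have h1 := hhp v
      have h2 := hhp w
      have h3 : 0 ≤ A v w := A_nonneg (by omega) v.2.1 w.2.1 (fun h => hvw (Subtype.ext h))
      positivity
  have main := bochner_spec A (fun v w => BB_symm _ _ _ _) (fun v => W v / h v) (fun v => h v.1)
    (fun v => div_pos (hW v) (hhp v)) ?_ ?_ ?_ (fun v => z0 v.1) ?_
  · rw [hA2] at main
    have e : ∀ v, S.Fc (insert v Q) → z0 v = ex (fun v => z0 v.1) v :=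
      fun w hw => (hexx z0 hz0 w hw).symm
    rw [BB_congr e, BB_symm, BB_congr e]
    exact main
  · intro u
    rw [hA2, BB_desc hc fe hfe, sum_restrict (fun v => v ∉ Q ∧ S.Fc (insert v Q))]
    · refine Finset.sum_le_sum fun v _ => ?_
      rw [hA1, hBv, hfeh]
      have h1 := rcs (hcv v) v.2.2 (ih v.1 v.2.1 v.2.2) (ex u)
      have h2 : S.BB (insert v.1 Q) m 1 1 = W v := (hBv v 1).symm
      rw [h2] at h1
      have := hhp v
      have h3 := hW v
      rw [div_div_eq_mul_div, le_div_iff₀ h3]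
      nlinarith
    · intro v hv
      by_cases hvQ : v ∈ Q
      · rw [hfe v hvQ]; simp
      · rw [BB_apply, XQ_zero (fun h => hv ⟨hvQ, h⟩)]; simp
  · intro u
    rw [hDir]
    have := Finset.sum_nonneg fun v (_ : v ∈ (Finset.univ : Finset κ)) =>
      Finset.sum_nonneg fun w (_ : w ∈ (Finset.univ : Finset κ)) => hnn u v w
    linarith
  · intro u hu
    rw [hDir] at hu
    have h0 : ∑ v : κ, ∑ w : κ, A v w * h v * h w * (u v / h v - u w / h w) ^ 2 = 0 := by linarith
    have h1 : ∀ v w : κ, S.Fc (insert w.1 (insert v.1 Q)) → u v / h v = u w / h w := by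
      intro v w hF
      by_cases hvw : v = w
      · rw [hvw]
      have h2 := (Finset.sum_eq_zero_iff_of_nonneg fun v _ =>
        Finset.sum_nonneg fun w _ => hnn u v w).1 h0 v (Finset.mem_univ _)
      have h3 := (Finset.sum_eq_zero_iff_of_nonneg fun w _ => hnn u v w).1 h2 w (Finset.mem_univ _)
      have h4 : 0 < A v w := A_pos (by omega) v.2.1 w.2.1 (fun h => hvw (Subtype.ext h)) hF
      have h5 := hhp v
      have h6 := hhp w
      have h7 := (mul_eq_zero.1 h3).resolve_left (by positivity)
      have h8 := pow_eq_zero_iff (two_ne_zero) |>.1 h7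
      linarith
    obtain ⟨F0, hF0, hQ0⟩ := hQ
    obtain ⟨iz, hiz⟩ : F0.Nonempty := Finset.card_pos.1 (by rw [S.fac_card _ hF0]; omega)
    obtain ⟨v0, hv0F, hv0Q, -⟩ := exists_other hF0 hQ0 (by omega) iz
    have mk : ∀ {F}, F ∈ S.fac → Q ⊆ F → ∀ {v}, v ∈ F → v ∉ Q → v ∉ Q ∧ S.Fc (insert v Q) :=
      fun hF hQF v hv hvQ => ⟨hvQ, _, hF, Finset.insert_subset hv hQF⟩
    refine ⟨u ⟨v0, mk hF0 hQ0 hv0F hv0Q⟩ / h v0, fun v => ?_⟩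
    obtain ⟨F, hF, hvF⟩ := v.2.2
    have hP := conn Q (fun F => ∀ v : κ, v.1 ∈ F → u v / h v = u ⟨v0, mk hF0 hQ0 hv0F hv0Q⟩ / h v0)
      hF0 hQ0 ?_ ?_ hF ((Finset.subset_insert _ _).trans hvF)
    · rw [← hP v (hvF (Finset.mem_insert_self _ _))]
      have := hhp v
      field_simp
    · intro v hv
      exact h1 v ⟨v0, mk hF0 hQ0 hv0F hv0Q⟩ ⟨F0, hF0, by
        intro x hx; simp only [Finset.mem_insert] at hx
        rcases hx with rfl | rfl | hx
        · exact hv0F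
        · exact hv
        · exact hQ0 hx⟩
    · intro F hF hQF hPF i hi hiQ j hj hF' w hw
      rcases Finset.mem_insert.1 hw with hwj | hw'
      · obtain ⟨x, hxF, hxQ, hxi⟩ := exists_other hF hQF (by omega) i
        rw [← hPF ⟨x, mk hF hQF hxF hxQ⟩ hxF]
        refine h1 w ⟨x, mk hF hQF hxF hxQ⟩ ⟨_, hF', ?_⟩
        intro y hy; simp only [Finset.mem_insert] at hy
        rcases hy with rfl | rfl | hy
        · exact Finset.mem_insert_of_mem (Finset.mem_erase.2 ⟨hxi, hxF⟩)
        · exact hw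
        · exact Finset.mem_insert_of_mem (Finset.mem_erase.2 ⟨fun h => hiQ (h ▸ hy), hQF hy⟩)
      · exact hPF w (Finset.mem_of_mem_erase hw')
  · rw [hres z0 hz0] at hz1
    rw [← hz1]
    refine Finset.sum_congr rfl fun v _ => ?_
    have := hhp v
    simp only [W]
    field_simp

theorem HR_step {Q : Finset ι} {m : ℕ} (hc : Q.card + (m + 1) + 2 = d) (hQ : S.Fc Q)
    (ih : ∀ v, v ∉ Q → S.Fc (insert v Q) → S.HRP (insert v Q) m) : S.HRP Q (m + 1) := by
  have hle := HR_step_le hc hQ (fun v hv hF z hz => (ih v hv hF z hz).1)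
  intro z hz1
  refine ⟨hle z hz1, fun hz2 => ?_⟩
  have hker := HR_kernel (by omega) hQ hle hz1 hz2
  obtain ⟨fe, h, hh, hh0, hh1, hhB⟩ := exists_h (m := m + 1) (by omega) hQ
  have hfe : ∀ q ∈ Q, fe (S.p q) = 1 := fun q hq => by
    have := hh0 q hq; rw [hh] at this; simp at this; linarith
  have hfeh : ∀ v, 1 - fe (S.p v) = h v := fun v => by rw [hh]; simp
  have k1 : ∀ v, v ∉ Q → S.BB (insert v Q) m z 1 = 0 := by
    intro v hv
    have := hker (Pi.single v 1)
    rw [BB_symm, BB_single hv] at this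
    rw [BB_one, this]
  have k2 : ∀ v, v ∉ Q → S.BB (insert v Q) m z z ≤ 0 := by
    intro v hv
    by_cases hF : S.Fc (insert v Q)
    · exact (ih v hv hF z (k1 v hv)).1
    · rw [BB_apply, XQ_zero hF]; simp
  rw [BB_desc hc fe hfe] at hz2
  have k3 : ∀ v, v ∉ Q → S.BB (insert v Q) m z z = 0 := by
    intro v hv
    have h3 := (Finset.sum_eq_zero_iff_of_nonpos (fun w _ => by
      by_cases hw : w ∈ Q
      · rw [hfe w hw]; simp
      · rw [hfeh]; exact mul_nonpos_of_nonneg_of_nonpos (hh1 w hw).le (k2 w hw))).1 hz2 v (Finset.mem_univ _)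
    rw [hfeh] at h3
    exact (mul_eq_zero.1 h3).resolve_left (hh1 v hv).ne'
  obtain ⟨F0, hF0, hQ0⟩ := hQ
  refine ⟨S.lin F0 z, fun F hF hQF => ?_⟩
  refine conn Q (fun F => S.lin F z = S.lin F0 z) hF0 hQ0 rfl ?_ hF hQF
  intro F hF hQF hPF i hi hiQ j hj hF'
  obtain ⟨v, hvF, hvQ, hvi⟩ := exists_other hF hQF (by omega) i
  have i1 : insert v Q ⊆ F := Finset.insert_subset hvF hQF
  have i2 : insert v Q ⊆ insert j (F.erase i) := by
    refine (fun x hx => Finset.mem_insert_of_mem (Finset.mem_erase.2 ⟨?_, i1 hx⟩))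
    rintro rfl
    rcases Finset.mem_insert.1 hx with h | h
    · exact hvi h.symm
    · exact hiQ h
  obtain ⟨f, hf⟩ := (ih v hvQ ⟨F, hF, i1⟩ z (k1 v hvQ)).2 (k3 v hvQ)
  rw [← hPF, hf F hF i1, hf _ hF' i2]

theorem HR : ∀ (m : ℕ) (Q : Finset ι), Q.card + m + 2 = d → S.Fc Q → S.HRP Q m := by
  intro m
  induction m with
  | zero => intro Q hc hQ; exact HR_base (by omega) hQ
  | succ m ih =>
    intro Q hc hQ
    exact HR_step hc hQ fun v hv hF => ih _ (by rw [Finset.card_insert_of_notMem hv]; omega) hF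

/-! ### the involution -/
variable (S)
/-- action of the antipodal map on the ring -/
def th : S.Rg →ₐ[ℝ] S.Rg :=
  { toFun := fun g F => g ⟨F.1.image S.ν, S.νfac _ F.2⟩
    map_one' := rfl
    map_mul' := fun _ _ => rfl
    map_zero' := rfl
    map_add' := fun _ _ => rfl
    commutes' := fun _ => rfl }
variable {S}

lemma th_apply (g : S.Rg) (F) : S.th g F = g ⟨F.1.image S.ν, S.νfac _ F.2⟩ := rfl

lemma image_νν (F : Finset ι) : (F.image S.ν).image S.ν = F := by
  rw [Finset.image_image]
  have : S.ν ∘ S.ν = id := funext S.νν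
  rw [this, Finset.image_id]

lemma th_E (z : ι → ℝ) : S.th (S.E z) = - S.E (fun v => z (S.ν v)) := by
  ext F
  rw [th_apply, E_apply, Pi.neg_apply, E_apply, lin_apply, lin_apply, ← Finset.sum_neg_distrib]
  refine Fintype.sum_equiv ⟨S.ν, S.ν, S.νν, S.νν⟩ _ _ fun v => ?_
  have := co_ν F.2 (S.ν v)
  rw [S.νν] at this
  simp [S.νν, this]

lemma tr_th (g : S.Rg) : S.tr (S.th g) = (-1) ^ d * S.tr g := by
  rw [tr_apply, tr_apply, Finset.mul_sum]
  refine Fintype.sum_equiv ⟨fun F : {F // F ∈ S.fac} => (⟨F.1.image S.ν, S.νfac _ F.2⟩ : {F // F ∈ S.fac}),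
    fun F => ⟨F.1.image S.ν, S.νfac _ F.2⟩, fun F => Subtype.ext (image_νν F.1),
    fun F => Subtype.ext (image_νν F.1)⟩ _ _ fun F => ?_
  rw [th_apply]
  simp only [Equiv.coe_fn_mk]
  rw [vol_ν F.2, Finset.prod_image (fun a _ b _ h => ν_inj h)]
  simp only [co_ν F.2, LinearMap.neg_apply]
  rw [Finset.prod_neg, S.fac_card _ F.2]
  have h1 : ((-1 : ℝ) ^ d) * (-1) ^ d = 1 := by rw [← mul_pow]; simp
  have h2 : (((-1 : ℝ) ^ d))⁻¹ = (-1) ^ d := by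
    rw [← inv_pow]; norm_num
  simp only [mul_inv, h2]
  linear_combination (-((S.vol F.1)⁻¹ * (∏ v ∈ F.1, S.co F.1 v S.ξ)⁻¹ * g ⟨F.1.image S.ν, S.νfac _ F.2⟩)) * h1

end CFan
end

noncomputable section
set_option linter.unusedVariables false
set_option linter.unusedSectionVars false
namespace CFan
variable {d : ℕ} {ι : Type} [Fintype ι] [DecidableEq ι] {S : CFan d ι}

/-! ### parity -/
variable (S)
/-- odd functions on the vertex set -/
def Od (y : ι → ℝ) : Prop := ∀ v, y (S.ν v) = - y v
variable {S}

lemma th_X (v : ι) : S.th (S.X v) = - S.X (S.ν v) := by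
  unfold X
  rw [th_E]
  congr 2
  ext w
  by_cases h : w = S.ν v
  · subst h; simp [S.νν]
  · have h2 : S.ν w ≠ v := fun e => h (by rw [← e, S.νν])
    simp [Pi.single_apply, h, h2]

lemma th_om : S.th S.om = - S.om := by unfold om; rw [th_E]; rfl

lemma th_od {y} (hy : S.Od y) : S.th (S.E y) = S.E y := by
  rw [th_E, ← map_neg]; congr 1; ext v; simp [hy v]

lemma tr_par (g : S.Rg) (m : ℕ) :
    S.tr (g * S.om ^ m) = (-1) ^ (d + m) * S.tr (S.th g * S.om ^ m) := by
  have h := tr_th (g * S.om ^ m)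
  rw [map_mul, map_pow, th_om, neg_pow] at h
  have h1 : S.th g * ((-1) ^ m * S.om ^ m) = ((-1 : ℝ) ^ m) • (S.th g * S.om ^ m) := by
    rcases Nat.even_or_odd m with e | e
    · simp [e.neg_one_pow]
    · simp [e.neg_one_pow]
  rw [h1, map_smul, smul_eq_mul] at h
  have h2 : ((-1 : ℝ) ^ d) * (-1) ^ d = 1 := by rw [← mul_pow]; simp
  rw [pow_add]
  linear_combination ((-1) ^ d) * (-h) + (-S.tr (g * S.om ^ m)) * h2

lemma tr_pe (g : S.Rg) (m : ℕ) (h : Even (d + m)) :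
    S.tr (g * S.om ^ m) = S.tr (S.th g * S.om ^ m) := by
  rw [tr_par, h.neg_one_pow, one_mul]

lemma tr_po (g : S.Rg) (m : ℕ) (h : Odd (d + m)) :
    S.tr (g * S.om ^ m) = - S.tr (S.th g * S.om ^ m) := by
  rw [tr_par, h.neg_one_pow, neg_one_mul]

/-! ### strain -/

/-- dot product functional -/
def dl (a : Fin d → ℝ) : (Fin d → ℝ) →ₗ[ℝ] ℝ where
  toFun x := a ⬝ᵥ x
  map_add' x y := dotProduct_add _ _ _
  map_smul' c x := by simp [dotProduct_smul]

lemma dl_apply (a x : Fin d → ℝ) : dl a x = a ⬝ᵥ x := rfl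

lemma exists_dl (f : (Fin d → ℝ) →ₗ[ℝ] ℝ) : ∃ b, f = dl b := by
  refine ⟨fun i => f (Pi.single i 1), ?_⟩
  refine LinearMap.pi_ext' fun i => ?_
  ext
  simp [dl_apply]

variable (S)
/-- strain of a motion -/
def str (m : ι → Fin d → ℝ) (i j : ι) : ℝ := (S.p i - S.p j) ⬝ᵥ (m i - m j)
variable {S}

lemma two_sum (a b : ι → ℝ) (h : S.Rg) :
    S.tr (S.E a * S.E b * h) = ∑ i, ∑ j, a i * b j * S.tr (S.X i * S.X j * h) := by
  rw [E_sum a, E_sum b, Finset.sum_mul_sum, Finset.sum_mul, map_sum]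
  refine Finset.sum_congr rfl fun i _ => ?_
  rw [Finset.sum_mul, map_sum]
  refine Finset.sum_congr rfl fun j _ => ?_
  rw [smul_mul_smul_comm, smul_mul_assoc, map_smul, smul_eq_mul]

lemma strain_id {h : S.Rg} {k : ℕ} (hh : h ∈ S.PL ^ k) (hk : k + 2 ≤ d) (m : ι → Fin d → ℝ) :
    ∑ i, ∑ j, S.tr (S.X i * S.X j * h) * S.str m i j =
      2 * S.tr (S.E (fun i => S.p i ⬝ᵥ m i) * S.om * h) := by
  have e1 : S.tr (S.E (fun i => S.p i ⬝ᵥ m i) * S.om * h) =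
      ∑ i, ∑ j, S.tr (S.X i * S.X j * h) * (S.p i ⬝ᵥ m i) := by
    unfold om; rw [two_sum]
    refine Finset.sum_congr rfl fun i _ => Finset.sum_congr rfl fun j _ => ?_
    simp; ring
  have e2 : ∑ i, ∑ j, S.tr (S.X i * S.X j * h) * (S.p j ⬝ᵥ m i) = 0 := by
    refine Finset.sum_eq_zero fun i _ => ?_
    have := kill (mm (mX i) hh) (by omega) (dl (m i))
    rw [E_sum, Finset.sum_mul, map_sum] at this
    rw [← this]
    refine Finset.sum_congr rfl fun j _ => ?_
    rw [smul_mul_assoc, map_smul, smul_eq_mul, dl_apply, dotProduct_comm (m i), mul_comm]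
    congr 2; ring
  have e3 : ∀ a : ι → ι → ℝ, ∑ i, ∑ j, S.tr (S.X i * S.X j * h) * a j i =
      ∑ i, ∑ j, S.tr (S.X i * S.X j * h) * a i j := by
    intro a; rw [Finset.sum_comm]
    refine Finset.sum_congr rfl fun i _ => Finset.sum_congr rfl fun j _ => ?_
    rw [mul_comm (S.X j)]
  have e4 := e3 fun i j => S.p i ⬝ᵥ m i
  have e5 := e3 fun i j => S.p j ⬝ᵥ m i
  have : ∀ i j, S.tr (S.X i * S.X j * h) * S.str m i j =
      S.tr (S.X i * S.X j * h) * (S.p i ⬝ᵥ m i) + S.tr (S.X i * S.X j * h) * (S.p j ⬝ᵥ m j)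
      - S.tr (S.X i * S.X j * h) * (S.p j ⬝ᵥ m i) - S.tr (S.X i * S.X j * h) * (S.p i ⬝ᵥ m j) := by
    intro i j
    simp only [str, sub_dotProduct, dotProduct_sub]; ring
  simp only [this, Finset.sum_add_distrib, Finset.sum_sub_distrib]
  rw [e4, e5, ← e1, e2]; ring

lemma XX_zero {u v : ι} (h : ¬ S.Fc {u, v}) : S.X u * S.X v = 0 := by
  have huv : u ≠ v := by
    rintro rfl
    obtain ⟨F, hF, hu⟩ := S.cover u
    exact h ⟨F, hF, by simpa using hu⟩
  have := XQ_zero h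
  rwa [XQ_insert (by simpa using huv), show S.XQ {v} = S.X v by simp [XQ]] at this

lemma Fc_empty : S.Fc ∅ := by
  obtain ⟨F, hF⟩ := S.fac_ne
  exact ⟨F, hF, by simp⟩

lemma Fc_one (v : ι) : S.Fc {v} := by
  obtain ⟨F, hF, h⟩ := S.cover v
  exact ⟨F, hF, by simpa using h⟩

lemma Fc_ν {Q : Finset ι} (h : S.Fc Q) : S.Fc (Q.image S.ν) := by
  obtain ⟨F, hF, h⟩ := h
  exact ⟨_, S.νfac F hF, Finset.image_subset_image h⟩

lemma Fc_ν2 {u v : ι} (h : S.Fc {u, v}) : S.Fc {S.ν u, S.ν v} := by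
  have := Fc_ν h
  simpa [Finset.image_insert] using this

lemma not_Fc_ν (v : ι) : ¬ S.Fc {v, S.ν v} := by
  rintro ⟨F, hF, h⟩
  exact not_mem_ν hF (v := v) (h (by simp)) (h (by simp))

/-- odd functions of norm zero are linear -/
lemma odd_lin (hd : 2 ≤ d) {c : ι → ℝ} (hc : S.Od c) (h0 : S.tr (S.E c * S.E c * S.om ^ (d - 2)) = 0) :
    ∃ f : (Fin d → ℝ) →ₗ[ℝ] ℝ, ∀ v, c v = f (S.p v) := by
  have hB : S.BB ∅ (d - 2) c 1 = 0 := by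
    rw [BB_one]
    have := tr_po (S.E c) (d - 2 + 1) (by rw [Nat.odd_iff]; omega)
    rw [th_od hc] at this
    simp only [XQ, Finset.prod_empty, one_mul]; linarith
  obtain ⟨f, hf⟩ := (HR (d - 2) ∅ (by simp; omega) Fc_empty c hB).2 (by
    rw [BB_apply]; simpa [XQ] using h0)
  refine ⟨f, fun v => ?_⟩
  obtain ⟨F, hF, hv⟩ := S.cover v
  rw [← hf F hF (by simp), lin_p hF hv]

lemma odd_nonpos (hd : 2 ≤ d) {c : ι → ℝ} (hc : S.Od c) :
    S.tr (S.E c * S.E c * S.om ^ (d - 2)) ≤ 0 := by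
  have hB : S.BB ∅ (d - 2) c 1 = 0 := by
    rw [BB_one]
    have := tr_po (S.E c) (d - 2 + 1) (by rw [Nat.odd_iff]; omega)
    rw [th_od hc] at this
    simp only [XQ, Finset.prod_empty, one_mul]; linarith
  have := (HR (d - 2) ∅ (by simp; omega) Fc_empty c hB).1
  rw [BB_apply] at this; simpa [XQ] using this

theorem rigid (hd : 3 ≤ d) (m : ι → Fin d → ℝ) (hm : ∀ v, m (S.ν v) = m v)
    (h0 : ∀ u v, u ≠ v → S.Fc {u, v} → S.str m u v = 0) : ∃ b, ∀ v, m v = b := by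
  set c : ι → ℝ := fun i => S.p i ⬝ᵥ m i with hc
  have hco : S.Od c := fun v => by simp [hc, hm, S.νp]
  have hz : S.tr (S.E c * S.E c * S.om ^ (d - 2)) = 0 := by
    have := strain_id (mm (mE c) (mom (d - 3))) (by omega) m (S := S)
    rw [Finset.sum_eq_zero] at this
    · have e : S.E c * S.om * (S.E c * S.om ^ (d - 3)) = S.E c * S.E c * S.om ^ (d - 2) := by
        rw [show d - 2 = (d - 3) + 1 by omega, pow_succ]; ring
      rw [e] at this; linarith
    · intro i _
      refine Finset.sum_eq_zero fun j _ => ?_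
      by_cases hij : i = j
      · subst hij; simp [str]
      by_cases hF : S.Fc {i, j}
      · rw [h0 i j hij hF, mul_zero]
      · rw [XX_zero hF]; simp
  obtain ⟨f, hf⟩ := odd_lin (by omega) hco hz
  obtain ⟨b, rfl⟩ := exists_dl f
  set m' : ι → Fin d → ℝ := fun v => m v - b with hm'
  have h1 : ∀ v, S.p v ⬝ᵥ m' v = 0 := fun v => by
    have := hf v
    simp only [hc, dl_apply] at this
    simp only [hm', dotProduct_sub, this, dotProduct_comm b, sub_self]
  have h2 : ∀ u v, S.Fc {u, v} → S.p u ⬝ᵥ m' v + S.p v ⬝ᵥ m' u = 0 := by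
    intro u v huv
    by_cases e : u = v
    · subst e; simp [h1]
    have := h0 u v e huv
    have e1 : m u - m v = m' u - m' v := by simp [hm']
    rw [str, e1] at this
    simp only [sub_dotProduct, dotProduct_sub, h1] at this
    linarith
  -- the linear map on each facet
  obtain ⟨F0, hF0⟩ := S.fac_ne
  have key : ∀ F ∈ S.fac, ∀ x : Fin d → ℝ, S.lin F (fun v => m' v ⬝ᵥ x) = S.lin F0 (fun v => m' v ⬝ᵥ x) := by
    intro F hF
    refine conn ∅ (fun F => ∀ x : Fin d → ℝ, S.lin F (fun v => m' v ⬝ᵥ x) = S.lin F0 (fun v => m' v ⬝ᵥ x))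
      hF0 (by simp) (fun x => rfl) ?_ hF (by simp)
    intro F hF _ hP i hi _ j hj hF'
    intro x
    rw [← hP x]
    -- difference form
    set G := insert j (F.erase i) with hG
    have skew : ∀ F ∈ S.fac, ∀ x, S.lin F (fun v => m' v ⬝ᵥ x) x = 0 := by
      intro F hF x
      have a1 : S.lin F (fun v => m' v ⬝ᵥ x) x = ∑ v ∈ F, ∑ w ∈ F, S.co F v x * S.co F w x * (m' v ⬝ᵥ S.p w) := by
        rw [expand hF]
        refine Finset.sum_congr rfl fun v hv => ?_
        rw [lin_p hF hv, ← dl_apply, expand hF (dl (m' v)), Finset.mul_sum]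
        refine Finset.sum_congr rfl fun w hw => ?_
        rw [dl_apply]; ring
      have a2 := a1
      rw [Finset.sum_comm] at a2
      have : ∑ v ∈ F, ∑ w ∈ F, S.co F v x * S.co F w x * (m' v ⬝ᵥ S.p w) +
        ∑ v ∈ F, ∑ w ∈ F, S.co F w x * S.co F v x * (m' w ⬝ᵥ S.p v) = 0 := by
        rw [← Finset.sum_add_distrib]
        refine Finset.sum_eq_zero fun v hv => ?_
        rw [← Finset.sum_add_distrib]
        refine Finset.sum_eq_zero fun w hw => ?_
        have := h2 v w ⟨F, hF, by simp [Finset.insert_subset_iff, hv, hw]⟩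
        rw [dotProduct_comm (m' v), dotProduct_comm (m' w)]
        linear_combination (S.co F v x * S.co F w x) * this
      linarith
    have addx : ∀ F, ∀ x y, S.lin F (fun v => m' v ⬝ᵥ (x + y)) = S.lin F (fun v => m' v ⬝ᵥ x) + S.lin F (fun v => m' v ⬝ᵥ y) := by
      intro F x y; ext; simp [lin_apply, dotProduct_add, add_mul, Finset.sum_add_distrib]
    have sk2 : ∀ F ∈ S.fac, ∀ x y, S.lin F (fun v => m' v ⬝ᵥ x) y = - S.lin F (fun v => m' v ⬝ᵥ y) x := by
      intro F hF x y
      have a := skew F hF (x + y)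
      rw [addx] at a
      simp only [map_add, LinearMap.add_apply, skew F hF] at a
      linarith
    have dif : ∀ x, S.lin G (fun v => m' v ⬝ᵥ x) = S.lin F (fun v => m' v ⬝ᵥ x) +
        (S.lin G (fun v => m' v ⬝ᵥ x) (S.p i) - S.lin F (fun v => m' v ⬝ᵥ x) (S.p i)) • S.co F i := by
      intro x
      refine piv_diff hF hi hj hF' fun v hv => ?_
      rw [lin_p hF' (Finset.mem_insert_of_mem hv), lin_p hF (Finset.mem_of_mem_erase hv)]
    rw [dif x]
    have e0 : S.lin G (fun v => m' v ⬝ᵥ S.p i) = S.lin F (fun v => m' v ⬝ᵥ S.p i) := by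
      rw [dif (S.p i), skew F hF]
      rw [sk2 G hF']
      have := skew G hF' (S.p i)
      rw [this]; simp
    have : S.lin G (fun v => m' v ⬝ᵥ x) (S.p i) = S.lin F (fun v => m' v ⬝ᵥ x) (S.p i) := by
      rw [sk2 G hF', sk2 F hF, e0]
    rw [this]; simp
  have fin : ∀ v x, m' v ⬝ᵥ x = S.lin F0 (fun v => m' v ⬝ᵥ x) (S.p v) := by
    intro v x
    obtain ⟨F, hF, hv⟩ := S.cover v
    rw [← key F hF x, lin_p hF hv]
  refine ⟨b, fun v => ?_⟩
  have : m' v = 0 := by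
    rw [← dotProduct_self_eq_zero]
    have a := fin v (m' v)
    have b := fin (S.ν v) (m' v)
    rw [S.νp, map_neg, ← a] at b
    have : m' (S.ν v) = m' v := by simp [hm', hm]
    rw [this] at b
    linarith
  simpa [hm', sub_eq_zero] using this

lemma exists_ht : ∃ ht : ι → ℝ, Function.Injective ht ∧ S.Od ht := by
  have hne : ∀ k : {k : ι × ι // k.1 ≠ k.2}, ∃ x, dl (S.p k.1.1 - S.p k.1.2) x ≠ 0 := by
    intro k
    refine ⟨S.p k.1.1 - S.p k.1.2, ?_⟩
    rw [dl_apply, Ne, dotProduct_self_eq_zero, sub_eq_zero]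
    exact fun h => k.2 (p_inj h)
  obtain ⟨x, hx⟩ := exists_generic (fun k : {k : ι × ι // k.1 ≠ k.2} => dl (S.p k.1.1 - S.p k.1.2)) hne
  refine ⟨fun v => S.p v ⬝ᵥ x, fun u v h => ?_, fun v => by simp [S.νp]⟩
  by_contra huv
  refine hx ⟨(u, v), huv⟩ ?_
  simp only [dl_apply, sub_dotProduct]
  simp only at h
  linarith

end CFan
end

noncomputable section
set_option linter.unusedVariables false
set_option linter.unusedSectionVars false
namespace CFan
variable {d : ℕ} {ι : Type} [Fintype ι] [DecidableEq ι] {S : CFan d ι}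

variable (S)
/-- ordered edges -/
def ed : Finset (ι × ι) := Finset.univ.filter fun e => e.1 ≠ e.2 ∧ S.Fc {e.1, e.2}
variable {S}

lemma mem_ed {u v : ι} : (u, v) ∈ S.ed ↔ u ≠ v ∧ S.Fc {u, v} := by simp [ed]

lemma ed_swap {e : ι × ι} (h : e ∈ S.ed) : (e.2, e.1) ∈ S.ed := by
  rw [← Prod.mk.eta (p := e), mem_ed] at h
  exact mem_ed.2 ⟨h.1.symm, by rw [Finset.pair_comm]; exact h.2⟩

lemma ed_ν {e : ι × ι} (h : e ∈ S.ed) : (S.ν e.1, S.ν e.2) ∈ S.ed := by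
  rw [← Prod.mk.eta (p := e), mem_ed] at h
  exact mem_ed.2 ⟨fun e => h.1 (ν_inj e), Fc_ν2 h.2⟩

/-- half of the elements for a fixed point free involution with sign -/
lemma half_card {α : Type} [DecidableEq α] (A : Finset α) (s : α → α) (hs : ∀ a ∈ A, s a ∈ A)
    (hss : ∀ a ∈ A, s (s a) = a) (q : α → ℝ) (hq : ∀ a ∈ A, q (s a) = - q a) (h0 : ∀ a ∈ A, q a ≠ 0) :
    A.card = 2 * (A.filter fun a => 0 < q a).card := by
  have h1 := Finset.card_filter_add_card_filter_not (s := A) (fun a => 0 < q a)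
  have h2 : (A.filter fun a => 0 < q a).card = (A.filter fun a => ¬ 0 < q a).card := by
    refine Finset.card_nbij' s s ?_ ?_ ?_ ?_
    · intro a ha
      simp only [Finset.coe_filter, Set.mem_setOf_eq] at ha ⊢
      exact ⟨hs a ha.1, by rw [hq a ha.1]; linarith⟩
    · intro a ha
      simp only [Finset.coe_filter, Set.mem_setOf_eq] at ha ⊢
      refine ⟨hs a ha.1, ?_⟩
      rw [hq a ha.1]
      have := h0 a ha.1
      have := lt_of_le_of_ne (not_lt.1 ha.2) this
      linarith
    · intro a ha; exact hss a (Finset.mem_filter.1 ha).1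
    · intro a ha; exact hss a (Finset.mem_filter.1 ha).1
  omega

theorem surj (hd : 3 ≤ d) (hE : S.ed.card + 4 * d = 2 * d * Fintype.card ι) (g : ι → ι → ℝ)
    (hs : ∀ u v, g u v = g v u) (ho : ∀ u v, g (S.ν u) (S.ν v) = - g u v) :
    ∃ m : ι → Fin d → ℝ, (∀ v, m (S.ν v) = m v) ∧ ∀ u v, u ≠ v → S.Fc {u, v} → S.str m u v = g u v := by
  obtain ⟨ht, hti, hto⟩ := S.exists_ht
  have hn0 : ∀ v, ht v ≠ 0 := fun v h => by
    have := hto v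
    rw [h, neg_zero, ← h] at this
    exact ν_ne v (hti this)
  let A : Finset ι := Finset.univ.filter fun v => 0 < ht v
  let R0 : Finset (ι × ι) := S.ed.filter fun e => 0 < ht e.1 - ht e.2
  let R : Finset (ι × ι) := R0.filter fun e => 0 < ht e.1 + ht e.2
  have cA : Fintype.card ι = 2 * A.card := by
    rw [← Finset.card_univ]
    exact half_card _ S.ν (by simp) (fun a _ => S.νν a) ht (fun a _ => hto a) (fun a _ => hn0 a)
  have cR0 : S.ed.card = 2 * R0.card := by
    refine half_card _ (fun e => (e.2, e.1)) (fun e he => ed_swap he) (fun e _ => rfl) (fun e => ht e.1 - ht e.2)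
      (fun e _ => by simp) (fun e he => ?_)
    rw [← Prod.mk.eta (p := e), mem_ed] at he
    exact fun h => he.1 (hti (sub_eq_zero.1 h))
  have cR : R0.card = 2 * R.card := by
    refine half_card _ (fun e => (S.ν e.2, S.ν e.1)) (fun e he => ?_) (fun e _ => by simp [S.νν])
      (fun e => ht e.1 + ht e.2) (fun e _ => by simp [hto e.1, hto e.2]) (fun e he => ?_)
    · rw [Finset.mem_filter] at he ⊢
      refine ⟨ed_swap (ed_ν he.1), ?_⟩
      simp only [hto e.1, hto e.2]; linarith [he.2]
    · have he := (Finset.mem_filter.1 he).1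
      rw [← Prod.mk.eta (p := e), mem_ed] at he
      intro h
      have : e.1 = S.ν e.2 := hti (by rw [hto]; linarith)
      refine not_Fc_ν e.2 (S := S) ?_
      have := he.2
      rwa [‹e.1 = _›, Finset.pair_comm] at this
  -- the strain map
  have cases : ∀ v, v ∈ A ∨ S.ν v ∈ A := fun v => by
    simp only [A, Finset.mem_filter, Finset.mem_univ, true_and, hto v]
    rcases lt_or_gt_of_ne (hn0 v) with h | h
    · right; linarith
    · left; exact h
  have excl : ∀ v, v ∈ A → S.ν v ∉ A := fun v h => by
    simp only [A, Finset.mem_filter, Finset.mem_univ, true_and, hto v] at h ⊢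
    linarith
  let rep : ι → A := fun v => if h : v ∈ A then ⟨v, h⟩ else ⟨S.ν v, (cases v).resolve_left h⟩
  have repν : ∀ v, rep (S.ν v) = rep v := fun v => by
    rcases cases v with h | h
    · have h' := excl v h
      simp only [rep, h, h', dif_pos, dif_neg, not_false_eq_true, S.νν]
    · have h' := excl _ h
      rw [S.νν] at h'
      simp only [rep, h, h', dif_pos, dif_neg, not_false_eq_true]
  have repA : ∀ a : A, rep a.1 = a := fun a => by
    simp only [rep, a.2, dif_pos]
  let T : (A → Fin d → ℝ) →ₗ[ℝ] (R → ℝ) :=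
    { toFun := fun m e => S.str (fun v => m (rep v)) e.1.1 e.1.2
      map_add' := fun m m' => by
        ext e; simp only [str, Pi.add_apply]
        rw [← dotProduct_add]; congr 1; abel
      map_smul' := fun c m => by
        ext e; simp only [str, Pi.smul_apply, ← smul_sub, dotProduct_smul, RingHom.id_apply] }
  -- rules for extending from R
  have ext : ∀ q : ι → ι → ℝ, (∀ u v, q u v = q v u) → (∀ u v, q (S.ν u) (S.ν v) = - q u v) →
      (∀ e ∈ R, q e.1 e.2 = 0) → ∀ u v, u ≠ v → S.Fc {u, v} → q u v = 0 := by
    intro q q1 q2 q3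
    have st1 : ∀ u v, (u, v) ∈ R0 → q u v = 0 := by
      intro u v h
      by_cases h2 : (u, v) ∈ R
      · exact q3 _ h2
      · have h3 : ¬ (0 < ht u + ht v) := fun h' => h2 (Finset.mem_filter.2 ⟨h, h'⟩)
        have h4 := Finset.mem_filter.1 h
        have h5 : ht u + ht v ≠ 0 := fun h' => by
          have : u = S.ν v := hti (by rw [hto]; linarith)
          have h6 := (mem_ed.1 h4.1).2
          rw [this, Finset.pair_comm] at h6
          exact not_Fc_ν v h6
        have : (S.ν v, S.ν u) ∈ R := by
          refine Finset.mem_filter.2 ⟨Finset.mem_filter.2 ⟨ed_swap (ed_ν h4.1), ?_⟩, ?_⟩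
          · have := h4.2; simp only at this; simp only [hto u, hto v]; linarith
          · have := lt_of_le_of_ne (not_lt.1 h3) h5; simp only [hto u, hto v]; linarith
        have := q3 _ this
        simp only [q2] at this
        rw [q1]; linarith
    intro u v huv hF
    have he : (u, v) ∈ S.ed := mem_ed.2 ⟨huv, hF⟩
    rcases lt_or_gt_of_ne (fun h => huv (hti h) : ht u ≠ ht v) with h | h
    · rw [q1]; exact st1 _ _ (Finset.mem_filter.2 ⟨ed_swap he, by simp only; linarith⟩)
    · exact st1 _ _ (Finset.mem_filter.2 ⟨he, by simp only; linarith⟩)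
  have strs : ∀ m : ι → Fin d → ℝ, ∀ u v, S.str m u v = S.str m v u := by
    intro m u v; simp only [str, sub_dotProduct, dotProduct_sub]; ring
  have stro : ∀ m : ι → Fin d → ℝ, (∀ v, m (S.ν v) = m v) → ∀ u v, S.str m (S.ν u) (S.ν v) = - S.str m u v := by
    intro m hm u v; simp only [str, S.νp, hm, sub_dotProduct, dotProduct_sub, neg_dotProduct]; ring
  obtain ⟨F0, hF0⟩ := S.fac_ne
  have hAne : Nonempty A := by
    obtain ⟨v, hv⟩ := Finset.card_pos.1 (by rw [S.fac_card _ hF0]; omega : 0 < F0.card)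
    exact ⟨rep v⟩
  let Cn : (Fin d → ℝ) →ₗ[ℝ] (A → Fin d → ℝ) :=
    { toFun := fun b _ => b
      map_add' := fun _ _ => rfl
      map_smul' := fun _ _ => rfl }
  have hker : LinearMap.ker T = LinearMap.range Cn := by
    apply le_antisymm
    · intro m hm
      rw [LinearMap.mem_ker] at hm
      obtain ⟨b, hb⟩ := rigid hd (fun v => m (rep v)) (fun v => congrArg m (repν v)) (by
        refine ext _ (strs _) (stro _ fun v => congrArg m (repν v)) ?_
        intro e he
        exact congrFun hm ⟨e, he⟩)
      refine ⟨b, ?_⟩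
      ext a : 1
      have := hb a.1
      rw [repA] at this
      exact this.symm
    · rintro _ ⟨b, rfl⟩
      rw [LinearMap.mem_ker]
      ext e
      simp [T, Cn, str]
  have hinj : Function.Injective Cn := fun a b h => by
    obtain ⟨x⟩ := hAne
    exact congrFun h x
  have hrk := LinearMap.finrank_range_add_finrank_ker T
  rw [hker, LinearMap.finrank_range_of_inj hinj] at hrk
  have hsurj : Function.Surjective T := by
    rw [← LinearMap.range_eq_top]
    refine Submodule.eq_top_of_finrank_eq ?_
    have e1 : Module.finrank ℝ (A → Fin d → ℝ) = A.card * d := by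
      rw [Module.finrank_pi_fintype]; simp
    have e2 : Module.finrank ℝ (R → ℝ) = R.card := by simp
    rw [e1] at hrk
    rw [e2]
    simp only [Module.finrank_fin_fun] at hrk
    rw [cA, cR0, cR] at hE
    have : 4 * R.card + 4 * d = 4 * (A.card * d) := by rw [← mul_assoc] at hE; rw [show 2*2 = 4 by rfl] at hE; rw [hE]; ring
    omega
  obtain ⟨m, hm⟩ := hsurj (fun e => g e.1.1 e.1.2)
  refine ⟨fun v => m (rep v), fun v => by simp only [repν], fun u v huv hF => ?_⟩
  have := ext (fun u v => S.str (fun v => m (rep v)) u v - g u v) (fun u v => by simp only [strs _ u v, hs u v])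
    (fun u v => by simp only [stro (fun v => m (rep v)) (fun v => congrArg m (repν v)) u v, ho]; ring) (by
      intro e he
      have := congrFun hm ⟨e, he⟩
      exact sub_eq_zero.2 this) u v huv hF
  linarith

/-- orbit indicator -/
def orb (S : CFan d ι) (a b u v : ι) : ℝ :=
  (if u = a ∧ v = b then 1 else 0) + (if u = b ∧ v = a then 1 else 0)
  - (if u = S.ν a ∧ v = S.ν b then 1 else 0) - (if u = S.ν b ∧ v = S.ν a then 1 else 0)

lemma resolve (hd : 3 ≤ d) (hE : S.ed.card + 4 * d = 2 * d * Fintype.card ι) (a b : ι) :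
    ∃ m : ι → Fin d → ℝ, (∀ v, m (S.ν v) = m v) ∧
      ∀ u v, u ≠ v → S.Fc {u, v} → S.str m u v = orb S a b u v := by
  refine surj hd hE _ (fun u v => ?_) (fun u v => ?_)
  · simp only [orb, and_comm]; ring
  · have h : ∀ x y, S.ν x = y ↔ x = S.ν y := fun x y =>
      ⟨fun h => by rw [← h, S.νν], fun h => by rw [h, S.νν]⟩
    simp only [orb, h, S.νν]; ring

/-- no cliques of size `d + 2` -/
theorem no_clique (hd : 3 ≤ d) (hE : S.ed.card + 4 * d = 2 * d * Fintype.card ι) (C : Finset ι)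
    (hC : C.card = d + 2) (hcl : ∀ u ∈ C, ∀ v ∈ C, u ≠ v → S.Fc {u, v}) : False := by
  have : ∃ c : ι → ℝ, ∑ v ∈ C, c v • S.p v = 0 ∧ ∑ v ∈ C, c v = 0 ∧ ∃ x ∈ C, c x ≠ 0 := by
    have hcard : Module.finrank ℝ (Fin d → ℝ) + 1 < (C.image S.p).card := by
      rw [Finset.card_image_of_injective _ p_inj, hC]; simp
    refine (Module.exists_nontrivial_relation_sum_zero_of_finrank_succ_lt_card hcard).elim ?_
    · rintro f ⟨h1, h2, x, hx, hx0⟩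
      refine ⟨fun v => f (S.p v), ?_, ?_, ?_⟩
      · rwa [Finset.sum_image (fun a _ b _ h => p_inj h)] at h1
      · rwa [Finset.sum_image (fun a _ b _ h => p_inj h)] at h2
      · obtain ⟨v, hv, rfl⟩ := Finset.mem_image.1 hx
        exact ⟨v, hv, hx0⟩
  obtain ⟨c, h1, h2, a, ha, ha0⟩ := this
  have : ∃ b ∈ C, b ≠ a ∧ c b ≠ 0 := by
    by_contra hcon
    push Not at hcon
    rw [Finset.sum_eq_single_of_mem a ha hcon] at h2
    exact ha0 h2
  obtain ⟨b, hb, hba, hb0⟩ := this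
  obtain ⟨m, hm, hstr⟩ := resolve hd hE a b
  have e0 : ∑ u ∈ C, ∑ v ∈ C, c u * c v * S.str m u v = 0 := by
    have z1 : ∀ u, ∑ v ∈ C, c u * c v * (S.p u ⬝ᵥ m u) = 0 := fun u => by
      have : ∑ v ∈ C, c u * c v * (S.p u ⬝ᵥ m u) = (∑ v ∈ C, c v) * (c u * (S.p u ⬝ᵥ m u)) := by
        rw [Finset.sum_mul]; exact Finset.sum_congr rfl fun v _ => by ring
      rw [this, h2, zero_mul]
    have z2 : ∀ u, ∑ v ∈ C, c u * c v * (S.p v ⬝ᵥ m u) = 0 := fun u => by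
      have : ∑ v ∈ C, c u * c v * (S.p v ⬝ᵥ m u) = c u * ((∑ v ∈ C, c v • S.p v) ⬝ᵥ m u) := by
        rw [sum_dotProduct, Finset.mul_sum]; exact Finset.sum_congr rfl fun v _ => by rw [smul_dotProduct, smul_eq_mul]; ring
      rw [this, h1]; simp
    have z3 : ∑ u ∈ C, ∑ v ∈ C, c u * c v * (S.p v ⬝ᵥ m v) = 0 := by
      rw [Finset.sum_comm]
      refine Finset.sum_eq_zero fun u _ => ?_
      rw [← z1 u]; exact Finset.sum_congr rfl fun v _ => by ring
    have z4 : ∑ u ∈ C, ∑ v ∈ C, c u * c v * (S.p u ⬝ᵥ m v) = 0 := by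
      rw [Finset.sum_comm]
      refine Finset.sum_eq_zero fun u _ => ?_
      rw [← z2 u]; exact Finset.sum_congr rfl fun v _ => by ring
    have : ∀ u v, c u * c v * S.str m u v = c u * c v * (S.p u ⬝ᵥ m u) + c u * c v * (S.p v ⬝ᵥ m v)
       - c u * c v * (S.p v ⬝ᵥ m u) - c u * c v * (S.p u ⬝ᵥ m v) := by
      intro u v; simp only [str, sub_dotProduct, dotProduct_sub]; ring
    simp only [this, Finset.sum_add_distrib, Finset.sum_sub_distrib, z3, z4, z1, z2]; simp
  have nν : ∀ u ∈ C, ∀ v ∈ C, u ≠ S.ν v := by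
    rintro u hu v hv rfl
    have := hcl _ hv _ hu (ν_ne v).symm
    exact not_Fc_ν v this
  have e1 : ∀ u ∈ C, ∀ v ∈ C, c u * c v * S.str m u v =
      (if u = a then (if v = b then c u * c v else 0) else 0) + (if u = b then (if v = a then c u * c v else 0) else 0) := by
    intro u hu v hv
    by_cases huv : u = v
    · subst huv
      have : S.str m u u = 0 := by simp [str]
      rw [this]
      by_cases q1 : u = a
      · simp [q1, hba.symm]
      · simp [q1]
    · rw [hstr u v huv (hcl u hu v hv huv), orb]
      simp only [nν u hu a ha, nν u hu b hb, false_and, if_false, sub_zero]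
      by_cases q1 : u = a <;> by_cases q2 : v = b <;> by_cases q3 : u = b <;> by_cases q4 : v = a <;>
        simp_all
  rw [Finset.sum_congr rfl fun u hu => Finset.sum_congr rfl fun v hv => e1 u hu v hv] at e0
  simp only [Finset.sum_add_distrib] at e0
  have r1 : ∀ x ∈ C, ∀ y ∈ C, ∑ u ∈ C, ∑ v ∈ C, (if u = x then (if v = y then c u * c v else 0) else 0) = c x * c y := by
    intro x hx y hy
    rw [Finset.sum_eq_single_of_mem x hx, Finset.sum_eq_single_of_mem y hy]
    · simp
    · intro v _ hv; simp [hv]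
    · intro u _ hu; simp [hu]
  rw [r1 a ha b hb, r1 b hb a ha] at e0
  have : c a * c b = 0 := by linarith
  exact mul_ne_zero ha0 hb0 this

/-- multiplication by an even function on odd functions -/
theorem mult (hd : 3 ≤ d) (hE : S.ed.card + 4 * d = 2 * d * Fintype.card ι) {y w : ι → ℝ} (hy : S.Od y)
    (hw : ∀ v, w (S.ν v) = w v) : ∃ y', S.Od y' ∧ ∀ h ∈ S.PL ^ (d - 2),
      S.tr (S.E y * S.E w * h) = S.tr (S.E y' * S.om * h) := by
  let l : ι → ι → ℝ := fun i j => (S.p i ⬝ᵥ S.p j) / (S.p i ⬝ᵥ S.p i)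
  have l1 : ∀ i, l i i = 1 := fun i => by
    have : S.p i ⬝ᵥ S.p i ≠ 0 := by
      rw [Ne, dotProduct_self_eq_zero]
      intro h
      have h2 := S.νp i
      rw [h, neg_zero, ← h] at h2
      exact ν_ne i (p_inj h2)
    exact div_self this
  have lν : ∀ i j, l (S.ν i) (S.ν j) = l i j := fun i j => by simp [l, S.νp]
  let G : ι → ι → ℝ := fun i j => y i * w j - y i * w i * l i j
  have Gν : ∀ i j, G (S.ν i) (S.ν j) = - G i j := fun i j => by simp only [G, lν, hy i, hw]; ring
  obtain ⟨m, hm, hstr⟩ := surj hd hE (fun i j => G i j + G j i) (fun i j => add_comm _ _)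
    (fun i j => by simp only [Gν]; ring)
  refine ⟨fun i => S.p i ⬝ᵥ m i, fun v => by simp [S.νp, hm], fun h hh => ?_⟩
  have e1 := strain_id hh (by omega) m
  have e2 : S.tr (S.E y * S.E w * h) = ∑ i, ∑ j, G i j * S.tr (S.X i * S.X j * h) := by
    rw [two_sum]
    refine Finset.sum_congr rfl fun i _ => ?_
    have k := kill (mm (mX i) hh) (by omega) (dl ((S.p i ⬝ᵥ S.p i)⁻¹ • S.p i))
    rw [E_sum, Finset.sum_mul, map_sum] at k
    have : ∑ j, l i j * S.tr (S.X i * S.X j * h) = 0 := by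
      rw [← k]
      refine Finset.sum_congr rfl fun j _ => ?_
      rw [smul_mul_assoc, map_smul, smul_eq_mul, dl_apply, smul_dotProduct, smul_eq_mul]
      simp only [l]
      rw [div_eq_inv_mul]
      congr 2; ring
    simp only [G, sub_mul, Finset.sum_sub_distrib]
    have t : ∑ j, y i * w i * l i j * S.tr (S.X i * S.X j * h) = (y i * w i) * ∑ j, l i j * S.tr (S.X i * S.X j * h) := by
      rw [Finset.mul_sum]; exact Finset.sum_congr rfl fun j _ => by ring
    rw [t, this]; ring
  have e3 : ∑ i, ∑ j, S.tr (S.X i * S.X j * h) * S.str m i j =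
      ∑ i, ∑ j, (G i j * S.tr (S.X i * S.X j * h) + G j i * S.tr (S.X i * S.X j * h)) := by
    refine Finset.sum_congr rfl fun i _ => Finset.sum_congr rfl fun j _ => ?_
    by_cases hij : i = j
    · subst hij
      simp [str, G, l1]
    by_cases hF : S.Fc {i, j}
    · rw [hstr i j hij hF]; ring
    · rw [XX_zero hF]; simp
  simp only [Finset.sum_add_distrib] at e3
  have e4 : ∑ i, ∑ j, G j i * S.tr (S.X i * S.X j * h) = ∑ i, ∑ j, G i j * S.tr (S.X i * S.X j * h) := by
    rw [Finset.sum_comm]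
    refine Finset.sum_congr rfl fun i _ => Finset.sum_congr rfl fun j _ => ?_
    rw [mul_comm (S.X j)]
  rw [e4, ← e2] at e3
  linarith

end CFan
end

noncomputable section
set_option linter.unusedVariables false
set_option linter.unusedSectionVars false

/-- simultaneous diagonalization for a positive definite form -/
lemma joint_top {M : Type} [AddCommGroup M] [Module ℝ M] [FiniteDimensional ℝ M]
    (B : M →ₗ[ℝ] M →ₗ[ℝ] ℝ) (hs : ∀ x y, B x y = B y x) (hp : ∀ x, 0 ≤ B x x) (hd : ∀ x, B x x = 0 → x = 0)
    {κ : Type} (T : κ → M →ₗ[ℝ] M) (hT : ∀ k x y, B (T k x) y = B x (T k y))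
    (hC : ∀ i j, T i * T j = T j * T i) :
    ⨆ χ : κ → ℝ, ⨅ i, Module.End.eigenspace (T i) (χ i) = ⊤ := by
  let core : InnerProductSpace.Core ℝ M :=
    { inner := fun x y => B x y
      conj_inner_symm := fun x y => by simp [hs x y]
      re_inner_nonneg := fun x => by simpa using hp x
      add_left := fun x y z => by simp
      smul_left := fun x y r => by simp
      definite := fun x h => hd x h }
  letI : NormedAddCommGroup M := @InnerProductSpace.Core.toNormedAddCommGroup ℝ M _ _ _ core
  letI : InnerProductSpace ℝ M := InnerProductSpace.ofCore core.toCore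
  refine LinearMap.IsSymmetric.iSup_iInf_eq_top_of_commute (𝕜 := ℝ) (E := M) ?_ ?_
  · intro k x y
    exact hT k x y
  · intro i j _
    exact hC i j

namespace CFan
variable {d : ℕ} {ι : Type} [Fintype ι] [DecidableEq ι] {S : CFan d ι}

variable (S)
/-- symmetric pairs -/
def sX (u : ι) : S.Rg := S.X u + S.X (S.ν u)
/-- antisymmetric pairs -/
def av (u : ι) : ι → ℝ := Pi.single u 1 - Pi.single (S.ν u) 1
/-- odd functions -/
def OdM : Submodule ℝ (ι → ℝ) where
  carrier := {y | S.Od y}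
  add_mem' := fun {a b} ha hb v => by simp [ha v, hb v]; ring
  zero_mem' := fun v => by simp
  smul_mem' := fun c a ha v => by simp [ha v]

/-- joint eigenfunctions -/
def Eig (χ : ι → ℝ) : Submodule ℝ (ι → ℝ) where
  carrier := {y | S.Od y ∧ ∀ u, ∀ h ∈ S.PL ^ (d - 2),
    S.tr (S.E y * S.sX u * h) = χ u * S.tr (S.E y * S.om * h)}
  add_mem' := fun {a b} ha hb => ⟨S.OdM.add_mem ha.1 hb.1, fun u h hh => by
    simp only [map_add, add_mul, ha.2 u h hh, hb.2 u h hh]; ring⟩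
  zero_mem' := ⟨S.OdM.zero_mem, fun u h hh => by simp⟩
  smul_mem' := fun c a ha => ⟨S.OdM.smul_mem c ha.1, fun u h hh => by
    simp only [map_smul, smul_mul_assoc, ha.2 u h hh, smul_eq_mul]; ring⟩
variable {S}

lemma msX (u : ι) : S.sX u ∈ S.PL ^ 1 := Submodule.add_mem _ (mX _) (mX _)

lemma mE' (z : ι → ℝ) {k : ℕ} (hk : k = 1) : S.E z ∈ S.PL ^ k := hk ▸ mE z

lemma av_od (u : ι) : S.Od (S.av u) := fun v => by
  have h : ∀ x y, S.ν x = y ↔ x = S.ν y := fun x y =>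
      ⟨fun h => by rw [← h, S.νν], fun h => by rw [h, S.νν]⟩
  simp only [av, Pi.sub_apply, Pi.single_apply, h, S.νν]; ring

lemma E_av (u : ι) : S.E (S.av u) = S.X u - S.X (S.ν u) := by simp [av, X]

lemma sX_E (u : ι) : S.sX u = S.E (Pi.single u 1 + Pi.single (S.ν u) 1) := by simp [sX, X]

lemma tmul {k : ℕ} {x : S.Rg} (hx : x ∈ S.PL ^ k) (hk : k = d - 1) (f : (Fin d → ℝ) →ₗ[ℝ] ℝ) (hd : 0 < d) :
    S.tr (S.E (fun v => f (S.p v)) * x) = 0 := kill hx (by omega) f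

theorem odd_top (hd : 4 ≤ d) (hE : S.ed.card + 4 * d = 2 * d * Fintype.card ι) {z : ι → ℝ} (hz : S.Od z) :
    z ∈ ⨆ χ, S.Eig χ := by
  have hN : ∀ f : (Fin d → ℝ) →ₗ[ℝ] ℝ, ∀ x ∈ S.PL ^ (d - 1), S.tr (S.E (fun v => f (S.p v)) * x) = 0 :=
    fun f x hx => kill hx (by omega) f
  obtain ⟨M, i1, i2, i3, φ, hφo, hnd, hdec⟩ : ∃ (M : Type) (_ : AddCommGroup M) (_ : Module ℝ M)
      (_ : FiniteDimensional ℝ M) (φ : M →ₗ[ℝ] (ι → ℝ)), (∀ x, S.Od (φ x)) ∧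
      (∀ x, S.tr (S.E (φ x) * S.E (φ x) * S.om ^ (d - 2)) = 0 → x = 0) ∧
      ∀ y, S.Od y → ∃ (x : M) (f : (Fin d → ℝ) →ₗ[ℝ] ℝ), y = (fun v => f (S.p v)) + φ x := by
    let N : Submodule ℝ S.OdM :=
      { carrier := {y | ∃ f : (Fin d → ℝ) →ₗ[ℝ] ℝ, ∀ v, y.1 v = f (S.p v)}
        add_mem' := fun {a b} ⟨f, hf⟩ ⟨g, hg⟩ => ⟨f + g, fun v => by simp [hf v, hg v]⟩
        zero_mem' := ⟨0, fun v => rfl⟩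
        smul_mem' := fun c a ⟨f, hf⟩ => ⟨c • f, fun v => by simp [hf v]⟩ }
    obtain ⟨C, hC⟩ := N.exists_isCompl
    let φ : C →ₗ[ℝ] (ι → ℝ) := S.OdM.subtype ∘ₗ C.subtype
    have hφo : ∀ x : C, S.Od (φ x) := fun x => x.1.2
    refine ⟨C, inferInstance, inferInstance, inferInstance, φ, hφo, ?_, ?_⟩
    · intro x hx
      have h1 : x.1 ∈ N := odd_lin (by omega) (hφo x) hx
      have : x.1 ∈ N ⊓ C := ⟨h1, x.2⟩
      rw [hC.inf_eq_bot] at this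
      exact Subtype.ext this
    · intro y hy
      have : (⟨y, hy⟩ : S.OdM) ∈ N ⊔ C := by rw [hC.sup_eq_top]; trivial
      obtain ⟨n, ⟨f, hf⟩, c, hc, h⟩ := Submodule.mem_sup.1 this
      refine ⟨⟨c, hc⟩, f, ?_⟩
      have e : n.1 + c.1 = y := congrArg Subtype.val h
      rw [← e]
      ext v
      simp [φ, hf v]
  have huniq : ∀ x y : M, (∀ h ∈ S.PL ^ (d - 2), S.tr (S.E (φ x) * S.om * h) = S.tr (S.E (φ y) * S.om * h)) → x = y := by
    intro x y h
    rw [← sub_eq_zero]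
    refine hnd _ ?_
    have hm : S.E (φ (x - y)) * S.om ^ (d - 3) ∈ S.PL ^ (d - 2) := by
      have := mm (mE (φ (x - y))) (mom (d - 3)) (S := S)
      rwa [show 1 + (d - 3) = d - 2 by omega] at this
    have := h _ hm
    have e : S.E (φ (x - y)) * S.E (φ (x - y)) * S.om ^ (d - 2) =
      S.E (φ x) * S.om * (S.E (φ (x - y)) * S.om ^ (d - 3)) - S.E (φ y) * S.om * (S.E (φ (x - y)) * S.om ^ (d - 3)) := by
      rw [show d - 2 = (d - 3) + 1 by omega, pow_succ]
      have : φ (x - y) = φ x - φ y := map_sub _ _ _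
      rw [this, map_sub]; ring
    rw [e, map_sub, this, sub_self]
  have hex : ∀ u : ι, ∀ x : M, ∃ x' : M, ∀ h ∈ S.PL ^ (d - 2),
      S.tr (S.E (φ x) * S.sX u * h) = S.tr (S.E (φ x') * S.om * h) := by
    intro u x
    obtain ⟨y', hy', h'⟩ := mult (by omega) hE (hφo x) (w := Pi.single u 1 + Pi.single (S.ν u) 1) (fun v => by
      have h : ∀ x y, S.ν x = y ↔ x = S.ν y := fun x y =>
        ⟨fun h => by rw [← h, S.νν], fun h => by rw [h, S.νν]⟩
      simp only [Pi.add_apply, Pi.single_apply, h, S.νν]; ring)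
    obtain ⟨c, n, e'⟩ := hdec y' hy'
    refine ⟨c, fun h hh => ?_⟩
    rw [sX_E, h' h hh]
    rw [e', map_add, add_mul, add_mul, map_add, mul_assoc, hN n]
    · simp
    · have := mm (mom 1) hh (S := S)
      rwa [pow_one, show 1 + (d - 2) = d - 1 by omega] at this
  choose T0 hT0 using hex
  let T : ι → M →ₗ[ℝ] M := fun u =>
    { toFun := T0 u
      map_add' := fun x y => huniq _ _ fun h hh => by
        rw [← hT0 u _ h hh]; simp only [map_add, add_mul]; rw [← hT0 u _ h hh, ← hT0 u _ h hh]
      map_smul' := fun c x => huniq _ _ fun h hh => by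
        rw [← hT0 u _ h hh]; simp only [map_smul, smul_mul_assoc, RingHom.id_apply]; rw [← hT0 u _ h hh] }
  have hT : ∀ u x, ∀ h ∈ S.PL ^ (d - 2), S.tr (S.E (φ x) * S.sX u * h) = S.tr (S.E (φ (T u x)) * S.om * h) :=
    fun u x h hh => hT0 u x h hh
  let B : M →ₗ[ℝ] M →ₗ[ℝ] ℝ := - (S.BB ∅ (d - 2)).compl₁₂ φ φ
  have hB : ∀ x y, B x y = - S.tr (S.E (φ x) * S.om * (S.E (φ y) * S.om ^ (d - 3))) := by
    intro x y
    have : B x y = - S.BB ∅ (d - 2) (φ x) (φ y) := rfl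
    rw [this, BB_apply]
    congr 2
    rw [show d - 2 = (d - 3) + 1 by omega, pow_succ]; simp only [XQ, Finset.prod_empty]; ring
  have hBx : ∀ x, B x x = - S.tr (S.E (φ x) * S.E (φ x) * S.om ^ (d - 2)) := by
    intro x
    have : B x x = - S.BB ∅ (d - 2) (φ x) (φ x) := rfl
    rw [this, BB_apply]; simp [XQ]
  have m1 : ∀ y : M, S.E (φ y) * S.om ^ (d - 3) ∈ S.PL ^ (d - 2) := fun y => by
    have := mm (mE (φ y)) (mom (d - 3)) (S := S)
    rwa [show 1 + (d - 3) = d - 2 by omega] at this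
  have hsym : ∀ x y, B x y = B y x := fun x y => by rw [hB, hB]; congr 2; ring
  have hadj : ∀ k x y, B (T k x) y = B x (T k y) := by
    intro k x y
    rw [hsym x, hB, hB, ← hT k x _ (m1 y), ← hT k y _ (m1 x)]; congr 2; ring
  have hcomm : ∀ i j, T i * T j = T j * T i := by
    have m2 : ∀ i, ∀ y : M, S.sX i * S.E (φ y) * S.om ^ (d - 4) ∈ S.PL ^ (d - 2) := fun i y => by
      have := mm (mm (msX i) (mE (φ y))) (mom (d - 4)) (S := S)
      rwa [show 1 + 1 + (d - 4) = d - 2 by omega] at this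
    have e : ∀ i j x y, B (T i (T j x)) y = - S.tr (S.E (φ x) * S.sX j * (S.sX i * S.E (φ y) * S.om ^ (d - 4))) := by
      intro i j x y
      rw [hB, ← hT i _ _ (m1 y), hT j x _ (m2 i y)]
      congr 2
      rw [show d - 3 = (d - 4) + 1 by omega, pow_succ]; ring
    intro i j
    refine LinearMap.ext fun x => ?_
    rw [← sub_eq_zero]
    have h : ∀ y, B ((T i * T j) x - (T j * T i) x) y = 0 := by
      intro y
      have : B ((T i * T j) x - (T j * T i) x) y = B (T i (T j x)) y - B (T j (T i x)) y :=
        by simp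
      rw [this, e, e, sub_eq_zero]; congr 2; ring
    have := h ((T i * T j) x - (T j * T i) x)
    rw [hBx] at this
    exact hnd _ (by linarith)
  have top := joint_top B hsym (fun x => by rw [hBx]; linarith [odd_nonpos (by omega) (hφo x)])
    (fun x h => hnd x (by rw [hBx x] at h; linarith)) T hadj hcomm
  -- conclusion
  have hc : ∀ x : M, φ x ∈ ⨆ χ, S.Eig χ := by
    intro x
    have hx : x ∈ ⨆ χ : ι → ℝ, ⨅ i, Module.End.eigenspace (T i) (χ i) := by rw [top]; trivial
    have : (⨆ χ : ι → ℝ, ⨅ i, Module.End.eigenspace (T i) (χ i) : Submodule ℝ M) ≤ (⨆ χ, S.Eig χ).comap φ := by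
      refine iSup_le fun χ => ?_
      intro y hy
      rw [Submodule.mem_comap]
      refine (le_iSup S.Eig χ) ⟨hφo y, fun u h hh => ?_⟩
      have hy' := (Submodule.mem_iInf _).1 hy u
      rw [Module.End.mem_eigenspace_iff] at hy'
      rw [hT u y h hh, hy', map_smul, map_smul, smul_mul_assoc, smul_mul_assoc, map_smul, smul_eq_mul]
    exact this hx
  obtain ⟨c, n, e'⟩ := hdec z hz
  rw [e']
  refine Submodule.add_mem _ ((le_iSup S.Eig 0) ⟨fun v => by simp [S.νp], fun u h hh => ?_⟩) (hc c)
  rw [mul_assoc, hN n, mul_assoc, hN n]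
  · simp
  · have := mm (mom 1) hh (S := S)
    rwa [pow_one, show 1 + (d - 2) = d - 1 by omega] at this
  · have := mm (msX u) hh (S := S)
    rwa [show 1 + (d - 2) = d - 1 by omega] at this

end CFan
end

noncomputable section
set_option linter.unusedVariables false
set_option linter.unusedSectionVars false
namespace CFan
variable {d : ℕ} {ι : Type} [Fintype ι] [DecidableEq ι] {S : CFan d ι}

variable (S)
/-- general position of the vertices up to antipodes -/
def Gp : Prop := ∀ (c : ι → ℝ) (Q : Finset ι), Q.card ≤ d → (∀ u ∈ Q, ∀ v ∈ Q, u ≠ S.ν v) →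
  ∑ v ∈ Q, c v • S.p v = 0 → ∀ v ∈ Q, c v = 0
variable {S}

lemma gp_odd (hG : S.Gp) {c : ι → ℝ} (hc : S.Od c) (h0 : ∑ v, c v • S.p v = 0) (Z : Finset ι)
    (hZ : ∀ v, c v ≠ 0 → v ∈ Z) (hZν : ∀ v ∈ Z, S.ν v ∈ Z) (hcard : Z.card ≤ 2 * d) : ∀ v, c v = 0 := by
  obtain ⟨ht, hti, hto⟩ := S.exists_ht
  have hn0 : ∀ v, ht v ≠ 0 := fun v h => by
    have := hto v
    rw [h, neg_zero, ← h] at this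
    exact ν_ne v (hti this)
  have hh := half_card Z S.ν hZν (fun a _ => S.νν a) ht (fun a _ => hto a) (fun a _ => hn0 a)
  set Q := Z.filter fun a => 0 < ht a with hQ
  have e1 : ∑ v, c v • S.p v = ∑ v ∈ Z, c v • S.p v := by
    refine (Finset.sum_subset (Finset.subset_univ Z) fun v _ hv => ?_).symm
    have : c v = 0 := by by_contra h; exact hv (hZ v h)
    rw [this, zero_smul]
  have e2 : ∑ v ∈ Z.filter (fun a => ¬ 0 < ht a), c v • S.p v = ∑ v ∈ Q, c v • S.p v := by
    refine Finset.sum_nbij' S.ν S.ν ?_ ?_ (fun a _ => S.νν a) (fun a _ => S.νν a) ?_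
    · intro a ha
      rw [Finset.mem_filter] at ha
      refine Finset.mem_filter.2 ⟨hZν a ha.1, ?_⟩
      rw [hto a]
      have := lt_of_le_of_ne (not_lt.1 ha.2) (hn0 a)
      linarith
    · intro a ha
      rw [Finset.mem_filter] at ha
      refine Finset.mem_filter.2 ⟨hZν a ha.1, ?_⟩
      rw [hto a]; linarith [ha.2]
    · intro a _
      rw [hc a, S.νp]; simp
  have e3 : ∑ v ∈ Q, c v • S.p v = 0 := by
    have := Finset.sum_filter_add_sum_filter_not Z (fun a => 0 < ht a) (fun v => c v • S.p v)
    rw [e2, ← e1, h0, ← two_smul ℝ] at this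
    exact (smul_eq_zero.1 this).resolve_left (by norm_num)
  have e4 := hG c Q (by omega) (by
    intro u hu v hv e
    rw [Finset.mem_filter] at hu hv
    have := hu.2
    rw [e, hto v] at this
    linarith [hv.2]) e3
  intro v
  by_contra hv
  have hvZ := hZ v hv
  rcases lt_or_gt_of_ne (hn0 v) with h | h
  · have := e4 (S.ν v) (Finset.mem_filter.2 ⟨hZν v hvZ, by rw [hto v]; linarith⟩)
    rw [hc v] at this
    exact hv (by linarith)
  · exact hv (e4 v (Finset.mem_filter.2 ⟨hvZ, h⟩))

lemma ksum {x : S.Rg} {k : ℕ} (hx : x ∈ S.PL ^ k) (hk : k < d) : ∑ v, S.tr (S.X v * x) • S.p v = 0 := by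
  ext i
  have := kill hx hk (LinearMap.proj i)
  rw [E_sum, Finset.sum_mul, map_sum] at this
  rw [Finset.sum_apply, Pi.zero_apply, ← this]
  refine Finset.sum_congr rfl fun v _ => ?_
  rw [smul_mul_assoc, map_smul]; simp [mul_comm]

lemma XQ_two {u v : ι} (h : u ≠ v) : S.XQ {u, v} = S.X u * S.X v := by
  rw [XQ_insert (by simpa using h)]; simp [XQ]

lemma XQ_one (v : ι) : S.XQ {v} = S.X v := by simp [XQ]

/-- vanishing on a star -/
lemma star {Q : Finset ι} {m : ℕ} (hc : Q.card + m + 2 = d) {y : ι → ℝ}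
    (h1 : S.tr (S.XQ Q * S.E y * S.om ^ (m + 1)) = 0) (h2 : S.tr (S.XQ Q * S.E y * S.E y * S.om ^ m) = 0)
    {h : S.Rg} (hh : h ∈ S.PL ^ (m + 1)) : S.tr (S.XQ Q * S.E y * h) = 0 := by
  by_cases hQ : S.Fc Q
  · rw [← BB_one] at h1
    rw [← BB_apply] at h2
    obtain ⟨f, hf⟩ := (HR m Q hc hQ y h1).2 h2
    have : S.XQ Q * S.E y = S.XQ Q * S.E (fun v => f (S.p v)) := by
      refine XQ_congr fun v hv => ?_
      obtain ⟨F, hF, hs⟩ := hv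
      rw [← hf F hF fun x hx => hs (Finset.mem_insert_of_mem hx), lin_p hF (hs (Finset.mem_insert_self _ _))]
    rw [this, mul_comm (S.XQ Q), mul_assoc]
    exact kill (mm (mXQ Q) hh) (by omega) f
  · rw [XQ_zero hQ]; simp

lemma star_nonpos {Q : Finset ι} {m : ℕ} (hc : Q.card + m + 2 = d) {y : ι → ℝ}
    (h1 : S.tr (S.XQ Q * S.E y * S.om ^ (m + 1)) = 0) : S.tr (S.XQ Q * S.E y * S.E y * S.om ^ m) ≤ 0 := by
  by_cases hQ : S.Fc Q
  · rw [← BB_one] at h1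
    exact (HR m Q hc hQ y h1).1
  · rw [XQ_zero hQ]; simp

variable (S)
/-- eigenvector data -/
structure EV (y t : ι → ℝ) : Prop where
  hd : 4 ≤ d
  od : S.Od y
  rel : ∀ u, ∀ h ∈ S.PL ^ (d - 2), S.tr (S.E y * S.sX u * h) = t u * S.tr (S.E y * S.om * h)
  N : S.tr (S.E y * S.E y * S.om ^ (d - 2)) < 0

/-- vertex coefficients -/
def be (y : ι → ℝ) (v : ι) : ℝ := S.tr (S.X v * S.E y * S.om ^ (d - 2))
variable {S}

lemma cast_mem {x : S.Rg} {k l : ℕ} (h : x ∈ S.PL ^ k) (e : k = l) : x ∈ S.PL ^ l := e ▸ h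

lemma om_succ {k l : ℕ} (h : l = k + 1) : S.om ^ l = S.om * S.om ^ k := by rw [h, pow_succ, mul_comm]

lemma be_od {y : ι → ℝ} (hd : 2 ≤ d) (hy : S.Od y) : S.Od (S.be y) := fun v => by
  have := tr_pe (S.X v * S.E y) (d - 2) (by rw [Nat.even_iff]; omega)
  have e : S.th (S.X v * S.E y) = -(S.X (S.ν v) * S.E y) := by rw [map_mul, th_X, th_od hy]; ring
  rw [e] at this
  simp only [be, this]; simp

lemma be_sum {y : ι → ℝ} (hd : 2 ≤ d) : ∑ v, S.be y v • S.p v = 0 := by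
  rw [← ksum (mm (mE y) (mom (d - 2))) (by omega) (S := S)]
  simp only [be, mul_assoc]

lemma exists_EV (hd : 4 ≤ d) (hE : S.ed.card + 4 * d = 2 * d * Fintype.card ι) (hG : S.Gp)
    (hn : 2 * d < Fintype.card ι) (x : ι) : ∃ y t, S.EV y t ∧ S.be y x ≠ 0 := by
  by_contra hcon
  push Not at hcon
  -- otherwise the functional vanishes on all odd functions
  have h1 : ∀ z, S.Od z → S.tr (S.X x * S.E z * S.om ^ (d - 2)) = 0 := by
    intro z hz
    let L : (ι → ℝ) →ₗ[ℝ] ℝ := S.BB ∅ (d - 2) (Pi.single x 1)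
    have hL : ∀ w, L w = S.tr (S.X x * S.E w * S.om ^ (d - 2)) := fun w => by
      simp only [L, BB_apply, XQ, Finset.prod_empty, one_mul, X]
    have : (⨆ χ, S.Eig χ) ≤ LinearMap.ker L := by
      refine iSup_le fun χ y hy => ?_
      rw [LinearMap.mem_ker, hL]
      by_cases hN : S.tr (S.E y * S.E y * S.om ^ (d - 2)) = 0
      · obtain ⟨f, hf⟩ := odd_lin (by omega) hy.1 hN
        rw [show y = fun v => f (S.p v) from funext hf, mul_comm (S.X x), mul_assoc]
        exact kill (mm (mX x) (mom _)) (by omega) f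
      · exact hcon y χ ⟨hd, hy.1, hy.2, lt_of_le_of_ne (odd_nonpos (by omega) hy.1) hN⟩
    have := this (odd_top hd hE hz)
    rwa [LinearMap.mem_ker, hL] at this
  have h2 : S.tr (S.E (S.av x) * S.E (S.av x) * S.om ^ (d - 2)) = 0 := by
    have a := h1 _ (av_od x)
    have b := be_od (S := S) (by omega : 2 ≤ d) (av_od x) x
    simp only [be] at b
    rw [a, neg_zero] at b
    rw [E_av, sub_mul, sub_mul, map_sub, ← E_av, a, b, sub_zero]
  obtain ⟨f, hf⟩ := odd_lin (by omega) (av_od x) h2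
  -- vertices other than the pair
  obtain ⟨ht, hti, hto⟩ := S.exists_ht
  have hn0 : ∀ v, ht v ≠ 0 := fun v h => by
    have := hto v
    rw [h, neg_zero, ← h] at this
    exact ν_ne v (hti this)
  set Z : Finset ι := (Finset.univ.erase x).erase (S.ν x) with hZ
  have hZm : ∀ v, v ∈ Z ↔ v ≠ S.ν x ∧ v ≠ x := fun v => by simp [hZ]
  have hZc : Z.card + 2 = Fintype.card ι := by
    rw [hZ, Finset.card_erase_of_mem (Finset.mem_erase.2 ⟨ν_ne x, Finset.mem_univ _⟩),
      Finset.card_erase_of_mem (Finset.mem_univ _), Finset.card_univ]; omega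
  have hh := half_card Z S.ν (fun v hv => by
    rw [hZm] at hv ⊢
    refine ⟨fun h => hv.2 (ν_inj h), fun h => hv.1 (by rw [← h, S.νν])⟩) (fun a _ => S.νν a) ht (fun a _ => hto a) (fun a _ => hn0 a)
  obtain ⟨Q, hQs, hQc⟩ := Finset.exists_subset_card_eq (s := Z.filter fun a => 0 < ht a) (n := d) (by
    have : Even (Fintype.card ι) := by rw [← hZc, hh]; exact ⟨_ + 1, by ring⟩
    obtain ⟨k, hk⟩ := this
    omega)
  have hli : LinearIndependent ℝ (fun v : Q => S.p v) := by
    rw [Fintype.linearIndependent_iff]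
    intro g hg i
    have := hG (fun v => if h : v ∈ Q then g ⟨v, h⟩ else 0) Q hQc.le (by
      intro u hu v hv e
      have hu := Finset.mem_filter.1 (hQs hu)
      have hv := Finset.mem_filter.1 (hQs hv)
      have := hu.2
      rw [e, hto v] at this
      linarith [hv.2]) (by
      rw [← hg, ← Finset.sum_coe_sort]
      refine Finset.sum_congr rfl fun v _ => by simp) i.1 i.2
    simpa using this
  have hf0 : f = 0 := by
    have hspan : Submodule.span ℝ (Set.range fun v : Q => S.p v) = ⊤ :=
      hli.span_eq_top_of_card_eq_finrank' (by simp [hQc])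
    refine LinearMap.ext_on hspan ?_
    rintro _ ⟨v, rfl⟩
    have hv := (hZm v.1).1 (Finset.mem_filter.1 (hQs v.2)).1
    have := hf v.1
    simp only [av, Pi.sub_apply, Pi.single_apply, hv.1, hv.2, if_false, sub_zero] at this
    rw [← this]; rfl
  have := hf x
  rw [hf0] at this
  simp [av, (ν_ne x).symm] at this

namespace EV
variable {y t : ι → ℝ} (H : S.EV y t)

lemma m1 (H : S.EV y t) (z : ι → ℝ) : S.E z * S.om ^ (d - 3) ∈ S.PL ^ (d - 2) :=
  cast_mem (mm (mE z) (mom (d - 3))) (by have := H.hd; omega)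

lemma m1X (H : S.EV y t) (z : ι) : S.X z * S.om ^ (d - 3) ∈ S.PL ^ (d - 2) := H.m1 _

lemma m2 (H : S.EV y t) (z w : ι → ℝ) : S.E z * S.E w * S.om ^ (d - 4) ∈ S.PL ^ (d - 2) :=
  cast_mem (mm (mm (mE z) (mE w)) (mom (d - 4))) (by have := H.hd; omega)

lemma yyo (H : S.EV y t) : S.E y * S.om * (S.E y * S.om ^ (d - 3)) = S.E y * S.E y * S.om ^ (d - 2) := by
  rw [om_succ (show d - 2 = d - 3 + 1 by have := H.hd; omega)]; ring

lemma tν (H : S.EV y t) (u : ι) : t (S.ν u) = t u := by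
  have a := H.rel u _ (H.m1 y)
  have b := H.rel (S.ν u) _ (H.m1 y)
  have : S.sX (S.ν u) = S.sX u := by rw [sX, sX, S.νν, add_comm]
  rw [this, a, H.yyo] at b
  exact (mul_right_cancel₀ H.N.ne b).symm

lemma exists_t (H : S.EV y t) : ∃ w, t w ≠ 0 := by
  by_contra h
  push Not at h
  have e : ∀ u, S.tr (S.E y * S.sX u * (S.E y * S.om ^ (d - 3))) = 0 := fun u => by
    rw [H.rel u _ (H.m1 y), h u, zero_mul]
  have e2 : ∑ u, S.sX u = (2 : ℝ) • S.om := by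
    simp only [sX, Finset.sum_add_distrib]
    rw [om_sum, two_smul]
    congr 1
    exact Fintype.sum_equiv ⟨S.ν, S.ν, S.νν, S.νν⟩ _ _ fun v => rfl
  have e3 : S.tr (S.E y * (∑ u, S.sX u) * (S.E y * S.om ^ (d - 3))) = 0 := by
    rw [Finset.mul_sum, Finset.sum_mul, map_sum]
    exact Finset.sum_eq_zero fun u _ => e u
  rw [e2, mul_smul_comm, smul_mul_assoc, map_smul, H.yyo, smul_eq_mul] at e3
  have := H.N
  linarith

lemma bod (H : S.EV y t) : S.Od (S.be y) := be_od (by have := H.hd; omega) H.od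

lemma Bf (H : S.EV y t) (u v : ι) : S.tr (S.X u * S.X v * S.E y * S.om ^ (d - 3)) =
    (t v * S.be y u + t u * S.be y v) / 2 := by
  have hd := H.hd
  have a : ∀ u v, S.tr (S.X u * S.X v * S.E y * S.om ^ (d - 3)) +
      S.tr (S.X u * S.X (S.ν v) * S.E y * S.om ^ (d - 3)) = t v * S.be y u := by
    intro u v
    have := H.rel v _ (H.m1X u)
    rw [be, ← map_add]
    have e1 : S.X u * S.X v * S.E y * S.om ^ (d - 3) + S.X u * S.X (S.ν v) * S.E y * S.om ^ (d - 3) =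
      S.E y * S.sX v * (S.X u * S.om ^ (d - 3)) := by rw [sX]; ring
    have e2 : S.X u * S.E y * S.om ^ (d - 2) = S.E y * S.om * (S.X u * S.om ^ (d - 3)) := by
      rw [om_succ (show d - 2 = d - 3 + 1 by omega)]; ring
    rw [e1, e2, this]
  have b := tr_po (S.X u * S.X (S.ν v) * S.E y) (d - 3) (by rw [Nat.odd_iff]; omega)
  simp only [map_mul, th_X, th_od H.od, S.νν] at b
  have c : -S.X (S.ν u) * -S.X v = S.X v * S.X (S.ν u) := by ring
  rw [c] at b
  have a1 := a u v
  have a2 := a v u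
  rw [mul_comm (S.X v) (S.X u)] at a2
  linarith

lemma adj (H : S.EV y t) {u v : ι} (h : t v * S.be y u + t u * S.be y v ≠ 0) : S.Fc {u, v} := by
  by_contra hF
  have := H.Bf u v
  rw [XX_zero hF] at this
  simp at this
  exact h (by linarith)

lemma star1 (H : S.EV y t) {v : ι} (h1 : t v = 0) (h2 : S.be y v = 0) {h : S.Rg} (hh : h ∈ S.PL ^ (d - 2)) :
    S.tr (S.X v * S.E y * h) = 0 := by
  have hd := H.hd
  rw [← XQ_one]
  refine star (m := d - 3) (by simp; omega) ?_ ?_ (cast_mem hh (by omega))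
  · rw [XQ_one]; rw [show d - 3 + 1 = d - 2 by omega]; exact h2
  · rw [XQ_one]
    have a := H.rel v _ (H.m1 y)
    rw [h1, zero_mul, sX] at a
    have b := tr_po (S.X v * S.E y * S.E y) (d - 3) (by rw [Nat.odd_iff]; omega)
    simp only [map_mul, th_X, th_od H.od] at b
    have e : S.E y * (S.X v + S.X (S.ν v)) * (S.E y * S.om ^ (d - 3)) =
      S.X v * S.E y * S.E y * S.om ^ (d - 3) - -S.X (S.ν v) * S.E y * S.E y * S.om ^ (d - 3) := by ring
    rw [e, map_sub] at a
    linarith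

lemma star2 (H : S.EV y t) {u v : ι} (huv : u ≠ v) (h1 : S.tr (S.X u * S.X v * S.E y * S.om ^ (d - 3)) = 0)
    (h2 : S.tr (S.X u * S.X v * S.E y * S.E y * S.om ^ (d - 4)) = 0) {h : S.Rg} (hh : h ∈ S.PL ^ (d - 3)) :
    S.tr (S.X u * S.X v * S.E y * h) = 0 := by
  have hd := H.hd
  rw [← XQ_two huv] at h1 h2 ⊢
  refine star (m := d - 4) (by rw [Finset.card_pair huv]; omega) ?_ h2 (cast_mem hh (by omega))
  rw [show d - 4 + 1 = d - 3 by omega]; exact h1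

lemma lam_np (H : S.EV y t) {u v : ι} (huv : u ≠ v) (h1 : S.tr (S.X u * S.X v * S.E y * S.om ^ (d - 3)) = 0) :
    S.tr (S.X u * S.X v * S.E y * S.E y * S.om ^ (d - 4)) ≤ 0 := by
  have hd := H.hd
  rw [← XQ_two huv] at h1 ⊢
  refine star_nonpos (m := d - 4) (by rw [Finset.card_pair huv]; omega) ?_
  rw [show d - 4 + 1 = d - 3 by omega]; exact h1

end EV
end CFan
end

noncomputable section
set_option linter.unusedVariables false
set_option linter.unusedSectionVars false
namespace CFan
variable {d : ℕ} {ι : Type} [Fintype ι] [DecidableEq ι] {S : CFan d ι}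

lemma XX_ν (v : ι) : S.X v * S.X (S.ν v) = 0 := XX_zero (not_Fc_ν v)

lemma aa_ss (v : ι) : S.E (S.av v) * S.E (S.av v) = S.sX v * S.sX v := by
  have := XX_ν v (S := S)
  rw [E_av, sX]; linear_combination (-4 : S.Rg) * this

lemma orth1 {t χ : ι → ℝ} (hne : χ ≠ t) {e x : ι → ℝ} (he : e ∈ S.Eig t) (hx : x ∈ S.Eig χ) (hd : 4 ≤ d)
    {g : S.Rg} (hg : g ∈ S.PL ^ (d - 3)) : S.tr (S.E e * S.E x * S.om * g) = 0 := by
  obtain ⟨v, hv⟩ := Function.ne_iff.1 hne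
  have a := he.2 v (S.E x * g) (cast_mem (mm (mE x) hg) (by omega))
  have b := hx.2 v (S.E e * g) (cast_mem (mm (mE e) hg) (by omega))
  rw [show S.E e * S.sX v * (S.E x * g) = S.E x * S.sX v * (S.E e * g) by ring, b,
    show S.E x * S.om * (S.E e * g) = S.E e * S.E x * S.om * g by ring,
    show S.E e * S.om * (S.E x * g) = S.E e * S.E x * S.om * g by ring] at a
  have : (χ v - t v) * S.tr (S.E e * S.E x * S.om * g) = 0 := by linarith
  exact (mul_eq_zero.1 this).resolve_left (sub_ne_zero.2 hv)

lemma orth {t : ι → ℝ} {e x : ι → ℝ} (he : e ∈ S.Eig t) (hx : x ∈ ⨆ χ : {χ // χ ≠ t}, S.Eig χ.1) (hd : 4 ≤ d)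
    {g : S.Rg} (hg : g ∈ S.PL ^ (d - 3)) : S.tr (S.E e * S.E x * S.om * g) = 0 := by
  refine Submodule.iSup_induction (motive := fun x => S.tr (S.E e * S.E x * S.om * g) = 0)
    (fun χ : {χ // χ ≠ t} => S.Eig χ.1) hx ?_ ?_ ?_
  · intro χ x hx
    exact orth1 χ.2 he hx hd hg
  · simp
  · intro x y hx hy
    rw [map_add, mul_add, add_mul, add_mul, map_add, hx, hy, add_zero]

lemma split (hd : 4 ≤ d) (hE : S.ed.card + 4 * d = 2 * d * Fintype.card ι) (t : ι → ℝ) (u : ι) :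
    ∃ e ∈ S.Eig t, ∃ x ∈ ⨆ χ : {χ // χ ≠ t}, S.Eig χ.1, S.av u = e + x := by
  have h : (⨆ χ, S.Eig χ) ≤ S.Eig t ⊔ ⨆ χ : {χ // χ ≠ t}, S.Eig χ.1 := by
    refine iSup_le fun χ => ?_
    by_cases hχ : χ = t
    · rw [hχ]; exact le_sup_left
    · exact le_sup_of_le_right (le_iSup (fun χ : {χ // χ ≠ t} => S.Eig χ.1) ⟨χ, hχ⟩)
  obtain ⟨e, he, x, hx, h⟩ := Submodule.mem_sup.1 (h (odd_top hd hE (av_od u)))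
  exact ⟨e, he, x, hx, h.symm⟩

namespace EV
variable {y t : ι → ℝ}

lemma mem (H : S.EV y t) : y ∈ S.Eig t := ⟨H.od, H.rel⟩

lemma a_y (H : S.EV y t) (u : ι) : S.tr (S.E (S.av u) * S.E y * S.om ^ (d - 2)) = 2 * S.be y u := by
  rw [E_av, sub_mul, sub_mul, map_sub]
  have := H.bod u
  simp only [be] at this ⊢
  rw [this]; ring

lemma no0_big (H : S.EV y t) (hE : S.ed.card + 4 * d = 2 * d * Fintype.card ι) (hd5 : 5 ≤ d) {u : ι} (hu : t u = 0) :
    S.be y u = 0 := by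
  have hd := H.hd
  obtain ⟨v, hv⟩ := H.exists_t
  obtain ⟨eu, heu, xu, hxu, hu1⟩ := split hd hE t u
  obtain ⟨ev, hev, xv, hxv, hv1⟩ := split hd hE t v
  have hm : ∀ a b : ι → ℝ, S.E a * S.E b * S.om ^ (d - 5) ∈ S.PL ^ (d - 3) := fun a b =>
    cast_mem (mm (mm (mE a) (mE b)) (mom (d - 5))) (by omega)
  have ow : S.om ^ (d - 4) = S.om * S.om ^ (d - 5) := om_succ (by omega)
  have O : ∀ {e x : ι → ℝ}, e ∈ S.Eig t → x ∈ (⨆ χ : {χ // χ ≠ t}, S.Eig χ.1) → ∀ a b,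
      S.tr (S.E e * S.E x * S.E a * S.E b * S.om ^ (d - 4)) = 0 := fun {e x} he hx a b => by
    rw [← orth he hx hd (hm a b), ow]; congr 1; ring
  have sq : ∀ e, e ∈ S.Eig t → ∀ v, S.tr (S.E e * S.E e * S.E (S.av v) * S.E (S.av v) * S.om ^ (d - 4)) =
      t v * t v * S.tr (S.E e * S.E e * S.om ^ (d - 2)) := by
    intro e he v
    have h1 := he.2 v (S.sX v * S.E e * S.om ^ (d - 4)) (cast_mem (mm (mm (msX v) (mE e)) (mom _)) (by omega))
    have h2 := he.2 v (S.om * S.E e * S.om ^ (d - 4)) (cast_mem (mm (mm (by rw [← pow_one S.om]; exact mom 1) (mE e)) (mom _)) (show 1 + 1 + (d - 4) = d - 2 by omega))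
    rw [show S.E e * S.E e * S.E (S.av v) * S.E (S.av v) * S.om ^ (d - 4) =
      S.E e * S.sX v * (S.sX v * S.E e * S.om ^ (d - 4)) by linear_combination (S.E e * S.E e * S.om ^ (d - 4)) * aa_ss v (S := S), h1,
      show S.E e * S.om * (S.sX v * S.E e * S.om ^ (d - 4)) = S.E e * S.sX v * (S.om * S.E e * S.om ^ (d - 4)) by ring, h2,
      om_succ (show d - 2 = d - 3 + 1 by omega), om_succ (show d - 3 = d - 4 + 1 by omega),
      show S.E e * S.om * (S.om * S.E e * S.om ^ (d - 4)) = S.E e * S.E e * (S.om * (S.om * S.om ^ (d - 4))) by ring]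
    ring
  have key : t v * t v * S.tr (S.E eu * S.E eu * S.om ^ (d - 2)) = 0 := by
    rw [← sq eu heu v]
    have e1 := O heu hxu (S.av v) (S.av v)
    have e2 := O heu hxv (S.av u) (S.av v)
    have e3 := O hev hxu (S.av u) (S.av v)
    have e4 := O hev hxv (S.av u) (S.av u)
    have e5 := sq ev hev u
    rw [hu, zero_mul, zero_mul] at e5
    have hu2 : S.E xu = S.E (S.av u) - S.E eu := by rw [hu1, map_add]; ring
    have hv2 : S.E xv = S.E (S.av v) - S.E ev := by rw [hv1, map_add]; ring
    rw [hu2] at e1 e3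
    rw [hv2] at e2 e4
    set a := S.E (S.av u)
    set b := S.E (S.av v)
    set e := S.E eu
    set f := S.E ev
    set o := S.om ^ (d - 4)
    have : e * e * b * b * o = -(e * (a - e) * b * b * o) + e * (b - f) * a * b * o - f * (a - e) * a * b * o + f * (b - f) * a * a * o + f * f * a * a * o := by ring
    rw [this]
    simp only [map_add, map_sub, map_neg, e1, e2, e3, e4, e5]; simp
  have k0 : S.tr (S.E eu * S.E eu * S.om ^ (d - 2)) = 0 := by
    rcases mul_eq_zero.1 key with h | h
    · exact absurd (mul_self_eq_zero.1 h) hv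
    · exact h
  obtain ⟨f, hf⟩ := odd_lin (by omega) heu.1 k0
  have := H.a_y u
  rw [hu1, map_add, add_mul, add_mul, map_add] at this
  have h1 : S.tr (S.E eu * S.E y * S.om ^ (d - 2)) = 0 := by
    rw [show eu = fun v => f (S.p v) from funext hf, mul_assoc]
    exact kill (mm (mE y) (mom _)) (by omega) f
  have h2 : S.tr (S.E xu * S.E y * S.om ^ (d - 2)) = 0 := by
    rw [← orth H.mem hxu hd (mom (d - 3)), om_succ (show d - 2 = d - 3 + 1 by omega)]
    congr 1; ring
  linarith

lemma ν_iff (x z : ι) : S.ν x = z ↔ x = S.ν z :=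
  ⟨fun h => by rw [← h, S.νν], fun h => by rw [h, S.νν]⟩

/-- counting argument in dimension four -/
lemma count (hd : 4 = d) (hE : S.ed.card + 4 * d = 2 * d * Fintype.card ι) (u : ι) (w : Fin 6 → ι)
    (hw : Function.Injective w) (hwν : ∀ i j, w i ≠ S.ν (w j)) (hu : ∀ i, u ≠ w i) (huν : ∀ i, u ≠ S.ν (w i))
    (h1 : ∀ i, S.Fc {u, w i}) (h2 : ∀ i, S.Fc {u, S.ν (w i)})
    (h3 : ∀ i j, i ≠ j → S.Fc {w i, w j} ∨ S.Fc {w i, S.ν (w j)}) : False := by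
  subst hd
  let z : Fin 6 → Fin 6 → ι := fun i j => if S.Fc {w i, w j} then w j else S.ν (w j)
  have hz : ∀ i j, i ≠ j → S.Fc {w i, z i j} := by
    intro i j hij
    simp only [z]
    split_ifs with h
    · exact h
    · exact (h3 i j hij).resolve_left h
  have hzz : ∀ i j, z i j = w j ∨ z i j = S.ν (w j) := by
    intro i j
    simp only [z]
    split_ifs with h <;> simp
  let K := {q : Fin 6 × Fin 6 // q.1 < q.2} ⊕ (Fin 6 × Bool)
  let a : K → ι := Sum.elim (fun q => w q.1.1) (fun q => u)
  let b : K → ι := Sum.elim (fun q => z q.1.1 q.1.2) (fun q => if q.2 then w q.1 else S.ν (w q.1))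
  let dl' : (Fin 4 → ℝ) → (Fin 4 → ℝ) →ₗ[ℝ] ℝ := fun x => dotProductBilin ℝ ℝ x
  let pr : Fin 6 → (Fin 6 → Fin 4 → ℝ) →ₗ[ℝ] (Fin 4 → ℝ) := fun i => LinearMap.proj i
  let φ : K → Module.Dual ℝ (Fin 6 → Fin 4 → ℝ) := Sum.elim
    (fun q => dl' (S.p (w q.1.1) - S.p (z q.1.1 q.1.2)) ∘ₗ (pr q.1.1 - pr q.1.2))
    (fun q => - dl' (S.p u - S.p (if q.2 then w q.1 else S.ν (w q.1))) ∘ₗ pr q.1)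
  have hφ : ∀ k, ∀ m : ι → Fin 4 → ℝ, (∀ v, m (S.ν v) = m v) →
      φ k (fun i => m (w i) - m u) = S.str m (a k) (b k) := by
    intro k m hm
    rcases k with q | q
    · have : m (z q.1.1 q.1.2) = m (w q.1.2) := by
        rcases hzz q.1.1 q.1.2 with h | h <;> rw [h]
        exact hm _
      simp only [φ, a, b, Sum.elim_inl, str, this, dl', pr]
      simp
      ring
    · have : m (if q.2 then w q.1 else S.ν (w q.1)) = m (w q.1) := by
        split_ifs
        · rfl
        · exact hm _
      simp only [φ, a, b, Sum.elim_inr, str, this, dl', pr]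
      simp
      ring
  have hab : ∀ k, a k ≠ b k := by
    rintro (q | q)
    · simp only [a, b, Sum.elim_inl]
      rcases hzz q.1.1 q.1.2 with h | h <;> rw [h]
      · exact fun h => q.2.ne (hw h)
      · exact hwν _ _
    · simp only [a, b, Sum.elim_inr]
      split_ifs
      · exact hu _
      · exact huν _
  have hF : ∀ k, S.Fc {a k, b k} := by
    rintro (q | q)
    · exact hz _ _ q.2.ne
    · simp only [a, b, Sum.elim_inr]
      split_ifs
      · exact h1 _
      · exact h2 _
  have hwu : ∀ i, w i ≠ u := fun i => (hu i).symm
  have hwu' : ∀ i, w i ≠ S.ν u := fun i h => huν i (by rw [h, S.νν])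
  obtain ⟨π, hπw, hπν, hπu, hπuν⟩ : ∃ π : ι → Option (Fin 6), (∀ i, π (w i) = some i) ∧ (∀ i, π (S.ν (w i)) = some i) ∧
      π u = none ∧ π (S.ν u) = none := by
    have hn1 : ¬ ∃ i, u = w i ∨ u = S.ν (w i) := by
      rintro ⟨i, h | h⟩
      · exact hu i h
      · exact huν i h
    have hn2 : ¬ ∃ i, S.ν u = w i ∨ S.ν u = S.ν (w i) := by
      rintro ⟨i, h | h⟩
      · exact hwu' i h.symm
      · exact hu i (ν_inj h)
    refine ⟨fun x => if h : ∃ i, x = w i ∨ x = S.ν (w i) then some h.choose else none, fun i => ?_, fun i => ?_,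
      dif_neg hn1, dif_neg hn2⟩
    · have h : ∃ j, w i = w j ∨ w i = S.ν (w j) := ⟨i, Or.inl rfl⟩
      simp only [dif_pos h]
      rcases h.choose_spec with h' | h'
      · exact congrArg some (hw h').symm
      · exact absurd h' (hwν _ _)
    · have h : ∃ j, S.ν (w i) = w j ∨ S.ν (w i) = S.ν (w j) := ⟨i, Or.inr rfl⟩
      simp only [dif_pos h]
      rcases h.choose_spec with h' | h'
      · exact absurd h'.symm (hwν _ _)
      · exact congrArg some (hw (ν_inj h')).symm
  have hπz : ∀ i j, π (z i j) = some j := by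
    intro i j
    rcases hzz i j with h | h <;> rw [h] <;> simp [hπw, hπν]
  have hπz' : ∀ i j, π (S.ν (z i j)) = some j := by
    intro i j
    rcases hzz i j with h | h <;> rw [h]
    · exact hπν j
    · rw [S.νν]; exact hπw j
  have horb : ∀ k l, k ≠ l → orb S (a l) (b l) (a k) (b k) = 0 := by
    have sep : ∀ k l, k ≠ l → ¬ (a k = a l ∧ b k = b l) ∧ ¬ (a k = b l ∧ b k = a l) ∧
        ¬ (a k = S.ν (a l) ∧ b k = S.ν (b l)) ∧ ¬ (a k = S.ν (b l) ∧ b k = S.ν (a l)) := by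
      intro k l hkl
      rcases k with ⟨⟨i, j⟩, hij⟩ | ⟨i, s⟩ <;> rcases l with ⟨⟨i', j'⟩, hij'⟩ | ⟨i', s'⟩
      · simp only [a, b, Sum.elim_inl]
        have hkl' : ¬ (i = i' ∧ j = j') := by
          rintro ⟨rfl, rfl⟩; exact hkl rfl
        have hx : ¬ (i = j' ∧ j = i') := by
          rintro ⟨rfl, rfl⟩; exact lt_asymm hij hij'
        refine ⟨fun h => hkl' ?_, fun h => hx ?_, fun h => hkl' ?_, fun h => hx ?_⟩ <;>
        · have e1 := congrArg π h.1
          have e2 := congrArg π h.2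
          simp only [hπw, hπν, hπz, hπz', Option.some.injEq] at e1 e2
          exact ⟨e1, e2⟩
      · simp only [a, b, Sum.elim_inl, Sum.elim_inr]
        refine ⟨fun h => ?_, fun h => ?_, fun h => ?_, fun h => ?_⟩ <;>
        · have e1 := congrArg π h.1
          have e2 := congrArg π h.2
          simp [hπw, hπν, hπz, hπz', hπu, hπuν] at e1 e2
      · simp only [a, b, Sum.elim_inl, Sum.elim_inr]
        refine ⟨fun h => ?_, fun h => ?_, fun h => ?_, fun h => ?_⟩ <;>
        · have e1 := congrArg π h.1
          have e2 := congrArg π h.2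
          simp [hπw, hπν, hπz, hπz', hπu, hπuν] at e1 e2
      · simp only [a, b, Sum.elim_inr]
        have key : ∀ s, u ≠ (if s = true then w i' else S.ν (w i')) := by
          intro s; split_ifs
          · exact hu _
          · exact huν _
        have key2 : ∀ s, u ≠ S.ν (if s = true then w i' else S.ν (w i')) := by
          intro s; split_ifs
          · exact huν _
          · rw [S.νν]; exact hu _
        refine ⟨fun h => ?_, fun h => key _ h.1, fun h => ν_ne u h.1.symm, fun h => key2 _ h.1⟩
        have e2 := h.2
        have e3 := congrArg π e2
        have : i = i' := by
          revert e3
          split_ifs <;> simp only [hπw, hπν, Option.some.injEq] <;> exact id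
        subst this
        revert e2
        rcases s with _ | _ <;> rcases s' with _ | _
        · exact fun _ => hkl rfl
        · simpa using (hwν i i).symm
        · simpa using hwν i i
        · exact fun _ => hkl rfl
    intro k l hkl
    obtain ⟨s1, s2, s3, s4⟩ := sep k l hkl
    rw [orb, if_neg s1, if_neg s2, if_neg s3, if_neg s4]; norm_num
  have horb1 : ∀ k, orb S (a k) (b k) (a k) (b k) = 1 := by
    intro k
    have e1 : ¬ (a k = b k ∧ b k = a k) := fun h => hab k h.1
    have e2 : ¬ (a k = S.ν (a k) ∧ b k = S.ν (b k)) := fun h => ν_ne _ h.1.symm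
    have e3 : ¬ (a k = S.ν (b k) ∧ b k = S.ν (a k)) := fun h => not_Fc_ν (a k) (h.2 ▸ hF k)
    rw [orb, if_pos ⟨rfl, rfl⟩, if_neg e1, if_neg e2, if_neg e3]; norm_num
  have hK : Fintype.card K = 27 := by
    simp only [K, Fintype.card_sum, Fintype.card_prod, Fintype.card_fin, Fintype.card_bool]
    have : Fintype.card {q : Fin 6 × Fin 6 // q.1 < q.2} = 15 := by
      rw [Fintype.card_subtype]; decide
    rw [this]
  have hnl : ¬ LinearIndependent ℝ φ := by
    intro h
    have := h.fintype_card_le_finrank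
    rw [hK, Subspace.dual_finrank_eq] at this
    simp [Module.finrank_pi_fintype] at this
  obtain ⟨g, hg, l, hl⟩ := Fintype.not_linearIndependent_iff.1 hnl
  obtain ⟨m, hm, hm2⟩ := resolve (by norm_num) hE (a l) (b l)
  have := congrArg (fun F : Module.Dual ℝ (Fin 6 → Fin 4 → ℝ) => F (fun i => m (w i) - m u)) hg
  simp only [LinearMap.sum_apply, LinearMap.smul_apply, smul_eq_mul, LinearMap.zero_apply] at this
  rw [Finset.sum_eq_single l] at this
  · rw [hφ l m hm, hm2 _ _ (hab l) (hF l), horb1] at this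
    exact hl (by linarith)
  · intro k _ hk
    rw [hφ k m hm, hm2 _ _ (hab k) (hF k), horb k l hk, mul_zero]
  · simp

end EV
end CFan
end

noncomputable section
set_option linter.unusedVariables false
set_option linter.unusedSectionVars false
namespace CFan
variable {d : ℕ} {ι : Type} [Fintype ι] [DecidableEq ι] {S : CFan d ι}

lemma Fc_nν {u v : ι} (h : ¬ S.Fc {u, v}) : ¬ S.Fc {S.ν u, S.ν v} := fun h' => h (by
  have := Fc_ν2 h'; rwa [S.νν, S.νν] at this)

lemma Fc_comm {u v : ι} (h : S.Fc {u, v}) : S.Fc {v, u} := by rwa [Finset.pair_comm]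

lemma even_half (U : Finset ι) (hU : ∀ v ∈ U, S.ν v ∈ U) : ∃ A ⊆ U, U.card = 2 * A.card ∧
    ∀ u ∈ A, ∀ v ∈ A, u ≠ S.ν v := by
  obtain ⟨ht, hti, hto⟩ := S.exists_ht
  have hn0 : ∀ v, ht v ≠ 0 := fun v h => by
    have := hto v
    rw [h, neg_zero, ← h] at this
    exact ν_ne v (hti this)
  refine ⟨_, Finset.filter_subset _ _, half_card U S.ν hU (fun a _ => S.νν a) ht (fun a _ => hto a) (fun a _ => hn0 a), ?_⟩
  intro u hu v hv e
  rw [Finset.mem_filter] at hu hv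
  have := hu.2
  rw [e, hto v] at this
  linarith [hv.2]

namespace EV
variable {y t : ι → ℝ}

lemma mX2 (H : S.EV y t) (z : ι) (w : ι → ℝ) : S.X z * S.E w * S.om ^ (d - 4) ∈ S.PL ^ (d - 2) := H.m2 _ _

lemma yss (H : S.EV y t) (v w : ι) {h : S.Rg} (hh : h ∈ S.PL ^ 1) :
    S.tr (S.E y * S.sX v * S.sX w * h * S.om ^ (d - 4)) = t v * t w * S.tr (S.E y * h * S.om ^ (d - 2)) := by
  have hd := H.hd
  have h1 := H.rel v (S.sX w * h * S.om ^ (d - 4)) (cast_mem (mm (mm (msX w) hh) (mom _)) (by omega))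
  have h2 := H.rel w (S.om * h * S.om ^ (d - 4)) (cast_mem (mm (mm (by rw [← pow_one S.om]; exact mom 1) hh) (mom _)) (show 1 + 1 + (d - 4) = d - 2 by omega))
  rw [show S.E y * S.sX v * S.sX w * h * S.om ^ (d - 4) = S.E y * S.sX v * (S.sX w * h * S.om ^ (d - 4)) by ring, h1,
    show S.E y * S.om * (S.sX w * h * S.om ^ (d - 4)) = S.E y * S.sX w * (S.om * h * S.om ^ (d - 4)) by ring, h2,
    om_succ (show d - 2 = d - 3 + 1 by omega), om_succ (show d - 3 = d - 4 + 1 by omega),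
    show S.E y * S.om * (S.om * h * S.om ^ (d - 4)) = S.E y * h * (S.om * (S.om * S.om ^ (d - 4))) by ring]
  ring

lemma near (H : S.EV y t) {v w : ι} (hv : t v ≠ 0) (hw : t w ≠ 0) : S.Fc {v, w} ∨ S.Fc {v, S.ν w} := by
  by_contra hc
  push Not at hc
  have := H.yss v w (mE y)
  have e1 := XX_zero hc.1
  have e2 := XX_zero hc.2
  have e3 := XX_zero (Fc_nν hc.1)
  have e4 := XX_zero (Fc_nν hc.2)
  rw [S.νν] at e4
  have e : S.sX v * S.sX w = 0 := by rw [sX, sX]; linear_combination e1 + e2 + e3 + e4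
  rw [mul_assoc (S.E y), e] at this
  simp at this
  rcases this with (h | h) | h
  · exact hv h
  · exact hw h
  · exact H.N.ne h

lemma no0 (H : S.EV y t) (hE : S.ed.card + 4 * d = 2 * d * Fintype.card ι) (hG : S.Gp) {u : ι} (hu : t u = 0) :
    S.be y u = 0 := by
  have hd := H.hd
  by_cases hd5 : 5 ≤ d
  · exact H.no0_big hE hd5 hu
  have hd4 : 4 = d := by omega
  by_contra hb
  let C : ι → ι → ℝ := fun v w => S.tr (S.X v * S.X u * S.E (S.av w) * S.E y * S.om ^ (d - 4))
  have ow : S.om ^ (d - 3) = S.om * S.om ^ (d - 4) := om_succ (by omega)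
  have odd : ∀ v w, C (S.ν v) w = - C v w := by
    intro v w
    have h1 := H.rel v _ (H.mX2 u (S.av w))
    have h2 : S.tr (S.E y * S.om * (S.X u * S.E (S.av w) * S.om ^ (d - 4))) = 0 := by
      have b1 := H.Bf u w
      have b2 := H.Bf u (S.ν w)
      rw [H.tν, hu, ow] at b2
      rw [hu, ow] at b1
      rw [show S.E y * S.om * (S.X u * S.E (S.av w) * S.om ^ (d - 4)) =
        S.X u * S.X w * S.E y * (S.om * S.om ^ (d - 4)) - S.X u * S.X (S.ν w) * S.E y * (S.om * S.om ^ (d - 4)) by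
          rw [E_av]; ring, map_sub, b1, b2]
      ring
    rw [h2, mul_zero, sX] at h1
    have : S.E y * (S.X v + S.X (S.ν v)) * (S.X u * S.E (S.av w) * S.om ^ (d - 4)) =
      S.X v * S.X u * S.E (S.av w) * S.E y * S.om ^ (d - 4) + S.X (S.ν v) * S.X u * S.E (S.av w) * S.E y * S.om ^ (d - 4) := by ring
    rw [this, map_add] at h1
    simp only [C]; linarith
  have ks : ∀ w, ∑ v, C v w • S.p v = 0 := by
    intro w
    rw [← ksum (S := S) (mm (mm (mm (mX u) (mE (S.av w))) (mE y)) (mom (d - 4))) (by omega)]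
    simp only [C, mul_assoc]
  have supp : ∀ v w, t v = 0 → C v w = 0 := by
    intro v w hv
    have hνu : C (S.ν u) w = 0 := by
      simp only [C]
      rw [mul_comm (S.X (S.ν u)), XX_ν]; simp
    by_cases h1 : v = u
    · have := odd u w
      rw [hνu] at this
      rw [h1]; linarith
    by_cases h2 : v = S.ν u
    · rw [h2, hνu]
    have b1 := H.Bf u v
    have b2 := H.Bf u (S.ν v)
    rw [H.tν] at b2
    rw [hu, hv] at b1 b2
    simp only [zero_mul, add_zero, zero_div] at b1 b2
    have n1 := H.lam_np (Ne.symm h1) b1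
    have n2 := H.lam_np (fun h => h2 (by rw [h, S.νν])) b2
    have r := H.rel v _ (H.mX2 u y)
    rw [hv, zero_mul, sX, show S.E y * (S.X v + S.X (S.ν v)) * (S.X u * S.E y * S.om ^ (d - 4)) =
      S.X u * S.X v * S.E y * S.E y * S.om ^ (d - 4) + S.X u * S.X (S.ν v) * S.E y * S.E y * S.om ^ (d - 4) by ring, map_add] at r
    have := H.star2 (Ne.symm h1) b1 (by linarith) (h := S.E (S.av w) * S.om ^ (d - 4)) (cast_mem (mm (mE _) (mom _)) (by omega))
    rw [← this]
    simp only [C]; congr 1; ring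
  have sym2 : ∀ v w, 2 * C v w = S.tr (S.X u * S.E (S.av v) * S.E (S.av w) * S.E y * S.om ^ (d - 4)) := by
    intro v w
    have := odd v w
    have e : S.X u * S.E (S.av v) * S.E (S.av w) * S.E y * S.om ^ (d - 4) =
      S.X v * S.X u * S.E (S.av w) * S.E y * S.om ^ (d - 4) - S.X (S.ν v) * S.X u * S.E (S.av w) * S.E y * S.om ^ (d - 4) := by
      rw [E_av v]; ring
    rw [e, map_sub]
    simp only [C] at this ⊢
    linarith
  have sym : ∀ v w, C v w = C w v := by
    intro v w
    have h1 := sym2 v w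
    have h2 := sym2 w v
    rw [show S.X u * S.E (S.av v) * S.E (S.av w) * S.E y * S.om ^ (d - 4) =
      S.X u * S.E (S.av w) * S.E (S.av v) * S.E y * S.om ^ (d - 4) by ring] at h1
    linarith
  have diag : ∀ w, C w w = t w * t w * S.be y u / 2 := by
    intro w
    have h1 := sym2 w w
    have h2 := H.yss w w (mX u)
    have e : S.X u * S.E (S.av w) * S.E (S.av w) * S.E y * S.om ^ (d - 4) = S.E y * S.sX w * S.sX w * S.X u * S.om ^ (d - 4) := by
      linear_combination (S.X u * S.E y * S.om ^ (d - 4)) * aa_ss w (S := S)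
    rw [e, h2] at h1
    simp only [be]
    rw [mul_comm (S.X u)]
    linarith
  have bb : ∀ v w, S.tr (S.X v * S.X u * S.X w * S.E y * S.om ^ (d - 4)) +
      S.tr (S.X v * S.X u * S.X (S.ν w) * S.E y * S.om ^ (d - 4)) = t w * t v * S.be y u / 2 := by
    intro v w
    have h1 := H.rel w _ (H.mX2 v (Pi.single u 1))
    have b1 := H.Bf u v
    rw [hu, ow] at b1
    rw [← map_add, show S.X v * S.X u * S.X w * S.E y * S.om ^ (d - 4) + S.X v * S.X u * S.X (S.ν w) * S.E y * S.om ^ (d - 4) =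
      S.E y * S.sX w * (S.X v * S.X u * S.om ^ (d - 4)) by rw [sX]; ring]
    change S.tr (S.E y * S.sX w * (S.X v * S.X u * S.om ^ (d - 4))) = t w * S.tr (S.E y * S.om * (S.X v * S.X u * S.om ^ (d - 4))) at h1
    rw [h1, show S.E y * S.om * (S.X v * S.X u * S.om ^ (d - 4)) = S.X u * S.X v * S.E y * (S.om * S.om ^ (d - 4)) by ring, b1]
    ring
  set U : Finset ι := Finset.univ.filter fun v => t v ≠ 0 with hU
  have hUm : ∀ v, v ∈ U ↔ t v ≠ 0 := fun v => by simp [hU]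
  have hUν : ∀ v ∈ U, S.ν v ∈ U := fun v hv => by rw [hUm] at hv ⊢; rwa [H.tν]
  have huU : u ∉ U := fun h => (hUm u).1 h hu
  have adju : ∀ v, t v ≠ 0 → S.Fc {u, v} := fun v hv => H.adj (by
    rw [hu, zero_mul, add_zero]; exact mul_ne_zero hv hb)
  obtain ⟨w0, hw0⟩ := H.exists_t
  have dne : ∀ w, t w ≠ 0 → C w w ≠ 0 := fun w hw => by
    rw [diag]; exact div_ne_zero (mul_ne_zero (mul_ne_zero hw hw) hb) (by norm_num)
  obtain ⟨A, hAU, hAc, hAν⟩ := even_half (S := S) U hUν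
  have hbig : 2 * d < U.card := by
    by_contra hle
    exact dne w0 hw0 (gp_odd hG (c := fun v => C v w0) (fun v => odd v w0) (ks w0) U
      (fun v hv => (hUm v).2 fun h => hv (supp v w0 h)) hUν (by omega) w0)
  by_cases hUc : U.card = 2 * d + 2
  · -- exactly d + 1 pairs
    set Z := (U.erase w0).erase (S.ν w0) with hZ
    have hZc : Z.card = 2 * d := by
      rw [hZ, Finset.card_erase_of_mem (Finset.mem_erase.2 ⟨ν_ne w0, hUν _ ((hUm _).2 hw0)⟩),
        Finset.card_erase_of_mem ((hUm _).2 hw0)]; omega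
    have prop : ∀ w v, C w0 w0 * C v w = C w0 w * C v w0 := by
      intro w v
      have := gp_odd hG (c := fun v => C w0 w0 * C v w - C w0 w * C v w0) (fun v => by
        simp only [odd]; ring) (by
        simp only [sub_smul, mul_smul, Finset.sum_sub_distrib, ← Finset.smul_sum, ks]; simp) Z (fun v hv => by
          rw [hZ, Finset.mem_erase, Finset.mem_erase]
          refine ⟨?_, ?_, ?_⟩
          · rintro rfl; apply hv; simp only [odd]; ring
          · rintro rfl; apply hv; ring
          · rw [hUm]; intro h; apply hv; simp [supp v _ h]) (fun v hv => by
          rw [hZ, Finset.mem_erase, Finset.mem_erase] at hv ⊢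
          exact ⟨fun h => hv.2.1 (ν_inj h), fun h => hv.1 (by rw [← h, S.νν]), hUν _ hv.2.2⟩) (by omega) v
      have h' : C w0 w0 * C v w - C w0 w * C v w0 = 0 := this
      linarith
    let q : ι → ℝ := fun v => C v w0 * t v * t w0 * S.be y u
    have csq : ∀ v, (C v w0) ^ 2 = (t w0 * t v * S.be y u / 2) ^ 2 := by
      intro v
      have := prop v v
      rw [diag, diag, sym w0 v] at this
      linear_combination -this
    have hq0 : ∀ v ∈ U, q v ≠ 0 := by
      intro v hv
      rw [hUm] at hv
      have : C v w0 ≠ 0 := by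
        intro h
        have := csq v
        rw [h] at this
        have h2 : t w0 * t v * S.be y u / 2 ≠ 0 := div_ne_zero (mul_ne_zero (mul_ne_zero hw0 hv) hb) (by norm_num)
        exact h2 (pow_eq_zero_iff (two_ne_zero) |>.1 (by linarith))
      exact mul_ne_zero (mul_ne_zero (mul_ne_zero this hv) hw0) hb
    have hL := half_card U S.ν hUν (fun a _ => S.νν a) q (fun a _ => by
      simp only [q, odd, H.tν]; ring) hq0
    set L := U.filter fun a => 0 < q a with hLdef
    have hLc : ∀ v ∈ L, C v w0 = t w0 * t v * S.be y u / 2 := by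
      intro v hv
      rw [Finset.mem_filter] at hv
      rcases sq_eq_sq_iff_eq_or_eq_neg.1 (csq v) with h | h
      · exact h
      · exfalso
        have := hv.2
        simp only [q, h] at this
        nlinarith [sq_nonneg (t w0 * t v * S.be y u)]
    have hLL : ∀ v ∈ L, ∀ w ∈ L, C v w = t v * t w * S.be y u / 2 := by
      intro v hv w hw
      have := prop w v
      rw [sym w0 w, hLc v hv, hLc w hw, diag] at this
      have h2 : t w0 * t w0 * S.be y u / 2 ≠ 0 := div_ne_zero (mul_ne_zero (mul_ne_zero hw0 hw0) hb) (by norm_num)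
      refine mul_left_cancel₀ h2 ?_
      rw [this]; ring
    have adjL : ∀ v ∈ L, ∀ w ∈ L, S.Fc {v, w} := by
      intro v hv w hw
      by_contra hF
      have h1 := hLL v hv w hw
      have h2 := bb v w
      simp only [C] at h1
      rw [E_av, show S.X v * S.X u * (S.X w - S.X (S.ν w)) * S.E y * S.om ^ (d - 4) =
        S.X v * S.X u * S.X w * S.E y * S.om ^ (d - 4) - S.X v * S.X u * S.X (S.ν w) * S.E y * S.om ^ (d - 4) by ring, map_sub] at h1
      have h3 : S.X v * S.X u * S.X w = 0 := by linear_combination S.X u * XX_zero hF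
      rw [h3] at h1 h2
      simp only [zero_mul, map_zero] at h1 h2
      have hv := (hUm v).1 (Finset.mem_filter.1 hv).1
      have hw := (hUm w).1 (Finset.mem_filter.1 hw).1
      have : t w * t v * S.be y u ≠ 0 := mul_ne_zero (mul_ne_zero hw hv) hb
      exact this (by linarith)
    have hLU : ∀ v ∈ L, t v ≠ 0 := fun v hv => (hUm v).1 (Finset.mem_filter.1 hv).1
    refine no_clique (by omega) hE (insert u L) (by
      rw [Finset.card_insert_of_notMem (fun h => hLU u h hu)]; omega) ?_
    intro a ha b hb' hab
    rw [Finset.mem_insert] at ha hb'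
    rcases ha with rfl | ha <;> rcases hb' with rfl | hb'
    · exact absurd rfl hab
    · exact adju b (hLU b hb')
    · exact Fc_comm (adju a (hLU a ha))
    · exact adjL a ha b hb'
  · obtain ⟨B, hBA, hBc⟩ := Finset.exists_subset_card_eq (s := A) (n := 6) (by omega)
    let eq := (Finset.equivFinOfCardEq hBc).symm
    have hBt : ∀ i, t (eq i).1 ≠ 0 := fun i => (hUm _).1 (hAU (hBA (eq i).2))
    refine count hd4 hE u (fun i => (eq i).1) (fun i j h => eq.injective (Subtype.ext h))
      (fun i j => hAν _ (hBA (eq i).2) _ (hBA (eq j).2)) (fun i h => hBt i (h ▸ hu)) (fun i h => hBt i (by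
        rw [← H.tν, ← h]; exact hu)) (fun i => adju _ (hBt i)) (fun i => adju _ (by rw [H.tν]; exact hBt i))
      (fun i j _ => H.near (hBt i) (hBt j))

end EV
end CFan
end

noncomputable section
set_option linter.unusedVariables false
set_option linter.unusedSectionVars false
namespace CFan
variable {d : ℕ} {ι : Type} [Fintype ι] [DecidableEq ι] {S : CFan d ι}

namespace EV
variable {y t : ι → ℝ}

lemma half_tau (H : S.EV y t) (hE : S.ed.card + 4 * d = 2 * d * Fintype.card ι) (hG : S.Gp) {x : ι} (hx : S.be y x ≠ 0) :
    ∃ τ : Finset ι, (∀ v, v ∈ τ ↔ 0 < S.be y v * t v) ∧ τ.card = d + 1 ∧ (∀ v, S.be y v = 0 → t v = 0) ∧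
      (Finset.univ.filter fun v => S.be y v ≠ 0).card = 2 * (d + 1) := by
  have hd := H.hd
  set τ : Finset ι := Finset.univ.filter fun v => 0 < S.be y v * t v with hτ
  have hτm : ∀ v, v ∈ τ ↔ 0 < S.be y v * t v := fun v => by simp [hτ]
  have hcl : ∀ u ∈ τ, ∀ v ∈ τ, u ≠ v → S.Fc {u, v} := by
    intro u hu v hv _
    rw [hτm] at hu hv
    refine H.adj fun h => ?_
    have hu' : t u ≠ 0 := by rintro h; rw [h] at hu; simp at hu
    have hv' : t v ≠ 0 := by rintro h; rw [h] at hv; simp at hv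
    have h1 : 0 < t u ^ 2 := by positivity
    have h2 : 0 < t v ^ 2 := by positivity
    have : t u * t v * (t v * S.be y u + t u * S.be y v) = t v ^ 2 * (S.be y u * t u) + t u ^ 2 * (S.be y v * t v) := by ring
    rw [h, mul_zero] at this
    have := mul_pos h2 hu
    have := mul_pos h1 hv
    linarith
  set Z : Finset ι := Finset.univ.filter fun v => S.be y v ≠ 0 with hZ
  have hZm : ∀ v, v ∈ Z ↔ S.be y v ≠ 0 := fun v => by simp [hZ]
  have hZν : ∀ v ∈ Z, S.ν v ∈ Z := fun v hv => by rw [hZm] at hv ⊢; rw [H.bod v]; simpa using hv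
  have hcard := half_card Z S.ν hZν (fun a _ => S.νν a) (fun v => S.be y v * t v) (fun a _ => by
    simp only [H.bod a, H.tν]; ring) (fun a ha => by
      rw [hZm] at ha
      exact mul_ne_zero ha fun h => ha (H.no0 hE hG h))
  have hZτ : Z.filter (fun a => 0 < S.be y a * t a) = τ := by
    ext a
    rw [Finset.mem_filter, hτm, hZm]
    refine ⟨fun h => h.2, fun h => ⟨fun h' => ?_, h⟩⟩
    rw [h'] at h; simp at h
  rw [hZτ] at hcard
  have h1 : ¬ τ.card ≤ d := fun h => hx (gp_odd hG H.bod (be_sum (by omega)) Z (fun v hv => (hZm v).2 hv) hZν (by omega) x)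
  have h2 : ¬ d + 2 ≤ τ.card := by
    intro h
    obtain ⟨Q, hQ, hc⟩ := Finset.exists_subset_card_eq h
    exact no_clique (by omega) hE Q hc fun u hu v hv => hcl u (hQ hu) v (hQ hv)
  have hc : τ.card = d + 1 := by omega
  refine ⟨τ, hτm, hc, ?_, by omega⟩
  intro v hv
  by_contra ht
  have hvτ : v ∉ τ := by rw [hτm, hv]; simp
  have had : ∀ u ∈ τ, S.Fc {u, v} := by
    intro u hu
    rw [hτm] at hu
    refine H.adj ?_
    rw [hv, mul_zero, add_zero]
    refine mul_ne_zero ht ?_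
    rintro h; rw [h] at hu; simp at hu
  refine no_clique (by omega) hE (insert v τ) (by rw [Finset.card_insert_of_notMem hvτ, hc]) ?_
  intro a ha b hb hab
  rw [Finset.mem_insert] at ha hb
  rcases ha with rfl | ha <;> rcases hb with rfl | hb
  · exact absurd rfl hab
  · exact Fc_comm (had b hb)
  · exact had a ha
  · exact hcl a ha b hb hab

lemma half_faces (H : S.EV y t) (hE : S.ed.card + 4 * d = 2 * d * Fintype.card ι) (hG : S.Gp) {x : ι} (hx : S.be y x ≠ 0) :
    ∃ τ : Finset ι, (∀ v, v ∈ τ ↔ 0 < S.be y v * t v) ∧ τ.card = d + 1 ∧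
      ∀ R ⊆ τ, R.card = d - 1 → S.Fc R := by
  have hd := H.hd
  obtain ⟨τ, hτm, hτc, hzero, hZc⟩ := H.half_tau hE hG hx
  refine ⟨τ, hτm, hτc, ?_⟩
  set Z : Finset ι := Finset.univ.filter fun v => S.be y v ≠ 0 with hZ
  have hZm : ∀ v, v ∈ Z ↔ S.be y v ≠ 0 := fun v => by simp [hZ]
  have hZν : ∀ v ∈ Z, S.ν v ∈ Z := fun v hv => by rw [hZm] at hv ⊢; rw [H.bod v]; simpa using hv
  set N := S.tr (S.E y * S.E y * S.om ^ (d - 2)) with hN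
  let D : ι → ι → ℝ := fun v u => S.tr (S.X v * S.E (S.av u) * S.E y * S.E y * S.om ^ (d - 4))
  have ow : S.om ^ (d - 3) = S.om * S.om ^ (d - 4) := om_succ (by omega)
  have odd : ∀ v u, D (S.ν v) u = - D v u := by
    intro v u
    have h1 := H.rel v _ (H.m2 (S.av u) y)
    have h2 : S.tr (S.E y * S.om * (S.E (S.av u) * S.E y * S.om ^ (d - 4))) = 0 := by
      have := tr_po (S.E (S.av u) * S.E y * S.E y) (d - 3) (by rw [Nat.odd_iff]; omega)
      simp only [map_mul, th_od H.od, th_od (av_od u)] at this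
      rw [show S.E y * S.om * (S.E (S.av u) * S.E y * S.om ^ (d - 4)) = S.E (S.av u) * S.E y * S.E y * (S.om * S.om ^ (d - 4)) by ring, ← ow]
      linarith
    rw [h2, mul_zero, sX, show S.E y * (S.X v + S.X (S.ν v)) * (S.E (S.av u) * S.E y * S.om ^ (d - 4)) =
      S.X v * S.E (S.av u) * S.E y * S.E y * S.om ^ (d - 4) + S.X (S.ν v) * S.E (S.av u) * S.E y * S.E y * S.om ^ (d - 4) by ring, map_add] at h1
    simp only [D]; linarith
  have ks : ∀ u, ∑ v, D v u • S.p v = 0 := by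
    intro u
    rw [← ksum (S := S) (mm (mm (mm (mE (S.av u)) (mE y)) (mE y)) (mom (d - 4))) (by omega)]
    simp only [D, mul_assoc]
  have supp : ∀ v u, S.be y v = 0 → D v u = 0 := by
    intro v u hv
    have := H.star1 (hzero v hv) hv (H.m2 (S.av u) y)
    rw [← this]; simp only [D]; congr 1; ring
  have sym2 : ∀ v u, 2 * D v u = S.tr (S.E (S.av v) * S.E (S.av u) * S.E y * S.E y * S.om ^ (d - 4)) := by
    intro v u
    have := odd v u
    rw [E_av v, sub_mul, sub_mul, sub_mul, sub_mul, map_sub]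
    simp only [D] at this ⊢
    linarith
  have sym : ∀ v u, D v u = D u v := by
    intro v u
    have h1 := sym2 v u
    have h2 := sym2 u v
    rw [mul_comm (S.E (S.av v))] at h1
    linarith
  have diag : ∀ u, D u u = t u * t u * N / 2 := by
    intro u
    have h1 := sym2 u u
    have h2 := H.yss u u (mE y)
    rw [show S.E (S.av u) * S.E (S.av u) * S.E y * S.E y * S.om ^ (d - 4) = S.E y * S.sX u * S.sX u * S.E y * S.om ^ (d - 4) by
      linear_combination (S.E y * S.E y * S.om ^ (d - 4)) * aa_ss u (S := S), h2] at h1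
    linarith
  have prop : ∀ u v, S.be y x * D v u = D x u * S.be y v := by
    intro u v
    have hxZ := (hZm x).2 hx
    have := gp_odd hG (c := fun v => S.be y x * D v u - D x u * S.be y v) (fun v => by
        simp only [odd, H.bod v]; ring) (by
        simp only [sub_smul, mul_smul, Finset.sum_sub_distrib, ← Finset.smul_sum, ks, be_sum (show 2 ≤ d by omega)]; simp)
        ((Z.erase x).erase (S.ν x)) (fun v hv => by
          rw [Finset.mem_erase, Finset.mem_erase]
          refine ⟨?_, ?_, ?_⟩
          · rintro rfl; apply hv; simp only [odd, H.bod x]; ring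
          · rintro rfl; apply hv; ring
          · rw [hZm]; intro h; apply hv; simp [supp v _ h, h]) (fun v hv => by
          rw [Finset.mem_erase, Finset.mem_erase] at hv ⊢
          exact ⟨fun h => hv.2.1 (ν_inj h), fun h => hv.1 (by rw [← h, S.νν]), hZν _ hv.2.2⟩) (by
          rw [Finset.card_erase_of_mem (Finset.mem_erase.2 ⟨ν_ne x, hZν _ hxZ⟩), Finset.card_erase_of_mem hxZ]; omega) v
    have h' : S.be y x * D v u - D x u * S.be y v = 0 := this
    linarith
  have prop2 : ∀ u v, S.be y x ^ 2 * D v u = D x x * S.be y u * S.be y v := by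
    intro u v
    have h1 := prop u v
    have h2 := prop x u
    rw [sym u x] at h2
    linear_combination S.be y x * h1 + S.be y v * h2
  have htx : t x ≠ 0 := fun h => hx (H.no0 hE hG h)
  have hK : D x x ≠ 0 := by
    rw [diag]; exact div_ne_zero (mul_ne_zero (mul_ne_zero htx htx) H.N.ne) (by norm_num)
  have hNne : N ≠ 0 := H.N.ne
  have prop3 : ∀ u ∈ τ, ∀ v ∈ τ, S.be y u * t v = S.be y v * t u := by
    intro u hu v hv
    have hu' := (hτm u).1 hu
    have hv' := (hτm v).1 hv
    have a1 := prop2 u u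
    have a2 := prop2 v v
    rw [diag] at a1 a2
    have : (S.be y u * t v) ^ 2 = (S.be y v * t u) ^ 2 := by
      refine mul_left_cancel₀ hK ?_
      linear_combination t u ^ 2 * a2 - t v ^ 2 * a1
    rcases sq_eq_sq_iff_eq_or_eq_neg.1 this with h | h
    · exact h
    · exfalso
      have := mul_pos hu' hv'
      have e : S.be y u * t u * (S.be y v * t v) = - (S.be y v * t u) ^ 2 := by
        linear_combination (t u * S.be y v) * h
      nlinarith [sq_nonneg (S.be y v * t u)]
  have hDD : ∀ u ∈ τ, ∀ v ∈ τ, D u v = t u * t v * N / 2 := by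
    intro u hu v hv
    have hu' := (hτm u).1 hu
    have a1 := prop2 v u
    have a2 := prop2 u u
    rw [diag] at a2
    have a3 := prop3 u hu v hv
    have h0 : S.be y x ^ 2 * (S.be y u * t u) ≠ 0 := mul_ne_zero (pow_ne_zero _ hx) hu'.ne'
    refine mul_left_cancel₀ h0 ?_
    linear_combination (S.be y u * t u) * a1 - (S.be y v * t u) * a2 - (S.be y x ^ 2 * t u ^ 2 * N / 2) * a3
  have van : ∀ u ∈ τ, ∀ v ∈ τ, u ≠ v → ∀ h ∈ S.PL ^ (d - 3), S.tr (S.X u * S.X (S.ν v) * S.E y * h) = 0 := by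
    intro u hu v hv huv h hh
    have hu' := (hτm u).1 hu
    have hv' := (hτm v).1 hv
    have hne : u ≠ S.ν v := by
      rintro rfl
      rw [H.bod v, H.tν] at hu'
      linarith
    refine H.star2 hne ?_ ?_ hh
    · rw [H.Bf, H.tν, H.bod v]
      have := prop3 u hu v hv
      linarith
    · have h1 := hDD u hu v hv
      have h2 := H.rel v _ (H.mX2 u y)
      have h3 := H.rel u _ (H.m1 y)
      rw [H.yyo, ← hN] at h3
      have h4 := tr_po (S.X u * S.E y * S.E y) (d - 3) (by rw [Nat.odd_iff]; omega)
      simp only [map_mul, th_X, th_od H.od] at h4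
      rw [show S.E y * S.sX u * (S.E y * S.om ^ (d - 3)) = S.X u * S.E y * S.E y * S.om ^ (d - 3) -
        -S.X (S.ν u) * S.E y * S.E y * S.om ^ (d - 3) by rw [sX]; ring, map_sub] at h3
      rw [show S.E y * S.om * (S.X u * S.E y * S.om ^ (d - 4)) = S.X u * S.E y * S.E y * (S.om * S.om ^ (d - 4)) by ring, ← ow,
        show S.E y * S.sX v * (S.X u * S.E y * S.om ^ (d - 4)) = S.X u * S.X v * S.E y * S.E y * S.om ^ (d - 4) +
          S.X u * S.X (S.ν v) * S.E y * S.E y * S.om ^ (d - 4) by rw [sX]; ring, map_add] at h2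
      simp only [D] at h1
      rw [E_av, show S.X u * (S.X v - S.X (S.ν v)) * S.E y * S.E y * S.om ^ (d - 4) = S.X u * S.X v * S.E y * S.E y * S.om ^ (d - 4) -
          S.X u * S.X (S.ν v) * S.E y * S.E y * S.om ^ (d - 4) by ring, map_sub] at h1
      have h5 : S.tr (S.X u * S.E y * S.E y * S.om ^ (d - 3)) = t u * N / 2 := by linarith
      rw [h5] at h2
      linarith
  have step : ∀ u ∈ τ, ∀ v ∈ τ, u ≠ v → ∀ h ∈ S.PL ^ (d - 3),
      S.tr (S.X u * S.X v * S.E y * h) = t v * S.tr (S.X u * S.E y * S.om * h) := by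
    intro u hu v hv huv h hh
    have h1 := van u hu v hv huv h hh
    have h2 := H.rel v (S.X u * h) (cast_mem (mm (mX u) hh) (by omega))
    rw [show S.E y * S.sX v * (S.X u * h) = S.X u * S.X v * S.E y * h + S.X u * S.X (S.ν v) * S.E y * h by rw [sX]; ring,
      map_add, h1, add_zero] at h2
    rw [h2]; congr 2; ring
  have main : ∀ u ∈ τ, ∀ Q : Finset ι, Q ⊆ τ → u ∉ Q → ∀ k, Q.card + k + 2 = d →
      S.tr (S.X u * S.XQ Q * S.E y * S.om ^ k) = (∏ v ∈ Q, t v) * S.be y u := by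
    intro u hu Q
    induction Q using Finset.induction_on with
    | empty =>
      intro _ _ k hk
      rw [Finset.card_empty] at hk
      have : k = d - 2 := by omega
      subst this
      simp [XQ, be]
    | insert v Q hv ih =>
      intro hs hu2 k hk
      rw [Finset.card_insert_of_notMem hv] at hk
      rw [Finset.mem_insert, not_or] at hu2
      have h1 := step u hu v (hs (Finset.mem_insert_self _ _)) hu2.1 (S.XQ Q * S.om ^ k) (cast_mem (mm (mXQ Q) (mom k)) (by omega))
      have h2 := ih (fun a ha => hs (Finset.mem_insert_of_mem ha)) hu2.2 (k + 1) (by omega)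
      rw [XQ_insert hv, Finset.prod_insert hv, show S.X u * (S.X v * S.XQ Q) * S.E y * S.om ^ k =
        S.X u * S.X v * S.E y * (S.XQ Q * S.om ^ k) by ring, h1,
        show S.X u * S.E y * S.om * (S.XQ Q * S.om ^ k) = S.X u * S.XQ Q * S.E y * S.om ^ (k + 1) by ring, h2]
      ring
  intro R hR hRc
  obtain ⟨u, hu⟩ := Finset.card_pos.1 (by omega : 0 < R.card)
  by_contra hF
  have h1 := main u (hR hu) (R.erase u) (fun a ha => hR (Finset.mem_of_mem_erase ha)) (Finset.notMem_erase _ _) 0 (by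
    rw [Finset.card_erase_of_mem hu]; omega)
  rw [← XQ_insert (Finset.notMem_erase _ _), Finset.insert_erase hu, XQ_zero hF] at h1
  simp only [zero_mul, map_zero] at h1
  refine absurd h1.symm (mul_ne_zero (Finset.prod_ne_zero_iff.2 fun v hv => ?_) ?_)
  · have := (hτm v).1 (hR (Finset.mem_of_mem_erase hv))
    intro h; rw [h] at this; simp at this
  · have := (hτm u).1 (hR hu)
    intro h; rw [h] at this; simp at this

end EV

lemma exists_tau (hd : 4 ≤ d) (hE : S.ed.card + 4 * d = 2 * d * Fintype.card ι) (hG : S.Gp)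
    (hn : 2 * d < Fintype.card ι) (x : ι) : ∃ τ : Finset ι, x ∈ τ ∧ τ.card = d + 1 ∧ ∀ R ⊆ τ, R.card = d - 1 → S.Fc R := by
  obtain ⟨y, t, H, hx⟩ := exists_EV hd hE hG hn x
  obtain ⟨τ, h1, h2, h3⟩ := H.half_faces hE hG hx
  have htx : t x ≠ 0 := fun h => hx (H.no0 hE hG h)
  rcases lt_or_gt_of_ne (mul_ne_zero hx htx) with h | h
  · refine ⟨τ.image S.ν, Finset.mem_image.2 ⟨S.ν x, (h1 _).2 ?_, S.νν x⟩, by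
      rw [Finset.card_image_of_injective _ (fun a b h => ν_inj h), h2], ?_⟩
    · rw [H.bod x, H.tν]; linarith
    · intro R hR hc
      have := Fc_ν (h3 (R.image S.ν) (fun a ha => by
        obtain ⟨b, hb, rfl⟩ := Finset.mem_image.1 ha
        obtain ⟨c, hc, rfl⟩ := Finset.mem_image.1 (hR hb)
        rwa [S.νν]) (by rw [Finset.card_image_of_injective _ (fun a b h => ν_inj h), hc]))
      rwa [image_νν] at this
  · exact ⟨τ, (h1 x).2 h, h2, h3⟩

end CFan
end

noncomputable section
set_option linter.unusedVariables false
set_option linter.unusedSectionVars false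
namespace CFan
variable {d : ℕ} {ι : Type} [Fintype ι] [DecidableEq ι] {S : CFan d ι}

/-- expansions in a general position `d`-set -/
lemma gp_fun (hG : S.Gp) (σ : Finset ι) (hc : σ.card = d) (hν : ∀ u ∈ σ, ∀ v ∈ σ, u ≠ S.ν v) :
    ∃ f : (Fin d → ℝ) →ₗ[ℝ] ℝ, (∀ v ∈ σ, f (S.p v) = 1) ∧ ∀ z, ∃ c : ι → ℝ, z = ∑ v ∈ σ, c v • S.p v := by
  have hli : LinearIndependent ℝ (fun v : σ => S.p v) := by
    rw [Fintype.linearIndependent_iff]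
    intro g hg i
    have := hG (fun v => if h : v ∈ σ then g ⟨v, h⟩ else 0) σ hc.le hν (by
      rw [← hg, ← Finset.sum_coe_sort]
      refine Finset.sum_congr rfl fun v _ => by simp) i.1 i.2
    simpa using this
  have hspan : Submodule.span ℝ (Set.range fun v : σ => S.p v) = ⊤ :=
    hli.span_eq_top_of_card_eq_finrank' (by simp [hc])
  let b := Module.Basis.mk hli hspan.ge
  refine ⟨b.constr ℝ (fun _ => (1 : ℝ)), fun v hv => ?_, fun z => ?_⟩
  · have := b.constr_basis ℝ (fun _ => (1 : ℝ)) ⟨v, hv⟩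
    rwa [Module.Basis.mk_apply] at this
  · refine ⟨fun v => if h : v ∈ σ then b.repr z ⟨v, h⟩ else 0, ?_⟩
    conv_lhs => rw [← b.sum_repr z]
    refine Eq.trans ?_ (Finset.sum_coe_sort σ (fun v => (if h : v ∈ σ then b.repr z ⟨v, h⟩ else 0) • S.p v))
    refine Finset.sum_congr rfl fun v _ => by simp [b]

variable (S)
/-- all ridges of `σ` are faces -/
def Rdg (σ : Finset ι) : Prop := σ.card = d ∧ ∀ R ⊆ σ, R.card = d - 1 → S.Fc R
variable {S}

lemma Rdg.pair {σ : Finset ι} (hd : 4 ≤ d) (h : S.Rdg σ) {u v : ι} (hu : u ∈ σ) (hv : v ∈ σ) : S.Fc {u, v} := by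
  obtain ⟨R, h1, h2, h3⟩ := Finset.exists_subsuperset_card_eq (s := {u, v}) (t := σ) (n := d - 1) (by
    intro a ha; simp at ha; rcases ha with rfl | rfl <;> assumption)
    (by have := Finset.card_le_two (a := u) (b := v); omega) (by rw [h.1]; omega)
  exact (h.2 R h2 h3).mono h1

lemma Rdg.anti {σ : Finset ι} (hd : 4 ≤ d) (h : S.Rdg σ) : ∀ u ∈ σ, ∀ v ∈ σ, u ≠ S.ν v := by
  intro u hu v hv e
  have := h.pair hd hv hu
  rw [e] at this
  exact not_Fc_ν v this

lemma Rdg.slice {σ : Finset ι} (hd : 4 ≤ d) (h : S.Rdg σ) (hm : σ ∉ S.fac) {f : (Fin d → ℝ) →ₗ[ℝ] ℝ}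
    (hf : ∀ v ∈ σ, f (S.p v) = 1) {c : ι → ℝ} {z : Fin d → ℝ} (hz : z = ∑ v ∈ σ, c v • S.p v) (h1 : f z = 1)
    (h2 : ∀ F ∈ S.fac, S.ff F z ≤ 1) : (∀ v ∈ σ, 0 ≤ c v) ∧ ∑ v ∈ σ, c v = 1 := by
  have hs : ∑ v ∈ σ, c v = 1 := by
    rw [← h1, hz, map_sum]
    refine Finset.sum_congr rfl fun v hv => by rw [map_smul, hf v hv]; simp
  refine ⟨fun w hw => ?_, hs⟩
  by_contra hneg
  push Not at hneg
  obtain ⟨F, hF, hs2⟩ := h.2 (σ.erase w) (Finset.erase_subset _ _) (by rw [Finset.card_erase_of_mem hw, h.1])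
  have hwF : w ∉ F := by
    intro hwF
    have : σ ⊆ F := fun a ha => by
      by_cases e : a = w
      · rwa [e]
      · exact hs2 (Finset.mem_erase.2 ⟨e, ha⟩)
    have := Finset.eq_of_subset_of_card_le this (by rw [h.1, S.fac_card F hF])
    exact hm (this ▸ hF)
  have h3 := h2 F hF
  rw [hz, map_sum, ← Finset.add_sum_erase _ _ hw] at h3
  rw [← Finset.add_sum_erase _ _ hw] at hs
  have e : ∑ x ∈ σ.erase w, S.ff F (c x • S.p x) = ∑ x ∈ σ.erase w, c x :=
    Finset.sum_congr rfl fun v hv => by rw [map_smul, ff_p hF (hs2 hv)]; simp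
  rw [e, map_smul, smul_eq_mul] at h3
  have := ff_lt hF hwF
  nlinarith

lemma fac_of_le {σ : Finset ι} (hc : σ.card = d) (f : (Fin d → ℝ) →ₗ[ℝ] ℝ) (hf : ∀ v ∈ σ, f (S.p v) = 1)
    (hle : ∀ v, f (S.p v) ≤ 1) : σ ∈ S.fac := by
  obtain ⟨F, hF, hco⟩ := S.complete (∑ v ∈ σ, S.p v)
  have h1 : f (∑ v ∈ σ, S.p v) = σ.card := by
    rw [map_sum, Finset.sum_congr rfl hf]; simp
  have h2 : f (∑ v ∈ σ, S.p v) ≤ S.ff F (∑ v ∈ σ, S.p v) := by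
    rw [expand hF f, expand hF (S.ff F)]
    refine Finset.sum_le_sum fun v hv => ?_
    rw [ff_p hF hv]
    exact mul_le_mul_of_nonneg_left (hle v) (hco v)
  have h3 : ∀ v ∈ σ, S.ff F (S.p v) = 1 := by
    by_contra hc
    push Not at hc
    obtain ⟨v, hv, hne⟩ := hc
    have : ∑ v ∈ σ, S.ff F (S.p v) < ∑ v ∈ σ, 1 :=
      Finset.sum_lt_sum (fun v _ => ff_le hF v) ⟨v, hv, lt_of_le_of_ne (ff_le hF v) hne⟩
    simp only [Finset.sum_const, nsmul_eq_mul, mul_one] at this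
    rw [← map_sum] at this
    linarith
  have := Finset.eq_of_subset_of_card_le (fun v hv => mem_of_ff hF (h3 v hv) : σ ⊆ F) (by rw [hc, S.fac_card F hF])
  rwa [this]

/-- existence of a vertex with a simplicial star boundary -/
theorem exists_star (hd : 4 ≤ d) (hE : S.ed.card + 4 * d = 2 * d * Fintype.card ι) (hG : S.Gp)
    (hn : 2 * d < Fintype.card ι) :
    ∃ (x : ι) (τ : Finset ι), x ∈ τ ∧ τ.card = d + 1 ∧ ∀ w ∈ τ, w ≠ x → τ.erase w ∈ S.fac := by
  have hT := exists_tau hd hE hG hn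
  have hfun : ∀ σ : Finset ι, ∃ f : (Fin d → ℝ) →ₗ[ℝ] ℝ, S.Rdg σ → (∀ v ∈ σ, f (S.p v) = 1) ∧
      ∀ z, ∃ c : ι → ℝ, z = ∑ v ∈ σ, c v • S.p v := by
    intro σ
    by_cases h : S.Rdg σ
    · obtain ⟨f, hf⟩ := gp_fun hG σ h.1 (h.anti hd)
      exact ⟨f, fun _ => hf⟩
    · exact ⟨0, fun h' => absurd h' h⟩
  choose fσ hfσ using hfun
  have hsub : ∀ τ : Finset ι, τ.card = d + 1 → (∀ R ⊆ τ, R.card = d - 1 → S.Fc R) → ∀ w ∈ τ, S.Rdg (τ.erase w) := by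
    intro τ hc hR w hw
    exact ⟨by rw [Finset.card_erase_of_mem hw, hc]; omega, fun R h1 h2 => hR R (h1.trans (Finset.erase_subset _ _)) h2⟩
  let V : Finset ι → Finset ι := fun σ => Finset.univ.filter fun v => 1 < fσ σ (S.p v)
  have hVm : ∀ σ v, v ∈ V σ ↔ 1 < fσ σ (S.p v) := fun σ v => by simp [V]
  let M : Finset (Finset ι) := Finset.univ.filter fun σ => S.Rdg σ ∧ σ ∉ S.fac
  by_cases hM : M.Nonempty
  · obtain ⟨σ, hσ, hmin⟩ := Finset.exists_min_image M (fun σ => (V σ).card) hM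
    obtain ⟨hσr, hσm⟩ : S.Rdg σ ∧ σ ∉ S.fac := by simpa [M] using hσ
    have hmin' : ∀ ρ, S.Rdg ρ → ρ ∉ S.fac → (V σ).card ≤ (V ρ).card := fun ρ h1 h2 => hmin ρ (by simp [M, h1, h2])
    obtain ⟨hf, hex⟩ := hfσ σ hσr
    have hVne : (V σ).Nonempty := by
      by_contra h
      rw [Finset.not_nonempty_iff_eq_empty] at h
      refine hσm (fac_of_le hσr.1 (fσ σ) hf fun v => ?_)
      by_contra hv
      push Not at hv
      have := (hVm σ v).2 hv
      rw [h] at this; simp at this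
    obtain ⟨x, hx⟩ := hVne
    have hx1 := (hVm σ x).1 hx
    have hxσ : x ∉ σ := fun h => by rw [hf x h] at hx1; linarith
    obtain ⟨τ, hxτ, hτc, hτR⟩ := hT x
    have hpair : ∀ w ∈ τ, S.Fc {x, w} := by
      intro w hw
      obtain ⟨R, h1, h2, h3⟩ := Finset.exists_subsuperset_card_eq (s := {x, w}) (t := τ) (n := d - 1) (by
        intro a ha; simp at ha; rcases ha with rfl | rfl <;> assumption)
        (by have := Finset.card_le_two (a := x) (b := w); omega) (by omega)
      exact (hτR R h2 h3).mono h1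
    -- edges do not cross the hyperplane
    have hge : ∀ w ∈ τ, 1 ≤ fσ σ (S.p w) := by
      intro w hw
      by_contra hlt
      push Not at hlt
      obtain ⟨F, hF, hs⟩ := hpair w hw
      have hxF : x ∈ F := hs (by simp)
      have hwF : w ∈ F := hs (by simp)
      have hxw : x ≠ w := by rintro rfl; linarith
      set A := fσ σ (S.p x) with hA
      set B := fσ σ (S.p w) with hB
      set z : Fin d → ℝ := ((1 - B) / (A - B)) • S.p x + ((A - 1) / (A - B)) • S.p w with hz
      have hAB : 0 < A - B := by linarith
      have l1 : 0 < (1 - B) / (A - B) := div_pos (by linarith) hAB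
      have l2 : 0 < (A - 1) / (A - B) := div_pos (by linarith) hAB
      have l3 : (1 - B) / (A - B) + (A - 1) / (A - B) = 1 := by field_simp; ring
      have z1 : fσ σ z = 1 := by
        rw [hz, map_add, map_smul, map_smul, ← hA, ← hB, smul_eq_mul, smul_eq_mul]; field_simp; ring
      have z2 : ∀ G ∈ S.fac, S.ff G z ≤ 1 := by
        intro G hG'
        rw [hz, map_add, map_smul, map_smul, smul_eq_mul, smul_eq_mul]
        have := ff_le hG' x
        have := ff_le hG' w
        nlinarith
      obtain ⟨c, hc⟩ := hex z
      obtain ⟨c0, c1⟩ := hσr.slice hd hσm hf hc z1 z2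
      have zF : S.ff F z = 1 := by
        rw [hz, map_add, map_smul, map_smul, ff_p hF hxF, ff_p hF hwF]; simpa using l3
      have hcF : ∀ v ∈ σ, v ∉ F → c v = 0 := by
        intro v hv hvF
        by_contra hne
        have hpos : 0 < c v := lt_of_le_of_ne (c0 v hv) (Ne.symm hne)
        have : S.ff F z < ∑ v ∈ σ, c v := by
          rw [hc, map_sum]
          refine Finset.sum_lt_sum (fun v hv => ?_) ⟨v, hv, ?_⟩
          · rw [map_smul, smul_eq_mul]
            have := mul_le_mul_of_nonneg_left (ff_le hF v) (c0 v hv)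
            linarith
          · rw [map_smul, smul_eq_mul]
            have := mul_lt_mul_of_pos_left (ff_lt hF hvF) hpos
            linarith
        linarith
      have e1 : S.co F x z = (1 - B) / (A - B) := by
        rw [hz, map_add, map_smul, map_smul, S.co_eq F hF x hxF x hxF, S.co_eq F hF x hxF w hwF]
        simp [hxw]
      have e2 : S.co F x z = 0 := by
        rw [hc, map_sum]
        refine Finset.sum_eq_zero fun v hv => ?_
        by_cases hvF : v ∈ F
        · rw [map_smul, S.co_eq F hF x hxF v hvF, if_neg (by rintro rfl; exact hxσ hv)]; simp
        · rw [hcF v hv hvF]; simp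
      linarith
    refine ⟨x, τ, hxτ, hτc, fun w hw hwx => ?_⟩
    by_contra hρm
    have hρ := hsub τ hτc hτR w hw
    set ρ := τ.erase w with hρdef
    obtain ⟨gf, gex⟩ := hfσ ρ hρ
    have hxρ : x ∈ ρ := Finset.mem_erase.2 ⟨Ne.symm hwx, hxτ⟩
    have hlt : (V ρ).card < (V σ).card := by
      refine Finset.card_lt_card (Finset.ssubset_iff_of_subset ?_ |>.2 ⟨x, hx, ?_⟩)
      · intro v hv
        rw [hVm] at hv ⊢
        set a := fσ ρ (S.p v) with ha
        have z1 : fσ ρ (a⁻¹ • S.p v) = 1 := by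
          rw [map_smul, smul_eq_mul, ← ha, inv_mul_cancel₀ (by linarith)]
        have ai : a⁻¹ ≤ 1 := inv_le_one_of_one_le₀ hv.le
        have ap : 0 < a⁻¹ := inv_pos.2 (by linarith)
        have z2 : ∀ G ∈ S.fac, S.ff G (a⁻¹ • S.p v) ≤ 1 := by
          intro G hG'
          rw [map_smul, smul_eq_mul]
          have := mul_le_mul_of_nonneg_left (ff_le hG' v) ap.le
          linarith
        obtain ⟨c, hc⟩ := gex (a⁻¹ • S.p v)
        obtain ⟨c0, c1⟩ := hρ.slice hd hρm gf hc z1 z2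
        have h3 : 1 ≤ fσ σ (a⁻¹ • S.p v) := by
          rw [hc, map_sum, ← c1]
          refine Finset.sum_le_sum fun s hs => ?_
          rw [map_smul, smul_eq_mul]
          have := mul_le_mul_of_nonneg_left (hge s (Finset.mem_of_mem_erase hs)) (c0 s hs)
          linarith
        rw [map_smul, smul_eq_mul] at h3
        have h4 := mul_le_mul_of_nonneg_left h3 (by linarith : 0 ≤ a)
        rw [← mul_assoc, mul_inv_cancel₀ (by linarith), one_mul] at h4
        linarith
      · rw [hVm, gf x hxρ]; exact lt_irrefl _
    exact absurd (hmin' ρ hρ hρm) (by omega)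
  · obtain ⟨F, hF⟩ := S.fac_ne
    obtain ⟨x, hx⟩ := Finset.card_pos.1 (by rw [S.fac_card F hF]; omega : 0 < F.card)
    obtain ⟨τ, hxτ, hτc, hτR⟩ := hT x
    refine ⟨x, τ, hxτ, hτc, fun w hw hwx => ?_⟩
    by_contra h
    exact hM ⟨τ.erase w, by simp only [M, Finset.mem_filter, Finset.mem_univ, true_and]; exact ⟨hsub τ hτc hτR w hw, h⟩⟩

end CFan
end

noncomputable section
set_option linter.unusedVariables false
set_option linter.unusedSectionVars false

/-! ### Concrete centrally symmetric vertex sets -/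

/-- functional that is at most one on `V` -/
def Sp1 {d : ℕ} (V : Finset (Fin d → ℝ)) (f : (Fin d → ℝ) →ₗ[ℝ] ℝ) : Prop := ∀ v ∈ V, f v ≤ 1

/-- the vertices on the hyperplane `f = 1` -/
def top1 {d : ℕ} (V : Finset (Fin d → ℝ)) (f : (Fin d → ℝ) →ₗ[ℝ] ℝ) : Finset (Fin d → ℝ) := V.filter fun v => f v = 1

/-- vertex sets of cs simplicial polytopes -/
structure Csv {d : ℕ} (V : Finset (Fin d → ℝ)) : Prop where
  neg : ∀ v ∈ V, -v ∈ V
  ne : V.Nonempty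
  span : Submodule.span ℝ (V : Set (Fin d → ℝ)) = ⊤
  ext : ∀ v ∈ V, v ∉ convexHull ℝ ((V.erase v : Finset (Fin d → ℝ)) : Set (Fin d → ℝ))
  ind : ∀ f, Sp1 V f → ∀ c : (Fin d → ℝ) → ℝ, ∑ v ∈ top1 V f, c v • v = 0 → ∀ v ∈ top1 V f, c v = 0

section
variable {d : ℕ} {V : Finset (Fin d → ℝ)}

lemma mem_top1 {f : (Fin d → ℝ) →ₗ[ℝ] ℝ} {v} : v ∈ top1 V f ↔ v ∈ V ∧ f v = 1 := by simp [top1]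

lemma le_on_body {f : (Fin d → ℝ) →ₗ[ℝ] ℝ} {c : ℝ} (h : ∀ v ∈ V, f v ≤ c) : ∀ y ∈ polyBody V, f y ≤ c := by
  intro y hy
  have : convexHull ℝ (V : Set (Fin d → ℝ)) ⊆ {y | f y ≤ c} :=
    convexHull_min (fun v hv => h v hv) (convex_halfSpace_le f.isLinear c)
  exact this hy

lemma subset_body {v : Fin d → ℝ} (hv : v ∈ V) : v ∈ polyBody V := subset_convexHull ℝ _ (by exact_mod_cast hv)

lemma body_face {f : (Fin d → ℝ) →ₗ[ℝ] ℝ} {c : ℝ} (h : ∀ v ∈ V, f v ≤ c) :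
    {y ∈ polyBody V | f y = c} = convexHull ℝ ((V : Set (Fin d → ℝ)) ∩ {y ∈ polyBody V | f y = c}) := by
  apply Set.Subset.antisymm
  · rintro y ⟨hy, hfy⟩
    rw [polyBody, Finset.mem_convexHull'] at hy
    obtain ⟨w, hw0, hw1, hwy⟩ := hy
    have hz : ∀ v ∈ V, w v * (c - f v) = 0 := by
      have hs : ∑ v ∈ V, w v * (c - f v) = 0 := by
        simp only [mul_sub]
        rw [Finset.sum_sub_distrib, ← Finset.sum_mul, hw1, one_mul]
        have : f y = ∑ v ∈ V, w v * f v := by rw [← hwy, map_sum]; simp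
        linarith
      exact (Finset.sum_eq_zero_iff_of_nonneg fun v hv => mul_nonneg (hw0 v hv) (by linarith [h v hv])).1 hs
    have h2 : y ∈ convexHull ℝ ((V.filter fun v => f v = c : Finset (Fin d → ℝ)) : Set (Fin d → ℝ)) := by
      rw [Finset.mem_convexHull']
      have hq : ∀ v ∈ V, v ∉ V.filter (fun v => f v = c) → w v = 0 := by
        intro v hv hn
        rcases mul_eq_zero.1 (hz v hv) with h | h
        · exact h
        · exact absurd (Finset.mem_filter.2 ⟨hv, by linarith⟩) hn
      refine ⟨w, fun v hv => hw0 v (Finset.mem_filter.1 hv).1, ?_, ?_⟩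
      · rw [← hw1]
        exact Finset.sum_subset (Finset.filter_subset _ _) hq
      · rw [← hwy]
        exact Finset.sum_subset (Finset.filter_subset _ _) fun v hv hn => by rw [hq v hv hn, zero_smul]
    refine convexHull_mono ?_ h2
    intro v hv
    have hv := Finset.mem_filter.1 (Finset.mem_coe.1 hv)
    exact ⟨hv.1, subset_body hv.1, hv.2⟩
  · refine convexHull_min Set.inter_subset_right ?_
    exact (convex_convexHull ℝ _).inter (convex_hyperplane f.isLinear c)

lemma zero_aff (hne : V.Nonempty) (hneg : ∀ v ∈ V, -v ∈ V) : (0 : Fin d → ℝ) ∈ affineSpan ℝ (V : Set (Fin d → ℝ)) := by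
  obtain ⟨v, hv⟩ := hne
  have : midpoint ℝ v (-v) ∈ affineSpan ℝ (V : Set (Fin d → ℝ)) := by
    apply AffineMap.lineMap_mem
    · exact subset_affineSpan ℝ _ hv
    · exact subset_affineSpan ℝ _ (hneg v hv)
  simpa using this

lemma aff_eq (hne : V.Nonempty) (hneg : ∀ v ∈ V, -v ∈ V) :
    affineSpan ℝ (V : Set (Fin d → ℝ)) = ⊤ ↔ Submodule.span ℝ (V : Set (Fin d → ℝ)) = ⊤ := by
  have h := affineSpan_insert_eq_affineSpan ℝ (zero_aff hne hneg)
  have h2 : (affineSpan ℝ (insert 0 (V : Set (Fin d → ℝ))) : Set (Fin d → ℝ)) = Submodule.span ℝ (V : Set (Fin d → ℝ)) :=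
    affineSpan_insert_zero _
  rw [h] at h2
  constructor
  · intro e
    rw [e] at h2
    exact SetLike.coe_injective (by rw [← h2]; simp)
  · intro e
    rw [e] at h2
    exact SetLike.coe_injective (by rw [h2]; simp)

lemma aff_ind_iff (f : (Fin d → ℝ) →ₗ[ℝ] ℝ) {c : ℝ} (hc : c ≠ 0) :
    AffineIndependent ℝ (fun x : {y : Fin d → ℝ // y ∈ (V : Set (Fin d → ℝ)) ∩ {y ∈ polyBody V | f y = c}} => (x : Fin d → ℝ)) ↔
    ∀ a : (Fin d → ℝ) → ℝ, ∑ v ∈ V.filter (fun v => f v = c), a v • v = 0 → ∀ v ∈ V.filter (fun v => f v = c), a v = 0 := by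
  have hmem : ∀ v, v ∈ V.filter (fun v => f v = c) ↔ v ∈ (V : Set (Fin d → ℝ)) ∩ {y ∈ polyBody V | f y = c} := by
    intro v
    rw [Finset.mem_filter]
    exact ⟨fun h => ⟨h.1, subset_body h.1, h.2⟩, fun h => ⟨h.1, h.2.2⟩⟩
  haveI hft : Fintype {y : Fin d → ℝ // y ∈ (V : Set (Fin d → ℝ)) ∩ {y ∈ polyBody V | f y = c}} :=
    Fintype.subtype (V.filter fun v => f v = c) hmem
  rw [affineIndependent_iff]
  constructor
  · intro h a ha v hv
    have h0 : ∑ v ∈ V.filter (fun v => f v = c), a v = 0 := by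
      have := congrArg f ha
      rw [map_sum, map_zero] at this
      have e : ∑ v ∈ V.filter (fun v => f v = c), f (a v • v) = (∑ v ∈ V.filter (fun v => f v = c), a v) * c := by
        rw [Finset.sum_mul]
        exact Finset.sum_congr rfl fun v hv => by rw [map_smul, (Finset.mem_filter.1 hv).2]; rfl
      rw [e] at this
      exact (mul_eq_zero.1 this).resolve_right hc
    have hs := fun (g : (Fin d → ℝ) → ℝ) => Finset.sum_subtype (F := hft) (p := fun y => y ∈ (V : Set (Fin d → ℝ)) ∩ {y ∈ polyBody V | f y = c}) (V.filter (fun v => f v = c)) hmem g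
    have hs2 := fun (g : (Fin d → ℝ) → Fin d → ℝ) => Finset.sum_subtype (F := hft) (p := fun y => y ∈ (V : Set (Fin d → ℝ)) ∩ {y ∈ polyBody V | f y = c}) (V.filter (fun v => f v = c)) hmem g
    exact h Finset.univ (fun x => a x.1) (by rw [← h0, hs]) (by rw [← ha, hs2]) ⟨v, (hmem v).1 hv⟩ (Finset.mem_univ _)
  · intro h s w hw1 hw2 e he
    have := h (fun v => if hv : v ∈ (V : Set (Fin d → ℝ)) ∩ {y ∈ polyBody V | f y = c} then (if (⟨v, hv⟩ : {y : Fin d → ℝ // y ∈ (V : Set (Fin d → ℝ)) ∩ {y ∈ polyBody V | f y = c}}) ∈ s then w ⟨v, hv⟩ else 0) else 0) (by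
      rw [Finset.sum_subtype (F := hft) (p := fun y => y ∈ (V : Set (Fin d → ℝ)) ∩ {y ∈ polyBody V | f y = c}) _ hmem, ← hw2]
      rw [← Finset.sum_subset (Finset.subset_univ s)]
      · exact Finset.sum_congr rfl fun x hx => by rw [dif_pos x.2, if_pos hx]
      · intro x _ hx
        rw [dif_pos x.2, if_neg hx, zero_smul]) e.1 ((hmem _).2 e.2)
    simpa [dif_pos e.2, he] using this

lemma prop_face (hne : V.Nonempty) (hneg : ∀ v ∈ V, -v ∈ V) {f : (Fin d → ℝ) →ₗ[ℝ] ℝ} {c : ℝ} (hc : 0 < c) (h : ∀ v ∈ V, f v ≤ c) :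
    IsProperFace V {y ∈ polyBody V | f y = c} := by
  refine ⟨⟨f, c, le_on_body h, rfl⟩, fun e => ?_⟩
  obtain ⟨v, hv⟩ := hne
  have h1 : v ∈ polyBody V := subset_body hv
  have h2 : -v ∈ polyBody V := subset_body (hneg v hv)
  rw [← e] at h1 h2
  have h3 := h1.2
  have h4 := h2.2
  rw [map_neg] at h4
  linarith

/-- a proper face is either empty or given by a positive level -/
lemma face_pos (hneg : ∀ v ∈ V, -v ∈ V) {f : (Fin d → ℝ) →ₗ[ℝ] ℝ} {c : ℝ} {F : Set (Fin d → ℝ)}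
    (hs : IsSupport V f c F) (hF : F ≠ polyBody V) (hne : V.Nonempty) : 0 < c := by
  by_contra hc
  push Not at hc
  apply hF
  have h0 : ∀ v ∈ V, f v = 0 ∧ c = 0 := by
    intro v hv
    have h1 := hs.1 v (subset_body hv)
    have h2 := hs.1 (-v) (subset_body (hneg v hv))
    rw [map_neg] at h2
    constructor <;> linarith
  obtain ⟨v, hv⟩ := hne
  rw [hs.2]
  ext y
  refine ⟨fun h => h.1, fun h => ⟨h, ?_⟩⟩
  apply le_antisymm (hs.1 y h)
  have := le_on_body (f := -f) (c := 0) (fun v hv => by simp [(h0 v hv).1]) y h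
  rw [(h0 v hv).2]
  simpa using this

lemma SPolytope.ne (P : SPolytope d) : P.V.Nonempty := by
  by_contra h
  rw [Finset.not_nonempty_iff_eq_empty] at h
  have := P.span_top
  rw [h] at this
  simp at this

lemma csv_of (P : SPolytope d) (h : IsCS P) : Csv P.V where
  neg := h
  ne := P.ne
  span := (aff_eq P.ne h).1 P.span_top
  ext := P.extreme
  ind := fun f hf => (aff_ind_iff f one_ne_zero).1 (P.simplicial _ (prop_face P.ne h one_pos hf)).1

/-- the polytope with given vertex set -/
def Csv.poly (h : Csv V) : SPolytope d where
  V := V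
  span_top := (aff_eq h.ne h.neg).2 h.span
  extreme := h.ext
  simplicial := by
    rintro F ⟨⟨f, c, hs⟩, hF⟩
    have hc := face_pos h.neg hs hF h.ne
    rw [hs.2]
    refine ⟨?_, body_face fun v hv => hs.1 v (subset_body hv)⟩
    rw [aff_ind_iff f hc.ne']
    have h2 := h.ind (c⁻¹ • f) (fun v hv => by
      have := hs.1 v (subset_body hv)
      rw [LinearMap.smul_apply, smul_eq_mul, inv_mul_le_iff₀ hc]; linarith)
    have e : top1 V (c⁻¹ • f) = V.filter fun v => f v = c := by
      apply Finset.filter_congr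
      intro v _
      rw [LinearMap.smul_apply, smul_eq_mul, inv_mul_eq_iff_eq_mul₀ hc.ne', mul_one]
    rwa [e] at h2

lemma bface_iff (P : SPolytope d) (h : IsCS P) (s : Finset (Fin d → ℝ)) :
    BFace P s ↔ s ⊆ P.V ∧ ∃ f, Sp1 P.V f ∧ ∀ v ∈ s, f v = 1 := by
  constructor
  · rintro ⟨hs, F, ⟨⟨f, c, hf⟩, hF⟩, hsF⟩
    have hc := face_pos h hf hF P.ne
    refine ⟨hs, c⁻¹ • f, fun v hv => ?_, fun v hv => ?_⟩
    · have := hf.1 v (subset_body hv)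
      rw [LinearMap.smul_apply, smul_eq_mul, inv_mul_le_iff₀ hc]; linarith
    · have := hsF hv
      rw [hf.2] at this
      rw [LinearMap.smul_apply, smul_eq_mul, this.2, inv_mul_cancel₀ hc.ne']
  · rintro ⟨hs, f, hf, h1⟩
    exact ⟨hs, _, prop_face P.ne h one_pos hf, fun v hv => ⟨subset_body (hs hv), h1 v hv⟩⟩

lemma push1 (hneg : ∀ v ∈ V, -v ∈ V) {g k : (Fin d → ℝ) →ₗ[ℝ] ℝ} (hg : Sp1 V g) (hk : ∀ v ∈ top1 V g, k v ≤ 0) (hex : ∃ v ∈ V, 0 < k v) :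
    ∃ θ : ℝ, 0 < θ ∧ Sp1 V (g + θ • k) ∧ ∃ j ∈ V, g j < 1 ∧ 0 < k j ∧ (g + θ • k) j = 1 := by
  obtain ⟨j, hj, hmin⟩ := Finset.exists_min_image (V.filter fun v => 0 < k v) (fun v => (1 - g v) / k v)
    (by obtain ⟨v, hv, h⟩ := hex; exact ⟨v, Finset.mem_filter.2 ⟨hv, h⟩⟩)
  have hj := Finset.mem_filter.1 hj
  have hgj : g j < 1 := lt_of_le_of_ne (hg j hj.1) fun e => by
    have := hk j (mem_top1.2 ⟨hj.1, e⟩)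
    linarith [hj.2]
  have hθ : 0 < (1 - g j) / k j := div_pos (by linarith) hj.2
  refine ⟨(1 - g j) / k j, hθ, fun v hv => ?_, j, hj.1, hgj, hj.2, ?_⟩
  · simp only [LinearMap.add_apply, LinearMap.smul_apply, smul_eq_mul]
    by_cases hkv : 0 < k v
    · have := hmin v (Finset.mem_filter.2 ⟨hv, hkv⟩)
      rw [le_div_iff₀ hkv] at this
      linarith
    · push Not at hkv
      have := hg v hv
      nlinarith
  · simp only [LinearMap.add_apply, LinearMap.smul_apply, smul_eq_mul]
    rw [div_mul_cancel₀ _ hj.2.ne']; ring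

lemma Csv.li (h : Csv V) {f : (Fin d → ℝ) →ₗ[ℝ] ℝ} (hf : Sp1 V f) : LinearIndependent ℝ (fun v : top1 V f => (v : Fin d → ℝ)) := by
  rw [Fintype.linearIndependent_iff]
  intro g hg i
  have := h.ind f hf (fun v => if hv : v ∈ top1 V f then g ⟨v, hv⟩ else 0) (by
    rw [← hg, ← Finset.sum_coe_sort]
    refine Finset.sum_congr rfl fun v _ => by simp) i.1 i.2
  simpa using this

lemma Csv.card_le (h : Csv V) {f : (Fin d → ℝ) →ₗ[ℝ] ℝ} (hf : Sp1 V f) : (top1 V f).card ≤ d := by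
  have := (h.li hf).fintype_card_le_finrank
  simpa using this

lemma Csv.pos (h : Csv V) {k : (Fin d → ℝ) →ₗ[ℝ] ℝ} (hk : k ≠ 0) : ∃ v ∈ V, 0 < k v := by
  by_contra hc
  push Not at hc
  apply hk
  have : Submodule.span ℝ (V : Set (Fin d → ℝ)) ≤ LinearMap.ker k := by
    rw [Submodule.span_le]
    intro v hv
    have h1 := hc v hv
    have h2 := hc (-v) (h.neg v hv)
    rw [map_neg] at h2
    show k v = 0
    linarith
  rw [h.span] at this
  ext1 i
  apply LinearMap.ext
  intro y
  exact this Submodule.mem_top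

/-- every face is contained in a facet -/
lemma Csv.enlarge (h : Csv V) {f : (Fin d → ℝ) →ₗ[ℝ] ℝ} (hf : Sp1 V f) :
    ∃ g, Sp1 V g ∧ top1 V f ⊆ top1 V g ∧ (top1 V g).card = d := by
  have key : ∀ m : ℕ, ∀ f, Sp1 V f → d - (top1 V f).card = m → ∃ g, Sp1 V g ∧ top1 V f ⊆ top1 V g ∧ (top1 V g).card = d := by
    intro m
    induction m using Nat.strong_induction_on with
    | _ m ih =>
    intro f hf hm
    have hle := h.card_le hf
    by_cases he : (top1 V f).card = d
    · exact ⟨f, hf, subset_rfl, he⟩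
    have hlt : Submodule.span ℝ ((top1 V f : Finset (Fin d → ℝ)) : Set (Fin d → ℝ)) < ⊤ := by
      rw [lt_top_iff_ne_top]
      intro e
      have h1 := finrank_span_finset_le_card (R := ℝ) (top1 V f)
      rw [Set.finrank, e, finrank_top] at h1
      simp at h1
      omega
    obtain ⟨k, hk0, hk⟩ := Submodule.exists_le_ker_of_lt_top _ hlt
    have hk' : ∀ v ∈ top1 V f, k v = 0 := fun v hv => hk (Submodule.subset_span hv)
    obtain ⟨θ, hθ, hs, j, hj, hj1, hj2, hj3⟩ := push1 h.neg hf (fun v hv => (hk' v hv).le) (h.pos hk0)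
    have hsub : top1 V f ⊆ top1 V (f + θ • k) := fun v hv => by
      rw [mem_top1] at hv ⊢
      refine ⟨hv.1, ?_⟩
      simp [hv.2, hk' v (mem_top1.2 hv)]
    have hss : top1 V f ⊂ top1 V (f + θ • k) := by
      refine (Finset.ssubset_iff_of_subset hsub).2 ⟨j, mem_top1.2 ⟨hj, hj3⟩, fun hh => ?_⟩
      linarith [(mem_top1.1 hh).2]
    have hc := Finset.card_lt_card hss
    have hc2 := h.card_le hs
    obtain ⟨g, hg, hg1, hg2⟩ := ih _ (by omega) _ hs rfl
    exact ⟨g, hg, hsub.trans hg1, hg2⟩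
  exact key _ f hf rfl

/-- coordinate functional -/
lemma Csv.coord (h : Csv V) {f : (Fin d → ℝ) →ₗ[ℝ] ℝ} (hf : Sp1 V f) {i : Fin d → ℝ} (hi : i ∈ top1 V f) :
    ∃ k : (Fin d → ℝ) →ₗ[ℝ] ℝ, k i = 1 ∧ ∀ v ∈ top1 V f, v ≠ i → k v = 0 := by
  have hli := h.li hf
  obtain ⟨k, hk⟩ := (LinearMap.exists_extend (p := Submodule.span ℝ (Set.range fun v : top1 V f => (v : Fin d → ℝ)))
    ((Finsupp.lapply (⟨i, hi⟩ : top1 V f) : ((top1 V f) →₀ ℝ) →ₗ[ℝ] ℝ) ∘ₗ hli.repr))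
  have hv : ∀ v (hv : v ∈ top1 V f), k v = if v = i then 1 else 0 := by
    intro v hv
    have h1 := LinearMap.congr_fun hk ⟨v, Submodule.subset_span ⟨⟨v, hv⟩, rfl⟩⟩
    have h2 := hli.repr_eq_single ⟨v, hv⟩ ⟨v, Submodule.subset_span ⟨⟨v, hv⟩, rfl⟩⟩ rfl
    simp only [LinearMap.comp_apply, Submodule.subtype_apply, LinearEquiv.coe_coe, h2, Finsupp.lapply_apply, Finsupp.single_apply] at h1
    rw [h1]
    simp [Subtype.ext_iff]
  exact ⟨k, by rw [hv i hi]; simp, fun v hv' hne => by rw [hv v hv', if_neg hne]⟩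

/-- pivots -/
lemma Csv.pivot (h : Csv V) {f : (Fin d → ℝ) →ₗ[ℝ] ℝ} (hf : Sp1 V f) (hc : (top1 V f).card = d) {i : Fin d → ℝ} (hi : i ∈ top1 V f) :
    ∃ g, Sp1 V g ∧ ∃ j ∈ V, f j < 1 ∧ j ∉ top1 V f ∧ top1 V g = insert j ((top1 V f).erase i) := by
  obtain ⟨k, hk1, hk0⟩ := h.coord hf hi
  obtain ⟨θ, hθ, hs, j, hj, hj1, hj2, hj3⟩ := push1 (k := -k) h.neg hf (fun v hv => by
    by_cases e : v = i
    · rw [e]; simp [hk1]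
    · simp [hk0 v hv e]) ⟨-i, h.neg i (mem_top1.1 hi).1, by simp [hk1]⟩
  have hjn : j ∉ top1 V f := fun hh => by linarith [(mem_top1.1 hh).2]
  refine ⟨_, hs, j, hj, hj1, hjn, ?_⟩
  symm
  apply Finset.eq_of_subset_of_card_le
  · intro v hv
    rcases Finset.mem_insert.1 hv with rfl | hv
    · exact mem_top1.2 ⟨hj, hj3⟩
    · have hv := Finset.mem_erase.1 hv
      refine mem_top1.2 ⟨(mem_top1.1 hv.2).1, ?_⟩
      simp [hk0 v hv.2 hv.1, (mem_top1.1 hv.2).2]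
  · rw [Finset.card_insert_of_notMem (fun hh => hjn (Finset.mem_of_mem_erase hh)), Finset.card_erase_of_mem hi, hc]
    have := h.card_le hs
    have : 0 < d := hc ▸ Finset.card_pos.2 ⟨i, hi⟩
    omega

/-- vertices are exposed -/
lemma Csv.expose (hd : 0 < d) (h : Csv V) {v : Fin d → ℝ} (hv : v ∈ V) : ∃ f, Sp1 V f ∧ f v = 1 ∧ ∀ w ∈ V, w ≠ v → f w < 1 := by
  have hcl : IsClosed (convexHull ℝ ((V.erase v : Finset (Fin d → ℝ)) : Set (Fin d → ℝ))) :=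
    (Finset.finite_toSet _).isClosed_convexHull ℝ
  obtain ⟨f, u, h1, h2⟩ := geometric_hahn_banach_point_closed (convex_convexHull ℝ _) hcl (h.ext v hv)
  have h3 : ∀ w ∈ V, w ≠ v → f v < f w := fun w hw hne =>
    h1.trans (h2 w (subset_convexHull ℝ _ (by simp [hw, hne])))
  have hneg : f v < 0 := by
    by_cases e : -v = v
    · -- `v = 0` is impossible unless it is the only vertex
      exfalso
      have hv0 : v = 0 := by
        have : (2 : ℝ) • v = 0 := by rw [two_smul]; nth_rewrite 1 [← e]; simp
        simpa using this
      by_cases hex : ∃ w ∈ V, w ≠ v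
      · obtain ⟨w, hw, hwv⟩ := hex
        have a := h3 w hw hwv
        have b := h3 (-w) (h.neg w hw) (fun e2 => hwv (by rw [← neg_neg w, e2, e]))
        rw [map_neg] at b
        rw [hv0, map_zero] at a b
        linarith
      · push Not at hex
        obtain ⟨w, hw, hw0⟩ := h.pos (k := LinearMap.proj ⟨0, hd⟩) (fun e => by
          have := LinearMap.congr_fun e (fun _ => 1)
          simp at this)
        rw [hex w hw, hv0, map_zero] at hw0
        exact lt_irrefl _ hw0
    · have := h3 (-v) (h.neg v hv) e
      rw [map_neg] at this
      linarith
  refine ⟨(f v)⁻¹ • (f : (Fin d → ℝ) →ₗ[ℝ] ℝ), ?_, ?_, ?_⟩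
  · intro w hw
    by_cases e : w = v
    · rw [e]; simp [inv_mul_cancel₀ hneg.ne]
    · have := h3 w hw e
      simp only [LinearMap.smul_apply, smul_eq_mul, ContinuousLinearMap.coe_coe]
      rw [inv_mul_eq_div, div_le_one_of_neg hneg]; exact this.le
  · simp [inv_mul_cancel₀ hneg.ne]
  · intro w hw e
    have := h3 w hw e
    simp only [LinearMap.smul_apply, smul_eq_mul, ContinuousLinearMap.coe_coe]
    rw [inv_mul_eq_div, div_lt_one_of_neg hneg]; exact this
end
end

noncomputable section
set_option linter.unusedVariables false
set_option linter.unusedSectionVars false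

/-! ### Fans from point configurations, perturbation -/
section
variable {d : ℕ} {ι : Type} [Fintype ι] [DecidableEq ι]

/-- linear independence of the vectors indexed by `Q` -/
def LIQ (p : ι → Fin d → ℝ) (Q : Finset ι) : Prop := LinearIndependent ℝ (fun v : Q => p v)

lemma LIQ.sum {p : ι → Fin d → ℝ} {Q : Finset ι} (h : LIQ p Q) (c : ι → ℝ) (h0 : ∑ v ∈ Q, c v • p v = 0) : ∀ v ∈ Q, c v = 0 := by
  intro v hv
  have h1 := Fintype.linearIndependent_iff.1 h (fun v => c v) (by
    rw [← h0]; exact Finset.sum_coe_sort Q (fun v => c v • p v)) ⟨v, hv⟩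
  exact h1

/-- the matrix of the vectors indexed by `Q` -/
def mQ (p : ι → Fin d → ℝ) {Q : Finset ι} (e : Fin d ≃ Q) : Matrix (Fin d) (Fin d) ℝ := Matrix.of fun i j => p (e i) j

lemma LIQ_iff (p : ι → Fin d → ℝ) {Q : Finset ι} (e : Fin d ≃ Q) : LIQ p Q ↔ (mQ p e).det ≠ 0 := by
  rw [LIQ, ← linearIndependent_equiv e]
  have := Matrix.linearIndependent_rows_iff_isUnit (A := mQ p e)
  rw [Matrix.isUnit_iff_isUnit_det, isUnit_iff_ne_zero] at this
  rw [← this]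
  rfl

lemma exists_co {p : ι → Fin d → ℝ} {F : Finset ι} (hc : F.card = d) (hli : LIQ p F) :
    ∃ co : ι → ((Fin d → ℝ) →ₗ[ℝ] ℝ), (∀ v, v ∉ F → co v = 0) ∧
      (∀ v ∈ F, ∀ w ∈ F, co v (p w) = if v = w then 1 else 0) ∧ ∀ x, ∑ v, co v x • p v = x := by
  have hli' : LinearIndependent ℝ (fun v : F => p v) := hli
  have hspan : Submodule.span ℝ (Set.range fun v : F => p v) = ⊤ :=
    hli'.span_eq_top_of_card_eq_finrank' (by simp [hc])
  let b := Module.Basis.mk hli' hspan.ge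
  have hb : ∀ v : F, b v = p v := fun v => by simp [b]
  refine ⟨fun v => if h : v ∈ F then b.coord ⟨v, h⟩ else 0, fun v hv => by simp [hv], fun v hv w hw => ?_, fun x => ?_⟩
  · simp only [dif_pos hv]
    rw [← hb ⟨w, hw⟩]
    simp [Finsupp.single_apply, Subtype.ext_iff, eq_comm]
  · conv_rhs => rw [← b.sum_repr x]
    rw [← Finset.sum_subset (Finset.subset_univ F)]
    · refine (Finset.sum_coe_sort F (fun v => (if h : v ∈ F then b.coord ⟨v, h⟩ else 0) x • p v)).symm.trans ?_
      refine Finset.sum_congr rfl fun v _ => ?_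
      rw [dif_pos v.2, hb]
      rfl
    · intro v _ hv
      simp [hv]

lemma exists_fan (p : ι → Fin d → ℝ) (fac : Finset (Finset ι)) (ν : ι → ι) (fac_ne : fac.Nonempty)
    (fac_card : ∀ F ∈ fac, F.card = d) (hli : ∀ F ∈ fac, LIQ p F)
    (hlt : ∀ F ∈ fac, ∃ f : (Fin d → ℝ) →ₗ[ℝ] ℝ, (∀ v ∈ F, f (p v) = 1) ∧ ∀ v, v ∉ F → f (p v) < 1)
    (piv : ∀ F ∈ fac, ∀ i ∈ F, ∃ j, j ∉ F ∧ insert j (F.erase i) ∈ fac)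
    (cover : ∀ v, ∃ F ∈ fac, v ∈ F) (νν : ∀ v, ν (ν v) = v) (νp : ∀ v, p (ν v) = - p v)
    (νfac : ∀ F ∈ fac, F.image ν ∈ fac) :
    ∃ S : CFan d ι, S.p = p ∧ S.fac = fac ∧ S.ν = ν := by
  have hex : ∀ F : Finset ι, ∃ co : ι → ((Fin d → ℝ) →ₗ[ℝ] ℝ), F ∈ fac → ((∀ v, v ∉ F → co v = 0) ∧
      (∀ v ∈ F, ∀ w ∈ F, co v (p w) = if v = w then 1 else 0) ∧ ∀ x, ∑ v, co v x • p v = x) := by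
    intro F
    by_cases hF : F ∈ fac
    · obtain ⟨co, h⟩ := exists_co (fac_card F hF) (hli F hF)
      exact ⟨co, fun _ => h⟩
    · exact ⟨0, fun h => absurd h hF⟩
  choose co hco using hex
  refine ⟨⟨p, fac, fac_ne, fac_card, co, fun F hF => (hco F hF).1, fun F hF => (hco F hF).2.1, fun F hF => (hco F hF).2.2,
    fun F hF w hw => ?_, piv, cover, ν, νν, νp, νfac⟩, rfl, rfl, rfl⟩
  obtain ⟨f, hf1, hf2⟩ := hlt F hF
  have h1 := hf2 w hw
  rw [← (hco F hF).2.2 (p w), map_sum] at h1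
  refine lt_of_eq_of_lt (Finset.sum_congr rfl fun v _ => ?_) h1
  rw [map_smul, smul_eq_mul]
  by_cases hv : v ∈ F
  · rw [hf1 v hv, mul_one]
  · rw [(hco F hF).1 v hv]; simp

/-- perturbed points -/
def pert (p q : ι → Fin d → ℝ) (ε : ℝ) : ι → Fin d → ℝ := fun v => ε • q v + p v

lemma mQ_pert (p q : ι → Fin d → ℝ) {Q : Finset ι} (e : Fin d ≃ Q) (ε : ℝ) : mQ (pert p q ε) e = ε • mQ q e + mQ p e := by
  ext i j
  simp [mQ, pert]

lemma pert_facet {p q : ι → Fin d → ℝ} {F : Finset ι} (hc : F.card = d) (hli : LIQ p F)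
    (hlt : ∃ f : (Fin d → ℝ) →ₗ[ℝ] ℝ, (∀ v ∈ F, f (p v) = 1) ∧ ∀ v, v ∉ F → f (p v) < 1) :
    ∀ᶠ ε in nhds (0 : ℝ), LIQ (pert p q ε) F ∧
      ∃ f : (Fin d → ℝ) →ₗ[ℝ] ℝ, (∀ v ∈ F, f (pert p q ε v) = 1) ∧ ∀ v, v ∉ F → f (pert p q ε v) < 1 := by
  obtain ⟨f, hf1, hf2⟩ := hlt
  let e : Fin d ≃ F := (Finset.equivFinOfCardEq hc).symm
  have hcont : Continuous fun ε : ℝ => mQ (pert p q ε) e := by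
    simp only [mQ_pert]
    fun_prop
  have hdet : Continuous fun ε : ℝ => (mQ (pert p q ε) e).det := hcont.matrix_det
  have h0 : pert p q 0 = p := by funext v; simp [pert]
  have hd0 : (mQ (pert p q 0) e).det ≠ 0 := by rw [h0]; exact (LIQ_iff p e).1 hli
  let g : ℝ → Fin d → ℝ := fun ε => ((mQ (pert p q ε) e).det)⁻¹ • ((mQ (pert p q ε) e).adjugate.mulVec 1)
  have hg : ContinuousAt g 0 := by
    refine ContinuousAt.smul (f := fun ε => ((mQ (pert p q ε) e).det)⁻¹) (g := fun ε => (mQ (pert p q ε) e).adjugate.mulVec 1) ?_ ?_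
    · exact hdet.continuousAt.inv₀ hd0
    · exact (Continuous.matrix_mulVec hcont.matrix_adjugate continuous_const).continuousAt
  have hMg : ∀ ε, (mQ (pert p q ε) e).det ≠ 0 → (mQ (pert p q ε) e).mulVec (g ε) = 1 := by
    intro ε hε
    simp only [g]
    rw [Matrix.mulVec_smul, Matrix.mulVec_mulVec, Matrix.mul_adjugate, Matrix.smul_mulVec, Matrix.one_mulVec, smul_smul,
      inv_mul_cancel₀ hε, one_smul]
  have hgf : ∀ x : Fin d → ℝ, x ⬝ᵥ g 0 = f x := by
    let a : Fin d → ℝ := fun j => f (Pi.single j 1)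
    have hfa : ∀ x : Fin d → ℝ, f x = x ⬝ᵥ a := by
      intro x
      rw [LinearMap.pi_apply_eq_sum_univ f x]
      simp [dotProduct, a, Pi.single_apply, eq_comm]
      refine Finset.sum_congr rfl fun j _ => ?_
      congr 2
      funext i
      simp [Pi.single_apply, eq_comm]
    have hMa : (mQ (pert p q 0) e).mulVec a = 1 := by
      rw [h0]
      funext i
      show (fun j => p (e i) j) ⬝ᵥ a = 1
      rw [← hfa]
      exact hf1 _ (e i).2
    have : g 0 = a := by
      have h1 := hMg 0 hd0
      rw [← hMa] at h1
      exact Matrix.mulVec_injective_of_isUnit ((Matrix.isUnit_iff_isUnit_det _).2 (isUnit_iff_ne_zero.2 hd0)) h1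
    intro x
    rw [this, hfa]
  have hev : ∀ᶠ ε in nhds (0 : ℝ), ∀ v ∈ (univ : Finset ι), v ∉ F → pert p q ε v ⬝ᵥ g ε < 1 := by
    rw [Filter.eventually_all_finset]
    intro v _
    by_cases hv : v ∈ F
    · exact Filter.Eventually.of_forall fun ε h => absurd hv h
    · have hc : ContinuousAt (fun ε => pert p q ε v ⬝ᵥ g ε) 0 := by
        simp only [dotProduct]
        refine tendsto_finsetSum _ fun j _ => ?_
        refine ContinuousAt.mul ?_ ((continuousAt_pi.1 hg) j)
        simp only [pert, Pi.add_apply, Pi.smul_apply]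
        fun_prop
      have h2 : pert p q 0 v ⬝ᵥ g 0 < 1 := by rw [hgf, h0]; exact hf2 v hv
      exact (hc.eventually (gt_mem_nhds h2)).mono fun ε h _ => h
  have hev2 : ∀ᶠ ε in nhds (0 : ℝ), (mQ (pert p q ε) e).det ≠ 0 := hdet.continuousAt.eventually_ne hd0
  filter_upwards [hev, hev2] with ε h1 h2
  refine ⟨(LIQ_iff _ e).2 h2, ?_⟩
  have hl : ∀ x : Fin d → ℝ, (∑ j, g ε j • (LinearMap.proj j : (Fin d → ℝ) →ₗ[ℝ] ℝ)) x = x ⬝ᵥ g ε := by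
    intro x
    simp [dotProduct, LinearMap.sum_apply, mul_comm]
  refine ⟨∑ j, g ε j • (LinearMap.proj j : (Fin d → ℝ) →ₗ[ℝ] ℝ), fun v hv => ?_, fun v hv => ?_⟩
  · rw [hl]
    have h3 := congrFun (hMg ε h2) (e.symm ⟨v, hv⟩)
    change (fun j => pert p q ε (e (e.symm ⟨v, hv⟩)) j) ⬝ᵥ g ε = 1 at h3
    rwa [Equiv.apply_symm_apply] at h3
  · rw [hl]
    exact h1 v (Finset.mem_univ _) hv

lemma pert_gen {p q : ι → Fin d → ℝ} {Q : Finset ι} (hc : Q.card = d) (hq : LIQ q Q) :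
    ∀ᶠ ε in nhdsWithin (0 : ℝ) {0}ᶜ, LIQ (pert p q ε) Q := by
  let e : Fin d ≃ Q := (Finset.equivFinOfCardEq hc).symm
  let f : Polynomial ℝ := ((Polynomial.X : Polynomial ℝ) • (mQ q e).map Polynomial.C + (mQ p e).map Polynomial.C).det
  have hf : f ≠ 0 := by
    intro h
    have := Polynomial.coeff_det_X_add_C_card (mQ q e) (mQ p e)
    change f.coeff _ = _ at this
    rw [h, Polynomial.coeff_zero] at this
    exact (LIQ_iff q e).1 hq this.symm
  have hev : ∀ ε, f.eval ε = (mQ (pert p q ε) e).det := by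
    intro ε
    rw [mQ_pert]
    rw [← Polynomial.coe_evalRingHom, RingHom.map_det]
    congr 1
    ext i j
    simp; ring
  have hfin : (f.rootSet ℝ).Finite := Polynomial.rootSet_finite f ℝ
  have : ∀ᶠ ε in nhdsWithin (0 : ℝ) {0}ᶜ, ε ∉ f.rootSet ℝ \ {0} := by
    have h1 : IsOpen (f.rootSet ℝ \ {0})ᶜ := (hfin.subset Set.diff_subset).isClosed.isOpen_compl
    exact nhdsWithin_le_nhds (h1.mem_nhds (by simp))
  filter_upwards [this, self_mem_nhdsWithin] with ε h1 h2
  rw [LIQ_iff _ e, ← hev]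
  intro h3
  exact h1 ⟨by rw [Polynomial.mem_rootSet]; exact ⟨hf, by simpa using h3⟩, h2⟩

/-- odd generic configuration -/
lemma exists_q (ν : ι → ι) (νν : ∀ v, ν (ν v) = v) (νne : ∀ v, ν v ≠ v) : ∃ q : ι → Fin d → ℝ, (∀ v, q (ν v) = - q v) ∧
    ∀ Q : Finset ι, Q.card = d → (∀ u ∈ Q, ∀ v ∈ Q, u ≠ ν v) → LIQ q Q := by
  let e := Fintype.equivFin ι
  let a : ι → ℝ := fun v => if e v < e (ν v) then ((e v : ℕ) : ℝ) + 1 else - (((e (ν v) : ℕ) : ℝ) + 1)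
  have hlt : ∀ v, e v < e (ν v) ∨ e (ν v) < e v := fun v => by
    rcases lt_trichotomy (e v) (e (ν v)) with h | h | h
    · exact Or.inl h
    · exact absurd (e.injective h).symm (νne v)
    · exact Or.inr h
  have ha : ∀ v, a (ν v) = - a v := by
    intro v
    simp only [a, νν]
    rcases hlt v with h | h
    · rw [if_neg (by exact not_lt.2 h.le), if_pos h]
    · rw [if_pos h, if_neg (not_lt.2 h.le), neg_neg]
  have ha0 : ∀ v, a v ≠ 0 := by
    intro v
    have h1 : (0 : ℝ) ≤ ((e v : ℕ) : ℝ) := Nat.cast_nonneg _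
    have h2 : (0 : ℝ) ≤ ((e (ν v) : ℕ) : ℝ) := Nat.cast_nonneg _
    simp only [a]
    split_ifs
    · linarith
    · intro h; linarith
  have hsq : ∀ v, a v ^ 2 = (((min (e v) (e (ν v)) : Fin _) : ℕ) + 1 : ℝ) ^ 2 := by
    intro v
    simp only [a]
    rcases hlt v with h | h
    · rw [if_pos h, min_eq_left h.le]
    · rw [if_neg (not_lt.2 h.le), min_eq_right h.le, neg_sq]
  have hinj : ∀ u v, a u ^ 2 = a v ^ 2 → u = v ∨ u = ν v := by
    intro u v h
    rw [hsq, hsq] at h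
    have h1 := (sq_eq_sq₀ (by positivity) (by positivity)).1 h
    have h2 : min (e u) (e (ν u)) = min (e v) (e (ν v)) := by
      apply Fin.ext
      have : (((min (e u) (e (ν u)) : Fin _) : ℕ) : ℝ) = ((min (e v) (e (ν v)) : Fin _) : ℕ) := by linarith
      exact_mod_cast this
    rcases hlt u with h3 | h3 <;> rcases hlt v with h4 | h4
    · rw [min_eq_left h3.le, min_eq_left h4.le] at h2
      exact Or.inl (e.injective h2)
    · rw [min_eq_left h3.le, min_eq_right h4.le] at h2
      exact Or.inr (e.injective h2)
    · rw [min_eq_right h3.le, min_eq_left h4.le] at h2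
      right; rw [← e.injective h2, νν]
    · rw [min_eq_right h3.le, min_eq_right h4.le] at h2
      left; rw [← νν u, e.injective h2, νν]
  refine ⟨fun v j => a v ^ (2 * (j : ℕ) + 1), fun v => ?_, fun Q hc hQ => ?_⟩
  · funext j
    simp only [Pi.neg_apply]
    rw [ha, Odd.neg_pow ⟨j, rfl⟩]
  · let eq : Fin d ≃ Q := (Finset.equivFinOfCardEq hc).symm
    rw [LIQ_iff _ eq]
    have hm : mQ (fun v j => a v ^ (2 * (j : ℕ) + 1)) eq = Matrix.diagonal (fun i => a (eq i)) * Matrix.vandermonde (fun i => a (eq i) ^ 2) := by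
      ext i j
      rw [Matrix.diagonal_mul]
      simp only [mQ, Matrix.of_apply, Matrix.vandermonde_apply]
      rw [← pow_mul, pow_succ]; ring
    rw [hm, Matrix.det_mul, Matrix.det_diagonal]
    refine mul_ne_zero (Finset.prod_ne_zero_iff.2 fun i _ => ha0 _) ?_
    rw [Matrix.det_vandermonde_ne_zero_iff]
    intro i j hij
    rcases hinj _ _ hij with h | h
    · exact eq.injective (Subtype.ext h)
    · exact absurd h (hQ _ (eq i).2 _ (eq j).2)

lemma extendQ (ν : ι → ι) (νν : ∀ v, ν (ν v) = v) (νne : ∀ v, ν v ≠ v) (hn : 2 * d ≤ Fintype.card ι) (Q : Finset ι)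
    (hc : Q.card ≤ d) (hQ : ∀ u ∈ Q, ∀ v ∈ Q, u ≠ ν v) : ∃ Q', Q ⊆ Q' ∧ Q'.card = d ∧ ∀ u ∈ Q', ∀ v ∈ Q', u ≠ ν v := by
  obtain ⟨m, hm⟩ : ∃ m, m + Q.card = d := ⟨d - Q.card, by omega⟩
  induction m generalizing Q with
  | zero => exact ⟨Q, subset_rfl, by omega, hQ⟩
  | succ m ih =>
    have : ∃ x, x ∉ Q ∪ Q.image ν := by
      by_contra h
      push Not at h
      have h1 : (Q ∪ Q.image ν) = univ := Finset.eq_univ_of_forall h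
      have h2 := Finset.card_union_le Q (Q.image ν)
      have h3 : (Q.image ν).card ≤ Q.card := Finset.card_image_le
      rw [h1, Finset.card_univ] at h2
      omega
    obtain ⟨x, hx⟩ := this
    simp only [Finset.mem_union, Finset.mem_image, not_or, not_exists, not_and] at hx
    obtain ⟨Q', h1, h2⟩ := ih (insert x Q) (by rw [Finset.card_insert_of_notMem hx.1]; omega) (by
      intro u hu v hv
      rcases Finset.mem_insert.1 hu with hu' | hu' <;> rcases Finset.mem_insert.1 hv with hv' | hv'
      · rw [hu', hv']; exact (νne _).symm
      · exact fun e => hx.2 v hv' (by rw [← e, hu'])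
      · exact fun e => hx.2 u hu' (by rw [e, νν, hv'])
      · exact hQ u hu' v hv') (by rw [Finset.card_insert_of_notMem hx.1]; omega)
    exact ⟨Q', (Finset.subset_insert _ _).trans h1, h2⟩
end
end

noncomputable section
set_option linter.unusedVariables false
set_option linter.unusedSectionVars false

/-- ordered edges -/
def ed1 {d : ℕ} (V : Finset (Fin d → ℝ)) : Finset ((Fin d → ℝ) × (Fin d → ℝ)) :=
  (V ×ˢ V).filter fun e => e.1 ≠ e.2 ∧ ∃ f, Sp1 V f ∧ f e.1 = 1 ∧ f e.2 = 1

section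
variable {d : ℕ} {V : Finset (Fin d → ℝ)}

lemma LIQ.mono {ι : Type} {p : ι → Fin d → ℝ} {Q Q' : Finset ι} (h : LIQ p Q') (hs : Q ⊆ Q') : LIQ p Q := by
  have : LinearIndependent ℝ ((fun v : Q' => p v) ∘ (fun v : Q => (⟨v.1, hs v.2⟩ : Q'))) := by
    refine LinearIndependent.comp h _ ?_
    intro a b hab
    exact Subtype.ext (congrArg (fun x : Q' => x.1) hab)
  exact this

lemma Csv.neg_ne (hd : 0 < d) (h : Csv V) {v : Fin d → ℝ} (hv : v ∈ V) : -v ≠ v := by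
  intro e
  obtain ⟨f, hf, h1, h2⟩ := h.expose hd hv
  have := congrArg f e
  rw [map_neg, h1] at this
  linarith

lemma Csv.sp_neg (h : Csv V) {f : (Fin d → ℝ) →ₗ[ℝ] ℝ} (hf : Sp1 V f) : Sp1 V (-f) := by
  intro v hv
  have := hf (-v) (h.neg v hv)
  rwa [map_neg] at this

/-- facets as index sets -/
def facV (V : Finset (Fin d → ℝ)) : Finset (Finset V) :=
  univ.filter fun F => ∃ g, Sp1 V g ∧ F.card = d ∧ ∀ v, v ∈ F ↔ g v.1 = 1

lemma mem_facV {F : Finset V} : F ∈ facV V ↔ ∃ g, Sp1 V g ∧ F.card = d ∧ ∀ v, v ∈ F ↔ g v.1 = 1 := by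
  simp [facV]

lemma card_top1 (g : (Fin d → ℝ) →ₗ[ℝ] ℝ) (F : Finset V) (hF : ∀ v, v ∈ F ↔ g v.1 = 1) : F.map (Function.Embedding.subtype _) = top1 V g := by
  ext v
  simp only [Finset.mem_map, Function.Embedding.coe_subtype, mem_top1]
  constructor
  · rintro ⟨a, ha, rfl⟩
    exact ⟨a.2, (hF a).1 ha⟩
  · rintro ⟨h1, h2⟩
    exact ⟨⟨v, h1⟩, (hF _).2 h2, rfl⟩

lemma facV_of {g : (Fin d → ℝ) →ₗ[ℝ] ℝ} (hg : Sp1 V g) (hc : (top1 V g).card = d) :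
    (univ.filter fun v : V => g v.1 = 1) ∈ facV V := by
  refine mem_facV.2 ⟨g, hg, ?_, fun v => by simp⟩
  refine Eq.trans ?_ hc
  rw [← card_top1 g (univ.filter fun v : V => g v.1 = 1) (fun v => by simp), Finset.card_map]

lemma Csv.fan (hd : 0 < d) (h : Csv V) (hn : 2 * d ≤ V.card) : ∃ S : CFan d V, S.fac = facV V ∧ S.Gp := by
  let ν : V → V := fun v => ⟨-v.1, h.neg v.1 v.2⟩
  have νν : ∀ v, ν (ν v) = v := fun v => Subtype.ext (neg_neg _)
  have νne : ∀ v, ν v ≠ v := fun v e => h.neg_ne hd v.2 (congrArg Subtype.val e)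
  have fac_card : ∀ F ∈ facV V, F.card = d := fun F hF => (mem_facV.1 hF).choose_spec.2.1
  have hli : ∀ F ∈ facV V, LIQ (fun v : V => v.1) F := by
    intro F hF
    obtain ⟨g, hg, hc, hm⟩ := mem_facV.1 hF
    have : LinearIndependent ℝ ((fun v : top1 V g => (v : Fin d → ℝ)) ∘ (fun v : F => (⟨v.1.1, mem_top1.2 ⟨v.1.2, (hm v.1).1 v.2⟩⟩ : top1 V g))) := by
      refine LinearIndependent.comp (h.li hg) _ ?_
      intro a b hab
      exact Subtype.ext (Subtype.ext (congrArg (fun x : top1 V g => x.1) hab))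
    exact this
  have hlt : ∀ F ∈ facV V, ∃ f : (Fin d → ℝ) →ₗ[ℝ] ℝ, (∀ v ∈ F, f v.1 = 1) ∧ ∀ v : V, v ∉ F → f v.1 < 1 := by
    intro F hF
    obtain ⟨g, hg, hc, hm⟩ := mem_facV.1 hF
    exact ⟨g, fun v hv => (hm v).1 hv, fun v hv => lt_of_le_of_ne (hg v.1 v.2) fun e => hv ((hm v).2 e)⟩
  obtain ⟨q, hqν, hq⟩ := exists_q (d := d) ν νν νne
  have ev1 : ∀ᶠ ε in nhdsWithin (0 : ℝ) {0}ᶜ, ∀ F ∈ facV V, LIQ (pert (fun v : V => v.1) q ε) F ∧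
      ∃ f : (Fin d → ℝ) →ₗ[ℝ] ℝ, (∀ v ∈ F, f (pert (fun v : V => v.1) q ε v) = 1) ∧ ∀ v, v ∉ F → f (pert (fun v : V => v.1) q ε v) < 1 := by
    rw [Filter.eventually_all_finset]
    intro F hF
    exact (pert_facet (fac_card F hF) (hli F hF) (hlt F hF)).filter_mono nhdsWithin_le_nhds
  have ev2 : ∀ᶠ ε in nhdsWithin (0 : ℝ) {0}ᶜ, ∀ Q ∈ (univ : Finset (Finset V)), Q.card = d → (∀ u ∈ Q, ∀ v ∈ Q, u ≠ ν v) →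
      LIQ (pert (fun v : V => v.1) q ε) Q := by
    rw [Filter.eventually_all_finset]
    intro Q _
    by_cases hc : Q.card = d ∧ ∀ u ∈ Q, ∀ v ∈ Q, u ≠ ν v
    · exact (pert_gen hc.1 (hq Q hc.1 hc.2)).mono fun ε h _ _ => h
    · exact Filter.Eventually.of_forall fun ε h1 h2 => absurd ⟨h1, h2⟩ hc
  obtain ⟨ε, h1, h2⟩ := (ev1.and ev2).exists
  obtain ⟨S, hSp, hSf, hSν⟩ := exists_fan (pert (fun v : V => v.1) q ε) (facV V) ν (by
      obtain ⟨g, hg, _, hc⟩ := h.enlarge (f := 0) (fun v _ => by simp)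
      exact ⟨_, facV_of hg hc⟩) fac_card (fun F hF => (h1 F hF).1) (fun F hF => (h1 F hF).2) (by
      intro F hF i hi
      obtain ⟨g, hg, hc, hm⟩ := mem_facV.1 hF
      have hmap := card_top1 g F hm
      have hi' : i.1 ∈ top1 V g := mem_top1.2 ⟨i.2, (hm i).1 hi⟩
      obtain ⟨g', hg', j, hj, hj1, hjn, ht⟩ := h.pivot hg (by rw [← hmap, Finset.card_map, hc]) hi'
      have hjF : (⟨j, hj⟩ : V) ∉ F := fun hh => by have := (hm _).1 hh; exact absurd this hj1.ne
      refine ⟨⟨j, hj⟩, hjF, mem_facV.2 ⟨g', hg', ?_, fun v => ?_⟩⟩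
      · rw [Finset.card_insert_of_notMem (fun hh => hjF (Finset.mem_of_mem_erase hh)), Finset.card_erase_of_mem hi, hc]
        omega
      · have : g' v.1 = 1 ↔ v.1 ∈ top1 V g' := by rw [mem_top1]; simp [v.2]
        rw [this, ht]
        simp only [Finset.mem_insert, Finset.mem_erase, mem_top1, Subtype.ext_iff, hm, ne_eq]
        simp) (by
      intro v
      obtain ⟨f, hf, hf1, _⟩ := h.expose hd v.2
      obtain ⟨g, hg, hs, hc⟩ := h.enlarge hf
      refine ⟨_, facV_of hg hc, ?_⟩
      simp only [Finset.mem_filter, Finset.mem_univ, true_and]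
      exact (mem_top1.1 (hs (mem_top1.2 ⟨v.2, hf1⟩))).2) νν (by
      intro v
      simp only [pert]
      rw [hqν]
      simp only [ν, smul_neg, neg_add]) (by
      intro F hF
      obtain ⟨g, hg, hc, hm⟩ := mem_facV.1 hF
      have hinj : Function.Injective ν := fun a b e => by rw [← νν a, e, νν]
      refine mem_facV.2 ⟨-g, h.sp_neg hg, by rw [Finset.card_image_of_injective _ hinj, hc], fun v => ?_⟩
      have : v ∈ F.image ν ↔ ν v ∈ F := by
        constructor
        · intro hv
          obtain ⟨a, ha, rfl⟩ := Finset.mem_image.1 hv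
          rwa [νν]
        · intro hv
          exact Finset.mem_image.2 ⟨_, hv, νν v⟩
      rw [this, hm]
      simp [ν])
  refine ⟨S, hSf, fun c Q hc hQ h0 => ?_⟩
  rw [hSν] at hQ
  rw [hSp] at h0
  obtain ⟨Q', hs, hc', hQ'⟩ := extendQ ν νν νne (by simpa using hn) Q hc hQ
  exact ((h2 Q' (Finset.mem_univ _) hc' hQ').mono hs).sum c h0

lemma Csv.star (hd : 4 ≤ d) (h : Csv V) (hE : (ed1 V).card + 4 * d = 2 * d * V.card) (hn : 2 * d < V.card) :
    ∃ x τ, τ ⊆ V ∧ x ∈ τ ∧ τ.card = d + 1 ∧ ∀ w ∈ τ, w ≠ x → ∃ f, Sp1 V f ∧ top1 V f = τ.erase w := by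
  obtain ⟨S, hf, hG⟩ := h.fan (by omega) hn.le
  have hFc : ∀ u v : V, S.Fc {u, v} ↔ ∃ f, Sp1 V f ∧ f u.1 = 1 ∧ f v.1 = 1 := by
    intro u v
    constructor
    · rintro ⟨F, hF, hs⟩
      rw [hf] at hF
      obtain ⟨g, hg, hc, hm⟩ := mem_facV.1 hF
      exact ⟨g, hg, (hm u).1 (hs (by simp)), (hm v).1 (hs (by simp))⟩
    · rintro ⟨f, hf', h1, h2⟩
      obtain ⟨g, hg, hs, hc⟩ := h.enlarge hf'
      refine ⟨_, hf ▸ facV_of hg hc, ?_⟩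
      intro a ha
      simp only [Finset.mem_filter, Finset.mem_univ, true_and]
      simp only [Finset.mem_insert, Finset.mem_singleton] at ha
      rcases ha with rfl | rfl
      · exact (mem_top1.1 (hs (mem_top1.2 ⟨a.2, h1⟩))).2
      · exact (mem_top1.1 (hs (mem_top1.2 ⟨a.2, h2⟩))).2
  have hed : S.ed.card = (ed1 V).card := by
    rw [← Finset.card_map ((Function.Embedding.subtype (· ∈ V)).prodMap (Function.Embedding.subtype (· ∈ V)))]
    congr 1
    ext ⟨a, b⟩
    simp only [Finset.mem_map, ed1, Finset.mem_filter, Finset.mem_product]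
    constructor
    · rintro ⟨⟨u, v⟩, he, hab⟩
      rw [CFan.mem_ed, hFc] at he
      simp only [Function.Embedding.prodMap, Function.Embedding.coeFn_mk, Prod.map_apply, Function.Embedding.coe_subtype, Prod.mk.injEq] at hab
      obtain ⟨rfl, rfl⟩ := hab
      exact ⟨⟨u.2, v.2⟩, fun e => he.1 (Subtype.ext e), he.2⟩
    · rintro ⟨⟨ha, hb⟩, hne, hex⟩
      exact ⟨(⟨a, ha⟩, ⟨b, hb⟩), CFan.mem_ed.2 ⟨fun e => hne (congrArg Subtype.val e), (hFc _ _).2 hex⟩, rfl⟩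
  obtain ⟨x, τ, hx, hτ, hw⟩ := CFan.exists_star (S := S) hd (by rw [hed]; simpa using hE) hG (by simpa using hn)
  refine ⟨x.1, τ.map (Function.Embedding.subtype _), ?_, ?_, by rw [Finset.card_map, hτ], ?_⟩
  · intro a ha
    obtain ⟨b, _, rfl⟩ := Finset.mem_map.1 ha
    exact b.2
  · exact Finset.mem_map.2 ⟨x, hx, rfl⟩
  · intro w hwτ hwx
    obtain ⟨b, hb, rfl⟩ := Finset.mem_map.1 hwτ
    have h1 := hw b hb (fun e => hwx (by rw [e]; rfl))
    rw [hf] at h1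
    obtain ⟨g, hg, hc, hm⟩ := mem_facV.1 h1
    refine ⟨g, hg, ?_⟩
    rw [← card_top1 g _ hm, Finset.map_erase]
end
end

noncomputable section
set_option linter.unusedVariables false
set_option linter.unusedSectionVars false

/-! ### Vertices with simplex links -/

/-- `x` is a vertex whose star is the boundary of a simplex with the facet `σ` removed -/
structure Stv {d : ℕ} (V : Finset (Fin d → ℝ)) (x : Fin d → ℝ) (σ : Finset (Fin d → ℝ)) : Prop where
  xV : x ∈ V
  sub : σ ⊆ V
  xσ : x ∉ σ
  card : σ.card = d
  fac : ∀ w ∈ σ, ∃ f, Sp1 V f ∧ top1 V f = insert x (σ.erase w)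

/-- the data extracted from a star vertex -/
structure Std {d : ℕ} (V : Finset (Fin d → ℝ)) (x : Fin d → ℝ) (σ : Finset (Fin d → ℝ))
    (c : (Fin d → ℝ) → (Fin d → ℝ) → ℝ) (fw : (Fin d → ℝ) → ((Fin d → ℝ) →ₗ[ℝ] ℝ)) (f : (Fin d → ℝ) →ₗ[ℝ] ℝ) : Prop where
  sp : ∀ w ∈ σ, Sp1 V (fw w)
  fx : ∀ w ∈ σ, fw w x = 1
  fs : ∀ w ∈ σ, ∀ s ∈ σ, s ≠ w → fw w s = 1
  fl : ∀ w ∈ σ, fw w w < 1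
  cd : ∀ y, y - x = ∑ s ∈ σ, c y s • (s - x)
  c0 : ∀ y ∈ V, ∀ s ∈ σ, 0 ≤ c y s
  cL : ∀ y ∈ V, y ∉ insert x σ → 1 < ∑ s ∈ σ, c y s
  cz : 1 < ∑ s ∈ σ, c 0 s
  f1 : ∀ s ∈ σ, f s = 1
  f2 : 1 < f x
  f3 : ∀ v ∈ V, v ∉ insert x σ → f v < 1
  anti : ∀ u ∈ insert x σ, -u ∉ insert x σ

section
variable {d : ℕ} {V : Finset (Fin d → ℝ)} {x : Fin d → ℝ} {σ : Finset (Fin d → ℝ)}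

lemma Stv.data (hd : 4 ≤ d) (h : Csv V) (H : Stv V x σ) : ∃ c fw f, Std V x σ c fw f := by
  have hex : ∀ w, ∃ f, w ∈ σ → (Sp1 V f ∧ top1 V f = insert x (σ.erase w)) := by
    intro w
    by_cases hw : w ∈ σ
    · obtain ⟨f, hf⟩ := H.fac w hw
      exact ⟨f, fun _ => hf⟩
    · exact ⟨0, fun h => absurd h hw⟩
  choose fw hfw using hex
  have sp : ∀ w ∈ σ, Sp1 V (fw w) := fun w hw => (hfw w hw).1
  have fx : ∀ w ∈ σ, fw w x = 1 := fun w hw => (mem_top1.1 ((hfw w hw).2 ▸ Finset.mem_insert_self _ _ : x ∈ top1 V (fw w))).2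
  have fs : ∀ w ∈ σ, ∀ s ∈ σ, s ≠ w → fw w s = 1 := fun w hw s hs hne => by
    have : s ∈ top1 V (fw w) := by
      rw [(hfw w hw).2]
      exact Finset.mem_insert_of_mem (Finset.mem_erase.2 ⟨hne, hs⟩)
    exact (mem_top1.1 this).2
  have fl : ∀ w ∈ σ, fw w w < 1 := fun w hw => by
    refine lt_of_le_of_ne (sp w hw w (H.sub hw)) fun e => ?_
    have : w ∈ top1 V (fw w) := mem_top1.2 ⟨H.sub hw, e⟩
    rw [(hfw w hw).2] at this
    rcases Finset.mem_insert.1 this with e | e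
    · exact H.xσ (e ▸ hw)
    · exact Finset.notMem_erase _ _ e
  have hfsum : ∀ w ∈ σ, ∀ a : (Fin d → ℝ) → ℝ, fw w (∑ s ∈ σ, a s • (s - x)) = a w * (fw w w - 1) := by
    intro w hw a
    rw [map_sum, Finset.sum_eq_single w]
    · rw [map_smul, map_sub, fx w hw]; rfl
    · intro s hs hne
      rw [map_smul, map_sub, fx w hw, fs w hw s hs hne]; simp
    · exact fun hh => absurd hw hh
  have hli : LinearIndependent ℝ (fun s : σ => (s : Fin d → ℝ) - x) := by
    rw [Fintype.linearIndependent_iff]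
    intro g hg i
    have h1 := hfsum i.1 i.2 (fun v => if hv : v ∈ σ then g ⟨v, hv⟩ else 0)
    have h2 : ∑ s ∈ σ, (if hv : s ∈ σ then g ⟨s, hv⟩ else 0) • (s - x) = 0 := by
      rw [← hg, ← Finset.sum_coe_sort]
      exact Finset.sum_congr rfl fun v _ => by simp
    rw [h2, map_zero] at h1
    have h3 := (mul_eq_zero.1 h1.symm).resolve_right (by linarith [fl i.1 i.2])
    simpa using h3
  have hspan : Submodule.span ℝ (Set.range fun s : σ => (s : Fin d → ℝ) - x) = ⊤ :=
    hli.span_eq_top_of_card_eq_finrank' (by simp [H.card])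
  have hc : ∀ y, ∃ c : (Fin d → ℝ) → ℝ, y - x = ∑ s ∈ σ, c s • (s - x) := by
    intro y
    have hy : y - x ∈ Submodule.span ℝ (Set.range fun s : σ => (s : Fin d → ℝ) - x) := by rw [hspan]; exact Submodule.mem_top
    obtain ⟨c, hc⟩ := (Submodule.mem_span_range_iff_exists_fun ℝ).1 hy
    refine ⟨fun v => if hv : v ∈ σ then c ⟨v, hv⟩ else 0, ?_⟩
    rw [← hc, ← Finset.sum_coe_sort σ]
    exact Finset.sum_congr rfl fun v _ => by simp
  choose c cd using hc
  have cw : ∀ y, ∀ w ∈ σ, c y w = (1 - fw w y) / (1 - fw w w) := by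
    intro y w hw
    have h1 := congrArg (fw w) (cd y)
    rw [hfsum w hw, map_sub, fx w hw] at h1
    have := fl w hw
    rw [eq_div_iff (by linarith)]
    linarith
  have c0 : ∀ y ∈ V, ∀ s ∈ σ, 0 ≤ c y s := by
    intro y hy s hs
    rw [cw y s hs]
    exact div_nonneg (by linarith [sp s hs y hy]) (by linarith [fl s hs])
  have cL : ∀ y ∈ V, y ∉ insert x σ → 1 < ∑ s ∈ σ, c y s := by
    intro y hy hyn
    by_contra hle
    push Not at hle
    apply h.ext y hy
    rw [Finset.mem_convexHull']
    have hsubset : insert x σ ⊆ V.erase y := by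
      intro a ha
      refine Finset.mem_erase.2 ⟨fun e => hyn (e ▸ ha), ?_⟩
      rcases Finset.mem_insert.1 ha with rfl | ha
      · exact H.xV
      · exact H.sub ha
    have hw : ∃ w : (Fin d → ℝ) → ℝ, (∀ a ∈ insert x σ, 0 ≤ w a) ∧ (∀ a, a ∉ insert x σ → w a = 0) ∧ ∑ a ∈ insert x σ, w a = 1 ∧ ∑ a ∈ insert x σ, w a • a = y := by
      refine ⟨fun a => if a = x then 1 - ∑ s ∈ σ, c y s else if a ∈ σ then c y a else 0, ?_, ?_, ?_, ?_⟩
      · intro a ha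
        rcases Finset.mem_insert.1 ha with rfl | ha
        · simp; exact hle
        · have : a ≠ x := fun e => H.xσ (e ▸ ha)
          simp [this, ha, c0 y hy a ha]
      · intro a ha
        simp only [Finset.mem_insert, not_or] at ha
        simp [ha.1, ha.2]
      · rw [Finset.sum_insert H.xσ]
        have : ∑ a ∈ σ, (if a = x then 1 - ∑ s ∈ σ, c y s else if a ∈ σ then c y a else 0) = ∑ a ∈ σ, c y a :=
          Finset.sum_congr rfl fun a ha => by
            have hne : a ≠ x := fun e => H.xσ (e ▸ ha)
            rw [if_neg hne, if_pos ha]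
        rw [this]; simp
      · rw [Finset.sum_insert H.xσ]
        have : ∑ a ∈ σ, (if a = x then 1 - ∑ s ∈ σ, c y s else if a ∈ σ then c y a else 0) • a = ∑ a ∈ σ, c y a • a :=
          Finset.sum_congr rfl fun a ha => by
            have hne : a ≠ x := fun e => H.xσ (e ▸ ha)
            rw [if_neg hne, if_pos ha]
        beta_reduce
        rw [this, if_pos rfl]
        have h2 := cd y
        simp only [smul_sub] at h2
        rw [Finset.sum_sub_distrib, ← Finset.sum_smul] at h2
        refine Eq.trans ?_ (eq_add_of_sub_eq h2).symm
        rw [sub_smul, one_smul]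
        abel
    obtain ⟨w, hw0, hwn, hw1, hwy⟩ := hw
    refine ⟨w, fun a ha => ?_, ?_, ?_⟩
    · by_cases ha' : a ∈ insert x σ
      · exact hw0 a ha'
      · exact (hwn a ha').ge
    · rw [← hw1]
      exact (Finset.sum_subset hsubset fun a _ ha => hwn a ha).symm
    · exact (Finset.sum_subset (f := fun a => w a • a) hsubset (fun a _ ha => by rw [hwn a ha, zero_smul])).symm.trans hwy
  have hthird : ∀ u v, ∃ w ∈ σ, w ≠ u ∧ w ≠ v := by
    intro u v
    have : ∃ w ∈ σ, w ∉ ({u, v} : Finset (Fin d → ℝ)) := by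
      apply Finset.exists_mem_notMem_of_card_lt_card
      have := Finset.card_le_two (a := u) (b := v)
      rw [H.card]; omega
    obtain ⟨w, hw, hn⟩ := this
    simp only [Finset.mem_insert, Finset.mem_singleton, not_or] at hn
    exact ⟨w, hw, hn⟩
  have anti : ∀ u ∈ insert x σ, -u ∉ insert x σ := by
    intro u hu hnu
    obtain ⟨w, hw, h1, h2⟩ := hthird u (-u)
    have key : ∀ a ∈ insert x σ, w ≠ a → fw w a = 1 := by
      intro a ha hne
      rcases Finset.mem_insert.1 ha with rfl | ha
      · exact fx w hw
      · exact fs w hw a ha hne.symm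
    have h3 := key u hu h1
    have h4 := key (-u) hnu h2
    rw [map_neg] at h4
    linarith
  have cz : 1 < ∑ s ∈ σ, c 0 s := by
    obtain ⟨s, hs, _⟩ := hthird x x
    have h1 := cL (-s) (h.neg s (H.sub hs)) (anti s (Finset.mem_insert_of_mem hs))
    have h2 : ∑ w ∈ σ, c s w = 1 := by
      rw [Finset.sum_eq_single s]
      · rw [cw s s hs, div_self]; linarith [fl s hs]
      · intro w hw hne
        rw [cw s w hw, fs w hw s hs (Ne.symm hne)]; simp
      · exact fun hh => absurd hs hh
    have h3 : ∑ w ∈ σ, c s w + ∑ w ∈ σ, c (-s) w = 2 * ∑ w ∈ σ, c 0 w := by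
      rw [← Finset.sum_add_distrib, Finset.mul_sum]
      refine Finset.sum_congr rfl fun w hw => ?_
      rw [cw s w hw, cw (-s) w hw, cw 0 w hw, map_neg, map_zero]
      ring
    linarith
  set C := ∑ s ∈ σ, c 0 s with hC
  let f : (Fin d → ℝ) →ₗ[ℝ] ℝ := (C - 1)⁻¹ • ∑ w ∈ σ, (1 - fw w w)⁻¹ • fw w
  have hf : ∀ y, f y = (C - ∑ s ∈ σ, c y s) / (C - 1) := by
    intro y
    simp only [f, LinearMap.smul_apply, LinearMap.sum_apply, smul_eq_mul]
    rw [div_eq_inv_mul, hC, ← Finset.sum_sub_distrib]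
    congr 1
    refine Finset.sum_congr rfl fun w hw => ?_
    rw [cw y w hw, cw 0 w hw, map_zero]
    ring
  have hC1 : 0 < C - 1 := by linarith
  refine ⟨c, fw, f, sp, fx, fs, fl, cd, c0, cL, cz, ?_, ?_, ?_, anti⟩
  · intro s hs
    have h2 : ∑ w ∈ σ, c s w = 1 := by
      rw [Finset.sum_eq_single s]
      · rw [cw s s hs, div_self]; linarith [fl s hs]
      · intro w hw hne
        rw [cw s w hw, fs w hw s hs (Ne.symm hne)]; simp
      · exact fun hh => absurd hs hh
    rw [hf, h2, div_self hC1.ne']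
  · have h2 : ∑ w ∈ σ, c x w = 0 := Finset.sum_eq_zero fun w hw => by
      rw [cw x w hw, fx w hw]; simp
    rw [hf, h2, lt_div_iff₀ hC1]; linarith
  · intro v hv hvn
    rw [hf, div_lt_one hC1]
    linarith [cL v hv hvn]

variable {c : (Fin d → ℝ) → (Fin d → ℝ) → ℝ} {fw : (Fin d → ℝ) → ((Fin d → ℝ) →ₗ[ℝ] ℝ)} {f : (Fin d → ℝ) →ₗ[ℝ] ℝ}

lemma Stv.third (hd : 4 ≤ d) (H : Stv V x σ) (u v : Fin d → ℝ) : ∃ w ∈ σ, w ≠ u ∧ w ≠ v := by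
  have : ∃ w ∈ σ, w ∉ ({u, v} : Finset (Fin d → ℝ)) := by
    apply Finset.exists_mem_notMem_of_card_lt_card
    have := Finset.card_le_two (a := u) (b := v)
    rw [H.card]; omega
  obtain ⟨w, hw, hn⟩ := this
  simp only [Finset.mem_insert, Finset.mem_singleton, not_or] at hn
  exact ⟨w, hw, hn⟩

/-- `σ` is linearly independent -/
lemma Std.ind (D : Std V x σ c fw f) (a : (Fin d → ℝ) → ℝ) (h : ∑ s ∈ σ, a s • s = 0) : ∀ s ∈ σ, a s = 0 := by
  have h0 : ∑ s ∈ σ, a s = 0 := by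
    have := congrArg f h
    rw [map_sum, map_zero] at this
    rw [← this]
    exact Finset.sum_congr rfl fun s hs => by rw [map_smul, D.f1 s hs]; simp
  intro w hw
  have h1 := congrArg (fw w) h
  rw [map_sum, map_zero, ← Finset.add_sum_erase _ _ hw] at h1
  rw [← Finset.add_sum_erase _ _ hw] at h0
  have e : ∑ s ∈ σ.erase w, fw w (a s • s) = ∑ s ∈ σ.erase w, a s :=
    Finset.sum_congr rfl fun s hs => by
      rw [map_smul, D.fs w hw s (Finset.mem_of_mem_erase hs) (Finset.ne_of_mem_erase hs)]; simp
  rw [e, map_smul, smul_eq_mul] at h1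
  have h2 : a w * (fw w w - 1) = 0 := by linarith
  exact (mul_eq_zero.1 h2).resolve_right (by linarith [D.fl w hw])

lemma Std.xval (D : Std V x σ c fw f) (g : (Fin d → ℝ) →ₗ[ℝ] ℝ) (y : Fin d → ℝ) : g y - g x = ∑ s ∈ σ, c y s * (g s - g x) := by
  have := congrArg g (D.cd y)
  rw [map_sub, map_sum] at this
  rw [this]
  exact Finset.sum_congr rfl fun s hs => by rw [map_smul, map_sub]; rfl

lemma Std.beyond (D : Std V x σ c fw f) {g : (Fin d → ℝ) →ₗ[ℝ] ℝ} (hg : ∀ s ∈ σ, g s ≤ 1) (hx : 1 < g x) {v} (hv : v ∈ V)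
    (hn : v ∉ insert x σ) : g v < 1 := by
  have h1 := D.xval g v
  have h2 : ∑ s ∈ σ, c v s * (g s - g x) ≤ ∑ s ∈ σ, c v s * (1 - g x) :=
    Finset.sum_le_sum fun s hs => mul_le_mul_of_nonneg_left (by linarith [hg s hs]) (D.c0 v hv s hs)
  rw [← Finset.sum_mul] at h2
  have := D.cL v hv hn
  nlinarith

/-- neighbours of `x` -/
lemma Std.nbr (h : Csv V) (H : Stv V x σ) (D : Std V x σ c fw f) {v} (hv : v ∈ V) (hvx : v ≠ x) {g : (Fin d → ℝ) →ₗ[ℝ] ℝ} (hg : Sp1 V g)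
    (hgx : g x = 1) (hgv : g v = 1) : v ∈ σ := by
  by_contra hn
  have h1 := D.xval g v
  rw [hgx, hgv, sub_self] at h1
  have hz : ∀ s ∈ σ, c v s * (g s - 1) = 0 := by
    have := (Finset.sum_eq_zero_iff_of_nonpos (s := σ) (f := fun s => c v s * (g s - 1)) (fun s hs =>
      mul_nonpos_of_nonneg_of_nonpos (D.c0 v hv s hs) (by linarith [hg s (H.sub hs)]))).1 h1.symm
    exact this
  have hz' : ∀ s ∈ σ, s ∉ top1 V g → c v s = 0 := by
    intro s hs hns
    rcases mul_eq_zero.1 (hz s hs) with h | h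
    · exact h
    · exact absurd (mem_top1.2 ⟨H.sub hs, by linarith⟩) hns
  have hvt : v ∈ top1 V g := mem_top1.2 ⟨hv, hgv⟩
  have hxt : x ∈ top1 V g := mem_top1.2 ⟨H.xV, hgx⟩
  have key := h.ind g hg (fun u => (if u = v then 1 else 0) - (if u = x then 1 - ∑ s ∈ σ, c v s else 0) - (if u ∈ σ then c v u else 0)) (by
    simp only [sub_smul, ite_smul, one_smul, zero_smul]
    rw [Finset.sum_sub_distrib, Finset.sum_sub_distrib, Finset.sum_ite_eq', Finset.sum_ite_eq', if_pos hvt, if_pos hxt,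
      ← Finset.sum_filter]
    have e : ∑ a ∈ (top1 V g).filter (fun a => a ∈ σ), c v a • a = ∑ a ∈ σ, c v a • a := by
      apply Finset.sum_subset
      · intro a ha
        exact (Finset.mem_filter.1 ha).2
      · intro a ha hna
        rw [hz' a ha (fun hh => hna (Finset.mem_filter.2 ⟨hh, ha⟩)), zero_smul]
    rw [e]
    have h2 := D.cd v
    simp only [smul_sub] at h2
    rw [Finset.sum_sub_distrib, ← Finset.sum_smul] at h2
    have h3 : ∑ s ∈ σ, c v s • s = v - x + (∑ s ∈ σ, c v s) • x := by rw [h2]; abel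
    rw [h3]
    module) v hvt
  simp [hvx, hn] at key
end
end

noncomputable section
set_option linter.unusedVariables false
set_option linter.unusedSectionVars false

/-! ### Removing a pair of antipodal star vertices -/

/-- remove `x` and `-x` -/
def del {d : ℕ} (V : Finset (Fin d → ℝ)) (x : Fin d → ℝ) : Finset (Fin d → ℝ) := (V.erase x).erase (-x)

section
variable {d : ℕ} {V : Finset (Fin d → ℝ)} {x : Fin d → ℝ} {σ : Finset (Fin d → ℝ)}
variable {c : (Fin d → ℝ) → (Fin d → ℝ) → ℝ} {fw : (Fin d → ℝ) → ((Fin d → ℝ) →ₗ[ℝ] ℝ)} {f : (Fin d → ℝ) →ₗ[ℝ] ℝ}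

lemma mem_del {v : Fin d → ℝ} : v ∈ del V x ↔ v ∈ V ∧ v ≠ x ∧ v ≠ -x := by
  simp only [del, Finset.mem_erase]; tauto

lemma del_neg (hneg : ∀ v ∈ V, -v ∈ V) {v : Fin d → ℝ} (hv : v ∈ del V x) : -v ∈ del V x := by
  rw [mem_del] at hv ⊢
  exact ⟨hneg v hv.1, fun e => hv.2.2 (by rw [← e, neg_neg]), fun e => hv.2.1 (neg_injective e)⟩

lemma Std.sub_del (H : Stv V x σ) (D : Std V x σ c fw f) : σ ⊆ del V x := by
  intro s hs
  refine mem_del.2 ⟨H.sub hs, fun e => H.xσ (e ▸ hs), fun e => ?_⟩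
  exact D.anti x (Finset.mem_insert_self _ _) (Finset.mem_insert_of_mem (e ▸ hs))

lemma Std.xcomb (D : Std V x σ c fw f) : (∑ s ∈ σ, c 0 s - 1) • x = ∑ s ∈ σ, c 0 s • s := by
  have h2 := D.cd 0
  simp only [smul_sub] at h2
  rw [Finset.sum_sub_distrib, ← Finset.sum_smul] at h2
  rw [sub_smul, one_smul]
  have h3 : ∑ s ∈ σ, c 0 s • s = (0 - x) + (∑ s ∈ σ, c 0 s) • x := by rw [h2]; abel
  rw [h3]
  abel

lemma sp_ext {g : (Fin d → ℝ) →ₗ[ℝ] ℝ} (hg : Sp1 (del V x) g) (h1 : g x ≤ 1) (h2 : -1 ≤ g x) : Sp1 V g := by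
  intro v hv
  by_cases e1 : v = x
  · rw [e1]; exact h1
  by_cases e2 : v = -x
  · rw [e2, map_neg]; linarith
  exact hg v (mem_del.2 ⟨hv, e1, e2⟩)

lemma sp_restr {g : (Fin d → ℝ) →ₗ[ℝ] ℝ} (hg : Sp1 V g) : Sp1 (del V x) g := fun v hv => hg v (mem_del.1 hv).1

lemma Std.top_sub (H : Stv V x σ) (D : Std V x σ c fw f) {g : (Fin d → ℝ) →ₗ[ℝ] ℝ} (hg : Sp1 (del V x) g) (hx : 1 < g x) :
    top1 (del V x) g ⊆ σ := by
  intro v hv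
  rw [mem_top1] at hv
  by_contra hn
  have := D.beyond (fun s hs => hg s (D.sub_del H hs)) hx (mem_del.1 hv.1).1 (by
    rw [Finset.mem_insert, not_or]; exact ⟨(mem_del.1 hv.1).2.1, hn⟩)
  linarith [hv.2]

lemma sp_del_neg (hneg : ∀ v ∈ V, -v ∈ V) {g : (Fin d → ℝ) →ₗ[ℝ] ℝ} (hg : Sp1 (del V x) g) : Sp1 (del V x) (-g) := by
  intro v hv
  have := hg (-v) (del_neg hneg hv)
  rw [map_neg] at this
  exact this

lemma Csv.rem (h : Csv V) (H : Stv V x σ) (D : Std V x σ c fw f) (hd : 4 ≤ d) : Csv (del V x) where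
  neg := fun v hv => del_neg h.neg hv
  ne := by
    obtain ⟨w, hw, _⟩ := H.third hd x x
    exact ⟨w, D.sub_del H hw⟩
  span := by
    rw [eq_top_iff, ← h.span, Submodule.span_le]
    have hx : x ∈ Submodule.span ℝ ((del V x : Finset (Fin d → ℝ)) : Set (Fin d → ℝ)) := by
      have h1 : (∑ s ∈ σ, c 0 s - 1) • x ∈ Submodule.span ℝ ((del V x : Finset (Fin d → ℝ)) : Set (Fin d → ℝ)) := by
        rw [D.xcomb]
        exact Submodule.sum_mem _ fun s hs => Submodule.smul_mem _ _ (Submodule.subset_span (D.sub_del H hs))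
      have h2 := D.cz
      have h3 : ∑ s ∈ σ, c 0 s - 1 ≠ 0 := by linarith
      exact (Submodule.smul_mem_iff _ h3).1 h1
    intro v hv
    by_cases e1 : v = x
    · rw [e1]; exact hx
    by_cases e2 : v = -x
    · rw [e2]; exact Submodule.neg_mem _ hx
    exact Submodule.subset_span (mem_del.2 ⟨hv, e1, e2⟩)
  ext := by
    intro v hv hm
    apply h.ext v (mem_del.1 hv).1
    refine convexHull_mono ?_ hm
    intro u hu
    have hu := Finset.mem_erase.1 (Finset.mem_coe.1 hu)
    exact Finset.mem_coe.2 (Finset.mem_erase.2 ⟨hu.1, (mem_del.1 hu.2).1⟩)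
  ind := by
    have key : ∀ g, Sp1 (del V x) g → 1 < g x → ∀ c : (Fin d → ℝ) → ℝ, ∑ v ∈ top1 (del V x) g, c v • v = 0 → ∀ v ∈ top1 (del V x) g, c v = 0 := by
      intro g hg hx a ha v hv
      have hsub := D.top_sub H hg hx
      have := D.ind (fun u => if u ∈ top1 (del V x) g then a u else 0) (by
        rw [← ha, ← Finset.sum_subset hsub]
        · exact Finset.sum_congr rfl fun u hu => by rw [if_pos hu]
        · intro u _ hu
          rw [if_neg hu, zero_smul]) v (hsub hv)
      simpa [hv] using this
    intro g hg a ha v hv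
    rcases lt_or_ge 1 (g x) with hx | hx
    · exact key g hg hx a ha v hv
    rcases lt_or_ge (g x) (-1) with hx' | hx'
    · have hm : ∀ u, u ∈ top1 (del V x) (-g) ↔ -u ∈ top1 (del V x) g := by
        intro u
        rw [mem_top1, mem_top1, map_neg]
        refine and_congr ⟨fun hu => del_neg h.neg hu, fun hu => ?_⟩ Iff.rfl
        simpa using del_neg h.neg hu
      have := key (-g) (sp_del_neg h.neg hg) (by simp; linarith) (fun u => a (-u)) (by
        rw [← neg_eq_zero, ← Finset.sum_neg_distrib, ← ha]
        refine Finset.sum_bij' (fun u _ => -u) (fun u _ => -u) ?_ ?_ ?_ ?_ ?_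
        · exact fun u hu => (hm u).1 hu
        · exact fun u hu => (hm (-u)).2 (by simpa using hu)
        · simp
        · simp
        · intro u hu; simp) (-v) ((hm (-v)).2 (by simpa using hv))
      simpa using this
    · have hsp := sp_ext hg hx hx'
      have hsub : top1 (del V x) g ⊆ top1 V g := fun u hu => mem_top1.2 ⟨(mem_del.1 (mem_top1.1 hu).1).1, (mem_top1.1 hu).2⟩
      have := h.ind g hsp (fun u => if u ∈ top1 (del V x) g then a u else 0) (by
        rw [← ha, ← Finset.sum_subset hsub]
        · exact Finset.sum_congr rfl fun u hu => by rw [if_pos hu]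
        · intro u _ hu
          rw [if_neg hu, zero_smul]) v (hsub hv)
      simpa [hv] using this

/-- edges among the remaining vertices are unchanged -/
lemma Std.edge_del (h : Csv V) (H : Stv V x σ) (D : Std V x σ c fw f) (hd : 4 ≤ d) {u v : Fin d → ℝ} (hu : u ∈ del V x) (hv : v ∈ del V x)
    {g : (Fin d → ℝ) →ₗ[ℝ] ℝ} (hg : Sp1 (del V x) g) (hgu : g u = 1) (hgv : g v = 1) : ∃ f, Sp1 V f ∧ f u = 1 ∧ f v = 1 := by
  have key : ∀ (g : (Fin d → ℝ) →ₗ[ℝ] ℝ) u v, u ∈ del V x → v ∈ del V x → Sp1 (del V x) g → 1 < g x → g u = 1 → g v = 1 → ∃ f, Sp1 V f ∧ f u = 1 ∧ f v = 1 := by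
    intro g u v hu hv hg hx hgu hgv
    have hu' := D.top_sub H hg hx (mem_top1.2 ⟨hu, hgu⟩)
    have hv' := D.top_sub H hg hx (mem_top1.2 ⟨hv, hgv⟩)
    obtain ⟨w, hw, h1, h2⟩ := H.third hd u v
    exact ⟨fw w, D.sp w hw, D.fs w hw u hu' h1.symm, D.fs w hw v hv' h2.symm⟩
  rcases lt_or_ge 1 (g x) with hx | hx
  · exact key g u v hu hv hg hx hgu hgv
  rcases lt_or_ge (g x) (-1) with hx' | hx'
  · obtain ⟨f', h1, h2, h3⟩ := key (-g) (-u) (-v) (del_neg h.neg hu) (del_neg h.neg hv) (sp_del_neg h.neg hg) (by simp; linarith)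
      (by simp [hgu]) (by simp [hgv])
    exact ⟨-f', h.sp_neg h1, by simpa using h2, by simpa using h3⟩
  · exact ⟨g, sp_ext hg hx hx', hgu, hgv⟩

lemma Std.ed_card (h : Csv V) (H : Stv V x σ) (D : Std V x σ c fw f) (hd : 4 ≤ d) : (ed1 V).card = (ed1 (del V x)).card + 4 * d := by
  have hxn : -x ≠ x := h.neg_ne (by omega) H.xV
  have hnx : -x ∉ σ := fun hh => D.anti x (Finset.mem_insert_self _ _) (Finset.mem_insert_of_mem hh)
  have hmem : ∀ V : Finset (Fin d → ℝ), ∀ a b, (a, b) ∈ ed1 V ↔ (a ∈ V ∧ b ∈ V) ∧ a ≠ b ∧ ∃ f, Sp1 V f ∧ f a = 1 ∧ f b = 1 := by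
    intro V a b
    simp [ed1]
  have nbr : ∀ v ∈ V, v ≠ x → ((∃ g, Sp1 V g ∧ g x = 1 ∧ g v = 1) ↔ v ∈ σ) := by
    intro v hv hvx
    constructor
    · rintro ⟨g, hg, h1, h2⟩
      exact D.nbr h H hv hvx hg h1 h2
    · intro hs
      obtain ⟨w, hw, h1, h2⟩ := H.third hd v v
      exact ⟨fw w, D.sp w hw, D.fx w hw, D.fs w hw v hs h1.symm⟩
  have nbr' : ∀ v ∈ V, v ≠ -x → ((∃ g, Sp1 V g ∧ g (-x) = 1 ∧ g v = 1) ↔ -v ∈ σ) := by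
    intro v hv hvx
    rw [← nbr (-v) (h.neg v hv) (fun e => hvx (by rw [← e, neg_neg]))]
    constructor
    · rintro ⟨g, hg, h1, h2⟩
      exact ⟨-g, h.sp_neg hg, by simpa using h1, by simpa using h2⟩
    · rintro ⟨g, hg, h1, h2⟩
      exact ⟨-g, h.sp_neg hg, by simpa using h1, by simpa using h2⟩
  have sw : ∀ a b : Fin d → ℝ, (∃ g, Sp1 V g ∧ g a = 1 ∧ g b = 1) ↔ (∃ g, Sp1 V g ∧ g b = 1 ∧ g a = 1) := by
    intro a b
    exact ⟨fun ⟨g, h1, h2, h3⟩ => ⟨g, h1, h3, h2⟩, fun ⟨g, h1, h2, h3⟩ => ⟨g, h1, h3, h2⟩⟩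
  set A := σ.image (fun s => (x, s)) with hA
  set B := σ.image (fun s => (s, x)) with hB
  set A' := σ.image (fun s => (-x, -s)) with hA'
  set B' := σ.image (fun s => (-s, -x)) with hB'
  have mA : ∀ a b, (a, b) ∈ A ↔ a = x ∧ b ∈ σ := by
    intro a b; simp only [hA, Finset.mem_image, Prod.mk.injEq]; constructor
    · rintro ⟨s, hs, rfl, rfl⟩; exact ⟨rfl, hs⟩
    · rintro ⟨h1, hs⟩; exact ⟨b, hs, h1.symm, rfl⟩
  have mB : ∀ a b, (a, b) ∈ B ↔ b = x ∧ a ∈ σ := by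
    intro a b; simp only [hB, Finset.mem_image, Prod.mk.injEq]; constructor
    · rintro ⟨s, hs, rfl, rfl⟩; exact ⟨rfl, hs⟩
    · rintro ⟨h1, hs⟩; exact ⟨a, hs, rfl, h1.symm⟩
  have mA' : ∀ a b, (a, b) ∈ A' ↔ a = -x ∧ -b ∈ σ := by
    intro a b; simp only [hA', Finset.mem_image, Prod.mk.injEq]; constructor
    · rintro ⟨s, hs, rfl, rfl⟩; exact ⟨rfl, by simpa using hs⟩
    · rintro ⟨h1, hs⟩; exact ⟨-b, hs, h1.symm, by simp⟩
  have mB' : ∀ a b, (a, b) ∈ B' ↔ b = -x ∧ -a ∈ σ := by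
    intro a b; simp only [hB', Finset.mem_image, Prod.mk.injEq]; constructor
    · rintro ⟨s, hs, rfl, rfl⟩; exact ⟨rfl, by simpa using hs⟩
    · rintro ⟨h1, hs⟩; exact ⟨-a, hs, by simp, h1.symm⟩
  have cA : A.card = d := by
    rw [hA, Finset.card_image_of_injective _ (fun a b hab => (Prod.mk.inj hab).2), H.card]
  have cB : B.card = d := by
    rw [hB, Finset.card_image_of_injective _ (fun a b hab => (Prod.mk.inj hab).1), H.card]
  have cA' : A'.card = d := by
    rw [hA', Finset.card_image_of_injective _ (fun a b hab => neg_injective (Prod.mk.inj hab).2), H.card]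
  have cB' : B'.card = d := by
    rw [hB', Finset.card_image_of_injective _ (fun a b hab => neg_injective (Prod.mk.inj hab).1), H.card]
  have hsd := D.sub_del H
  have hns : ∀ s, -s ∈ σ → s ∈ V := fun s hs => by simpa using h.neg _ (H.sub hs)
  have hxs := H.xσ
  have heq : ed1 V = (((ed1 (del V x) ∪ A) ∪ B) ∪ A') ∪ B' := by
    ext ⟨a, b⟩
    simp only [Finset.mem_union, mA, mB, mA', mB', hmem]
    constructor
    · rintro ⟨⟨ha, hb⟩, hab, hg⟩
      by_cases e1 : a = x
      · rw [e1] at hg hab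
        exact Or.inl (Or.inl (Or.inl (Or.inr ⟨e1, (nbr b hb (Ne.symm hab)).1 hg⟩)))
      by_cases e2 : b = x
      · rw [e2] at hg hab
        exact Or.inl (Or.inl (Or.inr ⟨e2, (nbr a ha hab).1 ((sw _ _).1 hg)⟩))
      by_cases e3 : a = -x
      · rw [e3] at hg hab
        exact Or.inl (Or.inr ⟨e3, (nbr' b hb (Ne.symm hab)).1 hg⟩)
      by_cases e4 : b = -x
      · rw [e4] at hg hab
        exact (Or.inr ⟨e4, (nbr' a ha hab).1 ((sw _ _).1 hg)⟩)
      obtain ⟨g, hg, h1, h2⟩ := hg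
      exact Or.inl (Or.inl (Or.inl (Or.inl ⟨⟨mem_del.2 ⟨ha, e1, e3⟩, mem_del.2 ⟨hb, e2, e4⟩⟩, hab, g, sp_restr hg, h1, h2⟩)))
    · rintro ((((⟨⟨ha, hb⟩, hab, g, hg, h1, h2⟩ | ⟨e, hs⟩) | ⟨e, hs⟩) | ⟨e, hs⟩) | ⟨e, hs⟩)
      · exact ⟨⟨(mem_del.1 ha).1, (mem_del.1 hb).1⟩, hab, D.edge_del h H hd ha hb hg h1 h2⟩
      · rw [e]
        have hne : b ≠ x := fun e => hxs (e ▸ hs)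
        exact ⟨⟨H.xV, H.sub hs⟩, hne.symm, (nbr b (H.sub hs) hne).2 hs⟩
      · rw [e]
        have hne : a ≠ x := fun e => hxs (e ▸ hs)
        exact ⟨⟨H.sub hs, H.xV⟩, hne, (sw _ _).1 ((nbr a (H.sub hs) hne).2 hs)⟩
      · rw [e]
        have hne : b ≠ -x := fun e => hxs (by rw [e, neg_neg] at hs; exact hs)
        exact ⟨⟨h.neg _ H.xV, hns b hs⟩, hne.symm, (nbr' b (hns b hs) hne).2 hs⟩
      · rw [e]
        have hne : a ≠ -x := fun e => hxs (by rw [e, neg_neg] at hs; exact hs)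
        exact ⟨⟨hns a hs, h.neg _ H.xV⟩, hne, (sw _ _).1 ((nbr' a (hns a hs) hne).2 hs)⟩
  have d1 : Disjoint (ed1 (del V x)) A := by
    rw [Finset.disjoint_left]; rintro ⟨a, b⟩ h1 h2
    rw [hmem] at h1; rw [mA] at h2
    exact (mem_del.1 h1.1.1).2.1 h2.1
  have d2 : Disjoint (ed1 (del V x) ∪ A) B := by
    rw [Finset.disjoint_left]; rintro ⟨a, b⟩ h1 h2
    rw [Finset.mem_union, hmem, mA] at h1; rw [mB] at h2
    rcases h1 with h1 | h1
    · exact (mem_del.1 h1.1.2).2.1 h2.1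
    · exact hxs (h1.1 ▸ h2.2)
  have d3 : Disjoint ((ed1 (del V x) ∪ A) ∪ B) A' := by
    rw [Finset.disjoint_left]; rintro ⟨a, b⟩ h1 h2
    rw [Finset.mem_union, Finset.mem_union, hmem, mA, mB] at h1; rw [mA'] at h2
    rcases h1 with (h1 | h1) | h1
    · exact (mem_del.1 h1.1.1).2.2 h2.1
    · exact hxn (h2.1 ▸ h1.1)
    · exact hnx (h2.1 ▸ h1.2)
  have d4 : Disjoint (((ed1 (del V x) ∪ A) ∪ B) ∪ A') B' := by
    rw [Finset.disjoint_left]; rintro ⟨a, b⟩ h1 h2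
    rw [Finset.mem_union, Finset.mem_union, Finset.mem_union, hmem, mA, mB, mA'] at h1; rw [mB'] at h2
    rcases h1 with ((h1 | h1) | h1) | h1
    · exact (mem_del.1 h1.1.2).2.2 h2.1
    · exact hnx (h2.1 ▸ h1.2)
    · exact hxn (h2.1 ▸ h1.1)
    · have h3 := h2.2
      rw [h1.1, neg_neg] at h3
      exact hxs h3
  rw [heq, Finset.card_union_of_disjoint d4, Finset.card_union_of_disjoint d3, Finset.card_union_of_disjoint d2, Finset.card_union_of_disjoint d1,
    cA, cB, cA', cB']
  ring

lemma del_card (h : Csv V) (hd : 0 < d) (hx : x ∈ V) : V.card = (del V x).card + 2 := by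
  have h1 : -x ∈ V.erase x := Finset.mem_erase.2 ⟨h.neg_ne hd hx, h.neg x hx⟩
  have h2 := Finset.card_erase_add_one h1
  have h3 := Finset.card_erase_add_one hx
  rw [del]; omega

lemma Stv.count (h : Csv V) (H : Stv V x σ) (hd : 4 ≤ d) :
    (ed1 V).card + 4 * d = 2 * d * V.card ↔ (ed1 (del V x)).card + 4 * d = 2 * d * (del V x).card := by
  obtain ⟨c, fw, f, D⟩ := H.data hd h
  rw [D.ed_card h H hd, del_card h (by omega) H.xV]
  have : 2 * d * ((del V x).card + 2) = 2 * d * (del V x).card + 4 * d := by ring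
  omega
end
end

noncomputable section
set_option linter.unusedVariables false
set_option linter.unusedSectionVars false

/-! ### Facets and the forward direction -/

section
variable {d : ℕ} {V : Finset (Fin d → ℝ)} {x : Fin d → ℝ} {σ : Finset (Fin d → ℝ)}

lemma top_inter (g : (Fin d → ℝ) →ₗ[ℝ] ℝ) : (V : Set (Fin d → ℝ)) ∩ {y ∈ polyBody V | g y = 1} = (top1 V g : Finset (Fin d → ℝ)) := by
  ext y
  rw [Finset.mem_coe, mem_top1]
  exact ⟨fun hh => ⟨hh.1, hh.2.2⟩, fun hh => ⟨hh.1, subset_body hh.1, hh.2⟩⟩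

lemma face_hull {g : (Fin d → ℝ) →ₗ[ℝ] ℝ} (hg : Sp1 V g) : {y ∈ polyBody V | g y = 1} = convexHull ℝ ((top1 V g : Finset (Fin d → ℝ)) : Set (Fin d → ℝ)) := by
  rw [← top_inter, ← body_face hg]

lemma facet_of (P : SPolytope d) (h : IsCS P) {g : (Fin d → ℝ) →ₗ[ℝ] ℝ} (hg : Sp1 P.V g) (hc : (top1 P.V g).card = d) :
    IsFacet P {y ∈ polyBody P.V | g y = 1} := by
  refine ⟨prop_face P.ne h one_pos hg, ?_⟩
  rw [top_inter, Set.ncard_coe_finset, hc]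

lemma supp_of (V : Finset (Fin d → ℝ)) {g : (Fin d → ℝ) →ₗ[ℝ] ℝ} (hg : Sp1 V g) : IsSupport V g 1 {y ∈ polyBody V | g y = 1} :=
  ⟨le_on_body hg, rfl⟩

lemma facet_norm (P : SPolytope d) (h : IsCS P) {F : Set (Fin d → ℝ)} (hF : IsFacet P F) {f : (Fin d → ℝ) →ₗ[ℝ] ℝ} {c : ℝ} (hs : IsSupport P.V f c F) :
    0 < c ∧ Sp1 P.V (c⁻¹ • f) ∧ F = {y ∈ polyBody P.V | (c⁻¹ • f) y = 1} ∧ (top1 P.V (c⁻¹ • f)).card = d := by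
  have hc := face_pos h hs hF.1.2 P.ne
  have hsp : Sp1 P.V (c⁻¹ • f) := fun v hv => by
    have := hs.1 v (subset_body hv)
    rw [LinearMap.smul_apply, smul_eq_mul, inv_mul_le_iff₀ hc]; linarith
  have hFe : F = {y ∈ polyBody P.V | (c⁻¹ • f) y = 1} := by
    rw [hs.2]
    ext y
    refine and_congr Iff.rfl ?_
    rw [LinearMap.smul_apply, smul_eq_mul, inv_mul_eq_iff_eq_mul₀ hc.ne', mul_one]
  refine ⟨hc, hsp, hFe, ?_⟩
  have := hF.2
  rw [hFe, top_inter, Set.ncard_coe_finset] at this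
  exact this

lemma Csv.span_top1 (h : Csv V) {f : (Fin d → ℝ) →ₗ[ℝ] ℝ} (hf : Sp1 V f) (hc : (top1 V f).card = d) :
    Submodule.span ℝ ((top1 V f : Finset (Fin d → ℝ)) : Set (Fin d → ℝ)) = ⊤ := by
  have := (h.li hf).span_eq_top_of_card_eq_finrank' (by simp [hc])
  simpa using this

lemma Csv.top_unique (h : Csv V) {f g : (Fin d → ℝ) →ₗ[ℝ] ℝ} (hf : Sp1 V f) (hc : (top1 V f).card = d) (e : top1 V f = top1 V g) : f = g := by
  apply LinearMap.ext_on (h.span_top1 hf hc)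
  intro v hv
  have h1 := (mem_top1.1 (Finset.mem_coe.1 hv)).2
  have h2 : v ∈ top1 V g := e ▸ Finset.mem_coe.1 hv
  rw [h1, (mem_top1.1 h2).2]

lemma beyond_iff (P : SPolytope d) (h : IsCS P) (x : Fin d → ℝ) : BeyondExactlyOne P x ↔
    ∃ f, Sp1 P.V f ∧ (top1 P.V f).card = d ∧ 1 < f x ∧ ∀ g, Sp1 P.V g → (top1 P.V g).card = d → top1 P.V g ≠ top1 P.V f → g x < 1 := by
  constructor
  · rintro ⟨F, hF, h1, h2⟩
    obtain ⟨⟨f, c, hs⟩, hFn⟩ := hF.1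
    obtain ⟨hc, hsp, hFe, hcard⟩ := facet_norm P h hF hs
    refine ⟨c⁻¹ • f, hsp, hcard, ?_, ?_⟩
    · have := h1 f c hs
      rw [LinearMap.smul_apply, smul_eq_mul, lt_inv_mul_iff₀ hc]; linarith
    · intro g hg hgc hne
      refine h2 _ (facet_of P h hg hgc) (fun e => hne ?_) g 1 (supp_of P.V hg)
      rw [← Finset.coe_inj, ← top_inter, ← top_inter, e, ← hFe]
  · rintro ⟨f, hf, hfc, hfx, hg⟩
    refine ⟨_, facet_of P h hf hfc, ?_, ?_⟩
    · intro f' c hs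
      obtain ⟨hc, hsp, hFe, hcard⟩ := facet_norm P h (facet_of P h hf hfc) hs
      have e : top1 P.V f = top1 P.V (c⁻¹ • f') := by
        rw [← Finset.coe_inj, ← top_inter, ← top_inter, hFe]
      have e2 := (csv_of P h).top_unique hf hfc e
      rw [e2, LinearMap.smul_apply, smul_eq_mul, lt_inv_mul_iff₀ hc] at hfx
      linarith
    · intro F' hF' hne f' c hs
      obtain ⟨hc, hsp, hFe, hcard⟩ := facet_norm P h hF' hs
      have := hg _ hsp hcard (fun e => hne (by rw [hFe, face_hull hsp, e, face_hull hf]))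
      rw [LinearMap.smul_apply, smul_eq_mul, inv_mul_lt_iff₀ hc] at this
      linarith

lemma Stv.beyond1 (h : Csv V) (H : Stv V x σ) (hd : 4 ≤ d) (h' : Csv (del V x)) : BeyondExactlyOne h'.poly x := by
  obtain ⟨c, fw, f, D⟩ := H.data hd h
  rw [beyond_iff h'.poly h'.neg]
  show ∃ f, Sp1 (del V x) f ∧ (top1 (del V x) f).card = d ∧ 1 < f x ∧ ∀ g, Sp1 (del V x) g → (top1 (del V x) g).card = d → top1 (del V x) g ≠ top1 (del V x) f → g x < 1
  have hlt : ∀ v ∈ del V x, v ∉ σ → f v < 1 := fun v hv hs => D.f3 v (mem_del.1 hv).1 (by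
    rw [Finset.mem_insert, not_or]; exact ⟨(mem_del.1 hv).2.1, hs⟩)
  have htop : top1 (del V x) f = σ := by
    ext v
    rw [mem_top1]
    constructor
    · rintro ⟨hv, h1⟩
      by_contra hs
      have := hlt v hv hs
      linarith
    · exact fun hs => ⟨D.sub_del H hs, D.f1 v hs⟩
  refine ⟨f, ?_, ?_, D.f2, ?_⟩
  · intro v hv
    by_cases hs : v ∈ σ
    · exact (D.f1 v hs).le
    · exact (hlt v hv hs).le
  · rw [htop, H.card]
  · intro g hg hgc hne
    rw [htop] at hne
    by_contra hx
    push Not at hx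
    rcases hx.lt_or_eq with hx | hx
    · exact hne (Finset.eq_of_subset_of_card_le (D.top_sub H hg hx) (by rw [H.card, hgc]))
    · have hsp : Sp1 V g := sp_ext hg hx.ge (by linarith)
      have hsub : insert x (top1 (del V x) g) ⊆ top1 V g := by
        intro v hv
        rcases Finset.mem_insert.1 hv with e | hv
        · rw [e]; exact mem_top1.2 ⟨H.xV, hx.symm⟩
        · exact mem_top1.2 ⟨(mem_del.1 (mem_top1.1 hv).1).1, (mem_top1.1 hv).2⟩
      have h1 := Finset.card_le_card hsub
      have hxn : x ∉ top1 (del V x) g := fun hh => (mem_del.1 (mem_top1.1 hh).1).2.1 rfl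
      rw [Finset.card_insert_of_notMem hxn, hgc] at h1
      have := h.card_le hsp
      omega

lemma body_del (hneg : ∀ v ∈ V, -v ∈ V) (hx : x ∈ V) : polyBody V = convexHull ℝ (polyBody (del V x) ∪ {x, -x}) := by
  rw [polyBody, polyBody, convexHull_convexHull_union_left]
  congr 1
  ext v
  simp only [Set.mem_union, Finset.mem_coe, mem_del, Set.mem_insert_iff, Set.mem_singleton_iff]
  constructor
  · intro hv
    by_cases e1 : v = x
    · exact Or.inr (Or.inl e1)
    by_cases e2 : v = -x
    · exact Or.inr (Or.inr e2)
    exact Or.inl ⟨hv, e1, e2⟩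
  · rintro (hv | hv | hv)
    · exact hv.1
    · rw [hv]; exact hx
    · rw [hv]; exact hneg x hx

lemma stack_snoc {P P' : SPolytope d} (hP : IsCS P) (hs : SymmetricStackingFrom P') {v : Fin d → ℝ} (hb : BeyondExactlyOne P' v)
    (hh : polyBody P.V = convexHull ℝ (polyBody P'.V ∪ {v, -v})) : SymmetricStackingFrom P := by
  obtain ⟨m, Q, h1, h2, h3, h4⟩ := hs
  refine ⟨m + 1, Fin.snoc (α := fun _ => SPolytope d) Q P, ?_, ?_, ?_, ?_⟩
  · intro k
    refine Fin.lastCases ?_ (fun k => ?_) k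
    · rw [Fin.snoc_last]; exact hP
    · rw [Fin.snoc_castSucc]; exact h1 k
  · have : (0 : Fin (m + 1 + 1)) = Fin.castSucc 0 := rfl
    rw [this, Fin.snoc_castSucc]; exact h2
  · rw [Fin.snoc_last]
  · intro k
    refine Fin.lastCases ?_ (fun k => ?_) k
    · refine ⟨v, ?_⟩
      rw [Fin.snoc_castSucc, Fin.succ_last, Fin.snoc_last, h3]
      exact ⟨hb, hh⟩
    · rw [Fin.snoc_castSucc, Fin.succ_castSucc, Fin.snoc_castSucc]
      exact h4 k

/-- a maximal face and its antipode -/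
lemma Csv.half (hd : 0 < d) (h : Csv V) : ∃ T : Finset (Fin d → ℝ), T.card = d ∧ LinearIndependent ℝ (fun v : T => (v : Fin d → ℝ)) ∧
    T ∪ T.image (fun v => -v) ⊆ V ∧ (T ∪ T.image (fun v => -v)).card = 2 * d := by
  obtain ⟨g, hg, _, hc⟩ := h.enlarge (f := 0) (fun v _ => by simp)
  refine ⟨top1 V g, hc, h.li hg, ?_, ?_⟩
  · intro v hv
    rcases Finset.mem_union.1 hv with hv | hv
    · exact (mem_top1.1 hv).1
    · obtain ⟨u, hu, rfl⟩ := Finset.mem_image.1 hv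
      exact h.neg u (mem_top1.1 hu).1
  · rw [Finset.card_union_of_disjoint, Finset.card_image_of_injective _ neg_injective, hc]
    · ring
    · rw [Finset.disjoint_left]
      intro v hv hv'
      obtain ⟨u, hu, rfl⟩ := Finset.mem_image.1 hv'
      have h1 := (mem_top1.1 hv).2
      have h2 := (mem_top1.1 hu).2
      rw [map_neg] at h1
      linarith

lemma Csv.two_le (hd : 0 < d) (h : Csv V) : 2 * d ≤ V.card := by
  obtain ⟨T, _, _, h1, h2⟩ := h.half hd
  rw [← h2]; exact Finset.card_le_card h1

lemma Csv.cross (hd : 0 < d) (h : Csv V) (hc : V.card = 2 * d) : IsCrossPolytope h.poly := by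
  obtain ⟨T, hT, hli, h1, h2⟩ := h.half hd
  have hV : T ∪ T.image (fun v => -v) = V := Finset.eq_of_subset_of_card_le h1 (by rw [h2, hc])
  let e := T.equivFinOfCardEq hT
  refine ⟨fun i => (e.symm i : Fin d → ℝ), hli.comp e.symm e.symm.injective, ?_⟩
  show (V : Set (Fin d → ℝ)) = _
  rw [← hV]
  ext v
  simp only [Finset.mem_coe, Finset.mem_union, Finset.mem_image, Set.mem_union, Set.mem_range]
  constructor
  · rintro (hv | ⟨u, hu, rfl⟩)
    · exact Or.inl ⟨e ⟨v, hv⟩, by simp⟩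
    · exact Or.inr ⟨e ⟨u, hu⟩, by simp⟩
  · rintro (⟨i, rfl⟩ | ⟨i, rfl⟩)
    · exact Or.inl (e.symm i).2
    · exact Or.inr ⟨_, (e.symm i).2, rfl⟩

lemma forward (hd : 4 ≤ d) : ∀ n : ℕ, ∀ V : Finset (Fin d → ℝ), V.card = n → ∀ h : Csv V, (ed1 V).card + 4 * d = 2 * d * V.card →
    SymmetricStackingFrom h.poly := by
  intro n
  induction n using Nat.strong_induction_on with
  | _ n ih =>
    intro V hV h hE
    rcases (h.two_le (by omega)).eq_or_lt with hc | hc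
    · exact ⟨0, fun _ => h.poly, fun _ => h.neg, h.cross (by omega) hc.symm, rfl, fun k => k.elim0⟩
    obtain ⟨x, τ, h1, h2, h3, h4⟩ := h.star hd hE hc
    have H : Stv V x (τ.erase x) := by
      refine ⟨h1 h2, (Finset.erase_subset _ _).trans h1, Finset.notMem_erase _ _, ?_, ?_⟩
      · rw [Finset.card_erase_of_mem h2, h3]; rfl
      · intro w hw
        obtain ⟨hwx, hw⟩ := Finset.mem_erase.1 hw
        obtain ⟨f, hf, hft⟩ := h4 w hw hwx
        refine ⟨f, hf, hft.trans ?_⟩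
        ext v
        simp only [Finset.mem_erase, Finset.mem_insert]
        constructor
        · rintro ⟨a, b⟩
          by_cases e : v = x
          · exact Or.inl e
          · exact Or.inr ⟨a, e, b⟩
        · rintro (e | ⟨a, _, b⟩)
          · rw [e]; exact ⟨hwx.symm, h2⟩
          · exact ⟨a, b⟩
    obtain ⟨c, fw, f, D⟩ := H.data hd h
    have h' := h.rem H D hd
    have hcard := del_card h (by omega) H.xV
    have := ih _ (by omega) (del V x) rfl h' ((H.count h hd).1 hE)
    exact stack_snoc (P := h.poly) h.neg this (H.beyond1 h hd h') (body_del h.neg H.xV)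
end
end

noncomputable section
set_option linter.unusedVariables false
set_option linter.unusedSectionVars false

/-! ### The backward direction -/

section
variable {d : ℕ} {V V' : Finset (Fin d → ℝ)} {v : Fin d → ℝ}

lemma hull_ge {W : Finset (Fin d → ℝ)} {u : Fin d → ℝ} (hu : u ∈ convexHull ℝ (W : Set (Fin d → ℝ))) (g : (Fin d → ℝ) →ₗ[ℝ] ℝ) :
    ∃ w ∈ W, g u ≤ g w := by
  by_contra hc
  push Not at hc
  have hcv : Convex ℝ {y | g y < g u} := convex_halfSpace_lt g.isLinear _
  have := convexHull_min (s := (W : Set (Fin d → ℝ))) (fun w hw => hc w hw) hcv hu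
  exact lt_irrefl (g u) this

lemma Csv.sub_of_hull (hd : 0 < d) (h : Csv V) {W : Finset (Fin d → ℝ)} (e : polyBody V = polyBody W) : V ⊆ W := by
  intro u hu
  obtain ⟨f, hf, hfu, hlt⟩ := h.expose hd hu
  have hu' : u ∈ polyBody W := e ▸ subset_body hu
  obtain ⟨w, hw, hle⟩ := hull_ge hu' f
  have hwV : w ∈ polyBody V := e ▸ subset_body hw
  have h1 : f w = 1 := le_antisymm (le_on_body hf w hwV) (by linarith)
  have h2 : w ∈ {y ∈ polyBody V | f y = 1} := ⟨hwV, h1⟩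
  have h3 : top1 V f = {u} := by
    ext a
    rw [mem_top1, Finset.mem_singleton]
    constructor
    · rintro ⟨ha, h4⟩
      by_contra hne
      have := hlt a ha hne
      linarith
    · rintro rfl; exact ⟨hu, hfu⟩
  rw [face_hull hf, h3] at h2
  simp at h2
  rwa [← h2]

/-- a facet through a given vertex not separating `±v` -/
lemma Csv.avoid (hd : 4 ≤ d) (h : Csv V') {f : (Fin d → ℝ) →ₗ[ℝ] ℝ} (hf : Sp1 V' f) (hc : (top1 V' f).card = d)
    (hb : ∀ g, Sp1 V' g → (top1 V' g).card = d → top1 V' g ≠ top1 V' f → g v < 1) {s : Fin d → ℝ} (hs : s ∈ V') :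
    ∃ g, Sp1 V' g ∧ g s = 1 ∧ g v < 1 ∧ -1 < g v := by
  have hcn : ∀ g, Sp1 V' g → (top1 V' g).card = d → (top1 V' (-g)).card = d := by
    intro g hg hgc
    refine Eq.trans ?_ hgc
    refine Finset.card_bij' (fun u _ => -u) (fun u _ => -u) ?_ ?_ ?_ ?_
    · intro u hu
      rw [mem_top1] at hu ⊢
      exact ⟨h.neg u hu.1, by rw [map_neg]; exact hu.2⟩
    · intro u hu
      rw [mem_top1] at hu ⊢
      exact ⟨h.neg u hu.1, by simpa using hu.2⟩
    · simp
    · simp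
  have key : ∀ s ∈ top1 V' f, ∃ g, Sp1 V' g ∧ g s = 1 ∧ g v < 1 ∧ -1 < g v := by
    intro s hs
    obtain ⟨i, hi, hne⟩ : ∃ i ∈ top1 V' f, i ≠ s := by
      apply Finset.exists_mem_ne; omega
    obtain ⟨g, hg, j, hj, hfj, hjn, ht⟩ := h.pivot hf hc hi
    have hgc : (top1 V' g).card = d := by
      rw [ht, Finset.card_insert_of_notMem (fun hh => hjn (Finset.mem_of_mem_erase hh)), Finset.card_erase_of_mem hi, hc]; omega
    have hgs : g s = 1 := by
      have : s ∈ top1 V' g := by rw [ht]; exact Finset.mem_insert_of_mem (Finset.mem_erase.2 ⟨hne.symm, hs⟩)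
      exact (mem_top1.1 this).2
    refine ⟨g, hg, hgs, hb g hg hgc ?_, ?_⟩
    · intro e
      apply hjn
      rw [← e, ht]
      exact Finset.mem_insert_self _ _
    · have := hb (-g) (h.sp_neg hg) (hcn g hg hgc) (fun e => by
        rw [← e] at hs
        have := (mem_top1.1 hs).2
        rw [LinearMap.neg_apply] at this
        linarith)
      rw [LinearMap.neg_apply] at this
      linarith
  obtain ⟨f0', hf0, hf0s, _⟩ := h.expose (by omega) hs
  obtain ⟨g, hg, hsub, hgc⟩ := h.enlarge hf0
  have hgs : s ∈ top1 V' g := hsub (mem_top1.2 ⟨hs, hf0s⟩)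
  by_cases e1 : top1 V' g = top1 V' f
  · exact key s (e1 ▸ hgs)
  by_cases e2 : top1 V' (-g) = top1 V' f
  · have : -s ∈ top1 V' (-g) := mem_top1.2 ⟨h.neg s hs, by simpa using (mem_top1.1 hgs).2⟩
    obtain ⟨g', h1, h2, h3, h4⟩ := key (-s) (e2 ▸ this)
    refine ⟨-g', h.sp_neg h1, by simpa using h2, ?_, ?_⟩
    · rw [LinearMap.neg_apply]; linarith
    · rw [LinearMap.neg_apply]; linarith
  refine ⟨g, hg, (mem_top1.1 hgs).2, hb g hg hgc e1, ?_⟩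
  have := hb (-g) (h.sp_neg hg) (hcn g hg hgc) e2
  rw [LinearMap.neg_apply] at this
  linarith

lemma stack_step (hd : 4 ≤ d) (h' : Csv V') (h : Csv V) {f : (Fin d → ℝ) →ₗ[ℝ] ℝ} (hf : Sp1 V' f) (hc : (top1 V' f).card = d) (hfv : 1 < f v)
    (hb : ∀ g, Sp1 V' g → (top1 V' g).card = d → top1 V' g ≠ top1 V' f → g v < 1)
    (hbody : polyBody V = convexHull ℝ (polyBody V' ∪ {v, -v})) : Stv V v (top1 V' f) ∧ del V v = V' := by
  set W : Finset (Fin d → ℝ) := V' ∪ {v, -v} with hW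
  have mW : ∀ u, u ∈ W ↔ u ∈ V' ∨ u = v ∨ u = -v := by intro u; simp [hW]; tauto
  have hVW : polyBody V = polyBody W := by
    rw [hbody, polyBody, polyBody, convexHull_convexHull_union_left]
    congr 1
    ext u
    simp [hW]
  have hsub := h.sub_of_hull (by omega) hVW
  have hnv : ∀ u ∈ V', u ≠ v ∧ u ≠ -v := by
    intro u hu
    constructor
    · rintro rfl
      linarith [hf u hu]
    · rintro rfl
      have := hf _ (h'.neg _ hu)
      rw [neg_neg] at this
      linarith
  have hvV : v ∈ V := by
    have hv : v ∈ polyBody V := by rw [hVW]; exact subset_body ((mW v).2 (Or.inr (Or.inl rfl)))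
    obtain ⟨u, hu, hle⟩ := hull_ge hv f
    rcases (mW u).1 (hsub hu) with h1 | h1 | h1
    · linarith [hf u h1]
    · exact h1 ▸ hu
    · rw [h1, map_neg] at hle; linarith
  have hsV : V' ⊆ V := by
    intro s hs
    obtain ⟨g, hg, hgs, hg1, hg2⟩ := h'.avoid hd hf hc hb hs
    have hgV : Sp1 V g := by
      intro u hu
      rcases (mW u).1 (hsub hu) with h1 | h1 | h1
      · exact hg u h1
      · rw [h1]; exact hg1.le
      · rw [h1, map_neg]; linarith
    by_contra hn
    apply h'.ext s hs
    have hsb : s ∈ {y ∈ polyBody V | g y = 1} := ⟨by rw [hVW]; exact subset_body ((mW s).2 (Or.inl hs)), hgs⟩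
    rw [face_hull hgV] at hsb
    refine convexHull_mono ?_ hsb
    intro u hu
    have hu := mem_top1.1 (Finset.mem_coe.1 hu)
    refine Finset.mem_coe.2 (Finset.mem_erase.2 ⟨fun e => hn (e ▸ hu.1), ?_⟩)
    rcases (mW u).1 (hsub hu.1) with h1 | h1 | h1
    · exact h1
    · rw [h1] at hu; linarith [hu.2]
    · rw [h1, map_neg] at hu; linarith [hu.2]
  have hvt : v ∉ top1 V' f := fun hh => (hnv v (mem_top1.1 hh).1).1 rfl
  refine ⟨⟨hvV, fun s hs => hsV (mem_top1.1 hs).1, hvt, hc, ?_⟩, ?_⟩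
  · intro w hw
    obtain ⟨g, hg, j, hj, hfj, hjn, ht⟩ := h'.pivot hf hc hw
    have hgc : (top1 V' g).card = d := by
      rw [ht, Finset.card_insert_of_notMem (fun hh => hjn (Finset.mem_of_mem_erase hh)), Finset.card_erase_of_mem hw, hc]; omega
    have hgv : g v < 1 := hb g hg hgc (fun e => by
      apply hjn
      rw [← e, ht]
      exact Finset.mem_insert_self _ _)
    set a := (1 - g v) / (f v - g v) with ha
    have hden : 0 < f v - g v := by linarith
    have ha0 : 0 < a := div_pos (by linarith) hden
    have ha1 : a < 1 := by rw [ha, div_lt_one hden]; linarith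
    have hk : ∀ y, (a • f + (1 - a) • g) y = a * f y + (1 - a) * g y := fun y => rfl
    have hkv : (a • f + (1 - a) • g) v = 1 := by
      rw [hk, ha]; field_simp; ring
    have hle : ∀ u ∈ V', (a • f + (1 - a) • g) u ≤ 1 := by
      intro u hu
      rw [hk]
      nlinarith [hf u hu, hg u hu]
    refine ⟨a • f + (1 - a) • g, ?_, ?_⟩
    · intro u hu
      rcases (mW u).1 (hsub hu) with h1 | h1 | h1
      · exact hle u h1
      · rw [h1, hkv]
      · rw [h1, map_neg, hkv]; norm_num
    · ext u
      rw [mem_top1, Finset.mem_insert, Finset.mem_erase]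
      constructor
      · rintro ⟨hu, h1⟩
        rcases (mW u).1 (hsub hu) with h2 | h2 | h2
        · right
          rw [hk] at h1
          have hfu : f u = 1 := by nlinarith [hf u h2, hg u h2]
          have hgu : g u = 1 := by nlinarith [hf u h2, hg u h2]
          have hut : u ∈ top1 V' f := mem_top1.2 ⟨h2, hfu⟩
          have : u ∈ top1 V' g := mem_top1.2 ⟨h2, hgu⟩
          rw [ht, Finset.mem_insert] at this
          rcases this with h3 | h3
          · exact absurd (h3 ▸ hut) hjn
          · exact ⟨Finset.ne_of_mem_erase h3, hut⟩
        · exact Or.inl h2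
        · rw [h2, map_neg, hkv] at h1; norm_num at h1
      · rintro (e | ⟨h1, h2⟩)
        · rw [e]; exact ⟨hvV, hkv⟩
        · have h3 : u ∈ top1 V' g := by
            rw [ht]; exact Finset.mem_insert_of_mem (Finset.mem_erase.2 ⟨h1, h2⟩)
          rw [mem_top1] at h2 h3
          refine ⟨hsV h2.1, ?_⟩
          rw [hk, h2.2, h3.2]; ring
  · ext u
    rw [mem_del]
    constructor
    · rintro ⟨hu, h1, h2⟩
      rcases (mW u).1 (hsub hu) with h3 | h3 | h3
      · exact h3
      · exact absurd h3 h1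
      · exact absurd h3 h2
    · exact fun hu => ⟨hsV hu, hnv u hu⟩

lemma cross_count (hd : 4 ≤ d) (P : SPolytope d) (hP : IsCS P) (hcr : IsCrossPolytope P) : (ed1 P.V).card + 4 * d = 2 * d * P.V.card := by
  have h := csv_of P hP
  obtain ⟨b, hli, hb⟩ := hcr
  have hVe : P.V = Finset.univ.image b ∪ Finset.univ.image (fun i => -(b i)) := by
    rw [← Finset.coe_inj, hb]; simp
  have hcard : P.V.card = 2 * d := by
    apply le_antisymm
    · rw [hVe]
      refine (Finset.card_union_le _ _).trans ?_
      have h1 := Finset.card_image_le (s := (Finset.univ : Finset (Fin d))) (f := b)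
      have h2 := Finset.card_image_le (s := (Finset.univ : Finset (Fin d))) (f := fun i => -(b i))
      rw [Finset.card_univ, Fintype.card_fin] at h1 h2
      omega
    · exact h.two_le (by omega)
  have hmem : ∀ u ∈ P.V, ∃ i, ∃ s : ℝ, (s = 1 ∨ s = -1) ∧ u = s • b i := by
    intro u hu
    have hu' : u ∈ (P.V : Set (Fin d → ℝ)) := hu
    rw [hb] at hu'
    rcases hu' with ⟨i, rfl⟩ | ⟨i, rfl⟩
    · exact ⟨i, 1, Or.inl rfl, by simp⟩
    · exact ⟨i, -1, Or.inr rfl, by simp⟩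
  have hedge : ∀ u ∈ P.V, ∀ w ∈ P.V, w ≠ u → w ≠ -u → ∃ f, Sp1 P.V f ∧ f u = 1 ∧ f w = 1 := by
    intro u hu w hw h1 h2
    obtain ⟨i, s, hs, hui⟩ := hmem u hu
    obtain ⟨j, t, ht, hwj⟩ := hmem w hw
    have hij : j ≠ i := by
      rintro rfl
      rcases hs with rfl | rfl <;> rcases ht with rfl | rfl <;> simp_all
    haveI : Nonempty (Fin d) := ⟨⟨0, by omega⟩⟩
    let B := basisOfLinearIndependentOfCardEqFinrank (b := b) hli (by simp)
    let ε : Fin d → ℝ := fun k => if k = i then s else if k = j then t else 1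
    have hε : ∀ k, ε k = 1 ∨ ε k = -1 := by
      intro k
      simp only [ε]
      split_ifs
      · exact hs
      · exact ht
      · exact Or.inl rfl
    let f : (Fin d → ℝ) →ₗ[ℝ] ℝ := B.constr ℝ ε
    have hfb : ∀ k, f (b k) = ε k := by
      intro k
      have : b k = B k := by simp [B]
      rw [this]
      exact B.constr_basis ℝ ε k
    refine ⟨f, ?_, ?_, ?_⟩
    · intro a ha
      obtain ⟨k, r, hr, rfl⟩ := hmem a ha
      rw [map_smul, hfb, smul_eq_mul]
      rcases hr with rfl | rfl <;> rcases hε k with e | e <;> rw [e] <;> norm_num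
    · rw [hui, map_smul, hfb, smul_eq_mul]
      simp only [ε, if_true]
      rcases hs with rfl | rfl <;> norm_num
    · rw [hwj, map_smul, hfb, smul_eq_mul]
      simp only [ε, if_neg hij, if_true]
      rcases ht with rfl | rfl <;> norm_num
  set A := P.V.image (fun u => (u, u)) with hA
  set B := P.V.image (fun u => (u, -u)) with hB
  have cA : A.card = P.V.card := by
    rw [hA, Finset.card_image_of_injective _ (fun a b hab => (Prod.mk.inj hab).1)]
  have cB : B.card = P.V.card := by
    rw [hB, Finset.card_image_of_injective _ (fun a b hab => (Prod.mk.inj hab).1)]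
  have mA : ∀ a b, (a, b) ∈ A ↔ a ∈ P.V ∧ b = a := by
    intro a b; simp only [hA, Finset.mem_image, Prod.mk.injEq]; constructor
    · rintro ⟨s, hs, rfl, rfl⟩; exact ⟨hs, rfl⟩
    · rintro ⟨hs, h1⟩; exact ⟨a, hs, rfl, h1.symm⟩
  have mB : ∀ a b, (a, b) ∈ B ↔ a ∈ P.V ∧ b = -a := by
    intro a b; simp only [hB, Finset.mem_image, Prod.mk.injEq]; constructor
    · rintro ⟨s, hs, rfl, rfl⟩; exact ⟨hs, rfl⟩
    · rintro ⟨hs, h1⟩; exact ⟨a, hs, rfl, h1.symm⟩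
  have mE : ∀ a b, (a, b) ∈ ed1 P.V ↔ (a ∈ P.V ∧ b ∈ P.V) ∧ a ≠ b ∧ ∃ f, Sp1 P.V f ∧ f a = 1 ∧ f b = 1 := by
    intro a b
    simp [ed1]
  have heq : P.V ×ˢ P.V = (ed1 P.V ∪ A) ∪ B := by
    ext ⟨a, b⟩
    rw [Finset.mem_union, Finset.mem_union, mE, mA, mB, Finset.mem_product]
    constructor
    · rintro ⟨ha, hb⟩
      by_cases e1 : b = a
      · exact Or.inl (Or.inr ⟨ha, e1⟩)
      by_cases e2 : b = -a
      · exact Or.inr ⟨ha, e2⟩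
      exact Or.inl (Or.inl ⟨⟨ha, hb⟩, Ne.symm e1, hedge a ha b hb e1 e2⟩)
    · rintro ((h1 | h1) | h1)
      · exact h1.1
      · exact ⟨h1.1, h1.2 ▸ h1.1⟩
      · exact ⟨h1.1, h1.2 ▸ hP a h1.1⟩
  have d1 : Disjoint (ed1 P.V) A := by
    rw [Finset.disjoint_left]; rintro ⟨a, b⟩ h1 h2
    rw [mE] at h1; rw [mA] at h2
    exact h1.2.1 h2.2.symm
  have d2 : Disjoint (ed1 P.V ∪ A) B := by
    rw [Finset.disjoint_left]; rintro ⟨a, b⟩ h1 h2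
    rw [Finset.mem_union, mE, mA] at h1; rw [mB] at h2
    rcases h1 with h1 | h1
    · obtain ⟨_, _, f, _, h3, h4⟩ := h1
      rw [h2.2, map_neg] at h4
      linarith
    · exact h.neg_ne (by omega) h2.1 (h2.2.symm.trans h1.2)
  have := congrArg Finset.card heq
  rw [Finset.card_product, Finset.card_union_of_disjoint d2, Finset.card_union_of_disjoint d1, cA, cB, hcard] at this
  rw [hcard]
  omega

lemma backward (hd : 4 ≤ d) (P : SPolytope d) (hs : SymmetricStackingFrom P) : (ed1 P.V).card + 4 * d = 2 * d * P.V.card := by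
  obtain ⟨m, Q, h1, h2, h3, h4⟩ := hs
  have key : ∀ k, (ed1 (Q k).V).card + 4 * d = 2 * d * (Q k).V.card := by
    intro k
    induction k using Fin.induction with
    | zero => exact cross_count hd _ (h1 0) h2
    | succ k ih =>
      obtain ⟨v, hv, hbody⟩ := h4 k
      obtain ⟨f, hf, hc, hfv, hb⟩ := (beyond_iff _ (h1 _) v).1 hv
      have h' := csv_of _ (h1 k.castSucc)
      have h := csv_of _ (h1 k.succ)
      obtain ⟨H, e⟩ := stack_step hd h' h hf hc hfv hb hbody
      rw [H.count h hd, e]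
      exact ih
  rw [← h3]
  exact key _

lemma ed1_f1 (P : SPolytope d) (hP : IsCS P) : (ed1 P.V).card = 2 * f1 P := by
  have mE : ∀ a b, (a, b) ∈ ed1 P.V ↔ (a ∈ P.V ∧ b ∈ P.V) ∧ a ≠ b ∧ ∃ f, Sp1 P.V f ∧ f a = 1 ∧ f b = 1 := by
    intro a b
    simp [ed1]
  have mF : ∀ a b, a ≠ b → (({a, b} : Finset (Fin d → ℝ)) ∈ edgeFinset P ↔ (a, b) ∈ ed1 P.V) := by
    intro a b hab
    rw [mE, edgeFinset, Finset.mem_filter, Finset.mem_powerset, bface_iff P hP, Finset.card_pair hab]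
    have e : ({a, b} : Finset (Fin d → ℝ)) ⊆ P.V ↔ a ∈ P.V ∧ b ∈ P.V := by
      simp [Finset.insert_subset_iff]
    have e2 : ∀ f : (Fin d → ℝ) →ₗ[ℝ] ℝ, (∀ v ∈ ({a, b} : Finset (Fin d → ℝ)), f v = 1) ↔ f a = 1 ∧ f b = 1 := by
      intro f; simp
    simp only [e, e2]
    tauto
  have hmap : ∀ p ∈ ed1 P.V, ({p.1, p.2} : Finset (Fin d → ℝ)) ∈ edgeFinset P := by
    rintro ⟨a, b⟩ hp
    exact (mF a b ((mE a b).1 hp).2.1).2 hp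
  rw [Finset.card_eq_sum_card_fiberwise (f := fun p : (Fin d → ℝ) × (Fin d → ℝ) => ({p.1, p.2} : Finset (Fin d → ℝ))) (s := ed1 P.V) (t := edgeFinset P) (fun p hp => Finset.mem_coe.2 (hmap p (Finset.mem_coe.1 hp)))]
  have : ∀ e ∈ edgeFinset P, ((ed1 P.V).filter (fun p => ({p.1, p.2} : Finset (Fin d → ℝ)) = e)).card = 2 := by
    intro e he
    have hc := (Finset.mem_filter.1 he).2.1
    obtain ⟨a, b, hab, rfl⟩ := Finset.card_eq_two.1 hc
    have : (ed1 P.V).filter (fun p => ({p.1, p.2} : Finset (Fin d → ℝ)) = {a, b}) = {(a, b), (b, a)} := by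
      ext ⟨p, q⟩
      simp only [Finset.mem_filter, Finset.mem_insert, Finset.mem_singleton, Prod.mk.injEq]
      constructor
      · rintro ⟨h1, h2⟩
        have hpq := ((mE p q).1 h1).2.1
        have hp : p ∈ ({a, b} : Finset (Fin d → ℝ)) := h2 ▸ (by simp)
        have hq : q ∈ ({a, b} : Finset (Fin d → ℝ)) := h2 ▸ (by simp)
        simp only [Finset.mem_insert, Finset.mem_singleton] at hp hq
        rcases hp with hp | hp <;> rcases hq with hq | hq
        · exact absurd (hp.trans hq.symm) hpq
        · exact Or.inl ⟨hp, hq⟩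
        · exact Or.inr ⟨hp, hq⟩
        · exact absurd (hp.trans hq.symm) hpq
      · rintro (⟨h1, h2⟩ | ⟨h1, h2⟩)
        · rw [h1, h2]; exact ⟨(mF a b hab).1 he, rfl⟩
        · rw [h1, h2]
          refine ⟨(mF b a hab.symm).1 ?_, Finset.pair_comm _ _⟩
          rw [Finset.pair_comm]; exact he
    rw [this]
    apply Finset.card_pair
    intro e
    exact hab (Prod.mk.inj e).1
  rw [Finset.sum_congr rfl this, Finset.sum_const, smul_eq_mul, f1, mul_comm]

lemma g2_iff (P : SPolytope d) (hP : IsCS P) : g2 P = (d.choose 2 : ℤ) - (d : ℤ) ↔ (ed1 P.V).card + 4 * d = 2 * d * P.V.card := by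
  rw [ed1_f1 P hP, g2, f0]
  have h1 : (d + 1).choose 2 = d + d.choose 2 := by
    rw [Nat.choose_succ_succ' d 1, Nat.choose_one_right]
  rw [h1]
  push_cast
  constructor
  · intro h
    zify
    linarith
  · intro h
    zify at h
    linarith

/-- main equivalence -/
lemma main_iff (hd : 4 ≤ d) (P : SPolytope d) (hcs : IsCS P) :
    g2 P = (d.choose 2 : ℤ) - (d : ℤ) ↔ SymmetricStackingFrom P := by
  rw [g2_iff P hcs]
  constructor
  · intro h
    exact forward hd _ P.V rfl (csv_of P hcs) h
  · exact backward hd P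
end
end

/-- For `d ≥ 4` and a centrally symmetric simplicial `d`-polytope `P`,
`g₂(P) = C(d,2) - d` iff `P` is obtained from a `d`-dimensional cross-polytope by
symmetric stacking. -/
theorem stmt0 {d : ℕ} (hd : 4 ≤ d) (P : SPolytope d) (hcs : IsCS P) :
    g2 P = (d.choose 2 : ℤ) - (d : ℤ) ↔ SymmetricStackingFrom P := by
  exact main_iff hd P hcs
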